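/- Let 𝔸 and 𝔹 be generalized algebraic theories. Then for every h ≥ 0 the pair (𝔸,𝔹) is h-derivable; equivalently, for all derivable judgments J of 𝔸 and J' of 𝔹 for which J ⊙ J' is defined, the judgment J ⊙ J' is derivable in the pretheory 𝔸 ⊗ 𝔹. In particular every axiom of 𝔸 ⊗ 𝔹 is derivable, so the pretheory 𝔸 ⊗ 𝔹 is itself a generalized algebraic theory. -/

import Mathlib

set_option linter.unusedVariables false

/-! # Syntax of generalized algebraic theories (following Cartmell / the paper's appendix) -/

namespace GATPaper

/-- A sort-and-term alphabet: a countably infinite set of variables, a set of sort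
symbols and a set of term symbols. -/
structure Alphabet : Type 1 where
  Var : Type
  SortSym : Type
  TermSym : Type
  var_infinite : Infinite Var
  var_countable : Countable Var

attribute [instance] Alphabet.var_infinite Alphabet.var_countable

variable {A B : Alphabet}

/-- Term expressions over an alphabet. -/
inductive Expr (A : Alphabet) : Type where
  | var : A.Var → Expr A
  | app : A.TermSym → List (Expr A) → Expr A

/-- Sort expressions: a sort symbol applied to a list of term expressions. -/
structure SortE (A : Alphabet) : Type where
  head : A.SortSym
  args : List (Expr A)

/-- Occurrence of a variable in a term expression. -/
inductive Occurs (x : A.Var) : Expr A → Prop where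
  | var : Occurs x (Expr.var x)
  | app {t : A.TermSym} {es : List (Expr A)} {e : Expr A} :
      e ∈ es → Occurs x e → Occurs x (Expr.app t es)

/-- Occurrence of a variable in a sort expression. -/
def SOccurs (x : A.Var) (U : SortE A) : Prop := ∃ e ∈ U.args, Occurs x e

/-- Simultaneous substitution along a function on variables. -/
def Expr.subst (σ : A.Var → Expr A) : Expr A → Expr A
  | .var x => σ x
  | .app t es => .app t (es.attach.map fun e => Expr.subst σ e.1)
termination_by e => sizeOf e
decreasing_by
  have := List.sizeOf_lt_of_mem e.2
  simp only [Expr.app.sizeOf_spec]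
  omega

def SortE.subst (σ : A.Var → Expr A) (U : SortE A) : SortE A :=
  ⟨U.head, U.args.map (Expr.subst σ)⟩

open Classical in
/-- The function on variables determined by a finite list of substitution pairs
`(zᵢ, uᵢ)` (substituting `uᵢ` for `zᵢ`, first matching pair winning, all other
variables unchanged). -/
noncomputable def lookupV : List (A.Var × Expr A) → A.Var → Expr A
  | [], x => .var x
  | p :: ps, x => if p.1 = x then p.2 else lookupV ps x

/-- The simultaneous substitution `e[u₁ | z₁, …, u_k | z_k]` where
`ps = [(z₁,u₁),…,(z_k,u_k)]`. -/
noncomputable def Expr.substL (e : Expr A) (ps : List (A.Var × Expr A)) : Expr A :=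
  e.subst (lookupV ps)

noncomputable def SortE.substL (U : SortE A) (ps : List (A.Var × Expr A)) : SortE A :=
  U.subst (lookupV ps)

/-- A (pre)context is a finite list of (variable, sort expression) pairs. -/
abbrev PreCtx (A : Alphabet) := List (A.Var × SortE A)

/-- The list of variables of a precontext, as term expressions. -/
def ctxVars (X : PreCtx A) : List (Expr A) := X.map fun p => Expr.var p.1

/-- The scoping condition of a precontext: the `i`-th sort expression only contains
variables among the first `i` variables. -/
def IsPreCtx (X : PreCtx A) : Prop :=
  ∀ i (hi : i < X.length) (v : A.Var),
    SOccurs v (X[i]'hi).2 → v ∈ (X.take i).map Prod.fst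

/-- Substitution pairs sending the variables of `X` to the entries of `f`. -/
def mkSub (X : PreCtx A) (f : List (Expr A)) : List (A.Var × Expr A) :=
  (X.map Prod.fst).zip f

/-- `Xᵢ[f₁ | x₁, …, f_{i-1} | x_{i-1}]` (0-based: the `i`-th sort of `X`
substituted along the first `i` entries of `f`). -/
noncomputable def subPre (X : PreCtx A) (f : List (Expr A)) (i : ℕ) (hi : i < X.length) :
    SortE A :=
  ((X[i]'hi).2).substL (mkSub (X.take i) (f.take i))

/-- Judgments: context judgments and the four kinds of standard judgments. -/
inductive Judg (A : Alphabet) : Type where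
  | ctx (X : PreCtx A)
  | sort (X : PreCtx A) (U : SortE A)
  | term (X : PreCtx A) (u : Expr A) (U : SortE A)
  | sortEq (X : PreCtx A) (U V : SortE A)
  | termEq (X : PreCtx A) (u v : Expr A) (U : SortE A)

/-- The context of a judgment. -/
def Judg.ctxOf : Judg A → PreCtx A
  | .ctx X => X
  | .sort X _ => X
  | .term X _ _ => X
  | .sortEq X _ _ => X
  | .termEq X _ _ _ => X

/-- The judgment introducing a sort symbol over the context `X`. -/
def introSort (X : PreCtx A) (S : A.SortSym) : Judg A := .sort X ⟨S, ctxVars X⟩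

/-- The judgment introducing a term symbol over the context `X`, with sort `U`. -/
def introTerm (X : PreCtx A) (t : A.TermSym) (U : SortE A) : Judg A :=
  .term X (.app t (ctxVars X)) U

/-- A set of axioms is a pretheory if: no axiom is a context judgment, every
axiom's context is a precontext, every sort symbol has a unique introducing sort
axiom and there are no other sort axioms, and likewise for term symbols. -/
structure IsPretheory (Ax : Set (Judg A)) : Prop where
  no_ctx : ∀ X : PreCtx A, Judg.ctx X ∉ Ax
  wf_ctx : ∀ J ∈ Ax, IsPreCtx J.ctxOf
  sort_intro : ∀ S : A.SortSym, ∃! X : PreCtx A, introSort X S ∈ Ax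
  sort_shape : ∀ (X : PreCtx A) (U : SortE A), Judg.sort X U ∈ Ax → U.args = ctxVars X
  term_intro : ∀ t : A.TermSym, ∃! p : PreCtx A × SortE A, introTerm p.1 t p.2 ∈ Ax
  term_shape : ∀ (X : PreCtx A) (u : Expr A) (U : SortE A), Judg.term X u U ∈ Ax →
      ∃ t : A.TermSym, u = Expr.app t (ctxVars X)

/-- One inference step of the paper's system: `Step Ax D J` holds when `J` is the
conclusion of an instance of one of the sixteen rules all of whose premises
satisfy `D`. -/
inductive Step (Ax : Set (Judg A)) (D : Judg A → Prop) : Judg A → Prop where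
  | ctx_nil : Step Ax D (.ctx [])
  | ctx_cons {X : PreCtx A} {U : SortE A} {x : A.Var}
      (hs : D (.sort X U)) (hfresh : ∀ p ∈ X, p.1 ≠ x)
      (hpre : IsPreCtx (X ++ [(x, U)])) :
      Step Ax D (.ctx (X ++ [(x, U)]))
  | s1 {X : PreCtx A} {U : SortE A} (h : D (.sort X U)) : Step Ax D (.sortEq X U U)
  | s2 {X : PreCtx A} {U V : SortE A} (h : D (.sortEq X U V)) : Step Ax D (.sortEq X V U)
  | s3 {X : PreCtx A} {U V W : SortE A}
      (h1 : D (.sortEq X U V)) (h2 : D (.sortEq X V W)) : Step Ax D (.sortEq X U W)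
  | t1 {X : PreCtx A} {u : Expr A} {U : SortE A}
      (h : D (.term X u U)) : Step Ax D (.termEq X u u U)
  | t2 {X : PreCtx A} {u v : Expr A} {U : SortE A}
      (h : D (.termEq X u v U)) : Step Ax D (.termEq X v u U)
  | t3 {X : PreCtx A} {u v w : Expr A} {U : SortE A}
      (h1 : D (.termEq X u v U)) (h2 : D (.termEq X v w U)) : Step Ax D (.termEq X u w U)
  | seqt {X : PreCtx A} {U U' : SortE A} {u : Expr A}
      (h1 : D (.sortEq X U U')) (h2 : D (.term X u U)) : Step Ax D (.term X u U')
  | seqteq {X : PreCtx A} {U U' : SortE A} {u u' : Expr A}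
      (h1 : D (.sortEq X U U')) (h2 : D (.termEq X u u' U))
      (h3 : D (.term X u U')) (h4 : D (.term X u' U')) : Step Ax D (.termEq X u u' U')
  | var {X : PreCtx A} {i : ℕ} (hi : i < X.length)
      (h : D (.sort X (X[i]'hi).2)) :
      Step Ax D (.term X (.var (X[i]'hi).1) (X[i]'hi).2)
  | sA {X : PreCtx A} {U : SortE A} (hax : Judg.sort X U ∈ Ax) (h : D (.ctx X))
      (hv : ∀ i (hi : i < X.length), D (.term X (.var (X[i]'hi).1) (X[i]'hi).2)) :
      Step Ax D (.sort X U)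
  | tA {X : PreCtx A} {u : Expr A} {U : SortE A} (hax : Judg.term X u U ∈ Ax)
      (h : D (.sort X U))
      (hv : ∀ i (hi : i < X.length), D (.term X (.var (X[i]'hi).1) (X[i]'hi).2)) :
      Step Ax D (.term X u U)
  | seqA {X : PreCtx A} {U U' : SortE A} (hax : Judg.sortEq X U U' ∈ Ax)
      (h1 : D (.sort X U)) (h2 : D (.sort X U')) : Step Ax D (.sortEq X U U')
  | teqA {X : PreCtx A} {u u' : Expr A} {U : SortE A} (hax : Judg.termEq X u u' U ∈ Ax)
      (h1 : D (.term X u U)) (h2 : D (.term X u' U)) : Step Ax D (.termEq X u u' U)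
  | sSub {X : PreCtx A} {S : A.SortSym} (hax : introSort X S ∈ Ax)
      {Y : PreCtx A} (hY : IsPreCtx Y) {f : List (Expr A)} (hlen : f.length = X.length)
      (hJ : D (introSort X S)) (hYc : D (.ctx Y))
      (hargs : ∀ i (hi : i < X.length) (hif : i < f.length),
        D (.term Y (f[i]'hif) (subPre X f i hi))) :
      Step Ax D (.sort Y ⟨S, f⟩)
  | tSub {X : PreCtx A} {t : A.TermSym} {U : SortE A} (hax : introTerm X t U ∈ Ax)
      {Y : PreCtx A} (hY : IsPreCtx Y) {f : List (Expr A)} (hlen : f.length = X.length)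
      (hJ : D (introTerm X t U))
      (hU : D (.sort Y (U.substL (mkSub X f))))
      (hargs : ∀ i (hi : i < X.length) (hif : i < f.length),
        D (.term Y (f[i]'hif) (subPre X f i hi))) :
      Step Ax D (.term Y (.app t f) (U.substL (mkSub X f)))
  | seqSub1 {X : PreCtx A} {U U' : SortE A} (hax : Judg.sortEq X U U' ∈ Ax)
      {Y : PreCtx A} (hY : IsPreCtx Y) {f : List (Expr A)} (hlen : f.length = X.length)
      (hJ : D (.sortEq X U U'))
      (h1 : D (.sort Y (U.substL (mkSub X f)))) (h2 : D (.sort Y (U'.substL (mkSub X f))))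
      (hargs : ∀ i (hi : i < X.length) (hif : i < f.length),
        D (.term Y (f[i]'hif) (subPre X f i hi))) :
      Step Ax D (.sortEq Y (U.substL (mkSub X f)) (U'.substL (mkSub X f)))
  | seqSub2 {X : PreCtx A} {S : A.SortSym} (hax : introSort X S ∈ Ax)
      {Y : PreCtx A} (hY : IsPreCtx Y) {f g : List (Expr A)}
      (hlf : f.length = X.length) (hlg : g.length = X.length)
      (hJ : D (introSort X S))
      (h1 : D (.sort Y ⟨S, f⟩)) (h2 : D (.sort Y ⟨S, g⟩))
      (hargs : ∀ i (hi : i < X.length) (hif : i < f.length) (hig : i < g.length),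
        D (.termEq Y (f[i]'hif) (g[i]'hig) (subPre X f i hi))) :
      Step Ax D (.sortEq Y ⟨S, f⟩ ⟨S, g⟩)
  | teqSub1 {X : PreCtx A} {u u' : Expr A} {U : SortE A}
      (hax : Judg.termEq X u u' U ∈ Ax)
      {Y : PreCtx A} (hY : IsPreCtx Y) {f : List (Expr A)} (hlen : f.length = X.length)
      (hJ : D (.termEq X u u' U))
      (h1 : D (.term Y (u.substL (mkSub X f)) (U.substL (mkSub X f))))
      (h2 : D (.term Y (u'.substL (mkSub X f)) (U.substL (mkSub X f))))
      (hargs : ∀ i (hi : i < X.length) (hif : i < f.length),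
        D (.term Y (f[i]'hif) (subPre X f i hi))) :
      Step Ax D (.termEq Y (u.substL (mkSub X f)) (u'.substL (mkSub X f))
        (U.substL (mkSub X f)))
  | teqSub2 {X : PreCtx A} {t : A.TermSym} {U : SortE A} (hax : introTerm X t U ∈ Ax)
      {Y : PreCtx A} (hY : IsPreCtx Y) {f g : List (Expr A)}
      (hlf : f.length = X.length) (hlg : g.length = X.length)
      (hJ : D (introTerm X t U))
      (h1 : D (.term Y (.app t f) (U.substL (mkSub X f))))
      (h2 : D (.term Y (.app t g) (U.substL (mkSub X f))))
      (hargs : ∀ i (hi : i < X.length) (hif : i < f.length) (hig : i < g.length),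
        D (.termEq Y (f[i]'hif) (g[i]'hig) (subPre X f i hi))) :
      Step Ax D (.termEq Y (.app t f) (.app t g) (U.substL (mkSub X f)))

/-- `DerAt Ax n J`: `J` is the conclusion of an inference step in the `n`-th stage
`𝒟ₙ` of the recursive construction of the derivable judgments. -/
def DerAt (Ax : Set (Judg A)) : ℕ → Judg A → Prop
  | 0, _ => False
  | n + 1, J => DerAt Ax n J ∨ Step Ax (DerAt Ax n) J

/-- A judgment is derivable if it is the conclusion of a step of some stage. -/
def Derivable (Ax : Set (Judg A)) (J : Judg A) : Prop := ∃ n, DerAt Ax n J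

/-- The height of a (derivable) judgment: the least stage at which it appears. -/
noncomputable def ht (Ax : Set (Judg A)) (J : Judg A) : ℕ := sInf {n | DerAt Ax n J}

/-- The height of a context: `0` for the empty context, and the height of
`∂X ⊢ Xₙ sort` otherwise. -/
noncomputable def htCtx (Ax : Set (Judg A)) (X : PreCtx A) : ℕ :=
  match X with
  | [] => 0
  | p :: X' =>
      ht Ax (.sort ((p :: X').dropLast) (((p :: X').getLast (List.cons_ne_nil p X')).2))

/-- A generalized algebraic theory: a pretheory all of whose axioms are derivable. -/
def IsGAT (Ax : Set (Judg A)) : Prop := IsPretheory Ax ∧ ∀ J ∈ Ax, Derivable Ax J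

/-- The partial term judgment `X ⊢ u term` is derivable. -/
def DerTerm (Ax : Set (Judg A)) (X : PreCtx A) (u : Expr A) : Prop :=
  ∃ U, Derivable Ax (.term X u U)

/-- The partial term equality judgment `X ⊢ u ≡ v term` is derivable. -/
def DerTermEq (Ax : Set (Judg A)) (X : PreCtx A) (u v : Expr A) : Prop :=
  ∃ U, Derivable Ax (.termEq X u v U)

/-- Height of a derivable partial term judgment: the minimum of the heights of
`X ⊢ u : U` over all `U`. -/
noncomputable def htTerm (Ax : Set (Judg A)) (X : PreCtx A) (u : Expr A) : ℕ :=
  sInf {n | ∃ U, DerAt Ax n (.term X u U)}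

/-- `f` is a context morphism from `X` to `Y`. -/
def IsMor (Ax : Set (Judg A)) (X Y : PreCtx A) (f : List (Expr A)) : Prop :=
  Derivable Ax (.ctx X) ∧ Derivable Ax (.ctx Y) ∧ f.length = Y.length ∧
  ∀ i (hi : i < Y.length) (hif : i < f.length),
    Derivable Ax (.term X (f[i]'hif) (subPre Y f i hi))

/-- The morphism equality `f ≡ g : X → Y` is derivable. -/
def MorEq (Ax : Set (Judg A)) (X Y : PreCtx A) (f g : List (Expr A)) : Prop :=
  IsMor Ax X Y f ∧ IsMor Ax X Y g ∧
  ∀ i (hi : i < Y.length) (hif : i < f.length) (hig : i < g.length),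
    Derivable Ax (.termEq X (f[i]'hif) (g[i]'hig) (subPre Y f i hi))

/-- The context equality `X ≡ Y ctx` is derivable. -/
def CtxEq (Ax : Set (Judg A)) (X Y : PreCtx A) : Prop :=
  X.length = Y.length ∧ Derivable Ax (.ctx X) ∧ Derivable Ax (.ctx Y) ∧
  ∀ i (hX : i < X.length) (hY : i < Y.length),
    Derivable Ax (.sortEq (X.take i) (X[i]'hX).2
      (((Y[i]'hY).2).substL (mkSub (Y.take i) (ctxVars (X.take i)))))

/-- Height of a context morphism. -/
noncomputable def htMor (Ax : Set (Judg A)) (X Y : PreCtx A) (f : List (Expr A)) : ℕ :=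
  max (htCtx Ax X) (max (htCtx Ax Y)
    ((Finset.range Y.length).sup fun i =>
      if h : i < Y.length ∧ i < f.length then
        ht Ax (.term X (f[i]'h.2) (subPre Y f i h.1))
      else 0))

/-- Height of a morphism equality. -/
noncomputable def htMorEq (Ax : Set (Judg A)) (X Y : PreCtx A) (f g : List (Expr A)) : ℕ :=
  max (htMor Ax X Y f) (max (htMor Ax X Y g)
    ((Finset.range Y.length).sup fun i =>
      if h : i < Y.length ∧ i < f.length ∧ i < g.length then
        ht Ax (.termEq X (f[i]'h.2.1) (g[i]'h.2.2) (subPre Y f i h.1))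
      else 0))

/-- The composite `g ∘ f` of tuples of term expressions, where `f : X → Y` and
`g : Y → Z`: the `i`-th entry is `gᵢ[f]`. -/
noncomputable def compMor (Y : PreCtx A) (f g : List (Expr A)) : List (Expr A) :=
  g.map fun e => e.substL (mkSub Y f)

/-- The canonical sort `𝒮(u)` of a term in a context (as a relation). -/
inductive CanonSort (Ax : Set (Judg A)) (X : PreCtx A) : Expr A → SortE A → Prop where
  | var {i : ℕ} (hi : i < X.length) : CanonSort Ax X (.var (X[i]'hi).1) (X[i]'hi).2
  | app {t : A.TermSym} {f : List (Expr A)} {Xa : PreCtx A} {V : SortE A}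
      (hax : introTerm Xa t V ∈ Ax) :
      CanonSort Ax X (.app t f) (V.substL (mkSub Xa f))


/-! ## The tensor product of generalized algebraic theories (§2 of the paper) -/

/-- The tensor product of two sort-and-term alphabets. -/
abbrev Alphabet.tensor (A B : Alphabet) : Alphabet :=
  { Var := A.Var × B.Var
    SortSym := A.SortSym × B.SortSym
    TermSym := (A.SortSym × B.TermSym) ⊕ (A.TermSym × B.SortSym)
    var_infinite := inferInstance
    var_countable := inferInstance }

/-- An input for the tensor term operations `⊗_t`, `●_t`: a derivable term judgment
`X ⊢ u : U` (notation `u^U`), or an augmented derivable sort judgment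
`(X ⊢ U sort, x)` (notation `x^U`), represented with `tm = var x`. -/
structure TArg (A : Alphabet) : Type where
  ctx : PreCtx A
  tm : Expr A
  srt : SortE A

/-- `L` is the lexicographically ordered `m × n` grid whose `(i,j)` entry is `M i j`. -/
def IsGrid {γ : Type} (m n : ℕ) (M : ℕ → ℕ → γ) (L : List γ) : Prop :=
  L.length = m * n ∧
  ∀ i j (hi : i < m) (hj : j < n) (h : i * n + j < L.length), L[i * n + j]'h = M i j

/-- Substitution pairs `[g 1 | x y₁, …, g n | x yₙ]` where the `yⱼ` are the
variables of `Y`. -/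
def pairsR (x : A.Var) (Y : PreCtx B) (g : ℕ → Expr (A.tensor B)) :
    List ((A.tensor B).Var × Expr (A.tensor B)) :=
  (List.finRange Y.length).map fun j => ((x, (Y.get j).1), g j.1)

/-- Substitution pairs `[g 1 | x₁ y, …, g m | x_m y]` where the `xᵢ` are the
variables of `X`. -/
def pairsL (X : PreCtx A) (y : B.Var) (g : ℕ → Expr (A.tensor B)) :
    List ((A.tensor B).Var × Expr (A.tensor B)) :=
  (List.finRange X.length).map fun i => (((X.get i).1, y), g i.1)

variable {A B : Alphabet}

/-- The graph of the tensor term operation on pairs of (augmented sort / term)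
judgments: `TTg TA TB false a b e` means `e = a ⊗_t b` and
`TTg TA TB true a b e` means `e = a ⊗*_t b` (the variant of §8 in which the two
defining substitution formulas for non-variable terms are interchanged). -/
inductive TTg (TA : Set (Judg A)) (TB : Set (Judg B)) :
    Bool → TArg A → TArg B → Expr (A.tensor B) → Prop where
  | varvar {b : Bool} {X : PreCtx A} {U : SortE A} {x : A.Var}
      {Y : PreCtx B} {V : SortE B} {y : B.Var} :
      TTg TA TB b ⟨X, .var x, U⟩ ⟨Y, .var y, V⟩ (.var (x, y))
  | varapp {b : Bool} {X : PreCtx A} {x : A.Var} {S : A.SortSym} {ss : List (Expr A)}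
      {Y : PreCtx B} {t : B.TermSym} {ts : List (Expr B)} {V : SortE B}
      (SS : ℕ → SortE A) (TSf : ℕ → SortE B)
      (hSS : ∀ i (hi : i < ss.length), CanonSort TA X (ss[i]'hi) (SS i))
      (hTS : ∀ j (hj : j < ts.length), CanonSort TB Y (ts[j]'hj) (TSf j))
      (M : ℕ → ℕ → Expr (A.tensor B)) (out : List (Expr (A.tensor B)))
      (hM : ∀ i (hi : i < ss.length), ∀ j (hj : j < ts.length),
          TTg TA TB b ⟨X, ss[i]'hi, SS i⟩ ⟨Y, ts[j]'hj, TSf j⟩ (M i j))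
      (hMx : ∀ j (hj : j < ts.length),
          TTg TA TB b ⟨X, .var x, ⟨S, ss⟩⟩ ⟨Y, ts[j]'hj, TSf j⟩ (M ss.length j))
      (hout : IsGrid (ss.length + 1) ts.length M out) :
      TTg TA TB b ⟨X, .var x, ⟨S, ss⟩⟩ ⟨Y, .app t ts, V⟩ (.app (Sum.inl (S, t)) out)
  | appvar {b : Bool} {X : PreCtx A} {s : A.TermSym} {ss : List (Expr A)} {U : SortE A}
      {Y : PreCtx B} {y : B.Var} {T : B.SortSym} {ts : List (Expr B)}
      (SS : ℕ → SortE A) (TSf : ℕ → SortE B)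
      (hSS : ∀ i (hi : i < ss.length), CanonSort TA X (ss[i]'hi) (SS i))
      (hTS : ∀ j (hj : j < ts.length), CanonSort TB Y (ts[j]'hj) (TSf j))
      (M : ℕ → ℕ → Expr (A.tensor B)) (out : List (Expr (A.tensor B)))
      (hM : ∀ i (hi : i < ss.length), ∀ j (hj : j < ts.length),
          TTg TA TB b ⟨X, ss[i]'hi, SS i⟩ ⟨Y, ts[j]'hj, TSf j⟩ (M i j))
      (hMy : ∀ i (hi : i < ss.length),
          TTg TA TB b ⟨X, ss[i]'hi, SS i⟩ ⟨Y, .var y, ⟨T, ts⟩⟩ (M i ts.length))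
      (hout : IsGrid ss.length (ts.length + 1) M out) :
      TTg TA TB b ⟨X, .app s ss, U⟩ ⟨Y, .var y, ⟨T, ts⟩⟩ (.app (Sum.inr (s, T)) out)
  | appapp_base {X : PreCtx A} {s : A.TermSym} {ss : List (Expr A)} {U : SortE A}
      {Y : PreCtx B} {t : B.TermSym} {ts : List (Expr B)} {V : SortE B} {x : A.Var}
      (hx : ∀ p ∈ X, p.1 ≠ x)
      (e0 : Expr (A.tensor B))
      (h0 : TTg TA TB false ⟨X, .var x, U⟩ ⟨Y, .app t ts, V⟩ e0)
      (g : ℕ → Expr (A.tensor B))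
      (hg : ∀ j (hj : j < Y.length),
          TTg TA TB false ⟨X, .app s ss, U⟩
            ⟨Y.take j, .var (Y[j]'hj).1, (Y[j]'hj).2⟩ (g j)) :
      TTg TA TB false ⟨X, .app s ss, U⟩ ⟨Y, .app t ts, V⟩ (e0.substL (pairsR x Y g))
  | appapp_star {X : PreCtx A} {s : A.TermSym} {ss : List (Expr A)} {U : SortE A}
      {Y : PreCtx B} {t : B.TermSym} {ts : List (Expr B)} {V : SortE B} {y : B.Var}
      (hy : ∀ p ∈ Y, p.1 ≠ y)
      (e0 : Expr (A.tensor B))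
      (h0 : TTg TA TB true ⟨X, .app s ss, U⟩ ⟨Y, .var y, V⟩ e0)
      (g : ℕ → Expr (A.tensor B))
      (hg : ∀ i (hi : i < X.length),
          TTg TA TB true ⟨X.take i, .var (X[i]'hi).1, (X[i]'hi).2⟩
            ⟨Y, .app t ts, V⟩ (g i)) :
      TTg TA TB true ⟨X, .app s ss, U⟩ ⟨Y, .app t ts, V⟩ (e0.substL (pairsL X y g))

/-- The graph of the operation `●_t` (flag `false`), resp. of `●*_t` (flag `true`). -/
inductive TTd (TA : Set (Judg A)) (TB : Set (Judg B)) :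
    Bool → TArg A → TArg B → Expr (A.tensor B) → Prop where
  | varL {b : Bool} {X : PreCtx A} {x : A.Var} {U : SortE A} {bArg : TArg B}
      {e : Expr (A.tensor B)}
      (h : TTg TA TB b ⟨X, .var x, U⟩ bArg e) : TTd TA TB b ⟨X, .var x, U⟩ bArg e
  | varR {b : Bool} {aArg : TArg A} {Y : PreCtx B} {y : B.Var} {V : SortE B}
      {e : Expr (A.tensor B)}
      (h : TTg TA TB b aArg ⟨Y, .var y, V⟩ e) : TTd TA TB b aArg ⟨Y, .var y, V⟩ e
  | appapp_base {X : PreCtx A} {s : A.TermSym} {ss : List (Expr A)} {U : SortE A}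
      {Y : PreCtx B} {t : B.TermSym} {ts : List (Expr B)} {V : SortE B} {y : B.Var}
      (hy : ∀ p ∈ Y, p.1 ≠ y)
      (e0 : Expr (A.tensor B))
      (h0 : TTg TA TB false ⟨X, .app s ss, U⟩ ⟨Y, .var y, V⟩ e0)
      (g : ℕ → Expr (A.tensor B))
      (hg : ∀ i (hi : i < X.length),
          TTg TA TB false ⟨X.take i, .var (X[i]'hi).1, (X[i]'hi).2⟩
            ⟨Y, .app t ts, V⟩ (g i)) :
      TTd TA TB false ⟨X, .app s ss, U⟩ ⟨Y, .app t ts, V⟩ (e0.substL (pairsL X y g))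
  | appapp_star {X : PreCtx A} {s : A.TermSym} {ss : List (Expr A)} {U : SortE A}
      {Y : PreCtx B} {t : B.TermSym} {ts : List (Expr B)} {V : SortE B} {x : A.Var}
      (hx : ∀ p ∈ X, p.1 ≠ x)
      (e0 : Expr (A.tensor B))
      (h0 : TTg TA TB true ⟨X, .var x, U⟩ ⟨Y, .app t ts, V⟩ e0)
      (g : ℕ → Expr (A.tensor B))
      (hg : ∀ j (hj : j < Y.length),
          TTg TA TB true ⟨X, .app s ss, U⟩
            ⟨Y.take j, .var (Y[j]'hj).1, (Y[j]'hj).2⟩ (g j)) :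
      TTd TA TB true ⟨X, .app s ss, U⟩ ⟨Y, .app t ts, V⟩ (e0.substL (pairsR x Y g))

/-- The graph of the tensor sort operation `⊗_s` (resp. `⊗*_s` for flag `true`):
`TSo TA TB b X x U Y y V W` means `W = U^x ⊗ V^y`. -/
inductive TSo (TA : Set (Judg A)) (TB : Set (Judg B)) :
    Bool → PreCtx A → A.Var → SortE A → PreCtx B → B.Var → SortE B →
    SortE (A.tensor B) → Prop where
  | mk {b : Bool} {X : PreCtx A} {x : A.Var} {S : A.SortSym} {ss : List (Expr A)}
      {Y : PreCtx B} {y : B.Var} {T : B.SortSym} {ts : List (Expr B)}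
      (hx : ∀ p ∈ X, p.1 ≠ x) (hy : ∀ p ∈ Y, p.1 ≠ y)
      (SS : ℕ → SortE A) (TSf : ℕ → SortE B)
      (hSS : ∀ i (hi : i < ss.length), CanonSort TA X (ss[i]'hi) (SS i))
      (hTS : ∀ j (hj : j < ts.length), CanonSort TB Y (ts[j]'hj) (TSf j))
      (M : ℕ → ℕ → Expr (A.tensor B)) (out : List (Expr (A.tensor B)))
      (hM : ∀ i (hi : i < ss.length), ∀ j (hj : j < ts.length),
          TTg TA TB b ⟨X, ss[i]'hi, SS i⟩ ⟨Y, ts[j]'hj, TSf j⟩ (M i j))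
      (hMx : ∀ j (hj : j < ts.length),
          TTg TA TB b ⟨X, .var x, ⟨S, ss⟩⟩ ⟨Y, ts[j]'hj, TSf j⟩ (M ss.length j))
      (hMy : ∀ i (hi : i < ss.length),
          TTg TA TB b ⟨X, ss[i]'hi, SS i⟩ ⟨Y, .var y, ⟨T, ts⟩⟩ (M i ts.length))
      (hout : IsGrid (ss.length + 1) (ts.length + 1) M out) :
      TSo TA TB b X x ⟨S, ss⟩ Y y ⟨T, ts⟩ ⟨(S, T), out.dropLast⟩

/-- The tensor precontext `Z = X ⊗ Y`, with entries `xᵢyⱼ : Xᵢ ⊗ Yⱼ` ordered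
lexicographically. -/
def TCtx (TA : Set (Judg A)) (TB : Set (Judg B)) (b : Bool)
    (X : PreCtx A) (Y : PreCtx B) (Z : PreCtx (A.tensor B)) : Prop :=
  Z.length = X.length * Y.length ∧
  ∀ i j (hi : i < X.length) (hj : j < Y.length) (h : i * Y.length + j < Z.length),
    (Z[i * Y.length + j]'h).1 = ((X[i]'hi).1, (Y[j]'hj).1) ∧
    TSo TA TB b (X.take i) (X[i]'hi).1 (X[i]'hi).2
      (Y.take j) (Y[j]'hj).1 (Y[j]'hj).2 (Z[i * Y.length + j]'h).2

/-- The graph of the tensor operation `⊙` on pairs of judgments of the admissible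
kinds of Table 1 (flag `false`), resp. of the interchanged operation `⊙*` of §8
(flag `true`).  `chA` and `chB` are the functions choosing, for each context, a
variable not occurring in it. -/
inductive TJudg (TA : Set (Judg A)) (TB : Set (Judg B))
    (chA : PreCtx A → A.Var) (chB : PreCtx B → B.Var) :
    Bool → Judg A → Judg B → Judg (A.tensor B) → Prop where
  /- sort ⊙ sort -/
  | ss {b : Bool} {X : PreCtx A} {U : SortE A} {Y : PreCtx B} {V : SortE B}
      {Z : PreCtx (A.tensor B)} {W : SortE (A.tensor B)}
      (hZ : TCtx TA TB b (X ++ [(chA X, U)]) (Y ++ [(chB Y, V)]) Z)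
      (hW : TSo TA TB b X (chA X) U Y (chB Y) V W) :
      TJudg TA TB chA chB b (.sort X U) (.sort Y V) (.sort Z.dropLast W)
  /- sort ⊙ term -/
  | st {b : Bool} {X : PreCtx A} {U : SortE A} {Y : PreCtx B} {v : Expr B} {V : SortE B}
      {Z : PreCtx (A.tensor B)} {e : Expr (A.tensor B)} {W : SortE (A.tensor B)}
      {g : ℕ → Expr (A.tensor B)}
      (hZ : TCtx TA TB b (X ++ [(chA X, U)]) Y Z)
      (he : TTg TA TB b ⟨X, .var (chA X), U⟩ ⟨Y, v, V⟩ e)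
      (hW : TSo TA TB b X (chA X) U Y (chB Y) V W)
      (hg : ∀ i (hi : i < X.length),
          TTg TA TB b ⟨X.take i, .var (X[i]'hi).1, (X[i]'hi).2⟩ ⟨Y, v, V⟩ (g i)) :
      TJudg TA TB chA chB b (.sort X U) (.term Y v V)
        (.term Z e (W.substL (pairsL X (chB Y) g)))
  /- term ⊙ sort -/
  | ts {b : Bool} {X : PreCtx A} {u : Expr A} {U : SortE A} {Y : PreCtx B} {V : SortE B}
      {Z : PreCtx (A.tensor B)} {e : Expr (A.tensor B)} {W : SortE (A.tensor B)}
      {g : ℕ → Expr (A.tensor B)}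
      (hZ : TCtx TA TB b X (Y ++ [(chB Y, V)]) Z)
      (he : TTg TA TB b ⟨X, u, U⟩ ⟨Y, .var (chB Y), V⟩ e)
      (hW : TSo TA TB b X (chA X) U Y (chB Y) V W)
      (hg : ∀ j (hj : j < Y.length),
          TTg TA TB b ⟨X, u, U⟩ ⟨Y.take j, .var (Y[j]'hj).1, (Y[j]'hj).2⟩ (g j)) :
      TJudg TA TB chA chB b (.term X u U) (.sort Y V)
        (.term Z e (W.substL (pairsR (chA X) Y g)))
  /- term ⊙ term -/
  | tt {b : Bool} {X : PreCtx A} {u : Expr A} {U : SortE A}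
      {Y : PreCtx B} {v : Expr B} {V : SortE B}
      {Z : PreCtx (A.tensor B)} {e1 e2 : Expr (A.tensor B)} {W : SortE (A.tensor B)}
      {gx gy : ℕ → Expr (A.tensor B)}
      (hZ : TCtx TA TB b X Y Z)
      (he1 : TTg TA TB b ⟨X, u, U⟩ ⟨Y, v, V⟩ e1)
      (he2 : TTd TA TB b ⟨X, u, U⟩ ⟨Y, v, V⟩ e2)
      (hW : TSo TA TB b X (chA X) U Y (chB Y) V W)
      (hgx : ∀ i (hi : i < X.length),
          TTg TA TB b ⟨X.take i, .var (X[i]'hi).1, (X[i]'hi).2⟩ ⟨Y, v, V⟩ (gx i))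
      (hgy : ∀ j (hj : j < Y.length),
          TTg TA TB b ⟨X, u, U⟩ ⟨Y.take j, .var (Y[j]'hj).1, (Y[j]'hj).2⟩ (gy j)) :
      TJudg TA TB chA chB b (.term X u U) (.term Y v V)
        (.termEq Z e1 e2 (W.substL (pairsL X (chB Y) gx ++ pairsR (chA X) Y gy)))
  /- sort ⊙ sort equality -/
  | sseq {b : Bool} {X : PreCtx A} {U : SortE A} {Y : PreCtx B} {V V' : SortE B}
      {Z : PreCtx (A.tensor B)} {W W' : SortE (A.tensor B)}
      (hZ : TCtx TA TB b (X ++ [(chA X, U)]) (Y ++ [(chB Y, V)]) Z)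
      (hW : TSo TA TB b X (chA X) U Y (chB Y) V W)
      (hW' : TSo TA TB b X (chA X) U Y (chB Y) V' W') :
      TJudg TA TB chA chB b (.sort X U) (.sortEq Y V V') (.sortEq Z.dropLast W W')
  /- sort equality ⊙ sort -/
  | seqs {b : Bool} {X : PreCtx A} {U U' : SortE A} {Y : PreCtx B} {V : SortE B}
      {Z : PreCtx (A.tensor B)} {W W' : SortE (A.tensor B)}
      (hZ : TCtx TA TB b (X ++ [(chA X, U)]) (Y ++ [(chB Y, V)]) Z)
      (hW : TSo TA TB b X (chA X) U Y (chB Y) V W)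
      (hW' : TSo TA TB b X (chA X) U' Y (chB Y) V W') :
      TJudg TA TB chA chB b (.sortEq X U U') (.sort Y V) (.sortEq Z.dropLast W W')
  /- sort ⊙ term equality -/
  | steq {b : Bool} {X : PreCtx A} {U : SortE A} {Y : PreCtx B} {v v' : Expr B}
      {V : SortE B} {Z : PreCtx (A.tensor B)} {e e' : Expr (A.tensor B)}
      {W : SortE (A.tensor B)} {g : ℕ → Expr (A.tensor B)}
      (hZ : TCtx TA TB b (X ++ [(chA X, U)]) Y Z)
      (he : TTg TA TB b ⟨X, .var (chA X), U⟩ ⟨Y, v, V⟩ e)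
      (he' : TTg TA TB b ⟨X, .var (chA X), U⟩ ⟨Y, v', V⟩ e')
      (hW : TSo TA TB b X (chA X) U Y (chB Y) V W)
      (hg : ∀ i (hi : i < X.length),
          TTg TA TB b ⟨X.take i, .var (X[i]'hi).1, (X[i]'hi).2⟩ ⟨Y, v, V⟩ (g i)) :
      TJudg TA TB chA chB b (.sort X U) (.termEq Y v v' V)
        (.termEq Z e e' (W.substL (pairsL X (chB Y) g)))
  /- term equality ⊙ sort -/
  | teqs {b : Bool} {X : PreCtx A} {u u' : Expr A} {U : SortE A} {Y : PreCtx B}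
      {V : SortE B} {Z : PreCtx (A.tensor B)} {e e' : Expr (A.tensor B)}
      {W : SortE (A.tensor B)} {g : ℕ → Expr (A.tensor B)}
      (hZ : TCtx TA TB b X (Y ++ [(chB Y, V)]) Z)
      (he : TTg TA TB b ⟨X, u, U⟩ ⟨Y, .var (chB Y), V⟩ e)
      (he' : TTg TA TB b ⟨X, u', U⟩ ⟨Y, .var (chB Y), V⟩ e')
      (hW : TSo TA TB b X (chA X) U Y (chB Y) V W)
      (hg : ∀ j (hj : j < Y.length),
          TTg TA TB b ⟨X, u, U⟩ ⟨Y.take j, .var (Y[j]'hj).1, (Y[j]'hj).2⟩ (g j)) :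
      TJudg TA TB chA chB b (.termEq X u u' U) (.sort Y V)
        (.termEq Z e e' (W.substL (pairsR (chA X) Y g)))
  /- sort equality ⊙ term -/
  | seqt {b : Bool} {X : PreCtx A} {U U' : SortE A} {Y : PreCtx B} {v : Expr B}
      {V : SortE B} {Z : PreCtx (A.tensor B)} {e e' : Expr (A.tensor B)}
      {W : SortE (A.tensor B)} {g : ℕ → Expr (A.tensor B)}
      (hZ : TCtx TA TB b (X ++ [(chA X, U)]) Y Z)
      (he : TTg TA TB b ⟨X, .var (chA X), U⟩ ⟨Y, v, V⟩ e)
      (he' : TTg TA TB b ⟨X, .var (chA X), U'⟩ ⟨Y, v, V⟩ e')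
      (hW : TSo TA TB b X (chA X) U Y (chB Y) V W)
      (hg : ∀ i (hi : i < X.length),
          TTg TA TB b ⟨X.take i, .var (X[i]'hi).1, (X[i]'hi).2⟩ ⟨Y, v, V⟩ (g i)) :
      TJudg TA TB chA chB b (.sortEq X U U') (.term Y v V)
        (.termEq Z e e' (W.substL (pairsL X (chB Y) g)))
  /- term ⊙ sort equality -/
  | tseq {b : Bool} {X : PreCtx A} {u : Expr A} {U : SortE A} {Y : PreCtx B}
      {V V' : SortE B} {Z : PreCtx (A.tensor B)} {e e' : Expr (A.tensor B)}
      {W : SortE (A.tensor B)} {g : ℕ → Expr (A.tensor B)}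
      (hZ : TCtx TA TB b X (Y ++ [(chB Y, V)]) Z)
      (he : TTg TA TB b ⟨X, u, U⟩ ⟨Y, .var (chB Y), V⟩ e)
      (he' : TTg TA TB b ⟨X, u, U⟩ ⟨Y, .var (chB Y), V'⟩ e')
      (hW : TSo TA TB b X (chA X) U Y (chB Y) V W)
      (hg : ∀ j (hj : j < Y.length),
          TTg TA TB b ⟨X, u, U⟩ ⟨Y.take j, .var (Y[j]'hj).1, (Y[j]'hj).2⟩ (g j)) :
      TJudg TA TB chA chB b (.term X u U) (.sortEq Y V V')
        (.termEq Z e e' (W.substL (pairsR (chA X) Y g)))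

/-- A choice, for every precontext, of a variable not contained in it. -/
def FreshCh {A : Alphabet} (ch : PreCtx A → A.Var) : Prop :=
  ∀ X : PreCtx A, ∀ p ∈ X, p.1 ≠ ch X

/-- The set of axioms of the pretheory `𝔸 ⊗ 𝔹`: the judgments `J ⊙ J'` for `J` an
axiom of `𝔸` and `J'` an axiom of `𝔹`. -/
def tensorAx (TA : Set (Judg A)) (TB : Set (Judg B))
    (chA : PreCtx A → A.Var) (chB : PreCtx B → B.Var) : Set (Judg (A.tensor B)) :=
  {K | ∃ J J', J ∈ TA ∧ J' ∈ TB ∧ TJudg TA TB chA chB false J J' K}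

/-- The pair `(𝔸, 𝔹)` is `h`-derivable: `J ⊙ J'` is derivable in the pretheory
`𝔸 ⊗ 𝔹` whenever `J`, `J'` are derivable judgments of `𝔸`, `𝔹` (of admissible
kinds) with `ht J * ht J' ≤ h`. -/
def hDerivable (TA : Set (Judg A)) (TB : Set (Judg B))
    (chA : PreCtx A → A.Var) (chB : PreCtx B → B.Var) (h : ℕ) : Prop :=
  ∀ (J : Judg A) (J' : Judg B) (K : Judg (A.tensor B)),
    Derivable TA J → Derivable TB J' → ht TA J * ht TB J' ≤ h →
    TJudg TA TB chA chB false J J' K → Derivable (tensorAx TA TB chA chB) K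

/-- The tensor `out = f ⊗ g` of two tuples of derivable terms, each entry being
the tensor of terms taken at their canonical sorts, ordered lexicographically. -/
def TMor (TA : Set (Judg A)) (TB : Set (Judg B)) (b : Bool)
    (X : PreCtx A) (f : List (Expr A)) (Y : PreCtx B) (g : List (Expr B))
    (out : List (Expr (A.tensor B))) : Prop :=
  out.length = f.length * g.length ∧
  ∀ i j (hi : i < f.length) (hj : j < g.length) (h : i * g.length + j < out.length),
    ∃ U V, CanonSort TA X (f[i]'hi) U ∧ CanonSort TB Y (g[j]'hj) V ∧
      TTg TA TB b ⟨X, f[i]'hi, U⟩ ⟨Y, g[j]'hj, V⟩ (out[i * g.length + j]'h)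

/-- The tensor `out = f ⊗ Y` of a tuple of derivable terms of `𝔸` with a context
of `𝔹`: entries `fᵢ^{𝒮(fᵢ)} ⊗ yⱼ^{Yⱼ}`. -/
def TMorCtx (TA : Set (Judg A)) (TB : Set (Judg B)) (b : Bool)
    (X : PreCtx A) (f : List (Expr A)) (Y : PreCtx B)
    (out : List (Expr (A.tensor B))) : Prop :=
  out.length = f.length * Y.length ∧
  ∀ i j (hi : i < f.length) (hj : j < Y.length) (h : i * Y.length + j < out.length),
    ∃ U, CanonSort TA X (f[i]'hi) U ∧
      TTg TA TB b ⟨X, f[i]'hi, U⟩ ⟨Y.take j, .var (Y[j]'hj).1, (Y[j]'hj).2⟩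
        (out[i * Y.length + j]'h)

/-- The tensor `out = X ⊗ g` of a context of `𝔸` with a tuple of derivable terms
of `𝔹`: entries `xᵢ^{Xᵢ} ⊗ gⱼ^{𝒮(gⱼ)}`. -/
def TCtxMor (TA : Set (Judg A)) (TB : Set (Judg B)) (b : Bool)
    (X : PreCtx A) (Y : PreCtx B) (g : List (Expr B))
    (out : List (Expr (A.tensor B))) : Prop :=
  out.length = X.length * g.length ∧
  ∀ i j (hi : i < X.length) (hj : j < g.length) (h : i * g.length + j < out.length),
    ∃ V, CanonSort TB Y (g[j]'hj) V ∧
      TTg TA TB b ⟨X.take i, .var (X[i]'hi).1, (X[i]'hi).2⟩ ⟨Y, g[j]'hj, V⟩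
        (out[i * g.length + j]'h)

/-- The tensor `out = (x₁,…,x_m,u^U) ⊗ Y` of the section determined by a term
`X ⊢ u : U` with a context of `𝔹`. -/
def TSecL (TA : Set (Judg A)) (TB : Set (Judg B)) (b : Bool)
    (X : PreCtx A) (u : Expr A) (U : SortE A) (Y : PreCtx B)
    (out : List (Expr (A.tensor B))) : Prop :=
  out.length = (X.length + 1) * Y.length ∧
  (∀ i j (hi : i < X.length) (hj : j < Y.length) (h : i * Y.length + j < out.length),
      TTg TA TB b ⟨X.take i, .var (X[i]'hi).1, (X[i]'hi).2⟩
        ⟨Y.take j, .var (Y[j]'hj).1, (Y[j]'hj).2⟩ (out[i * Y.length + j]'h)) ∧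
  (∀ j (hj : j < Y.length) (h : X.length * Y.length + j < out.length),
      TTg TA TB b ⟨X, u, U⟩ ⟨Y.take j, .var (Y[j]'hj).1, (Y[j]'hj).2⟩
        (out[X.length * Y.length + j]'h))

/-- The tensor `out = X ⊗ (y₁,…,yₙ,v^V)` of a context of `𝔸` with the section
determined by a term `Y ⊢ v : V` of `𝔹`. -/
def TSecR (TA : Set (Judg A)) (TB : Set (Judg B)) (b : Bool)
    (X : PreCtx A) (Y : PreCtx B) (v : Expr B) (V : SortE B)
    (out : List (Expr (A.tensor B))) : Prop :=
  out.length = X.length * (Y.length + 1) ∧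
  (∀ i j (hi : i < X.length) (hj : j < Y.length)
      (h : i * (Y.length + 1) + j < out.length),
      TTg TA TB b ⟨X.take i, .var (X[i]'hi).1, (X[i]'hi).2⟩
        ⟨Y.take j, .var (Y[j]'hj).1, (Y[j]'hj).2⟩ (out[i * (Y.length + 1) + j]'h)) ∧
  (∀ i (hi : i < X.length) (h : i * (Y.length + 1) + Y.length < out.length),
      TTg TA TB b ⟨X.take i, .var (X[i]'hi).1, (X[i]'hi).2⟩ ⟨Y, v, V⟩
        (out[i * (Y.length + 1) + Y.length]'h))

/-! ## Substitution calculus -/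

theorem Expr.induct {P : Expr A → Prop} (hv : ∀ x, P (.var x))
    (ha : ∀ t es, (∀ e ∈ es, P e) → P (.app t es)) : ∀ e, P e
  | .var x => hv x
  | .app t es => ha t es fun e he => Expr.induct hv ha e
termination_by e => sizeOf e
decreasing_by
  have := List.sizeOf_lt_of_mem he
  simp only [Expr.app.sizeOf_spec]
  omega

theorem Expr.subst_var (σ : A.Var → Expr A) (x : A.Var) : (Expr.var x).subst σ = σ x := by
  rw [Expr.subst]

theorem Expr.subst_app (σ : A.Var → Expr A) (t : A.TermSym) (es : List (Expr A)) :
    (Expr.app t es).subst σ = .app t (es.map (Expr.subst σ)) := by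
  rw [Expr.subst]
  congr 1
  exact List.attach_map_val (f := Expr.subst σ)

theorem SortE.ext' {U V : SortE A} (h : U.head = V.head) (h' : U.args = V.args) : U = V := by
  cases U; cases V; simp_all

@[simp] theorem SortE.subst_head (σ : A.Var → Expr A) (U : SortE A) :
    (U.subst σ).head = U.head := rfl

@[simp] theorem SortE.subst_args (σ : A.Var → Expr A) (U : SortE A) :
    (U.subst σ).args = U.args.map (Expr.subst σ) := rfl

theorem Expr.subst_congr {σ τ : A.Var → Expr A} (e : Expr A) :
    (∀ x, Occurs x e → σ x = τ x) → e.subst σ = e.subst τ := by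
  induction e using Expr.induct with
  | hv x => intro h; rw [Expr.subst_var, Expr.subst_var]; exact h x .var
  | ha t es ih =>
    intro h
    rw [Expr.subst_app, Expr.subst_app]
    congr 1
    exact List.map_congr_left fun e he => ih e he fun x hx => h x (.app he hx)

theorem SortE.subst_congr {σ τ : A.Var → Expr A} (U : SortE A)
    (h : ∀ x, SOccurs x U → σ x = τ x) : U.subst σ = U.subst τ :=
  SortE.ext' rfl (List.map_congr_left fun e he => Expr.subst_congr e fun x hx => h x ⟨e, he, hx⟩)

theorem Expr.subst_subst (σ τ : A.Var → Expr A) (e : Expr A) :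
    (e.subst σ).subst τ = e.subst fun x => (σ x).subst τ := by
  induction e using Expr.induct with
  | hv x => simp only [Expr.subst_var]
  | ha t es ih =>
    simp only [Expr.subst_app, List.map_map]
    congr 1
    exact List.map_congr_left fun e he => ih e he

theorem SortE.subst_subst (σ τ : A.Var → Expr A) (U : SortE A) :
    (U.subst σ).subst τ = U.subst fun x => (σ x).subst τ := by
  refine SortE.ext' rfl ?_
  simp only [SortE.subst_args, List.map_map]
  exact List.map_congr_left fun e he => Expr.subst_subst σ τ e

theorem Expr.subst_id (e : Expr A) : e.subst Expr.var = e := by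
  induction e using Expr.induct with
  | hv x => simp only [Expr.subst_var]
  | ha t es ih =>
    simp only [Expr.subst_app]
    congr 1
    exact (List.map_congr_left fun e he => ih e he).trans (List.map_id _)

theorem SortE.subst_id (U : SortE A) : U.subst Expr.var = U := by
  refine SortE.ext' rfl ?_
  simp only [SortE.subst_args]
  exact (List.map_congr_left fun e he => Expr.subst_id e).trans (List.map_id _)

theorem Occurs.var_iff {x y : A.Var} : Occurs x (Expr.var y) ↔ x = y := by
  constructor
  · intro h; cases h; rfl
  · rintro rfl; exact .var

theorem Occurs.app_iff {x : A.Var} {t : A.TermSym} {es : List (Expr A)} :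
    Occurs x (Expr.app t es) ↔ ∃ e ∈ es, Occurs x e := by
  constructor
  · intro h; cases h with | app h1 h2 => exact ⟨_, h1, h2⟩
  · rintro ⟨e, h1, h2⟩; exact .app h1 h2

/-! ### Lookup -/

theorem lookupV_not_mem {ps : List (A.Var × Expr A)} {x : A.Var}
    (h : x ∉ ps.map Prod.fst) : lookupV ps x = .var x := by
  induction ps with
  | nil => rfl
  | cons p ps ih =>
    simp only [List.map_cons, List.mem_cons, not_or] at h
    rw [lookupV, if_neg (Ne.symm h.1), ih h.2]

theorem lookupV_append_left {ps qs : List (A.Var × Expr A)} {x : A.Var}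
    (h : x ∈ ps.map Prod.fst) : lookupV (ps ++ qs) x = lookupV ps x := by
  induction ps with
  | nil => simp at h
  | cons p ps ih =>
    rw [List.cons_append, lookupV, lookupV]
    split
    · rfl
    · next hne =>
      refine ih ?_
      simp only [List.map_cons, List.mem_cons] at h
      exact h.resolve_left (Ne.symm hne)

theorem lookupV_append_right {ps qs : List (A.Var × Expr A)} {x : A.Var}
    (h : x ∉ ps.map Prod.fst) : lookupV (ps ++ qs) x = lookupV qs x := by
  induction ps with
  | nil => rfl
  | cons p ps ih =>
    simp only [List.map_cons, List.mem_cons, not_or] at h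
    rw [List.cons_append, lookupV, if_neg (Ne.symm h.1), ih h.2]

theorem lookupV_of_mem {ps : List (A.Var × Expr A)} {x : A.Var} {e : Expr A}
    (h : (x, e) ∈ ps) (hu : ∀ e', (x, e') ∈ ps → e' = e) : lookupV ps x = e := by
  induction ps with
  | nil => simp at h
  | cons p ps ih =>
    rw [lookupV]
    split
    · next hx => exact hu _ (by rw [← hx]; exact List.mem_cons_self)
    · next hx =>
      refine ih ?_ fun e' he' => hu e' (List.mem_cons_of_mem _ he')
      rcases List.mem_cons.1 h with h | h
      · exact absurd (by rw [← h]) hx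
      · exact h

theorem mkSub_map (X : PreCtx A) (σ : A.Var → Expr A) :
    mkSub X (X.map fun p => σ p.1) = X.map fun p => (p.1, σ p.1) := by
  unfold mkSub
  induction X with
  | nil => rfl
  | cons p X ih => simp only [List.map_cons, List.zip_cons_cons, ih]

theorem lookupV_mkSub_map (X : PreCtx A) (σ : A.Var → Expr A) {x : A.Var}
    (hx : x ∈ X.map Prod.fst) : lookupV (mkSub X (X.map fun p => σ p.1)) x = σ x := by
  rw [mkSub_map]
  obtain ⟨p, hp, rfl⟩ := List.mem_map.1 hx
  refine lookupV_of_mem (List.mem_map.2 ⟨p, hp, rfl⟩) ?_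
  intro e' he'
  obtain ⟨q, hq, h⟩ := List.mem_map.1 he'
  simp only [Prod.mk.injEq] at h
  rw [← h.2, h.1]

theorem mkSub_fst {X : PreCtx A} {f : List (Expr A)} (hl : f.length = X.length) :
    (mkSub X f).map Prod.fst = X.map Prod.fst := by
  unfold mkSub
  rw [List.map_fst_zip]
  simp [hl]

theorem map_lookupV {X : PreCtx A} {f : List (Expr A)} (hnd : (X.map Prod.fst).Nodup)
    (hl : f.length = X.length) : (X.map fun p => lookupV (mkSub X f) p.1) = f := by
  induction X generalizing f with
  | nil => cases f with
    | nil => rfl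
    | cons => simp at hl
  | cons p X ih =>
    cases f with
    | nil => simp at hl
    | cons e f =>
      simp only [List.map_cons, List.nodup_cons] at hnd
      simp only [List.length_cons, Nat.add_right_cancel_iff] at hl
      have h0 : mkSub (p :: X) (e :: f) = (p.1, e) :: mkSub X f := rfl
      rw [h0, List.map_cons, lookupV, if_pos rfl]
      refine congrArg _ (Eq.trans ?_ (ih hnd.2 hl))
      refine List.map_congr_left fun q hq => ?_
      rw [lookupV, if_neg]
      intro h
      exact hnd.1 (h ▸ List.mem_map_of_mem hq)

theorem mkSub_take (X : PreCtx A) (f : List (Expr A)) (i : ℕ) :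
    mkSub (X.take i) (f.take i) = (mkSub X f).take i := by
  unfold mkSub
  rw [List.map_take, List.zip_eq_zipWith, List.zip_eq_zipWith, List.take_zipWith]

theorem lookupV_take {X : PreCtx A} {f : List (Expr A)} (hl : f.length = X.length) {i : ℕ}
    {x : A.Var} (hx : x ∈ (X.take i).map Prod.fst) :
    lookupV (mkSub (X.take i) (f.take i)) x = lookupV (mkSub X f) x := by
  rw [mkSub_take]
  conv_rhs => rw [← List.take_append_drop i (mkSub X f)]
  rw [lookupV_append_left]
  rw [List.map_take, mkSub_fst hl, ← List.map_take]
  exact hx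

theorem subPre_eq {X : PreCtx A} (hX : IsPreCtx X) {f : List (Expr A)}
    (hl : f.length = X.length) (i : ℕ) (hi : i < X.length) :
    subPre X f i hi = (X[i]'hi).2.subst (lookupV (mkSub X f)) :=
  SortE.subst_congr _ fun x hx => lookupV_take hl (hX i hi x hx)

/-! ## Stages of derivability -/

section Stage

variable {Ax : Set (Judg A)}

theorem DerAt.mono {m n : ℕ} (hmn : m ≤ n) {J : Judg A} (h : DerAt Ax m J) : DerAt Ax n J := by
  induction hmn with
  | refl => exact h
  | step _ ih => exact Or.inl ih

theorem exists_stage_fam {k : ℕ} {F : (i : ℕ) → i < k → Judg A}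
    (h : ∀ i hi, Derivable Ax (F i hi)) : ∃ N, ∀ i hi, DerAt Ax N (F i hi) := by
  choose n hn using h
  refine ⟨Finset.univ.sup fun i : Fin k => n i.1 i.2, fun i hi => DerAt.mono ?_ (hn i hi)⟩
  exact Finset.le_sup (f := fun i : Fin k => n i.1 i.2) (Finset.mem_univ ⟨i, hi⟩)

theorem Derivable.step {J : Judg A} (hs : Step Ax (Derivable Ax) J) : Derivable Ax J := by
  have fin : ∃ N, Step Ax (DerAt Ax N) J := by
    have m2 : ∀ {a b : ℕ} {J}, DerAt Ax a J → DerAt Ax (max a b) J :=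
      fun h => DerAt.mono (le_max_left _ _) h
    have m3 : ∀ {a b : ℕ} {J}, DerAt Ax b J → DerAt Ax (max a b) J :=
      fun h => DerAt.mono (le_max_right _ _) h
    cases hs with
    | ctx_nil => exact ⟨0, .ctx_nil⟩
    | ctx_cons a b c => obtain ⟨n, a⟩ := a; exact ⟨n, .ctx_cons a b c⟩
    | s1 a => obtain ⟨n, a⟩ := a; exact ⟨n, .s1 a⟩
    | s2 a => obtain ⟨n, a⟩ := a; exact ⟨n, .s2 a⟩
    | s3 a b =>
      obtain ⟨n, a⟩ := a; obtain ⟨m, b⟩ := b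
      exact ⟨max n m, .s3 (m2 a) (m3 b)⟩
    | t1 a => obtain ⟨n, a⟩ := a; exact ⟨n, .t1 a⟩
    | t2 a => obtain ⟨n, a⟩ := a; exact ⟨n, .t2 a⟩
    | t3 a b =>
      obtain ⟨n, a⟩ := a; obtain ⟨m, b⟩ := b
      exact ⟨max n m, .t3 (m2 a) (m3 b)⟩
    | seqt a b =>
      obtain ⟨n, a⟩ := a; obtain ⟨m, b⟩ := b
      exact ⟨max n m, .seqt (m2 a) (m3 b)⟩
    | seqteq a b c d =>
      obtain ⟨n, a⟩ := a; obtain ⟨m, b⟩ := b; obtain ⟨k, c⟩ := c; obtain ⟨l, d⟩ := d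
      exact ⟨max (max n m) (max k l),
        .seqteq (m2 (m2 a)) (m2 (m3 b)) (m3 (m2 c)) (m3 (m3 d))⟩
    | var hi a => obtain ⟨n, a⟩ := a; exact ⟨n, .var hi a⟩
    | sA hax a b =>
      obtain ⟨n, a⟩ := a; obtain ⟨m, b⟩ := exists_stage_fam b
      exact ⟨max n m, .sA hax (m2 a) fun i hi => m3 (b i hi)⟩
    | tA hax a b =>
      obtain ⟨n, a⟩ := a; obtain ⟨m, b⟩ := exists_stage_fam b
      exact ⟨max n m, .tA hax (m2 a) fun i hi => m3 (b i hi)⟩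
    | seqA hax a b =>
      obtain ⟨n, a⟩ := a; obtain ⟨m, b⟩ := b
      exact ⟨max n m, .seqA hax (m2 a) (m3 b)⟩
    | teqA hax a b =>
      obtain ⟨n, a⟩ := a; obtain ⟨m, b⟩ := b
      exact ⟨max n m, .teqA hax (m2 a) (m3 b)⟩
    | sSub hax hY hl a b c =>
      obtain ⟨n, a⟩ := a; obtain ⟨m, b⟩ := b
      obtain ⟨k, c⟩ := exists_stage_fam fun i hi => c i hi (hl ▸ hi)
      exact ⟨max (max n m) k, .sSub hax hY hl (m2 (m2 a)) (m2 (m3 b)) fun i hi _ => m3 (c i hi)⟩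
    | tSub hax hY hl a b c =>
      obtain ⟨n, a⟩ := a; obtain ⟨m, b⟩ := b
      obtain ⟨k, c⟩ := exists_stage_fam fun i hi => c i hi (hl ▸ hi)
      exact ⟨max (max n m) k, .tSub hax hY hl (m2 (m2 a)) (m2 (m3 b)) fun i hi _ => m3 (c i hi)⟩
    | seqSub1 hax hY hl a b c d =>
      obtain ⟨n, a⟩ := a; obtain ⟨m, b⟩ := b; obtain ⟨k, c⟩ := c
      obtain ⟨l, d⟩ := exists_stage_fam fun i hi => d i hi (hl ▸ hi)
      exact ⟨max (max n m) (max k l), .seqSub1 hax hY hl (m2 (m2 a)) (m2 (m3 b)) (m3 (m2 c))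
        fun i hi _ => m3 (m3 (d i hi))⟩
    | seqSub2 hax hY hl hl' a b c d =>
      obtain ⟨n, a⟩ := a; obtain ⟨m, b⟩ := b; obtain ⟨k, c⟩ := c
      obtain ⟨l, d⟩ := exists_stage_fam fun i hi => d i hi (hl ▸ hi) (hl' ▸ hi)
      exact ⟨max (max n m) (max k l), .seqSub2 hax hY hl hl' (m2 (m2 a)) (m2 (m3 b)) (m3 (m2 c))
        fun i hi _ _ => m3 (m3 (d i hi))⟩
    | teqSub1 hax hY hl a b c d =>
      obtain ⟨n, a⟩ := a; obtain ⟨m, b⟩ := b; obtain ⟨k, c⟩ := c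
      obtain ⟨l, d⟩ := exists_stage_fam fun i hi => d i hi (hl ▸ hi)
      exact ⟨max (max n m) (max k l), .teqSub1 hax hY hl (m2 (m2 a)) (m2 (m3 b)) (m3 (m2 c))
        fun i hi _ => m3 (m3 (d i hi))⟩
    | teqSub2 hax hY hl hl' a b c d =>
      obtain ⟨n, a⟩ := a; obtain ⟨m, b⟩ := b; obtain ⟨k, c⟩ := c
      obtain ⟨l, d⟩ := exists_stage_fam fun i hi => d i hi (hl ▸ hi) (hl' ▸ hi)
      exact ⟨max (max n m) (max k l), .teqSub2 hax hY hl hl' (m2 (m2 a)) (m2 (m3 b)) (m3 (m2 c))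
        fun i hi _ _ => m3 (m3 (d i hi))⟩
  obtain ⟨N, h⟩ := fin
  exact ⟨N + 1, Or.inr h⟩

theorem DerAt.ctx {n : ℕ} {J : Judg A} (h : DerAt Ax n J) : DerAt Ax n (.ctx J.ctxOf) := by
  suffices H : ∀ J X, DerAt Ax n J → J.ctxOf = X → DerAt Ax n (.ctx X) from H _ _ h rfl
  clear h J
  intro J X h hX
  induction n generalizing J X with
  | zero => exact h.elim
  | succ n ih =>
    rcases h with h | h
    · exact Or.inl (ih _ _ h hX)
    · subst hX
      cases h with
      | ctx_nil => exact Or.inr .ctx_nil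
      | ctx_cons a b c => exact Or.inr (.ctx_cons a b c)
      | s1 a => exact Or.inl (ih _ _ a rfl)
      | s2 a => exact Or.inl (ih _ _ a rfl)
      | s3 a b => exact Or.inl (ih _ _ a rfl)
      | t1 a => exact Or.inl (ih _ _ a rfl)
      | t2 a => exact Or.inl (ih _ _ a rfl)
      | t3 a b => exact Or.inl (ih _ _ a rfl)
      | seqt a b => exact Or.inl (ih _ _ a rfl)
      | seqteq a b c d => exact Or.inl (ih _ _ a rfl)
      | var hi a => exact Or.inl (ih _ _ a rfl)
      | sA hax a b => exact Or.inl a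
      | tA hax a b => exact Or.inl (ih _ _ a rfl)
      | seqA hax a b => exact Or.inl (ih _ _ a rfl)
      | teqA hax a b => exact Or.inl (ih _ _ a rfl)
      | sSub hax hY hl a b c => exact Or.inl b
      | tSub hax hY hl a b c => exact Or.inl (ih _ _ b rfl)
      | seqSub1 hax hY hl a b c d => exact Or.inl (ih _ _ b rfl)
      | seqSub2 hax hY hl hl' a b c d => exact Or.inl (ih _ _ b rfl)
      | teqSub1 hax hY hl a b c d => exact Or.inl (ih _ _ b rfl)
      | teqSub2 hax hY hl hl' a b c d => exact Or.inl (ih _ _ b rfl)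

theorem DerAt.ctx_inv {n : ℕ} {X : PreCtx A} {p : A.Var × SortE A}
    (h : DerAt Ax n (.ctx (X ++ [p]))) :
    DerAt Ax n (.sort X p.2) ∧ (∀ q ∈ X, q.1 ≠ p.1) ∧ IsPreCtx (X ++ [p]) := by
  induction n with
  | zero => exact h.elim
  | succ n ih =>
    rcases h with h | h
    · exact ⟨Or.inl (ih h).1, (ih h).2⟩
    · generalize hJ : Judg.ctx (X ++ [p]) = J at h
      cases h with
      | ctx_nil => simp at hJ
      | ctx_cons a b c =>
        simp only [Judg.ctx.injEq] at hJ
        obtain ⟨rfl, h2⟩ := List.append_inj' hJ rfl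
        simp only [List.cons.injEq, and_true] at h2
        subst h2
        exact ⟨Or.inl a, b, c⟩
      | _ => cases hJ

theorem DerAt.ctx_nodup {n : ℕ} {X : PreCtx A} (h : DerAt Ax n (.ctx X)) :
    (X.map Prod.fst).Nodup := by
  induction X using List.reverseRecOn with
  | nil => simp
  | append_singleton X p ih =>
    have h1 := h.ctx_inv
    rw [List.map_append, List.nodup_append]
    refine ⟨ih h1.1.ctx, by simp, ?_⟩
    intro a ha b hb
    simp only [List.map_cons, List.map_nil, List.mem_singleton] at hb
    obtain ⟨q, hq, rfl⟩ := List.mem_map.1 ha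
    rw [hb]
    exact h1.2.1 q hq

theorem isPreCtx_nil : IsPreCtx ([] : PreCtx A) := by
  intro i hi; simp at hi

theorem DerAt.isPreCtx {n : ℕ} {X : PreCtx A} (h : DerAt Ax n (.ctx X)) : IsPreCtx X := by
  rcases List.eq_nil_or_concat X with rfl | ⟨Y, p, rfl⟩
  · exact isPreCtx_nil
  · rw [List.concat_eq_append] at h ⊢; exact h.ctx_inv.2.2

/-- One inference step, with the substitution rules phrased for functions on variables. -/
inductive CStep (Ax : Set (Judg A)) (D : Judg A → Prop) : Judg A → Prop where
  | ctx_nil : CStep Ax D (.ctx [])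
  | ctx_cons {X : PreCtx A} {p : A.Var × SortE A}
      (hs : D (.sort X p.2)) (hfresh : ∀ q ∈ X, q.1 ≠ p.1)
      (hpre : IsPreCtx (X ++ [p])) : CStep Ax D (.ctx (X ++ [p]))
  | s1 {X : PreCtx A} {U : SortE A} (h : D (.sort X U)) : CStep Ax D (.sortEq X U U)
  | s2 {X : PreCtx A} {U V : SortE A} (h : D (.sortEq X U V)) : CStep Ax D (.sortEq X V U)
  | s3 {X : PreCtx A} {U V W : SortE A}
      (h1 : D (.sortEq X U V)) (h2 : D (.sortEq X V W)) : CStep Ax D (.sortEq X U W)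
  | t1 {X : PreCtx A} {u : Expr A} {U : SortE A}
      (h : D (.term X u U)) : CStep Ax D (.termEq X u u U)
  | t2 {X : PreCtx A} {u v : Expr A} {U : SortE A}
      (h : D (.termEq X u v U)) : CStep Ax D (.termEq X v u U)
  | t3 {X : PreCtx A} {u v w : Expr A} {U : SortE A}
      (h1 : D (.termEq X u v U)) (h2 : D (.termEq X v w U)) : CStep Ax D (.termEq X u w U)
  | seqt {X : PreCtx A} {U U' : SortE A} {u : Expr A}
      (h1 : D (.sortEq X U U')) (h2 : D (.term X u U)) : CStep Ax D (.term X u U')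
  | seqteq {X : PreCtx A} {U U' : SortE A} {u u' : Expr A}
      (h1 : D (.sortEq X U U')) (h2 : D (.termEq X u u' U))
      (h3 : D (.term X u U')) (h4 : D (.term X u' U')) : CStep Ax D (.termEq X u u' U')
  | var {X : PreCtx A} {p : A.Var × SortE A} (hp : p ∈ X)
      (h : D (.sort X p.2)) : CStep Ax D (.term X (.var p.1) p.2)
  | sA {X : PreCtx A} {S : A.SortSym} (hax : introSort X S ∈ Ax) (h : D (.ctx X))
      (hv : ∀ p ∈ X, D (.term X (.var p.1) p.2)) : CStep Ax D (.sort X ⟨S, ctxVars X⟩)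
  | tA {X : PreCtx A} {t : A.TermSym} {U : SortE A} (hax : introTerm X t U ∈ Ax)
      (h : D (.sort X U)) (hv : ∀ p ∈ X, D (.term X (.var p.1) p.2)) :
      CStep Ax D (.term X (.app t (ctxVars X)) U)
  | seqA {X : PreCtx A} {U U' : SortE A} (hax : Judg.sortEq X U U' ∈ Ax)
      (h1 : D (.sort X U)) (h2 : D (.sort X U')) : CStep Ax D (.sortEq X U U')
  | teqA {X : PreCtx A} {u u' : Expr A} {U : SortE A} (hax : Judg.termEq X u u' U ∈ Ax)
      (h1 : D (.term X u U)) (h2 : D (.term X u' U)) : CStep Ax D (.termEq X u u' U)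
  | sSub {X : PreCtx A} {S : A.SortSym} (hax : introSort X S ∈ Ax)
      {Y : PreCtx A} {σ : A.Var → Expr A} (hJ : D (introSort X S)) (hY : D (.ctx Y))
      (hσ : ∀ p ∈ X, D (.term Y (σ p.1) (p.2.subst σ))) :
      CStep Ax D (.sort Y ⟨S, X.map fun p => σ p.1⟩)
  | tSub {X : PreCtx A} {t : A.TermSym} {U : SortE A} (hax : introTerm X t U ∈ Ax)
      {Y : PreCtx A} {σ : A.Var → Expr A} (hJ : D (introTerm X t U))
      (hU : D (.sort Y (U.subst σ)))
      (hσ : ∀ p ∈ X, D (.term Y (σ p.1) (p.2.subst σ))) :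
      CStep Ax D (.term Y (.app t (X.map fun p => σ p.1)) (U.subst σ))
  | seqSub1 {X : PreCtx A} {U U' : SortE A} (hax : Judg.sortEq X U U' ∈ Ax)
      {Y : PreCtx A} {σ : A.Var → Expr A} (hJ : D (.sortEq X U U'))
      (h1 : D (.sort Y (U.subst σ))) (h2 : D (.sort Y (U'.subst σ)))
      (hσ : ∀ p ∈ X, D (.term Y (σ p.1) (p.2.subst σ))) :
      CStep Ax D (.sortEq Y (U.subst σ) (U'.subst σ))
  | seqSub2 {X : PreCtx A} {S : A.SortSym} (hax : introSort X S ∈ Ax)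
      {Y : PreCtx A} {σ τ : A.Var → Expr A} (hJ : D (introSort X S))
      (h1 : D (.sort Y ⟨S, X.map fun p => σ p.1⟩)) (h2 : D (.sort Y ⟨S, X.map fun p => τ p.1⟩))
      (hστ : ∀ p ∈ X, D (.termEq Y (σ p.1) (τ p.1) (p.2.subst σ))) :
      CStep Ax D (.sortEq Y ⟨S, X.map fun p => σ p.1⟩ ⟨S, X.map fun p => τ p.1⟩)
  | teqSub1 {X : PreCtx A} {u u' : Expr A} {U : SortE A} (hax : Judg.termEq X u u' U ∈ Ax)
      {Y : PreCtx A} {σ : A.Var → Expr A} (hJ : D (.termEq X u u' U))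
      (h1 : D (.term Y (u.subst σ) (U.subst σ))) (h2 : D (.term Y (u'.subst σ) (U.subst σ)))
      (hσ : ∀ p ∈ X, D (.term Y (σ p.1) (p.2.subst σ))) :
      CStep Ax D (.termEq Y (u.subst σ) (u'.subst σ) (U.subst σ))
  | teqSub2 {X : PreCtx A} {t : A.TermSym} {U : SortE A} (hax : introTerm X t U ∈ Ax)
      {Y : PreCtx A} {σ τ : A.Var → Expr A} (hJ : D (introTerm X t U))
      (h1 : D (.term Y (.app t (X.map fun p => σ p.1)) (U.subst σ)))
      (h2 : D (.term Y (.app t (X.map fun p => τ p.1)) (U.subst σ)))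
      (hστ : ∀ p ∈ X, D (.termEq Y (σ p.1) (τ p.1) (p.2.subst σ))) :
      CStep Ax D (.termEq Y (.app t (X.map fun p => σ p.1)) (.app t (X.map fun p => τ p.1))
        (U.subst σ))

theorem lookupV_get {X : PreCtx A} {f : List (Expr A)} (hnd : (X.map Prod.fst).Nodup)
    (hl : f.length = X.length) (i : ℕ) (hi : i < X.length) (hif : i < f.length) :
    f[i]'hif = lookupV (mkSub X f) (X[i]'hi).1 := by
  have h := map_lookupV hnd hl
  have h2 : f[i]? = (X.map fun p => lookupV (mkSub X f) p.1)[i]? := by rw [h]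
  rw [List.getElem?_map, List.getElem?_eq_getElem hif, List.getElem?_eq_getElem hi] at h2
  simpa using h2

theorem Step.clean (hP : IsPretheory Ax) {n : ℕ} {J : Judg A} (h : Step Ax (DerAt Ax n) J) :
    CStep Ax (DerAt Ax n) J := by
  have key : ∀ {X Y : PreCtx A} {f : List (Expr A)} {J : Judg A}, DerAt Ax n J → J.ctxOf = X →
      f.length = X.length → (∀ i (hi : i < X.length) (hif : i < f.length),
        DerAt Ax n (.term Y (f[i]'hif) (subPre X f i hi))) →
      ∀ p ∈ X, DerAt Ax n
        (.term Y (lookupV (mkSub X f) p.1) (p.2.subst (lookupV (mkSub X f)))) := by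
    intro X Y f J hJ hX hl h p hp
    subst hX
    obtain ⟨i, hi, rfl⟩ := List.getElem_of_mem hp
    have := h i hi (hl ▸ hi)
    rwa [subPre_eq hJ.ctx.isPreCtx hl, lookupV_get hJ.ctx.ctx_nodup hl i hi] at this
  have key2 : ∀ {X Y : PreCtx A} {f g : List (Expr A)} {J : Judg A}, DerAt Ax n J →
      J.ctxOf = X →
      f.length = X.length → g.length = X.length →
      (∀ i (hi : i < X.length) (hif : i < f.length) (hig : i < g.length),
        DerAt Ax n (.termEq Y (f[i]'hif) (g[i]'hig) (subPre X f i hi))) →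
      ∀ p ∈ X, DerAt Ax n
        (.termEq Y (lookupV (mkSub X f) p.1) (lookupV (mkSub X g) p.1)
          (p.2.subst (lookupV (mkSub X f)))) := by
    intro X Y f g J hJ hX hl hl' h p hp
    subst hX
    obtain ⟨i, hi, rfl⟩ := List.getElem_of_mem hp
    have := h i hi (hl ▸ hi) (hl' ▸ hi)
    rwa [subPre_eq hJ.ctx.isPreCtx hl, lookupV_get hJ.ctx.ctx_nodup hl i hi,
      lookupV_get hJ.ctx.ctx_nodup hl' i hi] at this
  have nd : ∀ {X : PreCtx A} {f : List (Expr A)} {J : Judg A}, DerAt Ax n J → J.ctxOf = X →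
      f.length = X.length → f = X.map fun p => lookupV (mkSub X f) p.1 := by
    intro X f J hJ hX hl
    subst hX
    exact (map_lookupV hJ.ctx.ctx_nodup hl).symm
  cases h with
  | ctx_nil => exact .ctx_nil
  | ctx_cons a b c => exact .ctx_cons (p := (_, _)) a b c
  | s1 a => exact .s1 a
  | s2 a => exact .s2 a
  | s3 a b => exact .s3 a b
  | t1 a => exact .t1 a
  | t2 a => exact .t2 a
  | t3 a b => exact .t3 a b
  | seqt a b => exact .seqt a b
  | seqteq a b c d => exact .seqteq a b c d
  | var hi a => exact .var (List.getElem_mem hi) a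
  | @sA X U hax a b =>
    obtain ⟨S, es⟩ := U
    obtain rfl : es = ctxVars X := hP.sort_shape _ _ hax
    refine .sA hax a fun p hp => ?_
    obtain ⟨i, hi, rfl⟩ := List.getElem_of_mem hp
    exact b i hi
  | @tA X u U hax a b =>
    obtain ⟨t, rfl⟩ := hP.term_shape _ _ _ hax
    refine .tA hax a fun p hp => ?_
    obtain ⟨i, hi, rfl⟩ := List.getElem_of_mem hp
    exact b i hi
  | seqA hax a b => exact .seqA hax a b
  | teqA hax a b => exact .teqA hax a b
  | @sSub X S hax Y hY f hl a b c =>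
    rw [nd (X := X) a rfl hl]
    exact .sSub hax a b (key a rfl hl c)
  | @tSub X t U hax Y hY f hl a b c =>
    have := CStep.tSub (D := DerAt Ax n) hax a b (key a rfl hl c)
    rwa [← nd (X := X) a rfl hl] at this
  | seqSub1 hax hY hl a b c d => exact .seqSub1 hax a b c (key a rfl hl d)
  | @seqSub2 X S hax Y hY f g hl hl' a b c d =>
    have := CStep.seqSub2 (D := DerAt Ax n) hax a (σ := lookupV (mkSub X f))
      (τ := lookupV (mkSub X g))
      (by rw [← nd (X := X) a rfl hl]; exact b) (by rw [← nd (X := X) a rfl hl']; exact c) (key2 a rfl hl hl' d)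
    rwa [← nd (X := X) a rfl hl, ← nd (X := X) a rfl hl'] at this
  | teqSub1 hax hY hl a b c d => exact .teqSub1 hax a b c (key a rfl hl d)
  | @teqSub2 X t U hax Y hY f g hl hl' a b c d =>
    have := CStep.teqSub2 (D := DerAt Ax n) hax a (σ := lookupV (mkSub X f))
      (τ := lookupV (mkSub X g))
      (by rw [← nd (X := X) a rfl hl]; exact b) (by rw [← nd (X := X) a rfl hl']; exact c) (key2 a rfl hl hl' d)
    rwa [← nd (X := X) a rfl hl, ← nd (X := X) a rfl hl'] at this

end Stage

/-- Inversion principles shared by all stages of derivability. -/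
structure Hered (Ax : Set (Judg A)) (D : Judg A → Prop) : Prop where
  ctx : ∀ {J}, D J → D (.ctx J.ctxOf)
  ctx_inv : ∀ {X p}, D (.ctx (X ++ [p])) → D (.sort X p.2) ∧ ∀ q ∈ X, q.1 ≠ p.1
  sortEq : ∀ {X U V}, D (.sortEq X U V) → D (.sort X U) ∧ D (.sort X V)
  term : ∀ {X u U}, D (.term X u U) → D (.sort X U)
  termEq : ∀ {X u v U}, D (.termEq X u v U) → D (.term X u U) ∧ D (.term X v U)
  sort_inv : ∀ {X S f}, D (.sort X ⟨S, f⟩) → ∃ Xa σ, introSort Xa S ∈ Ax ∧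
    D (introSort Xa S) ∧ f = Xa.map (fun p => σ p.1) ∧
    ∀ p ∈ Xa, D (.term X (σ p.1) (p.2.subst σ))
  term_inv : ∀ {X t f V}, D (.term X (.app t f) V) → ∃ Xa U σ, introTerm Xa t U ∈ Ax ∧
    D (introTerm Xa t U) ∧ f = Xa.map (fun p => σ p.1) ∧
    (∀ p ∈ Xa, D (.term X (σ p.1) (p.2.subst σ))) ∧
    D (.term X (.app t f) (U.subst σ)) ∧
    (U.subst σ = V ∨ D (.sortEq X (U.subst σ) V))
  var_inv : ∀ {X x V}, D (.term X (.var x) V) → ∃ U, (x, U) ∈ X ∧ D (.sort X U) ∧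
    D (.term X (.var x) U) ∧ (U = V ∨ D (.sortEq X U V))

section Metatheory

variable {Ax : Set (Judg A)}

theorem ctxVars_eq (X : PreCtx A) : ctxVars X = X.map fun p => Expr.var p.1 := rfl

theorem DerAt.hered (hP : IsPretheory Ax) (n : ℕ) : Hered Ax (DerAt Ax n) := by
  induction n with
  | zero => constructor <;> intros <;> contradiction
  | succ n ih =>
    refine ⟨fun h => h.ctx, fun h => ⟨h.ctx_inv.1, h.ctx_inv.2.1⟩, ?_, ?_, ?_, ?_, ?_, ?_⟩
    · intro X U V h
      rcases h with h | h
      · exact ⟨Or.inl (ih.sortEq h).1, Or.inl (ih.sortEq h).2⟩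
      · cases h.clean hP with
        | s1 a => exact ⟨Or.inl a, Or.inl a⟩
        | s2 a => exact ⟨Or.inl (ih.sortEq a).2, Or.inl (ih.sortEq a).1⟩
        | s3 h1 h2 => exact ⟨Or.inl (ih.sortEq h1).1, Or.inl (ih.sortEq h2).2⟩
        | seqA _ h1 h2 => exact ⟨Or.inl h1, Or.inl h2⟩
        | seqSub1 _ _ h1 h2 _ => exact ⟨Or.inl h1, Or.inl h2⟩
        | seqSub2 _ _ h1 h2 _ => exact ⟨Or.inl h1, Or.inl h2⟩
    · intro X u U h
      rcases h with h | h
      · exact Or.inl (ih.term h)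
      · cases h.clean hP with
        | seqt h1 h2 => exact Or.inl (ih.sortEq h1).2
        | var _ a => exact Or.inl a
        | tA _ a _ => exact Or.inl a
        | tSub _ _ a _ => exact Or.inl a
    · intro X u v U h
      rcases h with h | h
      · exact ⟨Or.inl (ih.termEq h).1, Or.inl (ih.termEq h).2⟩
      · cases h.clean hP with
        | t1 a => exact ⟨Or.inl a, Or.inl a⟩
        | t2 a => exact ⟨Or.inl (ih.termEq a).2, Or.inl (ih.termEq a).1⟩
        | t3 h1 h2 => exact ⟨Or.inl (ih.termEq h1).1, Or.inl (ih.termEq h2).2⟩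
        | seqteq _ _ h1 h2 => exact ⟨Or.inl h1, Or.inl h2⟩
        | teqA _ h1 h2 => exact ⟨Or.inl h1, Or.inl h2⟩
        | teqSub1 _ _ h1 h2 _ => exact ⟨Or.inl h1, Or.inl h2⟩
        | teqSub2 _ _ h1 h2 _ => exact ⟨Or.inl h1, Or.inl h2⟩
    · intro X S f h
      rcases h with h | h
      · obtain ⟨Xa, σ, h1, h2, h3, h4⟩ := ih.sort_inv h
        exact ⟨Xa, σ, h1, Or.inl h2, h3, fun p hp => Or.inl (h4 p hp)⟩
      · have h0 := h
        cases h.clean hP with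
        | sA hax a hv =>
          refine ⟨X, Expr.var, hax, Or.inr h0, rfl, fun p hp => Or.inl ?_⟩
          rw [SortE.subst_id]; exact hv p hp
        | sSub hax h1 h2 h3 => exact ⟨_, _, hax, Or.inl h1, rfl, fun p hp => Or.inl (h3 p hp)⟩
    · intro X t f V h
      rcases h with h | h
      · obtain ⟨Xa, U, σ, h1, h2, h3, h4, h5, h6⟩ := ih.term_inv h
        exact ⟨Xa, U, σ, h1, Or.inl h2, h3, fun p hp => Or.inl (h4 p hp), Or.inl h5,
          h6.imp id Or.inl⟩
      · have h0 := h
        cases h.clean hP with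
        | tA hax a hv =>
          refine ⟨X, V, Expr.var, hax, Or.inr h0, rfl, fun p hp => Or.inl ?_, ?_, Or.inl ?_⟩
          · rw [SortE.subst_id]; exact hv p hp
          · rw [SortE.subst_id]; exact Or.inr h0
          · rw [SortE.subst_id]
        | tSub hax h1 h2 h3 =>
          exact ⟨_, _, _, hax, Or.inl h1, rfl, fun p hp => Or.inl (h3 p hp), Or.inr h0,
            Or.inl rfl⟩
        | seqt hE hT =>
          obtain ⟨Xa, U, σ, h1, h2, h3, h4, h5, h6⟩ := ih.term_inv hT
          refine ⟨Xa, U, σ, h1, Or.inl h2, h3, fun p hp => Or.inl (h4 p hp), Or.inl h5,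
            Or.inr ?_⟩
          rcases h6 with rfl | h6
          · exact Or.inl hE
          · exact Or.inr (.s3 h6 hE)
    · intro X x V h
      rcases h with h | h
      · obtain ⟨U, h1, h2, h3, h4⟩ := ih.var_inv h
        exact ⟨U, h1, Or.inl h2, Or.inl h3, h4.imp id Or.inl⟩
      · have h0 := h
        generalize hJ : Judg.term X (.var x) V = J at h
        cases h.clean hP with
        | @var X' p hp h' =>
          simp only [Judg.term.injEq, Expr.var.injEq] at hJ
          obtain ⟨rfl, rfl, rfl⟩ := hJ
          exact ⟨_, hp, Or.inl h', Or.inr h0, Or.inl rfl⟩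
        | seqt hE hT =>
          cases hJ
          obtain ⟨U, h1, h2, h3, h4⟩ := ih.var_inv hT
          refine ⟨U, h1, Or.inl h2, Or.inl h3, Or.inr ?_⟩
          rcases h4 with rfl | h4
          · exact Or.inl hE
          · exact Or.inr (.s3 h4 hE)
        | _ => cases hJ

theorem Derivable.hered (hP : IsPretheory Ax) : Hered Ax (Derivable Ax) := by
  have H := DerAt.hered hP
  refine ⟨fun ⟨n, h⟩ => ⟨n, h.ctx⟩, fun ⟨n, h⟩ => ⟨⟨n, h.ctx_inv.1⟩, h.ctx_inv.2.1⟩,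
    fun ⟨n, h⟩ => ⟨⟨n, ((H n).sortEq h).1⟩, ⟨n, ((H n).sortEq h).2⟩⟩,
    fun ⟨n, h⟩ => ⟨n, (H n).term h⟩,
    fun ⟨n, h⟩ => ⟨⟨n, ((H n).termEq h).1⟩, ⟨n, ((H n).termEq h).2⟩⟩, ?_, ?_, ?_⟩
  · rintro X S f ⟨n, h⟩
    obtain ⟨Xa, σ, h1, h2, h3, h4⟩ := (H n).sort_inv h
    exact ⟨Xa, σ, h1, ⟨n, h2⟩, h3, fun p hp => ⟨n, h4 p hp⟩⟩
  · rintro X t f V ⟨n, h⟩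
    obtain ⟨Xa, U, σ, h1, h2, h3, h4, h5, h6⟩ := (H n).term_inv h
    exact ⟨Xa, U, σ, h1, ⟨n, h2⟩, h3, fun p hp => ⟨n, h4 p hp⟩, ⟨n, h5⟩, h6.imp id fun h => ⟨n, h⟩⟩
  · rintro X x V ⟨n, h⟩
    obtain ⟨U, h1, h2, h3, h4⟩ := (H n).var_inv h
    exact ⟨U, h1, ⟨n, h2⟩, ⟨n, h3⟩, h4.imp id fun h => ⟨n, h⟩⟩

/-! ### Scoping -/

/-- All variables of an expression are among the names of a precontext. -/
def ScE (X : PreCtx A) (e : Expr A) : Prop := ∀ x, Occurs x e → x ∈ X.map Prod.fst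

/-- All variables of a sort expression are among the names of a precontext. -/
def ScS (X : PreCtx A) (U : SortE A) : Prop := ∀ x, SOccurs x U → x ∈ X.map Prod.fst

theorem DerAt.scoped (hP : IsPretheory Ax) (n : ℕ) :
    (∀ X U, DerAt Ax n (.sort X U) → ScS X U) ∧
    (∀ X u U, DerAt Ax n (.term X u U) → ScE X u) := by
  have var : ∀ {X : PreCtx A} {p}, p ∈ X → ScE X (.var p.1) := by
    intro X p hp x hx
    rw [Occurs.var_iff] at hx
    subst hx
    exact List.mem_map_of_mem hp
  induction n with
  | zero => exact ⟨fun _ _ h => h.elim, fun _ _ _ h => h.elim⟩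
  | succ n ih =>
    constructor
    · intro X U h
      rcases h with h | h
      · exact ih.1 _ _ h
      · cases h.clean hP with
        | sA hax h hv =>
          rintro x ⟨e, he, hx⟩
          obtain ⟨p, hp, rfl⟩ := List.mem_map.1 he
          exact var hp x hx
        | sSub hax h1 h2 h3 =>
          rintro x ⟨e, he, hx⟩
          obtain ⟨p, hp, rfl⟩ := List.mem_map.1 he
          exact ih.2 _ _ _ (h3 p hp) x hx
    · intro X u U h
      rcases h with h | h
      · exact ih.2 _ _ _ h
      · cases h.clean hP with
        | seqt h1 h2 => exact ih.2 _ _ _ h2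
        | var hp h => exact var hp
        | tA hax h hv =>
          intro x hx
          obtain ⟨e, he, hx⟩ := Occurs.app_iff.1 hx
          obtain ⟨p, hp, rfl⟩ := List.mem_map.1 he
          exact var hp x hx
        | tSub hax h1 h2 h3 =>
          intro x hx
          obtain ⟨e, he, hx⟩ := Occurs.app_iff.1 hx
          obtain ⟨p, hp, rfl⟩ := List.mem_map.1 he
          exact ih.2 _ _ _ (h3 p hp) x hx

theorem Derivable.scS (hP : IsPretheory Ax) {X : PreCtx A} {U : SortE A}
    (h : Derivable Ax (.sort X U)) : ScS X U := by
  obtain ⟨n, h⟩ := h; exact (DerAt.scoped hP n).1 _ _ h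

theorem Derivable.scE (hP : IsPretheory Ax) {X : PreCtx A} {u : Expr A} {U : SortE A}
    (h : Derivable Ax (.term X u U)) : ScE X u := by
  obtain ⟨n, h⟩ := h; exact (DerAt.scoped hP n).2 _ _ _ h

theorem Derivable.ctx {J : Judg A} (h : Derivable Ax J) : Derivable Ax (.ctx J.ctxOf) := by
  obtain ⟨n, h⟩ := h; exact ⟨n, h.ctx⟩

theorem Derivable.isPreCtx {X : PreCtx A} (h : Derivable Ax (.ctx X)) : IsPreCtx X := by
  obtain ⟨n, h⟩ := h; exact h.isPreCtx

theorem Derivable.ctx_nodup {X : PreCtx A} (h : Derivable Ax (.ctx X)) :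
    (X.map Prod.fst).Nodup := by
  obtain ⟨n, h⟩ := h; exact h.ctx_nodup

theorem SortE.substL_map {X : PreCtx A} {U : SortE A} (h : ScS X U) (σ : A.Var → Expr A) :
    U.substL (mkSub X (X.map fun p => σ p.1)) = U.subst σ :=
  SortE.subst_congr _ fun x hx => lookupV_mkSub_map X σ (h x hx)

theorem Expr.substL_map {X : PreCtx A} {u : Expr A} (h : ScE X u) (σ : A.Var → Expr A) :
    u.substL (mkSub X (X.map fun p => σ p.1)) = u.subst σ :=
  Expr.subst_congr _ fun x hx => lookupV_mkSub_map X σ (h x hx)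

theorem Derivable.cstep (hP : IsPretheory Ax) {J : Judg A} (h : CStep Ax (Derivable Ax) J) :
    Derivable Ax J := by
  have H := Derivable.hered hP
  have key : ∀ {X : PreCtx A} {σ : A.Var → Expr A} {J : Judg A}, Derivable Ax J → J.ctxOf = X →
      ∀ i (hi : i < X.length),
        subPre X (X.map fun p => σ p.1) i hi = (X[i]'hi).2.subst σ := by
    intro X σ J hJ hX i hi
    subst hX
    have hpre := hJ.ctx.isPreCtx
    rw [subPre_eq hpre (List.length_map _)]
    refine SortE.subst_congr _ fun x hx => lookupV_mkSub_map _ _ ?_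
    obtain ⟨p, hp, rfl⟩ := List.mem_map.1 (hpre i hi x hx)
    exact List.mem_map_of_mem (List.mem_of_mem_take hp)
  cases h with
  | ctx_nil => exact .step .ctx_nil
  | ctx_cons a b c => exact .step (.ctx_cons a b c)
  | s1 a => exact .step (.s1 a)
  | s2 a => exact .step (.s2 a)
  | s3 a b => exact .step (.s3 a b)
  | t1 a => exact .step (.t1 a)
  | t2 a => exact .step (.t2 a)
  | t3 a b => exact .step (.t3 a b)
  | seqt a b => exact .step (.seqt a b)
  | seqteq a b c d => exact .step (.seqteq a b c d)
  | var hp h =>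
    obtain ⟨i, hi, rfl⟩ := List.getElem_of_mem hp
    exact .step (.var hi h)
  | sA hax h hv => exact .step (.sA hax h fun i hi => hv _ (List.getElem_mem hi))
  | tA hax h hv => exact .step (.tA hax h fun i hi => hv _ (List.getElem_mem hi))
  | seqA hax a b => exact .step (.seqA hax a b)
  | teqA hax a b => exact .step (.teqA hax a b)
  | @sSub X S hax Y σ hJ hY hσ =>
    refine .step (.sSub hax hY.isPreCtx (List.length_map _) hJ hY fun i hi hif => ?_)
    rw [key (X := X) hJ rfl i hi, List.getElem_map]
    exact hσ _ (List.getElem_mem hi)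
  | @tSub X t U hax Y σ hJ hU hσ =>
    have hsc : ScS X U := (H.term hJ).scS hP
    have := Step.tSub (D := Derivable Ax) hax hU.ctx.isPreCtx
      (List.length_map (fun p : A.Var × SortE A => σ p.1)) hJ
      (by rw [SortE.substL_map hsc]; exact hU) fun i hi hif => by
        rw [key (X := X) hJ rfl i hi, List.getElem_map]
        exact hσ _ (List.getElem_mem hi)
    rw [SortE.substL_map hsc] at this
    exact .step this
  | @seqSub1 X U U' hax Y σ hJ h1 h2 hσ =>
    have hsc : ScS X U := (H.sortEq hJ).1.scS hP
    have hsc' : ScS X U' := (H.sortEq hJ).2.scS hP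
    have := Step.seqSub1 (D := Derivable Ax) hax h1.ctx.isPreCtx
      (List.length_map (fun p : A.Var × SortE A => σ p.1)) hJ
      (by rw [SortE.substL_map hsc]; exact h1) (by rw [SortE.substL_map hsc']; exact h2)
      fun i hi hif => by
        rw [key (X := X) hJ rfl i hi, List.getElem_map]
        exact hσ _ (List.getElem_mem hi)
    rw [SortE.substL_map hsc, SortE.substL_map hsc'] at this
    exact .step this
  | @seqSub2 X S hax Y σ τ hJ h1 h2 hσ =>
    refine .step (.seqSub2 hax h1.ctx.isPreCtx (List.length_map _) (List.length_map _) hJ h1 h2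
      fun i hi hif hig => ?_)
    rw [key (X := X) hJ rfl i hi, List.getElem_map, List.getElem_map]
    exact hσ _ (List.getElem_mem hi)
  | @teqSub1 X u u' U hax Y σ hJ h1 h2 hσ =>
    have hsc : ScS X U := (H.term (H.termEq hJ).1).scS hP
    have hsu : ScE X u := (H.termEq hJ).1.scE hP
    have hsu' : ScE X u' := (H.termEq hJ).2.scE hP
    have := Step.teqSub1 (D := Derivable Ax) hax h1.ctx.isPreCtx
      (List.length_map (fun p : A.Var × SortE A => σ p.1)) hJ
      (by rw [SortE.substL_map hsc, Expr.substL_map hsu]; exact h1)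
      (by rw [SortE.substL_map hsc, Expr.substL_map hsu']; exact h2)
      fun i hi hif => by
        rw [key (X := X) hJ rfl i hi, List.getElem_map]
        exact hσ _ (List.getElem_mem hi)
    rw [SortE.substL_map hsc, Expr.substL_map hsu, Expr.substL_map hsu'] at this
    exact .step this
  | @teqSub2 X t U hax Y σ τ hJ h1 h2 hσ =>
    have hsc : ScS X U := (H.term hJ).scS hP
    have := Step.teqSub2 (D := Derivable Ax) hax h1.ctx.isPreCtx
      (List.length_map (fun p : A.Var × SortE A => σ p.1))
      (List.length_map (fun p : A.Var × SortE A => τ p.1)) hJ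
      (by rw [SortE.substL_map hsc]; exact h1) (by rw [SortE.substL_map hsc]; exact h2)
      fun i hi hif hig => by
        rw [key (X := X) hJ rfl i hi, List.getElem_map, List.getElem_map]
        exact hσ _ (List.getElem_mem hi)
    rw [SortE.substL_map hsc] at this
    exact .step this

theorem Derivable.snoc (hP : IsPretheory Ax) {X : PreCtx A} {p : A.Var × SortE A}
    (hs : Derivable Ax (.sort X p.2)) (hf : ∀ q ∈ X, q.1 ≠ p.1) :
    Derivable Ax (.ctx (X ++ [p])) := by
  refine .cstep hP (.ctx_cons hs hf ?_)
  intro i hi v hv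
  rcases Nat.lt_or_ge i X.length with h | h
  · rw [List.getElem_append_left h] at hv
    rw [List.take_append_of_le_length h.le]
    exact hs.ctx.isPreCtx i h v hv
  · obtain rfl : i = X.length := by
      simp only [List.length_append, List.length_singleton] at hi; omega
    rw [List.getElem_append_right le_rfl] at hv
    simp only [Nat.sub_self, List.getElem_cons_zero] at hv
    rw [List.take_left]
    exact hs.scS hP v hv

/-! ### Substitution -/

/-- `σ` is a morphism from `Γ` to `Δ`. -/
def Mor (Ax : Set (Judg A)) (Γ Δ : PreCtx A) (σ : A.Var → Expr A) : Prop :=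
  Derivable Ax (.ctx Γ) ∧ ∀ p ∈ Δ, Derivable Ax (.term Γ (σ p.1) (p.2.subst σ))

/-- The action of a substitution on judgments. -/
def Judg.sub (Γ : PreCtx A) (σ : A.Var → Expr A) : Judg A → Judg A
  | .ctx _ => .ctx Γ
  | .sort _ U => .sort Γ (U.subst σ)
  | .term _ u U => .term Γ (u.subst σ) (U.subst σ)
  | .sortEq _ U V => .sortEq Γ (U.subst σ) (V.subst σ)
  | .termEq _ u v U => .termEq Γ (u.subst σ) (v.subst σ) (U.subst σ)

theorem Derivable.sub (hP : IsPretheory Ax) {J : Judg A} (hJ : Derivable Ax J) {Γ : PreCtx A}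
    {σ : A.Var → Expr A} (hσ : Mor Ax Γ J.ctxOf σ) : Derivable Ax (J.sub Γ σ) := by
  obtain ⟨n, hJ⟩ := hJ
  suffices H : ∀ J X, DerAt Ax n J → J.ctxOf = X → Mor Ax Γ X σ → Derivable Ax (J.sub Γ σ) from
    H _ _ hJ rfl hσ
  clear hJ hσ J
  have map_eq : ∀ (X : PreCtx A) (τ : A.Var → Expr A),
      (X.map fun p => τ p.1).map (Expr.subst σ) = X.map fun p => (τ p.1).subst σ := by
    intro X τ; rw [List.map_map]; rfl
  induction n with
  | zero => intro J X h; exact h.elim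
  | succ n ih =>
    intro J X h hX hσ
    subst hX
    rcases h with h | h
    · exact ih _ _ h rfl hσ
    have h0 : Derivable Ax J := ⟨n + 1, Or.inr h⟩
    cases h.clean hP with
    | ctx_nil => exact hσ.1
    | ctx_cons => exact hσ.1
    | s1 a => exact .cstep hP (.s1 (ih _ _ a rfl hσ))
    | s2 a => exact .cstep hP (.s2 (ih _ _ a rfl hσ))
    | s3 a b => exact .cstep hP (.s3 (ih _ _ a rfl hσ) (ih _ _ b rfl hσ))
    | t1 a => exact .cstep hP (.t1 (ih _ _ a rfl hσ))
    | t2 a => exact .cstep hP (.t2 (ih _ _ a rfl hσ))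
    | t3 a b => exact .cstep hP (.t3 (ih _ _ a rfl hσ) (ih _ _ b rfl hσ))
    | seqt a b => exact .cstep hP (.seqt (ih _ _ a rfl hσ) (ih _ _ b rfl hσ))
    | seqteq a b c d =>
      exact .cstep hP (.seqteq (ih _ _ a rfl hσ) (ih _ _ b rfl hσ) (ih _ _ c rfl hσ)
        (ih _ _ d rfl hσ))
    | var hp a => rw [Judg.sub, Expr.subst_var]; exact hσ.2 _ hp
    | @sA X S hax a b =>
      have := Derivable.cstep hP (.sSub hax h0 hσ.1 hσ.2)
      simpa [Judg.sub, SortE.subst, ctxVars, Expr.subst_var, Function.comp_def] using this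
    | @tA X t U hax a b =>
      have := Derivable.cstep hP (.tSub hax h0 (ih _ _ a rfl hσ) hσ.2)
      simpa [Judg.sub, ctxVars, Expr.subst_var, Expr.subst_app, Function.comp_def] using this
    | seqA hax a b =>
      exact .cstep hP (.seqSub1 hax h0 (ih _ _ a rfl hσ) (ih _ _ b rfl hσ) hσ.2)
    | teqA hax a b =>
      exact .cstep hP (.teqSub1 hax h0 (ih _ _ a rfl hσ) (ih _ _ b rfl hσ) hσ.2)
    | @sSub X S hax Y τ hJ hY hτ =>
      have := Derivable.cstep hP (.sSub hax ⟨n, hJ⟩ hσ.1 (σ := fun x => (τ x).subst σ)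
        fun p hp => by rw [← SortE.subst_subst]; exact ih _ _ (hτ p hp) rfl hσ)
      rw [← map_eq] at this
      exact this
    | @tSub X t U hax Y τ hJ hU hτ =>
      have := Derivable.cstep hP (.tSub hax ⟨n, hJ⟩ (σ := fun x => (τ x).subst σ)
        (by rw [← SortE.subst_subst]; exact ih _ _ hU rfl hσ)
        fun p hp => by rw [← SortE.subst_subst]; exact ih _ _ (hτ p hp) rfl hσ)
      rw [← map_eq, ← SortE.subst_subst, ← Expr.subst_app] at this
      exact this
    | @seqSub1 X U U' hax Y τ hJ h1 h2 hτ =>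
      have := Derivable.cstep hP (.seqSub1 hax ⟨n, hJ⟩ (σ := fun x => (τ x).subst σ)
        (by rw [← SortE.subst_subst]; exact ih _ _ h1 rfl hσ)
        (by rw [← SortE.subst_subst]; exact ih _ _ h2 rfl hσ)
        fun p hp => by rw [← SortE.subst_subst]; exact ih _ _ (hτ p hp) rfl hσ)
      rw [← SortE.subst_subst, ← SortE.subst_subst] at this
      exact this
    | @seqSub2 X S hax Y τ τ' hJ h1 h2 hτ =>
      have := Derivable.cstep hP (.seqSub2 hax ⟨n, hJ⟩ (σ := fun x => (τ x).subst σ)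
        (τ := fun x => (τ' x).subst σ)
        (by rw [← map_eq]; exact ih _ _ h1 rfl hσ)
        (by rw [← map_eq]; exact ih _ _ h2 rfl hσ)
        fun p hp => by rw [← SortE.subst_subst]; exact ih _ _ (hτ p hp) rfl hσ)
      rw [← map_eq, ← map_eq] at this
      exact this
    | @teqSub1 X u u' U hax Y τ hJ h1 h2 hτ =>
      have := Derivable.cstep hP (.teqSub1 hax ⟨n, hJ⟩ (σ := fun x => (τ x).subst σ)
        (by rw [← SortE.subst_subst, ← Expr.subst_subst]; exact ih _ _ h1 rfl hσ)
        (by rw [← SortE.subst_subst, ← Expr.subst_subst]; exact ih _ _ h2 rfl hσ)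
        fun p hp => by rw [← SortE.subst_subst]; exact ih _ _ (hτ p hp) rfl hσ)
      rw [← SortE.subst_subst, ← Expr.subst_subst, ← Expr.subst_subst] at this
      exact this
    | @teqSub2 X t U hax Y τ τ' hJ h1 h2 hτ =>
      have h1' := ih _ _ h1 rfl hσ
      have h2' := ih _ _ h2 rfl hσ
      rw [Judg.sub, Expr.subst_app] at h1' h2'
      have := Derivable.cstep hP (.teqSub2 hax ⟨n, hJ⟩ (σ := fun x => (τ x).subst σ)
        (τ := fun x => (τ' x).subst σ)
        (by rw [← map_eq, ← SortE.subst_subst]; exact h1')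
        (by rw [← map_eq, ← SortE.subst_subst]; exact h2')
        fun p hp => by rw [← SortE.subst_subst]; exact ih _ _ (hτ p hp) rfl hσ)
      rw [← map_eq, ← map_eq, ← SortE.subst_subst, ← Expr.subst_app, ← Expr.subst_app] at this
      exact this

end Metatheory

section Metatheory

variable {Ax : Set (Judg A)}

theorem Mor.build (hP : IsPretheory Ax) {Γ Δ : PreCtx A} {σ : A.Var → Expr A}
    (hΔ : Derivable Ax (.ctx Δ)) (hΓ : Derivable Ax (.ctx Γ))
    (h : ∀ p ∈ Δ, Derivable Ax (.sort Γ (p.2.subst σ)) →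
      Derivable Ax (.term Γ (σ p.1) (p.2.subst σ))) : Mor Ax Γ Δ σ := by
  induction Δ using List.reverseRecOn with
  | nil => exact ⟨hΓ, by simp⟩
  | append_singleton Δ q ih =>
    have hq := ((Derivable.hered hP).ctx_inv hΔ).1
    have hm := ih hq.ctx fun p hp => h p (List.mem_append_left _ hp)
    refine ⟨hΓ, fun p hp => ?_⟩
    rcases List.mem_append.1 hp with hp' | hp'
    · exact hm.2 p hp'
    · obtain rfl := List.mem_singleton.1 hp'
      exact h p hp (hq.sub hP hm)

theorem Mor.incl (hP : IsPretheory Ax) {Γ Δ : PreCtx A}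
    (hΔ : Derivable Ax (.ctx Δ)) (hΓ : Derivable Ax (.ctx Γ)) (h : Δ ⊆ Γ) :
    Mor Ax Γ Δ Expr.var := by
  refine Mor.build hP hΔ hΓ fun p hp hs => ?_
  rw [SortE.subst_id] at hs ⊢
  exact .cstep hP (.var (h hp) hs)

theorem Judg.sub_var (J : Judg A) (Γ : PreCtx A) :
    J.sub Γ Expr.var = match J with
      | .ctx _ => .ctx Γ
      | .sort _ U => .sort Γ U
      | .term _ u U => .term Γ u U
      | .sortEq _ U V => .sortEq Γ U V
      | .termEq _ u v U => .termEq Γ u v U := by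
  cases J <;> simp only [Judg.sub, SortE.subst_id, Expr.subst_id]

theorem Derivable.weak (hP : IsPretheory Ax) {J : Judg A} (hJ : Derivable Ax J) {Γ : PreCtx A}
    (hΓ : Derivable Ax (.ctx Γ)) (h : J.ctxOf ⊆ Γ) : Derivable Ax (J.sub Γ Expr.var) :=
  hJ.sub hP (Mor.incl hP hJ.ctx hΓ h)

theorem Derivable.weak_term (hP : IsPretheory Ax) {Δ Γ : PreCtx A} {u : Expr A} {U : SortE A}
    (hJ : Derivable Ax (.term Δ u U)) (hΓ : Derivable Ax (.ctx Γ)) (h : Δ ⊆ Γ) :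
    Derivable Ax (.term Γ u U) := by
  simpa only [Judg.sub_var] using hJ.weak hP hΓ h

theorem Derivable.var (hP : IsPretheory Ax) {Γ : PreCtx A} (hΓ : Derivable Ax (.ctx Γ))
    {p : A.Var × SortE A} (hp : p ∈ Γ) : Derivable Ax (.term Γ (.var p.1) p.2) := by
  have := (Mor.incl hP hΓ hΓ (List.Subset.refl _)).2 p hp
  rwa [SortE.subst_id] at this

theorem Derivable.conv (hP : IsPretheory Ax) {Γ : PreCtx A} {u : Expr A} {U V : SortE A}
    (h : Derivable Ax (.term Γ u U)) (hE : Derivable Ax (.sortEq Γ U V)) :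
    Derivable Ax (.term Γ u V) := .cstep hP (.seqt hE h)

theorem Derivable.symm (hP : IsPretheory Ax) {Γ : PreCtx A} {U V : SortE A}
    (hE : Derivable Ax (.sortEq Γ U V)) : Derivable Ax (.sortEq Γ V U) := .cstep hP (.s2 hE)

theorem Derivable.convEq (hP : IsPretheory Ax) {Γ : PreCtx A} {u v : Expr A} {U V : SortE A}
    (h : Derivable Ax (.termEq Γ u v U)) (hE : Derivable Ax (.sortEq Γ U V)) :
    Derivable Ax (.termEq Γ u v V) :=
  have H := (Derivable.hered hP).termEq h
  .cstep hP (.seqteq hE h (H.1.conv hP hE) (H.2.conv hP hE))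

theorem DerAt.sub_congr (hP : IsPretheory Ax) {Γ Δ : PreCtx A} {σ τ : A.Var → Expr A}
    (hσ : Mor Ax Γ Δ σ) (hτ : Mor Ax Γ Δ τ)
    (hE : ∀ p ∈ Δ, Derivable Ax (.termEq Γ (σ p.1) (τ p.1) (p.2.subst σ))) (n : ℕ) :
    (∀ U, DerAt Ax n (.sort Δ U) → Derivable Ax (.sortEq Γ (U.subst σ) (U.subst τ))) ∧
    (∀ u U, DerAt Ax n (.term Δ u U) →
      Derivable Ax (.termEq Γ (u.subst σ) (u.subst τ) (U.subst σ))) := by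
  have map_eq : ∀ (X : PreCtx A) (ρ σ : A.Var → Expr A),
      (X.map fun p => ρ p.1).map (Expr.subst σ) = X.map fun p => (ρ p.1).subst σ := by
    intro X τ σ; rw [List.map_map]; rfl
  have map_eq' : ∀ (X : PreCtx A) (σ : A.Var → Expr A),
      (ctxVars X).map (Expr.subst σ) = X.map fun p => σ p.1 := by
    intro X σ; rw [ctxVars, List.map_map]
    exact List.map_congr_left fun p _ => Expr.subst_var _ _
  have H := Derivable.hered hP
  induction n with
  | zero => exact ⟨fun _ h => h.elim, fun _ _ h => h.elim⟩
  | succ n ih =>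
    constructor
    · intro U h
      rcases h with h | h
      · exact ih.1 _ h
      have h0 : Derivable Ax (.sort Δ U) := ⟨n + 1, Or.inr h⟩
      have hs := h0.sub hP hσ
      have ht := h0.sub hP hτ
      cases h.clean hP with
      | sA hax a b =>
        simp only [Judg.sub, SortE.subst, map_eq'] at hs ht ⊢
        exact .cstep hP (.seqSub2 hax h0 hs ht hE)
      | @sSub X S hax Y ρ hJ hY hρ =>
        simp only [Judg.sub, SortE.subst, map_eq] at hs ht ⊢
        refine .cstep hP (.seqSub2 (σ := fun x => (ρ x).subst σ) (τ := fun x => (ρ x).subst τ)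
          hax ⟨n, hJ⟩ hs ht fun p hp => ?_)
        rw [← SortE.subst_subst]
        exact ih.2 _ _ (hρ p hp)
    · intro u U h
      rcases h with h | h
      · exact ih.2 _ _ h
      have h0 : Derivable Ax (.term Δ u U) := ⟨n + 1, Or.inr h⟩
      have hs := h0.sub hP hσ
      have ht := h0.sub hP hτ
      cases h.clean hP with
      | seqt a b =>
        have e := Derivable.sub hP ⟨n, a⟩ hσ
        exact (ih.2 _ _ b).convEq hP e
      | var hp a => rw [Expr.subst_var, Expr.subst_var]; exact hE _ hp
      | tA hax a b =>
        have e := ih.1 _ a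
        have ht := Derivable.conv hP ht (e.symm hP)
        simp only [Judg.sub, Expr.subst_app, map_eq'] at hs ht ⊢
        exact .cstep hP (.teqSub2 hax h0 hs ht hE)
      | @tSub X t V hax Y ρ hJ hU hρ =>
        have e := ih.1 _ hU
        have ht := Derivable.conv hP ht (e.symm hP)
        simp only [Judg.sub, Expr.subst_app, map_eq, SortE.subst_subst] at hs ht ⊢
        refine .cstep hP (.teqSub2 (σ := fun x => (ρ x).subst σ) (τ := fun x => (ρ x).subst τ)
          hax ⟨n, hJ⟩ hs ht fun p hp => ?_)
        rw [← SortE.subst_subst]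
        exact ih.2 _ _ (hρ p hp)

/-- Typability of a term expression. -/
def HasT (Ax : Set (Judg A)) (Γ : PreCtx A) (a : Expr A) : Prop :=
  ∃ W, Derivable Ax (.term Γ a W)

/-- Derivable equality of term expressions at some sort. -/
def EqT (Ax : Set (Judg A)) (Γ : PreCtx A) (a b : Expr A) : Prop :=
  ∃ W, Derivable Ax (.termEq Γ a b W)

theorem IsPretheory.term_unique (hP : IsPretheory Ax) {X X' : PreCtx A} {t : A.TermSym}
    {U U' : SortE A} (h : introTerm X t U ∈ Ax) (h' : introTerm X' t U' ∈ Ax) :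
    X = X' ∧ U = U' := by
  have := (hP.term_intro t).unique (y₁ := (X, U)) (y₂ := (X', U')) h h'
  exact Prod.mk.inj this

theorem subst_eq_of_map_eq {X : PreCtx A} {U : SortE A} (hU : ScS X U) {σ τ : A.Var → Expr A}
    (h : (X.map fun p => σ p.1) = X.map fun p => τ p.1) : U.subst σ = U.subst τ := by
  refine SortE.subst_congr _ fun x hx => ?_
  obtain ⟨p, hp, rfl⟩ := List.mem_map.1 (hU x hx)
  exact List.map_inj_left.1 h p hp

theorem Derivable.nodup_unique {Γ : PreCtx A} (hΓ : Derivable Ax (.ctx Γ)) {x : A.Var}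
    {U V : SortE A} (h : (x, U) ∈ Γ) (h' : (x, V) ∈ Γ) : U = V := by
  have := List.inj_on_of_nodup_map hΓ.ctx_nodup h h' rfl
  exact (Prod.mk.inj this).2

theorem Derivable.sort_unique (hP : IsPretheory Ax) {Γ : PreCtx A} {a : Expr A} {W W' : SortE A}
    (h : Derivable Ax (.term Γ a W)) (h' : Derivable Ax (.term Γ a W')) :
    Derivable Ax (.sortEq Γ W W') := by
  have H := Derivable.hered hP
  have fin : ∀ U, (U = W ∨ Derivable Ax (.sortEq Γ U W)) →
      (U = W' ∨ Derivable Ax (.sortEq Γ U W')) → Derivable Ax (.sortEq Γ W W') := by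
    intro U h1 h2
    have h1 : Derivable Ax (.sortEq Γ W U) := by
      rcases h1 with rfl | h1
      · exact .cstep hP (.s1 (H.term h))
      · exact h1.symm hP
    rcases h2 with rfl | h2
    · exact h1
    · exact .cstep hP (.s3 h1 h2)
  cases a with
  | var x =>
    obtain ⟨U, h1, _, _, h2⟩ := H.var_inv h
    obtain ⟨U', h1', _, _, h2'⟩ := H.var_inv h'
    obtain rfl := Derivable.nodup_unique h.ctx h1 h1'
    exact fin _ h2 h2'
  | app t f =>
    obtain ⟨Xa, U, σ, h1, h2, h3, _, _, h4⟩ := H.term_inv h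
    obtain ⟨Xa', U', σ', h1', h2', h3', _, _, h4'⟩ := H.term_inv h'
    obtain ⟨rfl, rfl⟩ := hP.term_unique h1 h1'
    have hsc : ScS Xa U := (H.term h2).scS hP
    rw [subst_eq_of_map_eq hsc (h3'.symm.trans h3)] at h4'
    exact fin _ h4 h4'

theorem EqT.hasT (hP : IsPretheory Ax) {Γ : PreCtx A} {a b : Expr A} (h : EqT Ax Γ a b) :
    HasT Ax Γ a ∧ HasT Ax Γ b := by
  obtain ⟨W, h⟩ := h
  exact ⟨⟨W, ((Derivable.hered hP).termEq h).1⟩, ⟨W, ((Derivable.hered hP).termEq h).2⟩⟩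

theorem HasT.refl (hP : IsPretheory Ax) {Γ : PreCtx A} {a : Expr A} (h : HasT Ax Γ a) :
    EqT Ax Γ a a := by
  obtain ⟨W, h⟩ := h; exact ⟨W, .cstep hP (.t1 h)⟩

theorem EqT.symm (hP : IsPretheory Ax) {Γ : PreCtx A} {a b : Expr A} (h : EqT Ax Γ a b) :
    EqT Ax Γ b a := by
  obtain ⟨W, h⟩ := h; exact ⟨W, .cstep hP (.t2 h)⟩

theorem EqT.at (hP : IsPretheory Ax) {Γ : PreCtx A} {a b : Expr A} {W : SortE A}
    (h : EqT Ax Γ a b) (ha : Derivable Ax (.term Γ a W)) : Derivable Ax (.termEq Γ a b W) := by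
  obtain ⟨W', h⟩ := h
  exact h.convEq hP (((Derivable.hered hP).termEq h).1.sort_unique hP ha)

theorem EqT.typed (hP : IsPretheory Ax) {Γ : PreCtx A} {a b : Expr A} {W : SortE A}
    (h : EqT Ax Γ a b) (ha : Derivable Ax (.term Γ a W)) : Derivable Ax (.term Γ b W) :=
  ((Derivable.hered hP).termEq (h.at hP ha)).2

theorem EqT.trans (hP : IsPretheory Ax) {Γ : PreCtx A} {a b c : Expr A} (h : EqT Ax Γ a b)
    (h' : EqT Ax Γ b c) : EqT Ax Γ a c := by
  obtain ⟨W, h⟩ := h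
  exact ⟨W, .cstep hP (.t3 h (h'.at hP ((Derivable.hered hP).termEq h).2))⟩

theorem Mor.congr (hP : IsPretheory Ax) {Γ Δ : PreCtx A} {σ τ : A.Var → Expr A}
    (hΔ : Derivable Ax (.ctx Δ)) (hσ : Mor Ax Γ Δ σ)
    (h : ∀ p ∈ Δ, EqT Ax Γ (σ p.1) (τ p.1)) : Mor Ax Γ Δ τ := by
  induction Δ using List.reverseRecOn with
  | nil => exact ⟨hσ.1, by simp⟩
  | append_singleton Δ q ih =>
    have hq := ((Derivable.hered hP).ctx_inv hΔ).1
    have hσ' : Mor Ax Γ Δ σ := ⟨hσ.1, fun p hp => hσ.2 p (List.mem_append_left _ hp)⟩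
    have hm := ih hq.ctx hσ' fun p hp => h p (List.mem_append_left _ hp)
    refine ⟨hσ.1, fun p hp => ?_⟩
    rcases List.mem_append.1 hp with hp' | hp'
    · exact hm.2 p hp'
    · obtain rfl := List.mem_singleton.1 hp'
      have h1 := (h p hp).typed hP (hσ.2 p hp)
      obtain ⟨n, hq⟩ := hq
      exact h1.conv hP ((DerAt.sub_congr hP hσ' hm (fun r hr =>
        (h r (List.mem_append_left _ hr)).at hP (hσ'.2 r hr)) n).1 _ hq)

theorem Derivable.sort_congr_map (hP : IsPretheory Ax) {Γ Δ : PreCtx A} {U : SortE A}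
    (hU : Derivable Ax (.sort Δ U)) {σ τ : A.Var → Expr A} (hσ : Mor Ax Γ Δ σ)
    (h : ∀ p ∈ Δ, EqT Ax Γ (σ p.1) (τ p.1)) :
    Derivable Ax (.sortEq Γ (U.subst σ) (U.subst τ)) := by
  have hτ := Mor.congr hP hU.ctx hσ h
  obtain ⟨n, hU⟩ := hU
  exact (DerAt.sub_congr hP hσ hτ (fun r hr => (h r hr).at hP (hσ.2 r hr)) n).1 _ hU

theorem exists_map {X : PreCtx A} (hX : (X.map Prod.fst).Nodup) {f : List (Expr A)}
    (hl : f.length = X.length) : ∃ σ : A.Var → Expr A, f = X.map fun p => σ p.1 :=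
  ⟨_, (map_lookupV hX hl).symm⟩

theorem EqT.app (hP : IsPretheory Ax) {Γ : PreCtx A} {t : A.TermSym} {h h' : List (Expr A)}
    (ht : HasT Ax Γ (.app t h)) (hh : List.Forall₂ (EqT Ax Γ) h h') :
    EqT Ax Γ (.app t h) (.app t h') := by
  have H := Derivable.hered hP
  obtain ⟨W, ht⟩ := ht
  obtain ⟨Xa, U, σ, h1, h2, rfl, h3, h4, _⟩ := H.term_inv ht
  obtain ⟨τ, rfl⟩ := exists_map (X := Xa) h2.ctx.ctx_nodup (f := h') (by
    rw [← hh.length_eq, List.length_map])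
  rw [List.forall₂_map_left_iff, List.forall₂_map_right_iff, List.forall₂_same] at hh
  have hσ : Mor Ax Γ Xa σ := ⟨ht.ctx, h3⟩
  have hτ := Mor.congr hP h2.ctx hσ hh
  have e := (H.term h2).sort_congr_map hP hσ hh
  have := Derivable.cstep hP (.tSub h1 h2 (H.sortEq e).2 hτ.2)
  exact ⟨_, .cstep hP (.teqSub2 h1 h2 h4 (this.conv hP (e.symm hP))
    fun p hp => (hh p hp).at hP (h3 p hp))⟩

theorem Derivable.sort_congr (hP : IsPretheory Ax) {Γ : PreCtx A} {S : A.SortSym}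
    {h h' : List (Expr A)} (hs : Derivable Ax (.sort Γ ⟨S, h⟩))
    (hh : List.Forall₂ (EqT Ax Γ) h h') : Derivable Ax (.sortEq Γ ⟨S, h⟩ ⟨S, h'⟩) := by
  have H := Derivable.hered hP
  obtain ⟨Xa, σ, h1, h2, rfl, h3⟩ := H.sort_inv hs
  obtain ⟨τ, rfl⟩ := exists_map (X := Xa) h2.ctx.ctx_nodup (f := h') (by
    rw [← hh.length_eq, List.length_map])
  rw [List.forall₂_map_left_iff, List.forall₂_map_right_iff, List.forall₂_same] at hh
  have hσ : Mor Ax Γ Xa σ := ⟨hs.ctx, h3⟩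
  have hτ := Mor.congr hP h2.ctx hσ hh
  exact .cstep hP (.seqSub2 h1 h2 hs (.cstep hP (.sSub h1 h2 hτ.1 hτ.2))
    fun p hp => (hh p hp).at hP (h3 p hp))

theorem HasT.args (hP : IsPretheory Ax) {Γ : PreCtx A} {t : A.TermSym} {h : List (Expr A)}
    (ht : HasT Ax Γ (.app t h)) : ∀ e ∈ h, HasT Ax Γ e := by
  obtain ⟨W, ht⟩ := ht
  obtain ⟨Xa, U, σ, h1, h2, rfl, h3, _⟩ := (Derivable.hered hP).term_inv ht
  intro e he
  obtain ⟨p, hp, rfl⟩ := List.mem_map.1 he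
  exact ⟨_, h3 p hp⟩

theorem Derivable.sort_args (hP : IsPretheory Ax) {Γ : PreCtx A} {U : SortE A}
    (hs : Derivable Ax (.sort Γ U)) : ∀ e ∈ U.args, HasT Ax Γ e := by
  obtain ⟨Xa, σ, h1, h2, h3, h4⟩ := (Derivable.hered hP).sort_inv (S := U.head) (f := U.args) hs
  intro e he
  rw [h3] at he
  obtain ⟨p, hp, rfl⟩ := List.mem_map.1 he
  exact ⟨_, h4 p hp⟩

/-- Substitution respects typability. -/
theorem HasT.subst (hP : IsPretheory Ax) {Γ Δ : PreCtx A} {σ : A.Var → Expr A} {a : Expr A}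
    (h : HasT Ax Δ a) (hσ : Mor Ax Γ Δ σ) : HasT Ax Γ (a.subst σ) := by
  obtain ⟨W, h⟩ := h; exact ⟨_, h.sub hP hσ⟩

theorem EqT.subst (hP : IsPretheory Ax) {Γ Δ : PreCtx A} {σ : A.Var → Expr A} {a b : Expr A}
    (h : EqT Ax Δ a b) (hσ : Mor Ax Γ Δ σ) : EqT Ax Γ (a.subst σ) (b.subst σ) := by
  obtain ⟨W, h⟩ := h; exact ⟨_, h.sub hP hσ⟩

theorem EqT.weak (hP : IsPretheory Ax) {Γ Δ : PreCtx A} {a b : Expr A}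
    (h : EqT Ax Δ a b) (hΓ : Derivable Ax (.ctx Γ)) (hs : Δ ⊆ Γ) : EqT Ax Γ a b := by
  obtain ⟨W, h⟩ := h
  exact ⟨W, by simpa only [Judg.sub_var] using h.weak hP hΓ hs⟩

end Metatheory

/-! ## The tensor operations as functions -/

section Fun

variable (c : Expr A → SortE A) (η : B.Var → Expr A → Expr (A.tensor B))

/-- The tensor of an expression `v` of `B` with a term `u` of sort `U` of `A`, by recursion on
`v`; `c` gives canonical sorts in `A` and `η` the value on variables of `B`. -/
def tenB : Expr B → Expr A → SortE A → Expr (A.tensor B)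
  | .var y, u, _ => η y u
  | .app t ts, u, U => .app (Sum.inl (U.head, t))
      ((U.args.flatMap fun s => ts.attach.map fun v => tenB v.1 s (c s)) ++
        ts.attach.map fun v => tenB v.1 u U)
termination_by v => sizeOf v
decreasing_by
  all_goals
    have := List.sizeOf_lt_of_mem v.2
    simp only [Expr.app.sizeOf_spec]
    omega

/-- The tensor of an expression of `A` with a generic term of sort `V` of `B`, by recursion on the
expression; `b` gives the value on variables of `A`. -/
def vty (V : SortE B) (b : A.Var → Expr (A.tensor B)) : Expr A → Expr (A.tensor B)
  | .var x => b x
  | .app s ss => .app (Sum.inr (s, V.head))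
      (ss.attach.flatMap fun e => (V.args.map fun v => tenB c η v e.1 (c e.1)) ++ [vty V b e.1])
termination_by e => sizeOf e
decreasing_by
  all_goals
    have := List.sizeOf_lt_of_mem e.2
    simp only [Expr.app.sizeOf_spec]
    omega

/-- The values of `(x, y)` for a variable `y` of `B`. -/
def vr (y : B.Var) : A.Var → Expr (A.tensor B) := fun x => .var (x, y)

/-- The values of an expression of `B` on variables of `A`. -/
def tb (v : Expr B) : A.Var → Expr (A.tensor B) := fun x => tenB c η v (.var x) (c (.var x))

/-- The arguments of the tensor of a sort `U` (with a term `u`) and a sort `V`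
(with values `b` on the variables of `A`). -/
def tsoArgs (u : Expr A) (U : SortE A) (V : SortE B) (b : A.Var → Expr (A.tensor B)) :
    List (Expr (A.tensor B)) :=
  (U.args.flatMap fun s => (V.args.map fun v => tenB c η v s (c s)) ++ [vty c η V b s]) ++
    V.args.map fun v => tenB c η v u U

/-- The tensor of a sort `U` (with a term `u`) and a sort `V` (with values `b` on the variables
of `A`). -/
def tso (u : Expr A) (U : SortE A) (V : SortE B) (b : A.Var → Expr (A.tensor B)) :
    SortE (A.tensor B) :=
  ⟨(U.head, V.head), tsoArgs c η u U V b⟩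

/-- The tensor precontext. -/
def tc (X : PreCtx A) (Y : PreCtx B) : PreCtx (A.tensor B) :=
  X.flatMap fun p => Y.map fun q => ((p.1, q.1), tso c η (.var p.1) p.2 q.2 (vr q.1))

variable {c η}

theorem tenB_var (y : B.Var) (u : Expr A) (U : SortE A) : tenB c η (.var y) u U = η y u := by
  rw [tenB]

theorem tenB_app (t : B.TermSym) (ts : List (Expr B)) (u : Expr A) (U : SortE A) :
    tenB c η (.app t ts) u U = .app (Sum.inl (U.head, t))
      ((U.args.flatMap fun s => ts.map fun v => tenB c η v s (c s)) ++
        ts.map fun v => tenB c η v u U) := by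
  rw [tenB]
  congr 2
  · congr 1; funext s; exact List.attach_map_val (f := fun v => tenB c η v s (c s))
  · exact List.attach_map_val (f := fun v => tenB c η v u U)

theorem vty_var (V : SortE B) (b : A.Var → Expr (A.tensor B)) (x : A.Var) :
    vty c η V b (.var x) = b x := by
  rw [vty]

theorem attach_flatMap_val {α β : Type*} (l : List α) (f : α → List β) :
    (l.attach.flatMap fun e => f e.1) = l.flatMap f := by
  rw [← List.flatMap_map (f := Subtype.val) (g := f), List.attach_map_subtype_val]

theorem vty_app (V : SortE B) (b : A.Var → Expr (A.tensor B)) (s : A.TermSym)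
    (ss : List (Expr A)) :
    vty c η V b (.app s ss) = .app (Sum.inr (s, V.head))
      (ss.flatMap fun e => (V.args.map fun v => tenB c η v e (c e)) ++ [vty c η V b e]) := by
  rw [vty]
  congr 1
  exact attach_flatMap_val ss fun e => (V.args.map fun v => tenB c η v e (c e)) ++ [vty c η V b e]

end Fun

/-! ### Congruences -/

/-- A partial congruence `R` on the typed expressions `Ty`. -/
structure Cong (Ty : Expr A → Prop) (R : Expr A → Expr A → Prop) : Prop where
  refl : ∀ {a}, Ty a → R a a
  trans : ∀ {a b c}, R a b → R b c → R a c
  args : ∀ {t h}, Ty (.app t h) → ∀ e ∈ h, Ty e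
  app : ∀ {t h h'}, Ty (.app t h) → List.Forall₂ R h h' → R (.app t h) (.app t h')

theorem cong_eq : Cong (fun _ : Expr A => True) Eq where
  refl _ := rfl
  trans h h' := h.trans h'
  args _ _ _ := trivial
  app _ h := by rw [List.forall₂_eq_eq_eq] at h; rw [h]

theorem cong_eqT {Ax : Set (Judg A)} (hP : IsPretheory Ax) (Γ : PreCtx A) :
    Cong (HasT Ax Γ) (EqT Ax Γ) where
  refl h := h.refl hP
  trans h h' := h.trans hP h'
  args h := h.args hP
  app h h' := EqT.app hP h h'

theorem forall₂_map_same {α β γ : Type*} {R : β → γ → Prop} {f : α → β} {g : α → γ} {l : List α}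
    (h : ∀ x ∈ l, R (f x) (g x)) : List.Forall₂ R (l.map f) (l.map g) := by
  rw [List.forall₂_map_left_iff, List.forall₂_map_right_iff, List.forall₂_same]
  exact h

theorem forall₂_append' {β γ : Type*} {R : β → γ → Prop} {l₁ l₂ : List β} {m₁ m₂ : List γ}
    (h₁ : List.Forall₂ R l₁ m₁) (h₂ : List.Forall₂ R l₂ m₂) :
    List.Forall₂ R (l₁ ++ l₂) (m₁ ++ m₂) := by
  induction h₁ with
  | nil => exact h₂
  | cons h _ ih => exact .cons h ih

theorem forall₂_flatMap_same {α β γ : Type*} {R : β → γ → Prop} {f : α → List β}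
    {g : α → List γ} {l : List α} (h : ∀ x ∈ l, List.Forall₂ R (f x) (g x)) :
    List.Forall₂ R (l.flatMap f) (l.flatMap g) := by
  induction l with
  | nil => simp
  | cons a l ih =>
    rw [List.flatMap_cons, List.flatMap_cons]
    exact forall₂_append' (h a (by simp)) (ih fun x hx => h x (List.mem_cons_of_mem _ hx))

/-- Expressions of `B` all of whose variables are in `Y`, hereditarily including the sorts of
those variables, and whose proper subexpressions satisfy `Q`. -/
inductive WT (Q : Expr B → Prop) (Y : PreCtx B) : Expr B → Prop
  | var {q : B.Var × SortE B} (hq : q ∈ Y) (h : ∀ τ ∈ q.2.args, WT Q Y τ)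
      (hQ : ∀ τ ∈ q.2.args, Q τ) : WT Q Y (.var q.1)
  | app {t : B.TermSym} {ts : List (Expr B)} (h : ∀ e ∈ ts, WT Q Y e) (hQ : ∀ e ∈ ts, Q e) :
      WT Q Y (.app t ts)

theorem WT.mono {Q Q' : Expr B → Prop} {Y Y' : PreCtx B} (hQ : ∀ v, Q v → Q' v) (hY : Y ⊆ Y')
    {v : Expr B} (h : WT Q Y v) : WT Q' Y' v := by
  induction h with
  | var hq _ h2 ih => exact .var (hY hq) ih fun τ hτ => hQ _ (h2 τ hτ)
  | app _ h2 ih => exact .app ih fun τ hτ => hQ _ (h2 τ hτ)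

/-- `η` is determined on `Y` by the generic tensors. -/
def EOK (c : Expr A → SortE A) (η : B.Var → Expr A → Expr (A.tensor B)) (Y : PreCtx B) : Prop :=
  ∀ q ∈ Y, ∀ u, η q.1 u = vty c η q.2 (vr q.1) u

theorem EOK.mono {c : Expr A → SortE A} {η : B.Var → Expr A → Expr (A.tensor B)}
    {Y Y' : PreCtx B} (h : EOK c η Y) (hY : Y' ⊆ Y) : EOK c η Y' := fun q hq => h q (hY hq)

/-! ### Substitution in the first factor -/

section SubstA

variable {Ty : Expr (A.tensor B) → Prop} {R : Expr (A.tensor B) → Expr (A.tensor B) → Prop}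
  {c c' : Expr A → SortE A} {η η' : B.Var → Expr A → Expr (A.tensor B)}
  {P : Expr A → Prop} {Q : Expr B → Prop} {Y : PreCtx B}
  {θ : A.Var → Expr A} {Θ : (A.tensor B).Var → Expr (A.tensor B)}

/-- Compatibility of a substitution `θ` on `A` with a substitution `Θ` on the tensor product. -/
structure SubA (Ty : Expr (A.tensor B) → Prop) (R : Expr (A.tensor B) → Expr (A.tensor B) → Prop)
    (c c' : Expr A → SortE A) (η η' : B.Var → Expr A → Expr (A.tensor B))
    (P : Expr A → Prop) (Q : Expr B → Prop) (Y : PreCtx B)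
    (θ : A.Var → Expr A) (Θ : (A.tensor B).Var → Expr (A.tensor B)) : Prop where
  cong : Cong Ty R
  app : ∀ {s ss}, P (.app s ss) → ∀ e ∈ ss, P e
  srt : ∀ {e}, P e → ∀ s ∈ (c e).args, P s
  can : ∀ {s ss}, P (.app s ss) → c' ((Expr.app s ss).subst θ) = (c (.app s ss)).subst θ
  eok : EOK c η Y
  eok' : EOK c' η' Y
  sub : ∀ {x}, P (.var x) → ∀ q ∈ Y, Θ (x, q.1) = η' q.1 (θ x)
  mis : ∀ {x v}, P (.var x) → Q v →
    R (tenB c' η' v (θ x) ((c (.var x)).subst θ)) (tenB c' η' v (θ x) (c' (θ x)))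

theorem SubA.canon (S : SubA Ty R c c' η η' P Q Y θ Θ) {e : Expr A} (hP : P e) {v : Expr B}
    (hQ : Q v)
    (h : R ((tenB c η v e (c e)).subst Θ) (tenB c' η' v (e.subst θ) ((c e).subst θ))) :
    R ((tenB c η v e (c e)).subst Θ) (tenB c' η' v (e.subst θ) (c' (e.subst θ))) := by
  cases e with
  | var x =>
    rw [Expr.subst_var] at h ⊢
    exact S.cong.trans h (S.mis hP hQ)
  | app s ss => rw [S.can hP]; exact h

theorem SubA.vty_of (S : SubA Ty R c c' η η' P Q Y θ Θ) {V : SortE B}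
    {b b' : A.Var → Expr (A.tensor B)}
    (hV : ∀ τ ∈ V.args, ∀ e, P e → Ty ((tenB c η τ e (c e)).subst Θ) →
      R ((tenB c η τ e (c e)).subst Θ) (tenB c' η' τ (e.subst θ) (c' (e.subst θ))))
    (hb : ∀ x, P (.var x) → Ty ((b x).subst Θ) → R ((b x).subst Θ) (vty c' η' V b' (θ x)))
    (u : Expr A) : P u → Ty ((vty c η V b u).subst Θ) →
      R ((vty c η V b u).subst Θ) (vty c' η' V b' (u.subst θ)) := by
  induction u using Expr.induct with
  | hv x => intro hP hT; rw [vty_var] at hT ⊢; rw [Expr.subst_var]; exact hb x hP hT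
  | ha s ss ih =>
    intro hP hT
    rw [vty_app, Expr.subst_app, List.map_flatMap] at hT ⊢
    rw [Expr.subst_app, vty_app, List.flatMap_map]
    refine S.cong.app hT (forall₂_flatMap_same fun e he => ?_)
    have hT' : ∀ a ∈ ((V.args.map fun v => tenB c η v e (c e)) ++ [vty c η V b e]),
        Ty (a.subst Θ) := fun a ha => S.cong.args hT _
      (List.mem_flatMap.2 ⟨e, he, List.mem_map_of_mem ha⟩)
    rw [List.map_append, List.map_map]
    refine forall₂_append' (forall₂_map_same fun τ hτ => ?_) (.cons ?_ .nil)
    · exact hV τ hτ e (S.app hP e he) (hT' _ (List.mem_append_left _ (List.mem_map_of_mem hτ)))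
    · exact ih e he (S.app hP e he) (hT' _ (by simp))

theorem SubA.ten (S : SubA Ty R c c' η η' P Q Y θ Θ) {v : Expr B} (hv : WT Q Y v) :
    ∀ u, P u → Ty ((tenB c η v u (c u)).subst Θ) →
      R ((tenB c η v u (c u)).subst Θ) (tenB c' η' v (u.subst θ) ((c u).subst θ)) := by
  induction hv with
  | @var q hq _ hQ ih =>
    intro u hP hT
    rw [tenB_var, S.eok q hq] at hT ⊢
    rw [tenB_var, S.eok' q hq]
    refine S.vty_of (fun τ hτ e he hT' => S.canon he (hQ τ hτ) (ih τ hτ e he hT'))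
      (fun x hx hT' => ?_) u hP hT
    have : (vr q.1 x : Expr (A.tensor B)).subst Θ = vty c' η' q.2 (vr q.1) (θ x) := by
      rw [vr, Expr.subst_var, S.sub hx q hq, S.eok' q hq]
    rw [this] at hT' ⊢
    exact S.cong.refl hT'
  | @app t ts _ hQ ih =>
    intro u hP hT
    rw [tenB_app, Expr.subst_app, List.map_append, List.map_flatMap, List.map_map] at hT ⊢
    rw [tenB_app, SortE.subst_args, List.flatMap_map]
    have hT' := S.cong.args hT
    refine S.cong.app hT (forall₂_append' (forall₂_flatMap_same fun s hs => ?_) ?_)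
    · rw [List.map_map]
      refine forall₂_map_same fun v hv => ?_
      have hPs := S.srt hP s hs
      exact S.canon hPs (hQ v hv) (ih v hv s hPs (hT' _ (List.mem_append_left _
        (List.mem_flatMap.2 ⟨s, hs, List.mem_map_of_mem (List.mem_map_of_mem hv)⟩))))
    · exact forall₂_map_same fun v hv => ih v hv u hP
        (hT' _ (List.mem_append_right _ (List.mem_map_of_mem hv)))

theorem SubA.ten_can (S : SubA Ty R c c' η η' P Q Y θ Θ) {v : Expr B} (hv : WT Q Y v) (hQ : Q v)
    {u : Expr A} (hP : P u) (hT : Ty ((tenB c η v u (c u)).subst Θ)) :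
    R ((tenB c η v u (c u)).subst Θ) (tenB c' η' v (u.subst θ) (c' (u.subst θ))) :=
  S.canon hP hQ (S.ten hv u hP hT)

theorem SubA.ten_top (S : SubA Ty R c c' η η' P Q Y θ Θ) {u u' : Expr A} {U : SortE A}
    (hU : ∀ s ∈ U.args, P s)
    (htop : ∀ q ∈ Y, Ty ((η q.1 u).subst Θ) → R ((η q.1 u).subst Θ) (η' q.1 u'))
    {v : Expr B} (hv : WT Q Y v) : Ty ((tenB c η v u U).subst Θ) →
      R ((tenB c η v u U).subst Θ) (tenB c' η' v u' (U.subst θ)) := by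
  induction hv with
  | @var q hq _ hQ ih => intro hT; rw [tenB_var] at hT ⊢; rw [tenB_var]; exact htop q hq hT
  | @app t ts h hQ ih =>
    intro hT
    rw [tenB_app, Expr.subst_app, List.map_append, List.map_flatMap, List.map_map] at hT ⊢
    rw [tenB_app, SortE.subst_args, List.flatMap_map]
    have hT' := S.cong.args hT
    refine S.cong.app hT (forall₂_append' (forall₂_flatMap_same fun s hs => ?_) ?_)
    · rw [List.map_map]
      refine forall₂_map_same fun v hv => ?_
      exact S.ten_can (h v hv) (hQ v hv) (hU s hs) (hT' _ (List.mem_append_left _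
        (List.mem_flatMap.2 ⟨s, hs, List.mem_map_of_mem (List.mem_map_of_mem hv)⟩)))
    · exact forall₂_map_same fun v hv => ih v hv
        (hT' _ (List.mem_append_right _ (List.mem_map_of_mem hv)))

theorem SubA.vty (S : SubA Ty R c c' η η' P Q Y θ Θ) {V : SortE B}
    (hV : ∀ τ ∈ V.args, WT Q Y τ ∧ Q τ) {b b' : A.Var → Expr (A.tensor B)}
    (hb : ∀ x, P (.var x) → Ty ((b x).subst Θ) → R ((b x).subst Θ) (vty c' η' V b' (θ x)))
    {u : Expr A} (hP : P u) (hT : Ty ((GATPaper.vty c η V b u).subst Θ)) :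
    R ((GATPaper.vty c η V b u).subst Θ) (GATPaper.vty c' η' V b' (u.subst θ)) :=
  S.vty_of (fun τ hτ _ he hT' => S.ten_can (hV τ hτ).1 (hV τ hτ).2 he hT') hb u hP hT

theorem SubA.tsoArgs (S : SubA Ty R c c' η η' P Q Y θ Θ) {u u' : Expr A} {U : SortE A}
    {V : SortE B} {b b' : A.Var → Expr (A.tensor B)} (hU : ∀ s ∈ U.args, P s)
    (hV : ∀ τ ∈ V.args, WT Q Y τ ∧ Q τ)
    (htop : ∀ q ∈ Y, Ty ((η q.1 u).subst Θ) → R ((η q.1 u).subst Θ) (η' q.1 u'))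
    (hb : ∀ x, P (.var x) → Ty ((b x).subst Θ) →
      R ((b x).subst Θ) (GATPaper.vty c' η' V b' (θ x)))
    (hT : ∀ e ∈ GATPaper.tsoArgs c η u U V b, Ty (e.subst Θ)) :
    List.Forall₂ R ((GATPaper.tsoArgs c η u U V b).map (Expr.subst Θ))
      (GATPaper.tsoArgs c' η' u' (U.subst θ) V b') := by
  unfold GATPaper.tsoArgs at hT ⊢
  rw [List.map_append, List.map_flatMap, List.map_map, SortE.subst_args, List.flatMap_map]
  refine forall₂_append' (forall₂_flatMap_same fun s hs => ?_) (forall₂_map_same fun v hv => ?_)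
  · rw [List.map_append, List.map_map]
    refine forall₂_append' (forall₂_map_same fun τ hτ => ?_) (.cons ?_ .nil)
    · exact S.ten_can (hV τ hτ).1 (hV τ hτ).2 (hU s hs) (hT _ (List.mem_append_left _
        (List.mem_flatMap.2 ⟨s, hs, List.mem_append_left _ (List.mem_map_of_mem hτ)⟩)))
    · exact S.vty hV hb (hU s hs) (hT _ (List.mem_append_left _
        (List.mem_flatMap.2 ⟨s, hs, by simp⟩)))
  · exact S.ten_top hU htop (hV v hv).1 (hT _ (List.mem_append_right _ (List.mem_map_of_mem hv)))

end SubstA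

/-! ### Substitution in the second factor -/

section SubstB

variable {Ty : Expr (A.tensor B) → Prop} {R : Expr (A.tensor B) → Expr (A.tensor B) → Prop}
  {c : Expr A → SortE A} {η η' : B.Var → Expr A → Expr (A.tensor B)}
  {P : Expr A → Prop} {Q : Expr B → Prop} {Y : PreCtx B}
  {φ : B.Var → Expr B} {Φ : (A.tensor B).Var → Expr (A.tensor B)}

/-- Compatibility of a substitution `φ` on `B` with a substitution `Φ` on the tensor product. -/
structure SubB (Ty : Expr (A.tensor B) → Prop) (R : Expr (A.tensor B) → Expr (A.tensor B) → Prop)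
    (c : Expr A → SortE A) (η η' : B.Var → Expr A → Expr (A.tensor B))
    (P : Expr A → Prop) (Y : PreCtx B)
    (φ : B.Var → Expr B) (Φ : (A.tensor B).Var → Expr (A.tensor B)) : Prop where
  cong : Cong Ty R
  app : ∀ {s ss}, P (.app s ss) → ∀ e ∈ ss, P e
  srt : ∀ {e}, P e → ∀ s ∈ (c e).args, P s
  eok : EOK c η Y
  sub : ∀ {x}, P (.var x) → ∀ q ∈ Y, Φ (x, q.1) = tb c η' (φ q.1) x
  int : ∀ q ∈ Y, ∀ {u}, P u →
    R (GATPaper.vty c η' (q.2.subst φ) (tb c η' (φ q.1)) u) (tenB c η' (φ q.1) u (c u))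

theorem SubB.vty_of (S : SubB Ty R c η η' P Y φ Φ) {V : SortE B}
    {b b' : A.Var → Expr (A.tensor B)}
    (hV : ∀ τ ∈ V.args, ∀ e, P e → Ty ((tenB c η τ e (c e)).subst Φ) →
      R ((tenB c η τ e (c e)).subst Φ) (tenB c η' (τ.subst φ) e (c e)))
    (hb : ∀ x, P (.var x) → Ty ((b x).subst Φ) → R ((b x).subst Φ) (b' x))
    (u : Expr A) : P u → Ty ((vty c η V b u).subst Φ) →
      R ((vty c η V b u).subst Φ) (vty c η' (V.subst φ) b' u) := by
  induction u using Expr.induct with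
  | hv x => intro hP hT; rw [vty_var] at hT ⊢; rw [vty_var]; exact hb x hP hT
  | ha s ss ih =>
    intro hP hT
    rw [vty_app, Expr.subst_app, List.map_flatMap] at hT ⊢
    rw [vty_app]
    refine S.cong.app hT (forall₂_flatMap_same fun e he => ?_)
    have hT' : ∀ a ∈ ((V.args.map fun v => tenB c η v e (c e)) ++ [vty c η V b e]),
        Ty (a.subst Φ) := fun a ha => S.cong.args hT _
      (List.mem_flatMap.2 ⟨e, he, List.mem_map_of_mem ha⟩)
    rw [List.map_append, List.map_map, SortE.subst_args, List.map_map]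
    refine forall₂_append' (forall₂_map_same fun τ hτ => ?_) (.cons ?_ .nil)
    · exact hV τ hτ e (S.app hP e he) (hT' _ (List.mem_append_left _ (List.mem_map_of_mem hτ)))
    · exact ih e he (S.app hP e he) (hT' _ (by simp))

theorem SubB.ten (S : SubB Ty R c η η' P Y φ Φ) {v : Expr B} (hv : WT Q Y v) :
    ∀ u, P u → Ty ((tenB c η v u (c u)).subst Φ) →
      R ((tenB c η v u (c u)).subst Φ) (tenB c η' (v.subst φ) u (c u)) := by
  induction hv with
  | @var q hq _ hQ ih =>
    intro u hP hT
    rw [tenB_var, S.eok q hq] at hT ⊢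
    rw [Expr.subst_var]
    refine S.cong.trans (S.vty_of ih (b' := tb c η' (φ q.1)) (fun x hx hT' => ?_) u hP hT)
      (S.int q hq hP)
    have : (vr q.1 x : Expr (A.tensor B)).subst Φ = tb c η' (φ q.1) x := by
      rw [vr, Expr.subst_var, S.sub hx q hq]
    rw [this] at hT' ⊢
    exact S.cong.refl hT'
  | @app t ts _ hQ ih =>
    intro u hP hT
    rw [tenB_app, Expr.subst_app, List.map_append, List.map_flatMap, List.map_map] at hT ⊢
    rw [Expr.subst_app, tenB_app]
    have hT' := S.cong.args hT
    refine S.cong.app hT (forall₂_append' (forall₂_flatMap_same fun s hs => ?_) ?_)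
    · rw [List.map_map, List.map_map]
      refine forall₂_map_same fun v hv => ?_
      have hPs := S.srt hP s hs
      exact ih v hv s hPs (hT' _ (List.mem_append_left _
        (List.mem_flatMap.2 ⟨s, hs, List.mem_map_of_mem (List.mem_map_of_mem hv)⟩)))
    · rw [List.map_map]
      exact forall₂_map_same fun v hv => ih v hv u hP
        (hT' _ (List.mem_append_right _ (List.mem_map_of_mem hv)))

theorem SubB.ten_top (S : SubB Ty R c η η' P Y φ Φ) {u u' : Expr A} {U : SortE A}
    (hU : ∀ s ∈ U.args, P s)
    (htop : ∀ q ∈ Y, Ty ((η q.1 u).subst Φ) → R ((η q.1 u).subst Φ) (tenB c η' (φ q.1) u' U))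
    {v : Expr B} (hv : WT Q Y v) : Ty ((tenB c η v u U).subst Φ) →
      R ((tenB c η v u U).subst Φ) (tenB c η' (v.subst φ) u' U) := by
  induction hv with
  | @var q hq _ hQ ih =>
    intro hT; rw [tenB_var] at hT ⊢; rw [Expr.subst_var]; exact htop q hq hT
  | @app t ts h hQ ih =>
    intro hT
    rw [tenB_app, Expr.subst_app, List.map_append, List.map_flatMap, List.map_map] at hT ⊢
    rw [Expr.subst_app, tenB_app]
    have hT' := S.cong.args hT
    refine S.cong.app hT (forall₂_append' (forall₂_flatMap_same fun s hs => ?_) ?_)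
    · rw [List.map_map, List.map_map]
      refine forall₂_map_same fun v hv => ?_
      exact S.ten (h v hv) s (hU s hs) (hT' _ (List.mem_append_left _
        (List.mem_flatMap.2 ⟨s, hs, List.mem_map_of_mem (List.mem_map_of_mem hv)⟩)))
    · rw [List.map_map]
      exact forall₂_map_same fun v hv => ih v hv
        (hT' _ (List.mem_append_right _ (List.mem_map_of_mem hv)))

theorem SubB.vty (S : SubB Ty R c η η' P Y φ Φ) {V : SortE B}
    (hV : ∀ τ ∈ V.args, WT Q Y τ) {b b' : A.Var → Expr (A.tensor B)}
    (hb : ∀ x, P (.var x) → Ty ((b x).subst Φ) → R ((b x).subst Φ) (b' x))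
    {u : Expr A} (hP : P u) (hT : Ty ((GATPaper.vty c η V b u).subst Φ)) :
    R ((GATPaper.vty c η V b u).subst Φ) (GATPaper.vty c η' (V.subst φ) b' u) :=
  S.vty_of (fun τ hτ _ he hT' => S.ten (hV τ hτ) _ he hT') hb u hP hT

theorem SubB.tsoArgs (S : SubB Ty R c η η' P Y φ Φ) {u u' : Expr A} {U : SortE A}
    {V : SortE B} {b b' : A.Var → Expr (A.tensor B)} (hU : ∀ s ∈ U.args, P s)
    (hV : ∀ τ ∈ V.args, WT Q Y τ)
    (htop : ∀ q ∈ Y, Ty ((η q.1 u).subst Φ) → R ((η q.1 u).subst Φ) (tenB c η' (φ q.1) u' U))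
    (hb : ∀ x, P (.var x) → Ty ((b x).subst Φ) → R ((b x).subst Φ) (b' x))
    (hT : ∀ e ∈ GATPaper.tsoArgs c η u U V b, Ty (e.subst Φ)) :
    List.Forall₂ R ((GATPaper.tsoArgs c η u U V b).map (Expr.subst Φ))
      (GATPaper.tsoArgs c η' u' U (V.subst φ) b') := by
  unfold GATPaper.tsoArgs at hT ⊢
  rw [List.map_append, List.map_flatMap, List.map_map, SortE.subst_args, List.map_map]
  refine forall₂_append' (forall₂_flatMap_same fun s hs => ?_) (forall₂_map_same fun v hv => ?_)
  · rw [List.map_append, List.map_map, List.map_map]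
    refine forall₂_append' (forall₂_map_same fun τ hτ => ?_) (.cons ?_ .nil)
    · exact S.ten (hV τ hτ) s (hU s hs) (hT _ (List.mem_append_left _
        (List.mem_flatMap.2 ⟨s, hs, List.mem_append_left _ (List.mem_map_of_mem hτ)⟩)))
    · exact S.vty hV hb (hU s hs) (hT _ (List.mem_append_left _
        (List.mem_flatMap.2 ⟨s, hs, by simp⟩)))
  · exact S.ten_top hU htop (hV v hv) (hT _ (List.mem_append_right _ (List.mem_map_of_mem hv)))

end SubstB

/-! ## Canonical sorts and generic tensors -/

/-- `c` computes canonical sorts over the context `X`. -/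
structure COK (TA : Set (Judg A)) (X : PreCtx A) (c : Expr A → SortE A) : Prop where
  var : ∀ p ∈ X, c (.var p.1) = p.2
  app : ∀ {Xa s V}, introTerm Xa s V ∈ TA → ∀ ss, c (.app s ss) = V.substL (mkSub Xa ss)

theorem COK.mono {TA : Set (Judg A)} {X X' : PreCtx A} {c : Expr A → SortE A} (h : COK TA X c)
    (hX : X' ⊆ X) : COK TA X' c := ⟨fun p hp => h.var p (hX hp), h.app⟩

open Classical in
theorem exists_cok {TA : Set (Judg A)} (hA : IsPretheory TA) (U : SortE A) {X : PreCtx A}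
    (hX : (X.map Prod.fst).Nodup) : ∃ c, COK TA X c := by
  choose p hp using fun s => (hA.term_intro s).exists
  refine ⟨fun e => match e with
    | .var x => if h : ∃ V, (x, V) ∈ X then h.choose else U
    | .app s ss => (p s).2.substL (mkSub (p s).1 ss), ?_, ?_⟩
  · intro q hq
    have h : ∃ V, (q.1, V) ∈ X := ⟨q.2, hq⟩
    simp only [dif_pos h]
    exact (Prod.mk.inj (List.inj_on_of_nodup_map hX h.choose_spec hq rfl)).2
  · intro Xa s V h ss
    obtain ⟨rfl, rfl⟩ := hA.term_unique (hp s) h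
    rfl

/-- The subexpressions of `v` that are arguments of sorts, and their types, only depend on the
values of `η` on the variables of `v`. -/
theorem tenB_congr {c : Expr A → SortE A} {η η' : B.Var → Expr A → Expr (A.tensor B)}
    (v : Expr B) : (∀ y, Occurs y v → η y = η' y) →
    ∀ u U, tenB c η v u U = tenB c η' v u U := by
  induction v using Expr.induct with
  | hv y => intro h u U; rw [tenB_var, tenB_var, h y .var]
  | ha t ts ih =>
    intro h u U
    have ih' : ∀ e ∈ ts, ∀ u U, tenB c η e u U = tenB c η' e u U := fun e he =>
      ih e he fun y hy => h y (.app he hy)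
    rw [tenB_app, tenB_app]
    congr 2
    · refine List.flatMap_congr fun s hs => List.map_congr_left fun e he => ih' e he _ _
    · exact List.map_congr_left fun e he => ih' e he _ _

theorem vty_congr {c : Expr A → SortE A} {η η' : B.Var → Expr A → Expr (A.tensor B)}
    {V : SortE B} (h : ∀ y, SOccurs y V → η y = η' y) (b : A.Var → Expr (A.tensor B))
    (u : Expr A) : vty c η V b u = vty c η' V b u := by
  induction u using Expr.induct with
  | hv x => rw [vty_var, vty_var]
  | ha s ss ih =>
    rw [vty_app, vty_app]
    congr 1
    refine List.flatMap_congr fun e he => ?_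
    rw [ih e he]
    congr 1
    exact List.map_congr_left fun v hv => tenB_congr v (fun y hy => h y ⟨v, hv, hy⟩) _ _

/-- A prefix of a context in a hereditary class. -/
theorem Hered.prefix {Ax : Set (Judg A)} {D : Judg A → Prop} (H : Hered Ax D) {X X' : PreCtx A}
    (h : D (.ctx X)) (hp : X' <+: X) : D (.ctx X') := by
  obtain ⟨Z, rfl⟩ := hp
  induction Z using List.reverseRecOn with
  | nil => rwa [List.append_nil] at h
  | append_singleton Z q ih =>
    rw [← List.append_assoc] at h
    exact ih (H.ctx (H.ctx_inv h).1)

open Classical in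
theorem exists_eok {TB : Set (Judg B)} (hB : IsPretheory TB) (c : Expr A → SortE A)
    {Y : PreCtx B} (hY : Derivable TB (.ctx Y)) : ∃ η : B.Var → Expr A → Expr (A.tensor B),
      EOK c η Y := by
  induction Y using List.reverseRecOn with
  | nil =>
    obtain ⟨y⟩ : Nonempty B.Var := inferInstance
    obtain ⟨x⟩ : Nonempty A.Var := inferInstance
    exact ⟨fun _ _ => .var (x, y), by simp [EOK]⟩
  | append_singleton Y q ih =>
    have hs := (Derivable.hered hB).ctx_inv hY
    obtain ⟨η, hη⟩ := ih hs.1.ctx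
    refine ⟨fun y u => if y = q.1 then vty c η q.2 (vr q.1) u else η y u, ?_⟩
    have key : ∀ V : SortE B, ScS Y V → ∀ y, SOccurs y V → η y =
        fun u => if y = q.1 then vty c η q.2 (vr q.1) u else η y u := by
      intro V hV y hy
      have hne : y ≠ q.1 := by
        rintro rfl
        obtain ⟨p, hp, hpq⟩ := List.mem_map.1 (hV _ hy)
        exact hs.2 p hp hpq
      simp only [if_neg hne]
    intro p hp u
    rcases List.mem_append.1 hp with hp | hp
    · beta_reduce
      rw [if_neg (hs.2 p hp), hη p hp]
      obtain ⟨Y1, Y2, rfl⟩ := List.append_of_mem hp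
      have hsc : Derivable TB (.ctx (Y1 ++ [p])) :=
        (Derivable.hered hB).prefix hs.1.ctx ⟨Y2, by simp [Judg.ctxOf]⟩
      have hsc := ((Derivable.hered hB).ctx_inv hsc).1.scS hB
      exact vty_congr (key _ fun y hy => by
        have := hsc y hy
        rw [List.map_append]
        exact List.mem_append_left _ this) _ _
    · obtain rfl := List.mem_singleton.1 hp
      beta_reduce
      rw [if_pos rfl]
      exact vty_congr (key _ (hs.1.scS hB)) _ _

theorem exists_prefix {α : Type*} {X : List α} {p : α} (hp : p ∈ X) :
    ∃ X1, X1 ++ [p] <+: X := by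
  obtain ⟨X1, X2, rfl⟩ := List.append_of_mem hp
  exact ⟨X1, X2, by simp⟩

/-- The sort of an entry of a context, over a prefix. -/
theorem Hered.entry {Ax : Set (Judg A)} {D : Judg A → Prop} (H : Hered Ax D) {X : PreCtx A}
    (h : D (.ctx X)) {p : A.Var × SortE A} (hp : p ∈ X) :
    ∃ X1, X1 ++ [p] <+: X ∧ D (.sort X1 p.2) := by
  obtain ⟨X1, h1⟩ := exists_prefix hp
  exact ⟨X1, h1, (H.ctx_inv (H.prefix h h1)).1⟩

/-- Typed in a prefix of `Y`. -/
def QD (D : Judg B → Prop) (Y : PreCtx B) (v : Expr B) : Prop :=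
  ∃ Y1 V, Y1 <+: Y ∧ D (.term Y1 v V)

theorem QD.mono {D : Judg B → Prop} {Y Y' : PreCtx B} (hY : Y <+: Y') {v : Expr B}
    (h : QD D Y v) : QD D Y' v := by
  obtain ⟨Y1, V, h1, h2⟩ := h
  exact ⟨Y1, V, h1.trans hY, h2⟩

theorem Hered.sort_args {Ax : Set (Judg A)} {D : Judg A → Prop} (H : Hered Ax D) {X : PreCtx A}
    {U : SortE A} (h : D (.sort X U)) : ∀ e ∈ U.args, ∃ V, D (.term X e V) := by
  obtain ⟨S, f⟩ := U
  obtain ⟨Xa, σ, -, -, rfl, h'⟩ := H.sort_inv h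
  intro e he
  obtain ⟨p, hp, rfl⟩ := List.mem_map.1 he
  exact ⟨_, h' p hp⟩

theorem Hered.wt {Ax : Set (Judg B)} {D : Judg B → Prop} (H : Hered Ax D) (n : ℕ) :
    ∀ {Y : PreCtx B}, Y.length = n → ∀ {v V}, D (.term Y v V) → WT (QD D Y) Y v := by
  induction n using Nat.strong_induction_on with
  | _ n ih =>
    intro Y hn v
    induction v using Expr.induct with
    | hv y =>
      intro V h
      obtain ⟨U, hU, -⟩ := H.var_inv h
      have hc : D (.ctx Y) := H.ctx (H.term h)
      obtain ⟨Y1, h1, h2⟩ := H.entry hc hU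
      have h3 : Y1 <+: Y := (List.prefix_append _ _).trans h1
      have hl : Y1.length < n := by
        have := h1.length_le
        simp only [List.length_append, List.length_singleton] at this
        omega
      refine WT.var hU (fun τ hτ => ?_) fun τ hτ => ?_
      · obtain ⟨W, hW⟩ := H.sort_args h2 τ hτ
        exact (ih _ hl rfl hW).mono (fun v => QD.mono h3) h3.subset
      · obtain ⟨W, hW⟩ := H.sort_args h2 τ hτ
        exact ⟨Y1, W, h3, hW⟩
    | ha t ts ihv =>
      intro V h
      obtain ⟨Xa, U, σ, -, -, rfl, h, -⟩ := H.term_inv h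
      refine WT.app (fun e he => ?_) fun e he => ?_
      · obtain ⟨p, hp, rfl⟩ := List.mem_map.1 he
        exact ihv _ he (h p hp)
      · obtain ⟨p, hp, rfl⟩ := List.mem_map.1 he
        exact ⟨Y, _, List.prefix_refl _, h p hp⟩

theorem Hered.wt_term {Ax : Set (Judg B)} {D : Judg B → Prop} (H : Hered Ax D) {Y : PreCtx B}
    {v : Expr B} {V : SortE B} (h : D (.term Y v V)) : WT (QD D Y) Y v ∧ QD D Y v :=
  ⟨H.wt _ rfl h, Y, V, List.prefix_refl _, h⟩

theorem Hered.wt_sort {Ax : Set (Judg B)} {D : Judg B → Prop} (H : Hered Ax D) {Y : PreCtx B}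
    {V : SortE B} (h : D (.sort Y V)) : ∀ τ ∈ V.args, WT (QD D Y) Y τ ∧ QD D Y τ := by
  intro τ hτ
  obtain ⟨W, hW⟩ := H.sort_args h τ hτ
  exact H.wt_term hW

section Canon

variable {TA : Set (Judg A)} {X : PreCtx A} {c : Expr A → SortE A}

theorem COK.typed (hA : IsPretheory TA) (h : COK TA X c) {e : Expr A} (he : HasT TA X e) :
    Derivable TA (.term X e (c e)) := by
  obtain ⟨W, he⟩ := he
  have H := Derivable.hered hA
  cases e with
  | var x =>
    obtain ⟨U, hU, -, h2, -⟩ := H.var_inv he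
    rw [h.var _ hU]; exact h2
  | app s ss =>
    obtain ⟨Xa, U, σ, hax, h1, rfl, -, h2, -⟩ := H.term_inv he
    have hsc : ScS Xa U := Derivable.scS hA (H.term h1)
    rw [h.app hax, SortE.substL_map hsc]; exact h2

theorem COK.sort (hA : IsPretheory TA) (h : COK TA X c) {e : Expr A} (he : HasT TA X e) :
    Derivable TA (.sort X (c e)) := (Derivable.hered hA).term (h.typed hA he)

theorem COK.args (hA : IsPretheory TA) (h : COK TA X c) {e : Expr A} (he : HasT TA X e) :
    ∀ s ∈ (c e).args, HasT TA X s := (h.sort hA he).sort_args hA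

theorem COK.can (hA : IsPretheory TA) (h : COK TA X c) {X' : PreCtx A} {c' : Expr A → SortE A}
    (h' : COK TA X' c') {s : A.TermSym} {ss : List (Expr A)} (he : HasT TA X (.app s ss))
    (θ : A.Var → Expr A) :
    c' ((Expr.app s ss).subst θ) = (c (.app s ss)).subst θ := by
  obtain ⟨W, he⟩ := he
  have H := Derivable.hered hA
  obtain ⟨Xa, U, σ, hax, h1, rfl, -, h2, -⟩ := H.term_inv he
  have hsc : ScS Xa U := Derivable.scS hA (H.term h1)
  rw [Expr.subst_app, h.app hax, h'.app hax, SortE.substL_map hsc, List.map_map, SortE.subst_subst]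
  exact SortE.substL_map hsc fun x => (σ x).subst θ

end Canon

/-! ## Tensors of judgments, relative to an ambient context -/

section Ambient

variable (TA : Set (Judg A)) (TB : Set (Judg B)) (T : Set (Judg (A.tensor B)))
  (c : Expr A → SortE A) (η : B.Var → Expr A → Expr (A.tensor B))

/-- The context of the tensor of sorts, with optional last column. -/
def zm (X : PreCtx A) (p : A.Var × SortE A) (Y Qs : PreCtx B) : PreCtx (A.tensor B) :=
  tc c η X (Y ++ Qs) ++ tc c η [p] Y

/-- `T` contains the tensors of the axioms of `TA` and `TB`. -/
structure TAx (chA : PreCtx A → A.Var) (chB : PreCtx B → B.Var) : Prop where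
  ss : ∀ {X U Y V}, .sort X U ∈ TA → .sort Y V ∈ TB → ∀ {c η}, COK TA X c → EOK c η Y →
    .sort (zm c η X (chA X, U) Y [(chB Y, V)])
      (tso c η (.var (chA X)) U V (vr (chB Y))) ∈ T
  seqs : ∀ {X U U' Y V}, .sortEq X U U' ∈ TA → .sort Y V ∈ TB → ∀ {c η}, COK TA X c → EOK c η Y →
    .sortEq (zm c η X (chA X, U) Y [(chB Y, V)])
      (tso c η (.var (chA X)) U V (vr (chB Y))) (tso c η (.var (chA X)) U' V (vr (chB Y))) ∈ T
  sseq : ∀ {X U Y V V'}, .sort X U ∈ TA → .sortEq Y V V' ∈ TB → ∀ {c η}, COK TA X c → EOK c η Y →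
    .sortEq (zm c η X (chA X, U) Y [(chB Y, V)])
      (tso c η (.var (chA X)) U V (vr (chB Y))) (tso c η (.var (chA X)) U V' (vr (chB Y))) ∈ T
  st : ∀ {X U Y v V}, .sort X U ∈ TA → .term Y v V ∈ TB → ∀ {c η}, COK TA X c → EOK c η Y →
    .term (zm c η X (chA X, U) Y []) (tenB c η v (.var (chA X)) U)
      (tso c η (.var (chA X)) U V (tb c η v)) ∈ T
  seqt : ∀ {X U U' Y v V}, .sortEq X U U' ∈ TA → .term Y v V ∈ TB → ∀ {c η}, COK TA X c →
    EOK c η Y → .termEq (zm c η X (chA X, U) Y []) (tenB c η v (.var (chA X)) U)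
      (tenB c η v (.var (chA X)) U') (tso c η (.var (chA X)) U V (tb c η v)) ∈ T
  steq : ∀ {X U Y v v' V}, .sort X U ∈ TA → .termEq Y v v' V ∈ TB → ∀ {c η}, COK TA X c →
    EOK c η Y → .termEq (zm c η X (chA X, U) Y []) (tenB c η v (.var (chA X)) U)
      (tenB c η v' (.var (chA X)) U) (tso c η (.var (chA X)) U V (tb c η v)) ∈ T
  ts : ∀ {X u U Y V}, .term X u U ∈ TA → .sort Y V ∈ TB → ∀ {c η}, COK TA X c → EOK c η Y →
    .term (tc c η X (Y ++ [(chB Y, V)])) (vty c η V (vr (chB Y)) u)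
      (tso c η u U V (vr (chB Y))) ∈ T
  teqs : ∀ {X u u' U Y V}, .termEq X u u' U ∈ TA → .sort Y V ∈ TB → ∀ {c η}, COK TA X c →
    EOK c η Y → .termEq (tc c η X (Y ++ [(chB Y, V)])) (vty c η V (vr (chB Y)) u)
      (vty c η V (vr (chB Y)) u') (tso c η u U V (vr (chB Y))) ∈ T
  tseq : ∀ {X u U Y V V'}, .term X u U ∈ TA → .sortEq Y V V' ∈ TB → ∀ {c η}, COK TA X c →
    EOK c η Y → .termEq (tc c η X (Y ++ [(chB Y, V)])) (vty c η V (vr (chB Y)) u)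
      (vty c η V' (vr (chB Y)) u) (tso c η u U V (vr (chB Y))) ∈ T
  tt : ∀ {X u U Y v V}, .term X u U ∈ TA → .term Y v V ∈ TB → ∀ {c η}, COK TA X c →
    EOK c η Y → .termEq (tc c η X Y) (tenB c η v u U) (vty c η V (tb c η v) u)
      (tso c η u U V (tb c η v)) ∈ T

/-- `Γ` contains the tensor of the contexts `X` and `Y`. -/
structure Env (X : PreCtx A) (Y : PreCtx B) (Γ : PreCtx (A.tensor B)) : Prop where
  ctxA : Derivable TA (.ctx X)
  ctxB : Derivable TB (.ctx Y)
  cok : COK TA X c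
  eok : EOK c η Y
  ctx : Derivable T (.ctx Γ)
  sub : tc c η X Y ⊆ Γ

/-- The tensors of `u` with the variables of `Y` are terms of the tensors of `U` with the sorts of
these variables. -/
def Act (Γ : PreCtx (A.tensor B)) (u : Expr A) (U : SortE A) (Y : PreCtx B) : Prop :=
  ∀ q ∈ Y, Derivable T (.term Γ (η q.1 u) (tso c η u U q.2 (vr q.1)))

/-- The values of `b` on the variables of `X` are terms of the tensors of the sorts of these
variables with `V`. -/
def ActB (Γ : PreCtx (A.tensor B)) (b : A.Var → Expr (A.tensor B)) (V : SortE B)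
    (X : PreCtx A) : Prop :=
  ∀ p ∈ X, Derivable T (.term Γ (b p.1) (tso c η (.var p.1) p.2 V b))

/-- The tensor of two judgments, over an ambient context, is derivable. -/
def G (J : Judg A) (J' : Judg B) : Prop :=
  ∀ c η Γ, Env TA TB T c η J.ctxOf J'.ctxOf Γ →
    match J, J' with
    | .sort X U, .sort Y V => ∀ u b, Act T c η Γ u U Y → ActB T c η Γ b V X →
        Derivable T (.sort Γ (tso c η u U V b))
    | .term X u U, .sort Y V => ∀ b, ActB T c η Γ b V X →
        Derivable T (.term Γ (vty c η V b u) (tso c η u U V b))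
    | .sortEq X U U', .sort Y V => ∀ u b, Act T c η Γ u U Y → ActB T c η Γ b V X →
        Derivable T (.sortEq Γ (tso c η u U V b) (tso c η u U' V b))
    | .termEq X u u' U, .sort Y V => ∀ b, ActB T c η Γ b V X →
        EqT T Γ (vty c η V b u) (vty c η V b u')
    | .sort X U, .term Y v V => ∀ u, Act T c η Γ u U Y →
        Derivable T (.term Γ (tenB c η v u U) (tso c η u U V (tb c η v)))
    | .sortEq X U U', .term Y v V => ∀ u, Act T c η Γ u U Y →
        EqT T Γ (tenB c η v u U) (tenB c η v u U')
    | .term X u U, .term Y v V => EqT T Γ (tenB c η v u U) (vty c η V (tb c η v) u)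
    | .sort X U, .sortEq Y V V' => ∀ u b, Act T c η Γ u U Y → ActB T c η Γ b V X →
        Derivable T (.sortEq Γ (tso c η u U V b) (tso c η u U V' b))
    | .term X u U, .sortEq Y V V' => ∀ b, ActB T c η Γ b V X →
        EqT T Γ (vty c η V b u) (vty c η V' b u)
    | .sort X U, .termEq Y v v' V => ∀ u, Act T c η Γ u U Y →
        EqT T Γ (tenB c η v u U) (tenB c η v' u U)
    | _, _ => True

end Ambient

section Basic

variable {TA : Set (Judg A)} {TB : Set (Judg B)} {T : Set (Judg (A.tensor B))}
  {c : Expr A → SortE A} {η : B.Var → Expr A → Expr (A.tensor B)}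

theorem mem_tc {X : PreCtx A} {Y : PreCtx B} {r : (A.tensor B).Var × SortE (A.tensor B)} :
    r ∈ tc c η X Y ↔ ∃ p ∈ X, ∃ q ∈ Y, ((p.1, q.1), tso c η (.var p.1) p.2 q.2 (vr q.1)) = r := by
  simp only [tc, List.mem_flatMap, List.mem_map]

theorem tc_subset {X X' : PreCtx A} {Y Y' : PreCtx B} (hX : X ⊆ X') (hY : Y ⊆ Y') :
    tc c η X Y ⊆ tc c η X' Y' := by
  intro r hr
  obtain ⟨p, hp, q, hq, rfl⟩ := mem_tc.1 hr
  exact mem_tc.2 ⟨p, hX hp, q, hY hq, rfl⟩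

theorem tc_append (X X' : PreCtx A) (Y : PreCtx B) :
    tc c η (X ++ X') Y = tc c η X Y ++ tc c η X' Y := List.flatMap_append ..

theorem tc_row_append (p : A.Var × SortE A) (Y Y' : PreCtx B) :
    tc c η [p] (Y ++ Y') = tc c η [p] Y ++ tc c η [p] Y' := by
  simp [tc]

theorem mem_zm {X : PreCtx A} {p : A.Var × SortE A} {Y Qs : PreCtx B}
    {r : (A.tensor B).Var × SortE (A.tensor B)} : r ∈ zm c η X p Y Qs ↔
      r ∈ tc c η X Y ∨ r ∈ tc c η X Qs ∨ r ∈ tc c η [p] Y := by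
  rw [zm, List.mem_append, ← or_assoc]
  refine or_congr_left ⟨fun h => ?_, fun h => ?_⟩
  · obtain ⟨p', hp, q, hq, rfl⟩ := mem_tc.1 h
    rcases List.mem_append.1 hq with hq | hq
    · exact .inl (mem_tc.2 ⟨p', hp, q, hq, rfl⟩)
    · exact .inr (mem_tc.2 ⟨p', hp, q, hq, rfl⟩)
  · rcases h with h | h
    · exact tc_subset (List.Subset.refl _) (List.subset_append_left _ _) h
    · exact tc_subset (List.Subset.refl _) (List.subset_append_right _ _) h

theorem zm_nil (X : PreCtx A) (p : A.Var × SortE A) (Y : PreCtx B) :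
    zm c η X p Y [] = tc c η (X ++ [p]) Y := by
  rw [zm, List.append_nil, tc_append]

theorem Env.prefix (hA : IsPretheory TA) (hB : IsPretheory TB) {X X' : PreCtx A} {Y Y' : PreCtx B}
    {Γ : PreCtx (A.tensor B)} (E : Env TA TB T c η X Y Γ) (hX : X' <+: X) (hY : Y' <+: Y) :
    Env TA TB T c η X' Y' Γ where
  ctxA := (Derivable.hered hA).prefix E.ctxA hX
  ctxB := (Derivable.hered hB).prefix E.ctxB hY
  cok := E.cok.mono hX.subset
  eok := E.eok.mono hY.subset
  ctx := E.ctx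
  sub := List.Subset.trans (tc_subset hX.subset hY.subset) E.sub

theorem Act.mono {Γ : PreCtx (A.tensor B)} {u : Expr A} {U : SortE A} {Y Y' : PreCtx B}
    (h : Act T c η Γ u U Y) (hY : Y' ⊆ Y) : Act T c η Γ u U Y' := fun q hq => h q (hY hq)

theorem ActB.mono {Γ : PreCtx (A.tensor B)} {b : A.Var → Expr (A.tensor B)} {V : SortE B}
    {X X' : PreCtx A} (h : ActB T c η Γ b V X) (hX : X' ⊆ X) : ActB T c η Γ b V X' :=
  fun q hq => h q (hX hq)

theorem act_of_tc (hP : IsPretheory T) {Γ : PreCtx (A.tensor B)} (hΓ : Derivable T (.ctx Γ))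
    {p : A.Var × SortE A} {Y : PreCtx B} (hη : EOK c η Y) (h : tc c η [p] Y ⊆ Γ) :
    Act T c η Γ (.var p.1) p.2 Y := by
  intro q hq
  rw [hη q hq, vty_var]
  exact hΓ.var hP (h (mem_tc.2 ⟨p, by simp, q, hq, rfl⟩))

theorem actB_of_tc (hP : IsPretheory T) {Γ : PreCtx (A.tensor B)} (hΓ : Derivable T (.ctx Γ))
    {q : B.Var × SortE B} {X : PreCtx A} (h : tc c η X [q] ⊆ Γ) :
    ActB T c η Γ (vr q.1) q.2 X := by
  intro p hp
  exact hΓ.var hP (h (mem_tc.2 ⟨p, hp, q, by simp, rfl⟩))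

theorem Env.act_var (hP : IsPretheory T) {X : PreCtx A} {Y : PreCtx B}
    {Γ : PreCtx (A.tensor B)} (E : Env TA TB T c η X Y Γ) {p : A.Var × SortE A} (hp : p ∈ X) :
    Act T c η Γ (.var p.1) p.2 Y :=
  act_of_tc hP E.ctx E.eok (List.Subset.trans
    (tc_subset (List.cons_subset.2 ⟨hp, List.nil_subset _⟩) (List.Subset.refl _)) E.sub)

theorem grid_row (hA : IsPretheory TA) (hB : IsPretheory TB) (hP : IsPretheory T)
    {X : PreCtx A} {Y : PreCtx B} {p : A.Var × SortE A} {Γ : PreCtx (A.tensor B)}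
    (hΓ : Derivable T (.ctx Γ)) (hsub : tc c η X Y ⊆ Γ) (hX : Derivable TA (.ctx X))
    (hc : COK TA X c) (hY : Derivable TB (.ctx Y)) (hη : ∀ Y1 q, Y1 ++ [q] <+: Y → EOK c η Y1)
    (hfr : ∀ r ∈ Γ, r.1.1 ≠ p.1)
    (K : ∀ Y1 q, Y1 ++ [q] <+: Y → G TA TB T (.sort X p.2) (.sort Y1 q.2))
    {Y' : PreCtx B} (hY' : Y' <+: Y) : Derivable T (.ctx (Γ ++ tc c η [p] Y')) := by
  induction Y' using List.reverseRecOn with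
  | nil => simpa [tc] using hΓ
  | append_singleton Y1 q ih =>
    have h1 : Y1 <+: Y := (List.prefix_append _ _).trans hY'
    have ih := ih h1
    have hY1 := (Derivable.hered hB).ctx_inv ((Derivable.hered hB).prefix hY hY')
    rw [tc_row_append, ← List.append_assoc]
    have E : Env TA TB T c η X Y1 (Γ ++ tc c η [p] Y1) :=
      ⟨hX, hY1.1.ctx, hc, hη _ _ hY', ih, List.Subset.trans
        (tc_subset (List.Subset.refl _) h1.subset)
        (List.Subset.trans hsub (List.subset_append_left _ _))⟩
    have key : Derivable T (.sort (Γ ++ tc c η [p] Y1)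
        (tso c η (.var p.1) p.2 q.2 (vr q.1))) := by
      refine K _ _ hY' c η _ E _ _ (act_of_tc hP ih E.eok (List.subset_append_right _ _))
        (actB_of_tc hP ih ?_)
      have hq : [q] ⊆ Y := List.cons_subset.2
        ⟨hY'.subset (List.mem_append_right Y1 (List.mem_singleton_self q)), List.nil_subset _⟩
      exact List.Subset.trans (tc_subset (List.Subset.refl _) hq)
        (List.Subset.trans hsub (List.subset_append_left _ _))
    refine key.snoc hP (p := ((p.1, q.1), _)) fun r hr => ?_
    rcases List.mem_append.1 hr with hr | hr
    · exact fun h => hfr r hr (by rw [h])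
    · obtain ⟨p', hp', q', hq', rfl⟩ := mem_tc.1 hr
      exact fun h => hY1.2 q' hq' (Prod.mk.inj h).2

theorem grid (hA : IsPretheory TA) (hB : IsPretheory TB) (hP : IsPretheory T)
    {X : PreCtx A} {Y : PreCtx B} (hX : Derivable TA (.ctx X))
    (hc : COK TA X c) (hY : Derivable TB (.ctx Y)) (hη : ∀ Y1 q, Y1 ++ [q] <+: Y → EOK c η Y1)
    (K : ∀ X1 p, X1 ++ [p] <+: X → ∀ Y1 q, Y1 ++ [q] <+: Y →
      G TA TB T (.sort X1 p.2) (.sort Y1 q.2)) : Derivable T (.ctx (tc c η X Y)) := by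
  induction X using List.reverseRecOn with
  | nil => exact .cstep hP .ctx_nil
  | append_singleton X p ih =>
    have hX1 := (Derivable.hered hA).ctx_inv hX
    have hc' : COK TA X c := hc.mono (List.subset_append_left _ _)
    rw [tc_append]
    refine grid_row hA hB hP (ih hX1.1.ctx hc' fun X1 p' h => K X1 p' (h.trans
      (List.prefix_append _ _))) (List.Subset.refl _) hX1.1.ctx hc' hY hη (fun r hr => ?_)
      (K X p (List.prefix_refl _)) (List.prefix_refl _)
    obtain ⟨p', hp', q', hq', rfl⟩ := mem_tc.1 hr
    exact hX1.2 p' hp'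

theorem prefix_of_snoc {α : Type*} {Y Y1 Qs : List α} {q : α} (hQ : Qs.length ≤ 1)
    (h : Y1 ++ [q] <+: Y ++ Qs) : Y1 <+: Y := by
  refine List.prefix_of_prefix_length_le ((List.prefix_append _ _).trans h)
    (List.prefix_append _ _) ?_
  have := h.length_le
  simp only [List.length_append, List.length_singleton] at this
  omega

theorem zm_ctx (hA : IsPretheory TA) (hB : IsPretheory TB) (hP : IsPretheory T)
    {X : PreCtx A} {Y Qs : PreCtx B} {p : A.Var × SortE A} (hX : Derivable TA (.ctx X))
    (hp : ∀ p' ∈ X, p'.1 ≠ p.1)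
    (hc : COK TA X c) (hY : Derivable TB (.ctx (Y ++ Qs))) (hQ : Qs.length ≤ 1)
    (hη : EOK c η Y)
    (K : ∀ X1 p', X1 ++ [p'] <+: X → ∀ Y1 q, Y1 ++ [q] <+: Y ++ Qs →
      G TA TB T (.sort X1 p'.2) (.sort Y1 q.2))
    (K' : ∀ Y1 q, Y1 ++ [q] <+: Y → G TA TB T (.sort X p.2) (.sort Y1 q.2)) :
    Derivable T (.ctx (zm c η X p Y Qs)) := by
  have hη' : ∀ Y1 q, Y1 ++ [q] <+: Y ++ Qs → EOK c η Y1 := fun Y1 q h =>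
    hη.mono (prefix_of_snoc hQ h).subset
  refine grid_row hA hB hP (grid hA hB hP hX hc hY hη' K)
    (tc_subset (List.Subset.refl _) (List.subset_append_left _ _)) hX hc
    ((Derivable.hered hB).prefix hY (List.prefix_append _ _))
    (fun Y1 q h => hη' _ _ (h.trans (List.prefix_append _ _))) (fun r hr => ?_) K'
    (List.prefix_refl _)
  obtain ⟨p', hp', q', hq', rfl⟩ := mem_tc.1 hr
  exact hp p' hp'

end Basic

/-! ## Basic consequences of the tensor of judgments -/

/-- The tensor of every judgment satisfying `D` with every derivable judgment is derivable. -/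
structure IH (TA : Set (Judg A)) (TB : Set (Judg B)) (T : Set (Judg (A.tensor B)))
    (D : Judg B → Prop) : Prop where
  hA : IsPretheory TA
  hB : IsPretheory TB
  hP : IsPretheory T
  her : Hered TB D
  der : ∀ {J'}, D J' → Derivable TB J'
  good : ∀ {J'}, D J' → ∀ {J}, Derivable TA J → G TA TB T J J'

section

variable {TA : Set (Judg A)} {TB : Set (Judg B)} {T : Set (Judg (A.tensor B))}
  {D : Judg B → Prop}
  {c : Expr A → SortE A} {η : B.Var → Expr A → Expr (A.tensor B)}
  {X : PreCtx A} {Y : PreCtx B} {Γ : PreCtx (A.tensor B)}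

theorem IH.wt_var (I : IH TA TB T D) (hY : D (.ctx Y)) {q : B.Var × SortE B} (hq : q ∈ Y) :
    WT (QD D Y) Y (.var q.1) := by
  obtain ⟨Y1, hpre, hs⟩ := I.her.entry hY hq
  have h1 : Y1 <+: Y := (List.prefix_append _ _).trans hpre
  have hw := I.her.wt_sort hs
  exact .var hq (fun τ hτ => (hw τ hτ).1.mono (fun v h => h.mono h1) h1.subset)
    fun τ hτ => (hw τ hτ).2.mono h1

theorem Env.act (I : IH TA TB T D) (E : Env TA TB T c η X Y Γ) (hY : D (.ctx Y))
    {u : Expr A} {U : SortE A} (hu : Derivable TA (.term X u U)) : Act T c η Γ u U Y := by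
  intro q hq
  obtain ⟨Y1, hpre, hs⟩ := I.her.entry hY hq
  rw [E.eok q hq]
  refine I.good hs hu c η Γ (E.prefix I.hA I.hB (List.prefix_refl _)
    ((List.prefix_append _ _).trans hpre)) (vr q.1) (actB_of_tc I.hP E.ctx ?_)
  exact List.Subset.trans (tc_subset (List.Subset.refl _)
    (List.cons_subset.2 ⟨hq, List.nil_subset _⟩)) E.sub

theorem Env.act_conv (I : IH TA TB T D) (E : Env TA TB T c η X Y Γ) (hY : D (.ctx Y))
    {u : Expr A} {U U' : SortE A} (hE : Derivable TA (.sortEq X U U')) (hu : Act T c η Γ u U Y) :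
    Act T c η Γ u U' Y := by
  intro q hq
  obtain ⟨Y1, hpre, hs⟩ := I.her.entry hY hq
  have h1 : Y1 <+: Y := (List.prefix_append _ _).trans hpre
  refine (hu q hq).conv I.hP (I.good hs hE c η Γ (E.prefix I.hA I.hB (List.prefix_refl _) h1)
    u (vr q.1) (hu.mono h1.subset) (actB_of_tc I.hP E.ctx ?_))
  exact List.Subset.trans (tc_subset (List.Subset.refl _)
    (List.cons_subset.2 ⟨hq, List.nil_subset _⟩)) E.sub

theorem Env.actB_of (hA : IsPretheory TA) (hB : IsPretheory TB) (hP : IsPretheory T)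
    (E : Env TA TB T c η X Y Γ) {v : Expr B} {V : SortE B}
    (K : ∀ X1 p, X1 ++ [p] <+: X → G TA TB T (.sort X1 p.2) (.term Y v V)) :
    ActB T c η Γ (tb c η v) V X := by
  intro p hp
  obtain ⟨X1, hpre, hs⟩ := (Derivable.hered hA).entry E.ctxA hp
  rw [tb, E.cok.var p hp]
  exact K X1 p hpre c η Γ (E.prefix hA hB ((List.prefix_append _ _).trans hpre)
    (List.prefix_refl _)) _ (E.act_var hP hp)

theorem Env.actB (I : IH TA TB T D) (E : Env TA TB T c η X Y Γ) {v : Expr B} {V : SortE B}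
    (hv : D (.term Y v V)) : ActB T c η Γ (tb c η v) V X :=
  E.actB_of I.hA I.hB I.hP fun X1 p h => I.good hv
    ((Derivable.hered I.hA).ctx_inv ((Derivable.hered I.hA).prefix E.ctxA h)).1

theorem Env.actB_conv (I : IH TA TB T D) (E : Env TA TB T c η X Y Γ) {V V' : SortE B}
    {b : A.Var → Expr (A.tensor B)} (hE : D (.sortEq Y V V')) (hb : ActB T c η Γ b V X) :
    ActB T c η Γ b V' X := by
  intro p hp
  obtain ⟨X1, hpre, hs⟩ := (Derivable.hered I.hA).entry E.ctxA hp
  have h1 : X1 <+: X := (List.prefix_append _ _).trans hpre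
  exact (hb p hp).conv I.hP (I.good hE hs c η Γ (E.prefix I.hA I.hB h1 (List.prefix_refl _))
    _ b (E.act_var I.hP hp) (hb.mono h1.subset))

theorem Env.actB_conv_symm (I : IH TA TB T D) (E : Env TA TB T c η X Y Γ) {V V' : SortE B}
    {b : A.Var → Expr (A.tensor B)} (hE : D (.sortEq Y V V')) (hb : ActB T c η Γ b V' X) :
    ActB T c η Γ b V X := by
  suffices H : ∀ X' : PreCtx A, X' <+: X → ActB T c η Γ b V X' from H X (List.prefix_refl _)
  intro X' hX'
  induction X' using List.reverseRecOn with
  | nil => intro p hp; cases hp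
  | append_singleton X1 p ih =>
    have h1 : X1 <+: X := (List.prefix_append _ _).trans hX'
    have ih := ih h1
    have hs := ((Derivable.hered I.hA).ctx_inv ((Derivable.hered I.hA).prefix E.ctxA hX')).1
    have hp : p ∈ X := hX'.subset (by simp)
    intro p' hp'
    rcases List.mem_append.1 hp' with h | h
    · exact ih p' h
    · obtain rfl := List.mem_singleton.1 h
      exact (hb p' hp).conv I.hP (.symm I.hP (I.good hE hs c η Γ
        (E.prefix I.hA I.hB h1 (List.prefix_refl _)) _ b (E.act_var I.hP hp) ih))

theorem Env.ten_sort (I : IH TA TB T D) (E : Env TA TB T c η X Y Γ) {u : Expr A} {U : SortE A}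
    (hu : Derivable TA (.term X u U)) {v : Expr B} {V : SortE B} (hv : D (.term Y v V)) :
    EqT T Γ (tenB c η v u (c u)) (tenB c η v u U) := by
  have hc := E.cok.typed I.hA ⟨U, hu⟩
  exact I.good hv (hc.sort_unique I.hA hu) c η Γ E u (E.act I (I.her.ctx hv) hc)

theorem zm_ctx_nil (I : IH TA TB T D) {p : A.Var × SortE A} (hU : Derivable TA (.sort X p.2))
    (hp : ∀ p' ∈ X, p'.1 ≠ p.1) (hc : COK TA X c) (hη : EOK c η Y) (hY : D (.ctx Y)) :
    Env TA TB T c η X Y (zm c η X p Y []) := by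
  have hX : Derivable TA (.ctx X) := hU.ctx
  refine ⟨hX, I.der hY, hc, hη, zm_ctx I.hA I.hB I.hP hX hp hc (Qs := []) ?_ (by simp) hη ?_ ?_,
    fun r hr => mem_zm.2 (.inl hr)⟩
  · rw [List.append_nil]; exact I.der hY
  · intro X1 p' h' Y1 q h
    rw [List.append_nil] at h
    exact I.good (I.her.ctx_inv (I.her.prefix hY h)).1
      ((Derivable.hered I.hA).ctx_inv ((Derivable.hered I.hA).prefix hX h')).1
  · exact fun Y1 q h => I.good (I.her.ctx_inv (I.her.prefix hY h)).1 hU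

theorem zm_ctx_singleton (I : IH TA TB T D) {p : A.Var × SortE A}
    (hU : Derivable TA (.sort X p.2))
    (hp : ∀ p' ∈ X, p'.1 ≠ p.1) (hc : COK TA X c) (hη : EOK c η Y) (hY : D (.ctx Y))
    {q : B.Var × SortE B} (hq : ∀ q' ∈ Y, q'.1 ≠ q.1) (hV : Derivable TB (.sort Y q.2))
    (K : ∀ X1 p', X1 ++ [p'] <+: X → G TA TB T (.sort X1 p'.2) (.sort Y q.2)) :
    Env TA TB T c η X Y (zm c η X p Y [q]) := by
  have hX : Derivable TA (.ctx X) := hU.ctx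
  refine ⟨hX, I.der hY, hc, hη, zm_ctx I.hA I.hB I.hP hX hp hc (Qs := [q])
    (hV.snoc I.hB hq) (by simp) hη ?_ ?_, fun r hr => mem_zm.2 (.inl hr)⟩
  · intro X1 p' h' Y1 q1 h
    rcases List.prefix_concat_iff.1 h with h | h
    · obtain ⟨rfl, h'⟩ := List.append_inj' h rfl
      obtain rfl := List.singleton_inj.1 h'
      exact K X1 p' (by assumption)
    · exact I.good (I.her.ctx_inv (I.her.prefix hY h)).1
        ((Derivable.hered I.hA).ctx_inv ((Derivable.hered I.hA).prefix hX h')).1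
  · exact fun Y1 q h => I.good (I.her.ctx_inv (I.her.prefix hY h)).1 hU

theorem Env.zm_act (hP : IsPretheory T) {p : A.Var × SortE A} {Qs : PreCtx B}
    (E : Env TA TB T c η X Y (zm c η X p Y Qs)) :
    Act T c η (zm c η X p Y Qs) (.var p.1) p.2 Y :=
  act_of_tc hP E.ctx E.eok fun r hr => mem_zm.2 (.inr (.inr hr))

theorem Env.zm_actB (hP : IsPretheory T) {p : A.Var × SortE A} {q : B.Var × SortE B}
    (E : Env TA TB T c η X Y (zm c η X p Y [q])) :
    ActB T c η (zm c η X p Y [q]) (vr q.1) q.2 X :=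
  actB_of_tc hP E.ctx fun r hr => mem_zm.2 (.inr (.inl hr))

/-! ### Transport along a substitution in the first factor -/

variable {c0 : Expr A → SortE A} {η0 : B.Var → Expr A → Expr (A.tensor B)} {X0 : PreCtx A}
  {p0 : A.Var × SortE A} {Qs : PreCtx B} {θ : A.Var → Expr A} {V0 : SortE B}
  {b : A.Var → Expr (A.tensor B)} {u : Expr A}
  {Θ : (A.tensor B).Var → Expr (A.tensor B)}

/-- `Θ` is the substitution on the tensor product induced by a substitution `θ` on `A`. -/
structure TrA (TA : Set (Judg A)) (T : Set (Judg (A.tensor B))) (D : Judg B → Prop)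
    (c0 c : Expr A → SortE A) (η0 η : B.Var → Expr A → Expr (A.tensor B)) (X0 : PreCtx A)
    (p0 : A.Var × SortE A) (Y Qs : PreCtx B) (Γ : PreCtx (A.tensor B)) (θ : A.Var → Expr A)
    (u : Expr A) (V0 : SortE B) (b : A.Var → Expr (A.tensor B))
    (Θ : (A.tensor B).Var → Expr (A.tensor B)) : Prop where
  mor : Mor T Γ (zm c0 η0 X0 p0 Y Qs) Θ
  sub : SubA (HasT T Γ) (EqT T Γ) c0 c η0 η (HasT TA X0) (QD D Y) Y θ Θ
  top : ∀ q ∈ Y, Θ (p0.1, q.1) = η q.1 u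
  col : ∀ q ∈ Qs, ∀ x, Θ (x, q.1) = vty c η V0 b (θ x)

theorem HasT.mem_ctx (hA : IsPretheory TA) {x : A.Var} (h : HasT TA X (.var x)) :
    ∃ p ∈ X, p.1 = x := by
  obtain ⟨V, h⟩ := h
  obtain ⟨U, hU, -⟩ := (Derivable.hered hA).var_inv h
  exact ⟨_, hU, rfl⟩

theorem SubA.tso_eq (I : IH TA TB T D)
    (S : SubA (HasT T Γ) (EqT T Γ) c0 c η0 η (HasT TA X0) (QD D Y) Y θ Θ)
    {u u' : Expr A} {U : SortE A} {V : SortE B} {b b' : A.Var → Expr (A.tensor B)}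
    (hs : Derivable T (.sort Γ ((tso c0 η0 u U V b).subst Θ)))
    (hU : ∀ s ∈ U.args, HasT TA X0 s) (hV : ∀ τ ∈ V.args, WT (QD D Y) Y τ ∧ QD D Y τ)
    (htop : ∀ q ∈ Y, HasT T Γ ((η0 q.1 u).subst Θ) → EqT T Γ ((η0 q.1 u).subst Θ) (η q.1 u'))
    (hb : ∀ x, HasT TA X0 (.var x) → HasT T Γ ((b x).subst Θ) →
      EqT T Γ ((b x).subst Θ) (GATPaper.vty c η V b' (θ x))) :
    Derivable T (.sortEq Γ ((tso c0 η0 u U V b).subst Θ) (tso c η u' (U.subst θ) V b')) := by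
  refine Derivable.sort_congr I.hP hs (S.tsoArgs hU hV htop hb fun e he => ?_)
  exact hs.sort_args I.hP _ (List.mem_map_of_mem he)

theorem Env.transA (I : IH TA TB T D) (E : Env TA TB T c η X Y Γ) (hY : D (.ctx Y))
    (E0 : Env TA TB T c0 η0 X0 Y (zm c0 η0 X0 p0 Y Qs)) (hp0 : ∀ p ∈ X0, p.1 ≠ p0.1)
    (hU0 : Derivable TA (.sort X0 p0.2)) (hθ : Mor TA X X0 θ)
    (hu : Act T c η Γ u (p0.2.subst θ) Y)
    (hQ : ∀ q0 ∈ Qs, (∀ q ∈ Y, q.1 ≠ q0.1) ∧ q0.2 = V0 ∧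
      (∀ τ ∈ V0.args, WT (QD D Y) Y τ ∧ QD D Y τ) ∧
      ∀ p ∈ X0, Derivable T (.term Γ (vty c η V0 b (θ p.1))
        (tso c η (θ p.1) (p.2.subst θ) V0 b))) :
    ∃ Θ, TrA TA T D c0 c η0 η X0 p0 Y Qs Γ θ u V0 b Θ := by
  classical
  let Θ : (A.tensor B).Var → Expr (A.tensor B) := fun z =>
    if z.2 ∈ Y.map Prod.fst then (if z.1 = p0.1 then η z.2 u else η z.2 (θ z.1))
    else vty c η V0 b (θ z.1)
  have top : ∀ q ∈ Y, Θ (p0.1, q.1) = η q.1 u := fun q hq => by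
    simp only [Θ]; rw [if_pos (List.mem_map_of_mem hq), if_pos trivial]
  have main : ∀ p ∈ X0, ∀ q ∈ Y, Θ (p.1, q.1) = η q.1 (θ p.1) := fun p hp q hq => by
    simp only [Θ]; rw [if_pos (List.mem_map_of_mem hq), if_neg (hp0 p hp)]
  have col : ∀ q ∈ Qs, ∀ x, Θ (x, q.1) = vty c η V0 b (θ x) := fun q hq x => by
    simp only [Θ]; rw [if_neg]
    intro h
    obtain ⟨q', hq', h⟩ := List.mem_map.1 h
    exact (hQ q hq).1 q' hq' h
  have S : SubA (HasT T Γ) (EqT T Γ) c0 c η0 η (HasT TA X0) (QD D Y) Y θ Θ := {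
    cong := cong_eqT I.hP Γ
    app := fun h => h.args I.hA
    srt := fun h => E0.cok.args I.hA h
    can := fun h => E0.cok.can I.hA E.cok h θ
    eok := E0.eok
    eok' := E.eok
    sub := fun h q hq => by
      obtain ⟨p, hp, rfl⟩ := h.mem_ctx I.hA
      exact main p hp q hq
    mis := fun h ⟨Y1, V, h1, hv⟩ => by
      obtain ⟨p, hp, rfl⟩ := h.mem_ctx I.hA
      rw [E0.cok.var p hp]
      exact ((E.prefix I.hA I.hB (List.prefix_refl _) h1).ten_sort I (hθ.2 p hp) hv).symm I.hP }
  refine ⟨Θ, Mor.build I.hP E0.ctx E.ctx fun r hr hs => ?_, S, top, col⟩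
  have key : ∀ (u1 u' : Expr A) (U : SortE A) (q : B.Var × SortE B)
      (b' : A.Var → Expr (A.tensor B)) (e : Expr (A.tensor B)),
      (∀ s ∈ U.args, HasT TA X0 s) →
      (∀ τ ∈ q.2.args, WT (QD D Y) Y τ ∧ QD D Y τ) →
      (∀ q ∈ Y, (η0 q.1 u1).subst Θ = η q.1 u') →
      (∀ x, HasT TA X0 (.var x) → Θ (x, q.1) = vty c η q.2 b' (θ x)) →
      Derivable T (.sort Γ ((tso c0 η0 u1 U q.2 (vr q.1)).subst Θ)) →
      Derivable T (.term Γ e (tso c η u' (U.subst θ) q.2 b')) →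
      Derivable T (.term Γ e ((tso c0 η0 u1 U q.2 (vr q.1)).subst Θ)) := by
    intro u1 u' U q b' e hU hV htop hb hs he
    refine he.conv I.hP (.symm I.hP (S.tso_eq I hs hU hV (fun q hq h => ?_) fun x hx h => ?_))
    · rw [htop q hq] at h ⊢; exact h.refl I.hP
    · have : (vr q.1 x : Expr (A.tensor B)).subst Θ = vty c η q.2 b' (θ x) := by
        rw [vr, Expr.subst_var]; exact hb x hx
      rw [this] at h ⊢; exact h.refl I.hP
  have top' : ∀ p : A.Var × SortE A, ∀ u', (∀ q ∈ Y, Θ (p.1, q.1) = η q.1 u') → ∀ q ∈ Y,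
      (η0 q.1 (.var p.1)).subst Θ = η q.1 u' := by
    intro p u' h q hq
    rw [E0.eok q hq, vty_var, vr, Expr.subst_var]
    exact h q hq
  have hX0 : ∀ p ∈ X0, ∀ s ∈ p.2.args, HasT TA X0 s := fun p hp =>
    ((Derivable.hered I.hA).term (E0.ctxA.var I.hA hp)).sort_args I.hA
  have hYq : ∀ q ∈ Y, ∀ τ ∈ q.2.args, WT (QD D Y) Y τ ∧ QD D Y τ := by
    intro q hq τ hτ
    obtain ⟨Y1, hpre, hs⟩ := I.her.entry hY hq
    have h1 : Y1 <+: Y := (List.prefix_append _ _).trans hpre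
    have hw := I.her.wt_sort hs τ hτ
    exact ⟨hw.1.mono (fun v h => h.mono h1) h1.subset, hw.2.mono h1⟩
  have hbY : ∀ q ∈ Y, ∀ x, HasT TA X0 (.var x) → Θ (x, q.1) = vty c η q.2 (vr q.1) (θ x) := by
    intro q hq x hx
    rw [← E.eok q hq]
    exact S.sub hx q hq
  rcases mem_zm.1 hr with hr | hr | hr
  · obtain ⟨p, hp, q, hq, rfl⟩ := mem_tc.1 hr
    refine key _ (θ p.1) _ q (vr q.1) _ (hX0 p hp) (hYq q hq) (top' p _ (main p hp)) (hbY q hq) hs ?_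
    rw [main p hp q hq]
    exact E.act I hY (hθ.2 p hp) q hq
  · obtain ⟨p, hp, q, hq, rfl⟩ := mem_tc.1 hr
    obtain ⟨-, rfl, h3, h4⟩ := hQ q hq
    refine key _ (θ p.1) _ q b _ (hX0 p hp) h3 (top' p _ (main p hp)) (fun x _ => col q hq x) hs ?_
    rw [col q hq]
    exact h4 p hp
  · obtain ⟨p, hp, q, hq, rfl⟩ := mem_tc.1 hr
    obtain rfl := List.mem_singleton.1 hp
    refine key _ u _ q (vr q.1) _ (hU0.sort_args I.hA) (hYq q hq) (top' p _ top) (hbY q hq) hs ?_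
    rw [top q hq]
    exact hu q hq

end

section

variable {TA : Set (Judg A)} {TB : Set (Judg B)} {T : Set (Judg (A.tensor B))}
  {D : Judg B → Prop}
  {c : Expr A → SortE A} {η : B.Var → Expr A → Expr (A.tensor B)}
  {X : PreCtx A} {Y : PreCtx B} {Γ : PreCtx (A.tensor B)}
  {c0 : Expr A → SortE A} {η0 : B.Var → Expr A → Expr (A.tensor B)} {X0 : PreCtx A}
  {p0 : A.Var × SortE A} {Qs : PreCtx B} {θ : A.Var → Expr A} {V0 : SortE B}
  {b : A.Var → Expr (A.tensor B)} {u : Expr A}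
  {Θ : (A.tensor B).Var → Expr (A.tensor B)}

theorem TrA.col_subst (t : TrA TA T D c0 c η0 η X0 p0 Y Qs Γ θ u V0 b Θ) {q : B.Var × SortE B}
    (hq : q ∈ Qs) (x : A.Var) :
    (vr q.1 x : Expr (A.tensor B)).subst Θ = vty c η V0 b (θ x) := by
  rw [vr, Expr.subst_var]; exact t.col q hq x

theorem TrA.top_subst (t : TrA TA T D c0 c η0 η X0 p0 Y Qs Γ θ u V0 b Θ) :
    ∀ q ∈ Y, (η0 q.1 (.var p0.1)).subst Θ = η q.1 u := by
  intro q hq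
  rw [t.sub.eok q hq, vty_var, vr, Expr.subst_var]
  exact t.top q hq

theorem TrA.act (I : IH TA TB T D) (hY : D (.ctx Y))
    (t : TrA TA T D c0 c η0 η X0 p0 Y Qs Γ θ u V0 b Θ) {u1 : Expr A} (hu : HasT TA X0 u1)
    {q : B.Var × SortE B} (hq : q ∈ Y) (h : HasT T Γ ((η0 q.1 u1).subst Θ)) :
    EqT T Γ ((η0 q.1 u1).subst Θ) (η q.1 (u1.subst θ)) := by
  have := t.sub.ten (I.wt_var hY hq) u1 hu
  rw [tenB_var, tenB_var] at this
  exact this h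

/-- Transport of a sort with generic first argument. -/
theorem TrA.tso (I : IH TA TB T D) (t : TrA TA T D c0 c η0 η X0 p0 Y Qs Γ θ u V0 b Θ)
    {U : SortE A} {V : SortE B} {b0 b' : A.Var → Expr (A.tensor B)}
    (hs : Derivable T (.sort (zm c0 η0 X0 p0 Y Qs) (tso c0 η0 (.var p0.1) U V b0)))
    (hU : ∀ s ∈ U.args, HasT TA X0 s) (hV : ∀ τ ∈ V.args, WT (QD D Y) Y τ ∧ QD D Y τ)
    (hb : ∀ x, HasT TA X0 (.var x) → HasT T Γ ((b0 x).subst Θ) →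
      EqT T Γ ((b0 x).subst Θ) (GATPaper.vty c η V b' (θ x))) :
    Derivable T (.sortEq Γ ((GATPaper.tso c0 η0 (.var p0.1) U V b0).subst Θ)
      (GATPaper.tso c η u (U.subst θ) V b')) := by
  refine t.sub.tso_eq I (hs.sub I.hP t.mor) hU hV (fun q hq h => ?_) hb
  rw [t.top_subst q hq] at h ⊢
  exact h.refl I.hP

/-- Transport of a sort with a term of the first theory as first argument. -/
theorem TrA.tso_term (I : IH TA TB T D) (hY : D (.ctx Y))
    (t : TrA TA T D c0 c η0 η X0 p0 Y Qs Γ θ u V0 b Θ)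
    {u1 : Expr A} {U : SortE A} {V : SortE B} {b0 b' : A.Var → Expr (A.tensor B)}
    (hs : Derivable T (.sort (zm c0 η0 X0 p0 Y Qs) (GATPaper.tso c0 η0 u1 U V b0)))
    (hu : HasT TA X0 u1)
    (hU : ∀ s ∈ U.args, HasT TA X0 s) (hV : ∀ τ ∈ V.args, WT (QD D Y) Y τ ∧ QD D Y τ)
    (hb : ∀ x, HasT TA X0 (.var x) → HasT T Γ ((b0 x).subst Θ) →
      EqT T Γ ((b0 x).subst Θ) (GATPaper.vty c η V b' (θ x))) :
    Derivable T (.sortEq Γ ((GATPaper.tso c0 η0 u1 U V b0).subst Θ)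
      (GATPaper.tso c η (u1.subst θ) (U.subst θ) V b')) :=
  t.sub.tso_eq I (hs.sub I.hP t.mor) hU hV (fun q hq h => t.act I hY hu hq h) hb

/-- Transport of the tensor of a sort and a term. -/
theorem TrA.ten (I : IH TA TB T D) (t : TrA TA T D c0 c η0 η X0 p0 Y Qs Γ θ u V0 b Θ)
    {U : SortE A} {v : Expr B}
    (h : HasT T (zm c0 η0 X0 p0 Y Qs) (tenB c0 η0 v (.var p0.1) U))
    (hU : ∀ s ∈ U.args, HasT TA X0 s) (hv : WT (QD D Y) Y v) :
    EqT T Γ ((tenB c0 η0 v (.var p0.1) U).subst Θ) (tenB c η v u (U.subst θ)) := by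
  refine t.sub.ten_top hU (fun q hq h => ?_) hv (h.subst I.hP t.mor)
  rw [t.top_subst q hq] at h ⊢
  exact h.refl I.hP

/-- Transport of the tensor of a term and a term. -/
theorem TrA.ten_term (I : IH TA TB T D) (hY : D (.ctx Y))
    (t : TrA TA T D c0 c η0 η X0 p0 Y Qs Γ θ u V0 b Θ)
    {u1 : Expr A} {U : SortE A} {v : Expr B}
    (h : HasT T (zm c0 η0 X0 p0 Y Qs) (tenB c0 η0 v u1 U)) (hu : HasT TA X0 u1)
    (hU : ∀ s ∈ U.args, HasT TA X0 s) (hv : WT (QD D Y) Y v) :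
    EqT T Γ ((tenB c0 η0 v u1 U).subst Θ) (tenB c η v (u1.subst θ) (U.subst θ)) :=
  t.sub.ten_top hU (fun q hq h => t.act I hY hu hq h) hv (h.subst I.hP t.mor)

/-- Transport of the tensor of a term and a sort. -/
theorem TrA.vty (I : IH TA TB T D) (t : TrA TA T D c0 c η0 η X0 p0 Y Qs Γ θ u V0 b Θ)
    {u1 : Expr A} {V : SortE B} {b0 b' : A.Var → Expr (A.tensor B)}
    (h : HasT T (zm c0 η0 X0 p0 Y Qs) (GATPaper.vty c0 η0 V b0 u1)) (hu : HasT TA X0 u1)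
    (hV : ∀ τ ∈ V.args, WT (QD D Y) Y τ ∧ QD D Y τ)
    (hb : ∀ x, HasT TA X0 (.var x) → HasT T Γ ((b0 x).subst Θ) →
      EqT T Γ ((b0 x).subst Θ) (GATPaper.vty c η V b' (θ x))) :
    EqT T Γ ((GATPaper.vty c0 η0 V b0 u1).subst Θ) (GATPaper.vty c η V b' (u1.subst θ)) :=
  t.sub.vty hV hb hu (h.subst I.hP t.mor)

/-! ### Transport along a substitution in the second factor -/

variable {Ya : PreCtx B} {φ : B.Var → Expr B} {Φ : (A.tensor B).Var → Expr (A.tensor B)}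
  {ηa : B.Var → Expr A → Expr (A.tensor B)}

/-- `Φ` is the substitution on the tensor product induced by a substitution `φ` on `B`. -/
structure TrB (TA : Set (Judg A)) (T : Set (Judg (A.tensor B)))
    (c : Expr A → SortE A) (ηa η : B.Var → Expr A → Expr (A.tensor B)) (X : PreCtx A)
    (p0 : A.Var × SortE A) (Ya Qs : PreCtx B) (Γ : PreCtx (A.tensor B)) (φ : B.Var → Expr B)
    (u : Expr A) (b : A.Var → Expr (A.tensor B))
    (Φ : (A.tensor B).Var → Expr (A.tensor B)) : Prop where
  mor : Mor T Γ (zm c ηa X p0 Ya Qs) Φ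
  sub : SubB (HasT T Γ) (EqT T Γ) c ηa η (HasT TA X) Ya φ Φ
  top : ∀ q ∈ Ya, Φ (p0.1, q.1) = tenB c η (φ q.1) u p0.2
  col : ∀ q ∈ Qs, ∀ x, Φ (x, q.1) = b x

theorem SubB.tso_eq (I : IH TA TB T D)
    (S : SubB (HasT T Γ) (EqT T Γ) c ηa η (HasT TA X) Ya φ Φ)
    {u u' : Expr A} {U : SortE A} {V : SortE B} {b b' : A.Var → Expr (A.tensor B)}
    (hs : Derivable T (.sort Γ ((tso c ηa u U V b).subst Φ)))
    (hU : ∀ s ∈ U.args, HasT TA X s) (hV : ∀ τ ∈ V.args, WT (QD D Ya) Ya τ)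
    (htop : ∀ q ∈ Ya, HasT T Γ ((ηa q.1 u).subst Φ) →
      EqT T Γ ((ηa q.1 u).subst Φ) (tenB c η (φ q.1) u' U))
    (hb : ∀ x, HasT TA X (.var x) → HasT T Γ ((b x).subst Φ) →
      EqT T Γ ((b x).subst Φ) (b' x)) :
    Derivable T (.sortEq Γ ((tso c ηa u U V b).subst Φ) (tso c η u' U (V.subst φ) b')) := by
  refine Derivable.sort_congr I.hP hs (S.tsoArgs hU hV htop hb fun e he => ?_)
  exact hs.sort_args I.hP _ (List.mem_map_of_mem he)

theorem Env.transB (I : IH TA TB T D) (E : Env TA TB T c η X Y Γ) (hYa : D (.ctx Ya))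
    (E0 : Env TA TB T c ηa X Ya (zm c ηa X p0 Ya Qs)) (hp0 : ∀ p ∈ X, p.1 ≠ p0.1)
    (hU0 : Derivable TA (.sort X p0.2))
    (hφ : ∀ q ∈ Ya, D (.term Y (φ q.1) (q.2.subst φ)))
    (hu : Act T c η Γ u p0.2 Y)
    (hQ : ∀ q0 ∈ Qs, (∀ q ∈ Ya, q.1 ≠ q0.1) ∧ (∀ τ ∈ q0.2.args, WT (QD D Ya) Ya τ) ∧
      ActB T c η Γ b (q0.2.subst φ) X) :
    ∃ Φ, TrB TA T c ηa η X p0 Ya Qs Γ φ u b Φ := by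
  classical
  let Φ : (A.tensor B).Var → Expr (A.tensor B) := fun z =>
    if z.2 ∈ Ya.map Prod.fst then
      (if z.1 = p0.1 then tenB c η (φ z.2) u p0.2 else tb c η (φ z.2) z.1) else b z.1
  have top : ∀ q ∈ Ya, Φ (p0.1, q.1) = tenB c η (φ q.1) u p0.2 := fun q hq => by
    simp only [Φ]; rw [if_pos (List.mem_map_of_mem hq), if_pos trivial]
  have main : ∀ p ∈ X, ∀ q ∈ Ya, Φ (p.1, q.1) = tb c η (φ q.1) p.1 := fun p hp q hq => by
    simp only [Φ]; rw [if_pos (List.mem_map_of_mem hq), if_neg (hp0 p hp)]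
  have col : ∀ q ∈ Qs, ∀ x, Φ (x, q.1) = b x := fun q hq x => by
    simp only [Φ]; rw [if_neg]
    intro h
    obtain ⟨q', hq', h⟩ := List.mem_map.1 h
    exact (hQ q hq).1 q' hq' h
  have S : SubB (HasT T Γ) (EqT T Γ) c ηa η (HasT TA X) Ya φ Φ := {
    cong := cong_eqT I.hP Γ
    app := fun h => h.args I.hA
    srt := fun h => E0.cok.args I.hA h
    eok := E0.eok
    sub := fun h q hq => by
      obtain ⟨p, hp, rfl⟩ := h.mem_ctx I.hA
      exact main p hp q hq
    int := fun q hq u hu => (I.good (hφ q hq) (E.cok.typed I.hA hu) c η Γ E).symm I.hP }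
  refine ⟨Φ, Mor.build I.hP E0.ctx E.ctx fun r hr hs => ?_, S, top, col⟩
  have key : ∀ (u1 u' : Expr A) (U : SortE A) (q : B.Var × SortE B)
      (b' : A.Var → Expr (A.tensor B)) (e : Expr (A.tensor B)),
      (∀ s ∈ U.args, HasT TA X s) →
      (∀ τ ∈ q.2.args, WT (QD D Ya) Ya τ) →
      (∀ q ∈ Ya, (ηa q.1 u1).subst Φ = tenB c η (φ q.1) u' U) →
      (∀ x, HasT TA X (.var x) → Φ (x, q.1) = b' x) →
      Derivable T (.sort Γ ((tso c ηa u1 U q.2 (vr q.1)).subst Φ)) →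
      Derivable T (.term Γ e (tso c η u' U (q.2.subst φ) b')) →
      Derivable T (.term Γ e ((tso c ηa u1 U q.2 (vr q.1)).subst Φ)) := by
    intro u1 u' U q b' e hU hV htop hb hs he
    refine he.conv I.hP (.symm I.hP (S.tso_eq I hs hU hV (fun q hq h => ?_) fun x hx h => ?_))
    · rw [htop q hq] at h ⊢; exact h.refl I.hP
    · have : (vr q.1 x : Expr (A.tensor B)).subst Φ = b' x := by
        rw [vr, Expr.subst_var]; exact hb x hx
      rw [this] at h ⊢; exact h.refl I.hP
  have top' : ∀ p : A.Var × SortE A, ∀ q ∈ Ya, ∀ e, Φ (p.1, q.1) = e →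
      (ηa q.1 (.var p.1)).subst Φ = e := by
    intro p q hq e h
    rw [E0.eok q hq, vty_var, vr, Expr.subst_var]
    exact h
  have mainc : ∀ p ∈ X, ∀ q ∈ Ya, Φ (p.1, q.1) = tenB c η (φ q.1) (.var p.1) p.2 := by
    intro p hp q hq
    rw [main p hp q hq, tb, E.cok.var p hp]
  have hX0 : ∀ p ∈ X, ∀ s ∈ p.2.args, HasT TA X s := fun p hp =>
    ((Derivable.hered I.hA).term (E0.ctxA.var I.hA hp)).sort_args I.hA
  have hYq : ∀ q ∈ Ya, ∀ τ ∈ q.2.args, WT (QD D Ya) Ya τ := by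
    intro q hq τ hτ
    obtain ⟨Y1, hpre, hs⟩ := I.her.entry hYa hq
    have h1 : Y1 <+: Ya := (List.prefix_append _ _).trans hpre
    exact (I.her.wt_sort hs τ hτ).1.mono (fun v h => h.mono h1) h1.subset
  rcases mem_zm.1 hr with hr | hr | hr
  · obtain ⟨p, hp, q, hq, rfl⟩ := mem_tc.1 hr
    refine key _ (.var p.1) _ q (tb c η (φ q.1)) _ (hX0 p hp) (hYq q hq)
      (fun q hq => top' p q hq _ (mainc p hp q hq)) (fun x hx => S.sub hx q hq) hs ?_
    rw [main p hp q hq]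
    exact E.actB I (hφ q hq) p hp
  · obtain ⟨p, hp, q, hq, rfl⟩ := mem_tc.1 hr
    obtain ⟨-, h3, h4⟩ := hQ q hq
    refine key _ (.var p.1) _ q b _ (hX0 p hp) h3
      (fun q hq => top' p q hq _ (mainc p hp q hq)) (fun x _ => col q hq x) hs ?_
    rw [col q hq]
    exact h4 p hp
  · obtain ⟨p, hp, q, hq, rfl⟩ := mem_tc.1 hr
    obtain rfl := List.mem_singleton.1 hp
    refine key _ u _ q (tb c η (φ q.1)) _ (hU0.sort_args I.hA) (hYq q hq)
      (fun q hq => top' p q hq _ (top q hq)) (fun x hx => S.sub hx q hq) hs ?_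
    rw [top q hq]
    exact I.good (hφ q hq) hU0 c η Γ E u hu

theorem TrB.col_subst (t : TrB TA T c ηa η X p0 Ya Qs Γ φ u b Φ) {q : B.Var × SortE B}
    (hq : q ∈ Qs) (x : A.Var) : (vr q.1 x : Expr (A.tensor B)).subst Φ = b x := by
  rw [vr, Expr.subst_var]; exact t.col q hq x

theorem TrB.top_subst (t : TrB TA T c ηa η X p0 Ya Qs Γ φ u b Φ) :
    ∀ q ∈ Ya, (ηa q.1 (.var p0.1)).subst Φ = tenB c η (φ q.1) u p0.2 := by
  intro q hq
  rw [t.sub.eok q hq, vty_var, vr, Expr.subst_var]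
  exact t.top q hq

theorem TrB.tso (I : IH TA TB T D) (t : TrB TA T c ηa η X p0 Ya Qs Γ φ u b Φ)
    {u1 u' : Expr A} {U : SortE A} {V : SortE B} {b0 b' : A.Var → Expr (A.tensor B)}
    (hs : Derivable T (.sort (zm c ηa X p0 Ya Qs) (tso c ηa u1 U V b0)))
    (hU : ∀ s ∈ U.args, HasT TA X s) (hV : ∀ τ ∈ V.args, WT (QD D Ya) Ya τ)
    (htop : ∀ q ∈ Ya, HasT T Γ ((ηa q.1 u1).subst Φ) →
      EqT T Γ ((ηa q.1 u1).subst Φ) (tenB c η (φ q.1) u' U))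
    (hb : ∀ x, HasT TA X (.var x) → HasT T Γ ((b0 x).subst Φ) →
      EqT T Γ ((b0 x).subst Φ) (b' x)) :
    Derivable T (.sortEq Γ ((GATPaper.tso c ηa u1 U V b0).subst Φ)
      (GATPaper.tso c η u' U (V.subst φ) b')) :=
  t.sub.tso_eq I (hs.sub I.hP t.mor) hU hV htop hb

theorem TrB.ten (I : IH TA TB T D) (t : TrB TA T c ηa η X p0 Ya Qs Γ φ u b Φ)
    {u1 u' : Expr A} {U : SortE A} {v : Expr B}
    (h : HasT T (zm c ηa X p0 Ya Qs) (tenB c ηa v u1 U))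
    (hU : ∀ s ∈ U.args, HasT TA X s) (hv : WT (QD D Ya) Ya v)
    (htop : ∀ q ∈ Ya, HasT T Γ ((ηa q.1 u1).subst Φ) →
      EqT T Γ ((ηa q.1 u1).subst Φ) (tenB c η (φ q.1) u' U)) :
    EqT T Γ ((tenB c ηa v u1 U).subst Φ) (tenB c η (v.subst φ) u' U) :=
  t.sub.ten_top hU htop hv (h.subst I.hP t.mor)

theorem TrB.vty (I : IH TA TB T D) (t : TrB TA T c ηa η X p0 Ya Qs Γ φ u b Φ)
    {u1 : Expr A} {V : SortE B} {b0 b' : A.Var → Expr (A.tensor B)}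
    (h : HasT T (zm c ηa X p0 Ya Qs) (GATPaper.vty c ηa V b0 u1)) (hu : HasT TA X u1)
    (hV : ∀ τ ∈ V.args, WT (QD D Ya) Ya τ)
    (hb : ∀ x, HasT TA X (.var x) → HasT T Γ ((b0 x).subst Φ) →
      EqT T Γ ((b0 x).subst Φ) (b' x)) :
    EqT T Γ ((GATPaper.vty c ηa V b0 u1).subst Φ) (GATPaper.vty c η (V.subst φ) b' u1) :=
  t.sub.vty hV hb hu (h.subst I.hP t.mor)

/-- The value on a variable of the second factor. -/
theorem TrB.act (I : IH TA TB T D) (E : Env TA TB T c η X Y Γ) (hYa : D (.ctx Ya))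
    (hφ : ∀ q ∈ Ya, D (.term Y (φ q.1) (q.2.subst φ)))
    (t : TrB TA T c ηa η X p0 Ya Qs Γ φ u b Φ) {u1 : Expr A} {U1 : SortE A}
    (hu : Derivable TA (.term X u1 U1)) {q : B.Var × SortE B} (hq : q ∈ Ya)
    (h : HasT T Γ ((ηa q.1 u1).subst Φ)) :
    EqT T Γ ((ηa q.1 u1).subst Φ) (tenB c η (φ q.1) u1 U1) := by
  have := t.sub.ten (I.wt_var hYa hq) u1 ⟨U1, hu⟩
  rw [tenB_var, Expr.subst_var] at this
  exact (this h).trans I.hP (E.ten_sort I hu (hφ q hq))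

end

/-! ## Axioms are derivable from the well-formedness of their components -/

section AxiomRules

variable {Ax : Set (Judg A)}

theorem Derivable.ax_sort (hP : IsPretheory Ax) {Γ : PreCtx A} {U : SortE A}
    (hax : .sort Γ U ∈ Ax) (hΓ : Derivable Ax (.ctx Γ)) : Derivable Ax (.sort Γ U) :=
  .step (.sA hax hΓ fun i hi => .var hP hΓ (List.getElem_mem hi))

theorem Derivable.ax_term (hP : IsPretheory Ax) {Γ : PreCtx A} {u : Expr A} {U : SortE A}
    (hax : .term Γ u U ∈ Ax) (hU : Derivable Ax (.sort Γ U)) : Derivable Ax (.term Γ u U) :=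
  .step (.tA hax hU fun i hi => .var hP hU.ctx (List.getElem_mem hi))

theorem Derivable.ax_termEq {Γ : PreCtx A} {u u' : Expr A} {U : SortE A}
    (hax : .termEq Γ u u' U ∈ Ax) (h : Derivable Ax (.term Γ u U))
    (h' : Derivable Ax (.term Γ u' U)) : EqT Ax Γ u u' := ⟨U, .step (.teqA hax h h')⟩

theorem Derivable.refl_sort {Γ : PreCtx A} {U : SortE A} (h : Derivable Ax (.sort Γ U)) :
    Derivable Ax (.sortEq Γ U U) := .step (.s1 h)

theorem Derivable.trans_sort {Γ : PreCtx A} {U V W : SortE A} (h : Derivable Ax (.sortEq Γ U V))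
    (h' : Derivable Ax (.sortEq Γ V W)) : Derivable Ax (.sortEq Γ U W) := .step (.s3 h h')

theorem EqT.conv (hP : IsPretheory Ax) {Γ : PreCtx A} {u u' : Expr A} {U U' : SortE A}
    (h : EqT Ax Γ u u') (hu : Derivable Ax (.term Γ u U)) (hE : Derivable Ax (.sortEq Γ U U')) :
    Derivable Ax (.term Γ u' U') := (h.typed hP hu).conv hP hE

theorem Derivable.sort_right (hP : IsPretheory Ax) {Γ : PreCtx A} {U V : SortE A}
    (h : Derivable Ax (.sortEq Γ U V)) : Derivable Ax (.sort Γ V) :=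
  ((Derivable.hered hP).sortEq h).2

/-- The identity is a morphism of contexts. -/
theorem Mor.id (hP : IsPretheory Ax) {X : PreCtx A} (hX : Derivable Ax (.ctx X)) :
    Mor Ax X X Expr.var := Mor.incl hP hX hX (List.Subset.refl _)

end AxiomRules

section Ambient

variable {TA : Set (Judg A)} {TB : Set (Judg B)} {T : Set (Judg (A.tensor B))}
  {D : Judg B → Prop} {c c0 : Expr A → SortE A} {η η0 : B.Var → Expr A → Expr (A.tensor B)}
  {X X0 : PreCtx A} {Y : PreCtx B} {Γ : PreCtx (A.tensor B)}
  {chA : PreCtx A → A.Var} {chB : PreCtx B → B.Var}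
  {V : SortE B} {θ : A.Var → Expr A} {b : A.Var → Expr (A.tensor B)}

/-- Induction on the derivation of a judgment of `A`. -/
theorem G.induct (hA : IsPretheory TA) {J' : Judg B}
    (h : ∀ DA : Judg A → Prop, Hered TA DA → (∀ J, DA J → Derivable TA J) →
      (∀ J, DA J → G TA TB T J J') → ∀ J, CStep TA DA J → G TA TB T J J') {J : Judg A}
    (hJ : Derivable TA J) : G TA TB T J J' := by
  obtain ⟨n, hn⟩ := hJ
  induction n generalizing J with
  | zero => exact hn.elim
  | succ n ih =>
    rcases hn with hn | hn
    · exact ih hn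
    · exact h (DerAt TA n) (DerAt.hered hA n) (fun J hJ => ⟨n, hJ⟩) (fun J hJ => ih hJ) J
        (hn.clean hA)

theorem Hered.prefix_sort {Ax : Set (Judg A)} {DA : Judg A → Prop} (H : Hered Ax DA)
    (h : DA (.ctx X)) {X1 : PreCtx A} {p : A.Var × SortE A} (hp : X1 ++ [p] <+: X) :
    DA (.sort X1 p.2) := (H.ctx_inv (H.prefix h hp)).1

theorem exists_cok_eok (I : IH TA TB T D) {U : SortE A} (hU : Derivable TA (.sort X U))
    (hY : D (.ctx Y)) : ∃ c : Expr A → SortE A, ∃ η : B.Var → Expr A → Expr (A.tensor B),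
      COK TA X c ∧ EOK c η Y := by
  obtain ⟨c, hc⟩ := exists_cok I.hA U (Derivable.ctx_nodup hU.ctx)
  obtain ⟨η, hη⟩ := exists_eok I.hB c (I.der hY)
  exact ⟨c, η, hc, hη⟩

theorem source_nil (I : IH TA TB T D) (fA : FreshCh chA) {U : SortE A}
    (hU : Derivable TA (.sort X U)) (hY : D (.ctx Y)) :
    ∃ c : Expr A → SortE A, ∃ η : B.Var → Expr A → Expr (A.tensor B),
      Env TA TB T c η X Y (zm c η X (chA X, U) Y []) := by
  obtain ⟨c, η, hc, hη⟩ := exists_cok_eok I hU hY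
  exact ⟨c, η, zm_ctx_nil I (p := (chA X, U)) hU (fA X) hc hη hY⟩

theorem source_col (I : IH TA TB T D) (fA : FreshCh chA) (fB : FreshCh chB) {U : SortE A}
    (hU : Derivable TA (.sort X U)) (hY : D (.ctx Y)) (hV : Derivable TB (.sort Y V))
    (K : ∀ X1 p', X1 ++ [p'] <+: X → G TA TB T (.sort X1 p'.2) (.sort Y V)) :
    ∃ c : Expr A → SortE A, ∃ η : B.Var → Expr A → Expr (A.tensor B),
      Env TA TB T c η X Y (zm c η X (chA X, U) Y [(chB Y, V)]) := by
  obtain ⟨c, η, hc, hη⟩ := exists_cok_eok I hU hY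
  exact ⟨c, η, zm_ctx_singleton I (p := (chA X, U)) hU (fA X) hc hη hY (q := (chB Y, V))
    (fB Y) hV K⟩

theorem Env.eta_congr (I : IH TA TB T D) (E : Env TA TB T c η X Y Γ) (hY : D (.ctx Y))
    {u u' : Expr A} {U : SortE A} (hu : Derivable TA (.termEq X u u' U)) {q : B.Var × SortE B}
    (hq : q ∈ Y) : EqT T Γ (η q.1 u) (η q.1 u') := by
  obtain ⟨Y1, hpre, hs⟩ := I.her.entry hY hq
  rw [E.eok q hq u, E.eok q hq u']
  refine I.good hs hu c η Γ (E.prefix I.hA I.hB (List.prefix_refl _)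
    ((List.prefix_append _ _).trans hpre)) (vr q.1) (actB_of_tc I.hP E.ctx ?_)
  exact List.Subset.trans (tc_subset (List.Subset.refl _)
    (List.cons_subset.2 ⟨hq, List.nil_subset _⟩)) E.sub

/-! ### Instances of judgments of `A` against a sort of `B` -/

section Column

/-- What is needed of a sort `V` of `B` in order to tensor with it. -/
structure Col (TA : Set (Judg A)) (TB : Set (Judg B)) (T : Set (Judg (A.tensor B)))
    (D : Judg B → Prop) (chA : PreCtx A → A.Var) (chB : PreCtx B → B.Var) (Y : PreCtx B)
    (V : SortE B) : Prop where
  ih : IH TA TB T D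
  freshA : FreshCh chA
  freshB : FreshCh chB
  ctx : D (.ctx Y)
  sort : Derivable TB (.sort Y V)
  wt : ∀ τ ∈ V.args, WT (QD D Y) Y τ ∧ QD D Y τ

theorem Col.trans (C : Col TA TB T D chA chB Y V) (E : Env TA TB T c η X Y Γ) {U0 : SortE A}
    (E0 : Env TA TB T c0 η0 X0 Y (zm c0 η0 X0 (chA X0, U0) Y [(chB Y, V)]))
    (hU0 : Derivable TA (.sort X0 U0)) (hθ : Mor TA X X0 θ) {u : Expr A}
    (hu : Act T c η Γ u (U0.subst θ) Y) (hb : ActB T c η Γ b V X)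
    (L : ∀ p ∈ X0, G TA TB T (.term X (θ p.1) (p.2.subst θ)) (.sort Y V)) :
    ∃ Θ, TrA TA T D c0 c η0 η X0 (chA X0, U0) Y [(chB Y, V)] Γ θ u V b Θ := by
  refine E.transA C.ih C.ctx E0 (C.freshA X0) hU0 hθ hu fun q0 hq0 => ?_
  obtain rfl := List.mem_singleton.1 hq0
  exact ⟨C.freshB Y, rfl, C.wt, fun p hp => L p hp c η Γ E b hb⟩

theorem TrA.tso_col (C : Col TA TB T D chA chB Y V) {U0 U : SortE A} {u : Expr A}
    {Θ : (A.tensor B).Var → Expr (A.tensor B)}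
    (t : TrA TA T D c0 c η0 η X0 (chA X0, U0) Y [(chB Y, V)] Γ θ u V b Θ)
    (hs : Derivable T (.sort (zm c0 η0 X0 (chA X0, U0) Y [(chB Y, V)])
      (GATPaper.tso c0 η0 (.var (chA X0)) U V (vr (chB Y)))))
    (hU : Derivable TA (.sort X0 U)) :
    Derivable T (.sortEq Γ
      ((GATPaper.tso c0 η0 (.var (chA X0)) U V (vr (chB Y))).subst Θ)
      (GATPaper.tso c η u (U.subst θ) V b)) :=
  t.tso C.ih hs (hU.sort_args C.ih.hA) C.wt fun x _ h => by
    have e := t.col_subst (List.mem_singleton_self _) x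
    rw [e] at h ⊢
    exact h.refl C.ih.hP

theorem TrA.vty_col (C : Col TA TB T D chA chB Y V) {U0 : SortE A} {u u1 : Expr A}
    {Θ : (A.tensor B).Var → Expr (A.tensor B)}
    (t : TrA TA T D c0 c η0 η X0 (chA X0, U0) Y [(chB Y, V)] Γ θ u V b Θ)
    (hs : HasT T (zm c0 η0 X0 (chA X0, U0) Y [(chB Y, V)])
      (GATPaper.vty c0 η0 V (vr (chB Y)) u1)) (hu : HasT TA X0 u1) :
    EqT T Γ ((GATPaper.vty c0 η0 V (vr (chB Y)) u1).subst Θ)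
      (GATPaper.vty c η V b (u1.subst θ)) :=
  t.vty C.ih hs hu C.wt fun x _ h => by
    have e := t.col_subst (List.mem_singleton_self _) x
    rw [e] at h ⊢
    exact h.refl C.ih.hP

theorem Col.sort_inst (C : Col TA TB T D chA chB Y V)
    {U0 : SortE A} (hU0 : Derivable TA (.sort X0 U0))
    (K : ∀ X1 p', X1 ++ [p'] <+: X0 → G TA TB T (.sort X1 p'.2) (.sort Y V))
    (key : ∀ c0 η0, Env TA TB T c0 η0 X0 Y (zm c0 η0 X0 (chA X0, U0) Y [(chB Y, V)]) →
      Derivable T (.sort (zm c0 η0 X0 (chA X0, U0) Y [(chB Y, V)])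
        (tso c0 η0 (.var (chA X0)) U0 V (vr (chB Y)))))
    (hθ : Mor TA X X0 θ)
    (L : ∀ p ∈ X0, G TA TB T (.term X (θ p.1) (p.2.subst θ)) (.sort Y V)) :
    G TA TB T (.sort X (U0.subst θ)) (.sort Y V) := by
  intro c η Γ E u b hu hb
  obtain ⟨c0, η0, E0⟩ := source_col C.ih C.freshA C.freshB hU0 C.ctx C.sort K
  obtain ⟨Θ, t⟩ := C.trans E E0 hU0 hθ hu hb L
  exact (t.tso_col C (key c0 η0 E0) hU0).sort_right C.ih.hP

theorem Col.sortEq_inst (C : Col TA TB T D chA chB Y V)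
    {U0 U0' : SortE A} (hU0 : Derivable TA (.sortEq X0 U0 U0'))
    (K : ∀ X1 p', X1 ++ [p'] <+: X0 → G TA TB T (.sort X1 p'.2) (.sort Y V))
    (key : ∀ c0 η0, Env TA TB T c0 η0 X0 Y (zm c0 η0 X0 (chA X0, U0) Y [(chB Y, V)]) →
      Derivable T (.sortEq (zm c0 η0 X0 (chA X0, U0) Y [(chB Y, V)])
        (tso c0 η0 (.var (chA X0)) U0 V (vr (chB Y)))
        (tso c0 η0 (.var (chA X0)) U0' V (vr (chB Y)))))
    (hθ : Mor TA X X0 θ)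
    (L : ∀ p ∈ X0, G TA TB T (.term X (θ p.1) (p.2.subst θ)) (.sort Y V)) :
    G TA TB T (.sortEq X (U0.subst θ) (U0'.subst θ)) (.sort Y V) := by
  intro c η Γ E u b hu hb
  obtain ⟨h1, h2⟩ := (Derivable.hered C.ih.hA).sortEq hU0
  obtain ⟨c0, η0, E0⟩ := source_col C.ih C.freshA C.freshB h1 C.ctx C.sort K
  obtain ⟨Θ, t⟩ := C.trans E E0 h1 hθ hu hb L
  have k := key c0 η0 E0
  obtain ⟨k1, k2⟩ := (Derivable.hered C.ih.hP).sortEq k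
  exact ((t.tso_col C k1 h1).symm C.ih.hP).trans_sort
    ((Derivable.sub C.ih.hP k t.mor).trans_sort (t.tso_col C k2 h2))

theorem Col.term_inst (C : Col TA TB T D chA chB Y V)
    {u0 : Expr A} {U0 : SortE A} (hu0 : Derivable TA (.term X0 u0 U0))
    (K : ∀ X1 p', X1 ++ [p'] <+: X0 → G TA TB T (.sort X1 p'.2) (.sort Y V))
    (key : ∀ c0 η0, Env TA TB T c0 η0 X0 Y (zm c0 η0 X0 (chA X0, U0) Y [(chB Y, V)]) →
      Derivable T (.term (zm c0 η0 X0 (chA X0, U0) Y [(chB Y, V)])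
        (vty c0 η0 V (vr (chB Y)) u0) (tso c0 η0 u0 U0 V (vr (chB Y)))))
    (hθ : Mor TA X X0 θ)
    (L : ∀ p ∈ X0, G TA TB T (.term X (θ p.1) (p.2.subst θ)) (.sort Y V)) :
    G TA TB T (.term X (u0.subst θ) (U0.subst θ)) (.sort Y V) := by
  intro c η Γ E b hb
  have hU0 := (Derivable.hered C.ih.hA).term hu0
  have hu : Derivable TA (.term X (u0.subst θ) (U0.subst θ)) := Derivable.sub C.ih.hA hu0 hθ
  obtain ⟨c0, η0, E0⟩ := source_col C.ih C.freshA C.freshB hU0 C.ctx C.sort K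
  obtain ⟨Θ, t⟩ := C.trans E E0 hU0 hθ (E.act C.ih C.ctx hu) hb L
  have k := key c0 η0 E0
  refine (t.vty_col C ⟨_, k⟩ ⟨_, hu0⟩).conv C.ih.hP (Derivable.sub C.ih.hP k t.mor)
    (t.tso_term C.ih C.ctx ((Derivable.hered C.ih.hP).term k) ⟨_, hu0⟩ (hU0.sort_args C.ih.hA)
      C.wt fun x _ h => ?_)
  have e := t.col_subst (List.mem_singleton_self _) x
  rw [e] at h ⊢
  exact h.refl C.ih.hP

theorem Col.termEq_inst (C : Col TA TB T D chA chB Y V)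
    {u0 u0' : Expr A} {U0 : SortE A}
    (hu0 : Derivable TA (.termEq X0 u0 u0' U0))
    (K : ∀ X1 p', X1 ++ [p'] <+: X0 → G TA TB T (.sort X1 p'.2) (.sort Y V))
    (key : ∀ c0 η0, Env TA TB T c0 η0 X0 Y (zm c0 η0 X0 (chA X0, U0) Y [(chB Y, V)]) →
      EqT T (zm c0 η0 X0 (chA X0, U0) Y [(chB Y, V)])
        (vty c0 η0 V (vr (chB Y)) u0) (vty c0 η0 V (vr (chB Y)) u0'))
    (hθ : Mor TA X X0 θ)
    (L : ∀ p ∈ X0, G TA TB T (.term X (θ p.1) (p.2.subst θ)) (.sort Y V)) :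
    G TA TB T (.termEq X (u0.subst θ) (u0'.subst θ) (U0.subst θ)) (.sort Y V) := by
  intro c η Γ E b hb
  obtain ⟨h1, h2⟩ := (Derivable.hered C.ih.hA).termEq hu0
  have hU0 := (Derivable.hered C.ih.hA).term h1
  have hu : Derivable TA (.term X (u0.subst θ) (U0.subst θ)) := Derivable.sub C.ih.hA h1 hθ
  obtain ⟨c0, η0, E0⟩ := source_col C.ih C.freshA C.freshB hU0 C.ctx C.sort K
  obtain ⟨Θ, t⟩ := C.trans E E0 hU0 hθ (E.act C.ih C.ctx hu) hb L
  have k := key c0 η0 E0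
  obtain ⟨k1, k2⟩ := k.hasT C.ih.hP
  exact ((t.vty_col C k1 ⟨_, h1⟩).symm C.ih.hP).trans C.ih.hP
    ((k.subst C.ih.hP t.mor).trans C.ih.hP (t.vty_col C k2 ⟨_, h2⟩))

end Column

end Ambient

section Ambient

variable {TA : Set (Judg A)} {TB : Set (Judg B)} {T : Set (Judg (A.tensor B))}
  {D : Judg B → Prop} {c c0 : Expr A → SortE A} {η η0 : B.Var → Expr A → Expr (A.tensor B)}
  {X X0 : PreCtx A} {Y : PreCtx B} {Γ : PreCtx (A.tensor B)}
  {chA : PreCtx A → A.Var} {chB : PreCtx B → B.Var}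
  {V : SortE B} {θ : A.Var → Expr A} {b : A.Var → Expr (A.tensor B)}

theorem Env.tc_env (hP : IsPretheory T) {p : A.Var × SortE A} {Qs : PreCtx B}
    (E : Env TA TB T c η X Y (zm c η X p Y Qs)) :
    Env TA TB T c η X Y (tc c η X (Y ++ Qs)) where
  ctxA := E.ctxA
  ctxB := E.ctxB
  cok := E.cok
  eok := E.eok
  ctx := (Derivable.hered hP).prefix E.ctx (List.prefix_append _ _)
  sub := tc_subset (List.Subset.refl _) (List.subset_append_left _ _)

theorem Env.tc_actB (hP : IsPretheory T) {q : B.Var × SortE B}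
    (E : Env TA TB T c η X Y (tc c η X (Y ++ [q]))) :
    ActB T c η (tc c η X (Y ++ [q])) (vr q.1) q.2 X :=
  actB_of_tc hP E.ctx (tc_subset (List.Subset.refl _) (List.subset_append_right _ _))

theorem sort_mem {TA : Set (Judg A)} {S : A.SortSym} (h : introSort X S ∈ TA) :
    Judg.sort X ⟨S, ctxVars X⟩ ∈ TA := h

theorem term_mem {TA : Set (Judg A)} {t : A.TermSym} {U : SortE A} (h : introTerm X t U ∈ TA) :
    Judg.term X (.app t (ctxVars X)) U ∈ TA := h

theorem app_ctxVars_subst (t : A.TermSym) (σ : A.Var → Expr A) :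
    (Expr.app t (ctxVars X)).subst σ = .app t (X.map fun p => σ p.1) := by
  rw [Expr.subst_app, ctxVars_eq, List.map_map]
  exact congrArg _ (List.map_congr_left fun p _ => Expr.subst_var ..)

theorem sort_ctxVars_subst (S : A.SortSym) (σ : A.Var → Expr A) :
    (⟨S, ctxVars X⟩ : SortE A).subst σ = ⟨S, X.map fun p => σ p.1⟩ := by
  refine SortE.ext' (by simp) ?_
  rw [SortE.subst_args, ctxVars_eq, List.map_map]
  exact List.map_congr_left fun p _ => Expr.subst_var ..

/-- Replacing the term `u` of `A` by an equal one in the tensor with a generic sort of `B`. -/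
theorem Env.tso_congr (I : IH TA TB T D) (E : Env TA TB T c η X Y Γ) (hY : D (.ctx Y))
    {u u' : Expr A} {U : SortE A} (hu : Derivable TA (.termEq X u u' U)) {S : B.SortSym}
    (hs : Derivable T (.sort Γ (tso c η u U ⟨S, ctxVars Y⟩ b))) :
    Derivable T (.sortEq Γ (tso c η u U ⟨S, ctxVars Y⟩ b) (tso c η u' U ⟨S, ctxVars Y⟩ b)) := by
  refine hs.sort_congr I.hP (forall₂_append' ?_ ?_)
  · rw [List.forall₂_same]
    exact fun e he => (hs.sort_args I.hP e (List.mem_append_left _ he)).refl I.hP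
  · refine forall₂_map_same fun τ hτ => ?_
    obtain ⟨q, hq, rfl⟩ := List.mem_map.1 hτ
    rw [tenB_var, tenB_var]
    exact E.eta_congr I hY hu hq

theorem good_sort_axiom (I : IH TA TB T D) (hT : TAx TA TB T chA chB) (fA : FreshCh chA)
    (fB : FreshCh chB) {S' : B.SortSym} (hax' : introSort Y S' ∈ TB) (hY : D (.ctx Y))
    (hv : ∀ q ∈ Y, D (.term Y (.var q.1) q.2)) {J : Judg A} (hJ : Derivable TA J) :
    G TA TB T J (.sort Y ⟨S', ctxVars Y⟩) := by
  have hA := I.hA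
  have hP := I.hP
  have C : Col TA TB T D chA chB Y ⟨S', ctxVars Y⟩ := by
    refine ⟨I, fA, fB, hY, .ax_sort I.hB hax' (I.der hY), fun τ hτ => ?_⟩
    obtain ⟨q, hq, rfl⟩ := List.mem_map.1 hτ
    exact ⟨I.wt_var hY hq, Y, q.2, List.prefix_refl _, hv q hq⟩
  refine G.induct hA (fun DA H hd ih J hs => ?_) hJ
  have K : ∀ {X0}, DA (.ctx X0) → ∀ X1 p', X1 ++ [p'] <+: X0 →
      G TA TB T (.sort X1 p'.2) (.sort Y ⟨S', ctxVars Y⟩) := fun h X1 p' hp =>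
    ih _ (H.prefix_sort h hp)
  have L : ∀ {X0}, (∀ p ∈ X0, DA (.term X0 (.var p.1) p.2)) → ∀ p ∈ X0,
      G TA TB T (.term X0 (Expr.var p.1) (p.2.subst Expr.var)) (.sort Y ⟨S', ctxVars Y⟩) := by
    intro X0 h p hp
    rw [SortE.subst_id]
    exact ih _ (h p hp)
  have M : ∀ {X X0 σ}, DA (.ctx X) → (∀ p ∈ X0, DA (.term X (σ p.1) (p.2.subst σ))) →
      Mor TA X X0 σ := fun h h' => ⟨hd _ h, fun p hp => hd _ (h' p hp)⟩
  cases hs with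
  | ctx_nil => exact fun _ _ _ _ => trivial
  | ctx_cons => exact fun _ _ _ _ => trivial
  | s1 h => exact fun c η Γ E u b hu hb => (ih _ h c η Γ E u b hu hb).refl_sort
  | s2 h =>
    exact fun c η Γ E u b hu hb =>
      (ih _ h c η Γ E u b (E.act_conv I hY ((hd _ h).symm hA) hu) hb).symm hP
  | s3 h1 h2 =>
    exact fun c η Γ E u b hu hb => (ih _ h1 c η Γ E u b hu hb).trans_sort
      (ih _ h2 c η Γ E u b (E.act_conv I hY (hd _ h1) hu) hb)
  | t1 h => exact fun c η Γ E b hb => HasT.refl hP ⟨_, ih _ h c η Γ E b hb⟩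
  | t2 h => exact fun c η Γ E b hb => EqT.symm hP (ih _ h c η Γ E b hb)
  | t3 h1 h2 =>
    exact fun c η Γ E b hb => EqT.trans hP (ih _ h1 c η Γ E b hb) (ih _ h2 c η Γ E b hb)
  | seqt h1 h2 =>
    exact fun c η Γ E b hb => (ih _ h2 c η Γ E b hb).conv hP
      (ih _ h1 c η Γ E _ b (E.act I hY (hd _ h2)) hb)
  | seqteq h1 h2 h3 h4 => exact fun c η Γ E b hb => ih _ h2 c η Γ E b hb
  | @var X p hp h =>
    intro c η Γ E b hb
    show Derivable T (.term Γ (vty c η _ b (.var p.1)) _)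
    rw [vty_var]
    exact hb p hp
  | @sA X S hax h hv' =>
    have hs : Derivable TA (.sort X ⟨S, ctxVars X⟩) := .ax_sort hA hax (hd _ h)
    have := C.sort_inst hs (K h) (fun c0 η0 E0 =>
      .ax_sort hP (hT.ss (sort_mem hax) (sort_mem hax') E0.cok E0.eok) E0.ctx)
      (Mor.id hA (hd _ h)) (L hv')
    rwa [SortE.subst_id] at this
  | @sSub X0 S hax X σ hJ hX hσ =>
    have := C.sort_inst (hd _ hJ) (K (H.ctx hJ)) (fun c0 η0 E0 =>
      ih _ hJ c0 η0 _ E0 _ _ (E0.zm_act hP) (E0.zm_actB hP))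
      (M hX hσ) (fun p hp => ih _ (hσ p hp))
    rwa [sort_ctxVars_subst] at this
  | @seqA X U U' hax h1 h2 =>
    have hs : Derivable TA (.sortEq X U U') := .step (.seqA hax (hd _ h1) (hd _ h2))
    have hc : DA (.ctx X) := H.ctx h1
    have := C.sortEq_inst (θ := Expr.var) hs (K hc) (fun c0 η0 E0 =>
      .step (.seqA (hT.seqs hax (sort_mem hax') E0.cok E0.eok)
        (ih _ h1 c0 η0 _ E0 _ _ (E0.zm_act hP) (E0.zm_actB hP))
        (ih _ h2 c0 η0 _ E0 _ _ (E0.act_conv I hY hs (E0.zm_act hP)) (E0.zm_actB hP))))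
      (Mor.id hA (hd _ hc)) (fun p hp => ?_)
    · rwa [SortE.subst_id, SortE.subst_id] at this
    · intro c η Γ E b hb
      show Derivable T (.term Γ (vty c η _ b (.var p.1)) _)
      rw [vty_var, SortE.subst_id]
      exact hb p hp
  | @seqSub1 X0 U U' hax X σ hJ h1 h2 hσ =>
    exact C.sortEq_inst (hd _ hJ) (K (H.ctx hJ)) (fun c0 η0 E0 =>
      ih _ hJ c0 η0 _ E0 _ _ (E0.zm_act hP) (E0.zm_actB hP))
      (M (H.ctx h1) hσ) (fun p hp => ih _ (hσ p hp))
  | @seqSub2 X0 S hax X σ τ hJ h1 h2 hστ =>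
    intro c η Γ E u b hu hb
    have hs := ih _ h1 c η Γ E u b hu hb
    refine hs.sort_congr hP (forall₂_append' ?_ ?_)
    · simp only [List.flatMap_map]
      refine forall₂_flatMap_same fun p hp => forall₂_append' (forall₂_map_same fun e he => ?_)
        (.cons (ih _ (hστ p hp) c η Γ E b hb) .nil)
      obtain ⟨q, hq, rfl⟩ := List.mem_map.1 he
      rw [tenB_var, tenB_var]
      exact E.eta_congr I hY (hd _ (hστ p hp)) hq
    · rw [List.forall₂_map_left_iff, List.forall₂_map_right_iff, List.forall₂_same]
      intro e he
      obtain ⟨q, hq, rfl⟩ := List.mem_map.1 he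
      rw [tenB_var, tenB_var]
      exact HasT.refl hP ⟨_, hu q hq⟩
  | @tA X t U hax h hv' =>
    have hu : Derivable TA (.term X (.app t (ctxVars X)) U) := .ax_term hA hax (hd _ h)
    have := C.term_inst hu (K (H.ctx h)) (fun c0 η0 E0 => by
      have E1 := E0.tc_env hP
      exact (Derivable.ax_term hP (hT.ts (term_mem hax) (sort_mem hax') E0.cok E0.eok)
        (ih _ h c0 η0 _ E1 _ _ (E1.act I hY hu) (E1.tc_actB hP))).weak_term hP E0.ctx
          (List.subset_append_left _ _))
      (Mor.id hA (hd _ (H.ctx h))) (L hv')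
    rwa [SortE.subst_id, Expr.subst_id] at this
  | @tSub X0 t U hax X σ hJ hU hσ =>
    have := C.term_inst (hd _ hJ) (K (H.ctx hJ)) (fun c0 η0 E0 =>
      ih _ hJ c0 η0 _ E0 _ (E0.zm_actB hP))
      (M (H.ctx hU) hσ) (fun p hp => ih _ (hσ p hp))
    rwa [app_ctxVars_subst] at this
  | @teqA X u u' U hax h1 h2 =>
    have hu : Derivable TA (.termEq X u u' U) := .step (.teqA hax (hd _ h1) (hd _ h2))
    have hc : DA (.ctx X) := H.ctx h1
    have := C.termEq_inst (θ := Expr.var) hu (K hc) (fun c0 η0 E0 => by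
      have E1 := E0.tc_env hP
      have k1 := ih _ h1 c0 η0 _ E1 _ (E1.tc_actB hP)
      have k2 := ih _ h2 c0 η0 _ E1 _ (E1.tc_actB hP)
      exact (Derivable.ax_termEq (hT.teqs hax (sort_mem hax') E0.cok E0.eok) k1
        (k2.conv hP ((E1.tso_congr I hY hu ((Derivable.hered hP).term k1)).symm hP))).weak hP
          E0.ctx (List.subset_append_left _ _))
      (Mor.id hA (hd _ hc)) (fun p hp => ?_)
    · rwa [SortE.subst_id, Expr.subst_id, Expr.subst_id] at this
    · intro c η Γ E b hb
      show Derivable T (.term Γ (vty c η _ b (.var p.1)) _)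
      rw [vty_var, SortE.subst_id]
      exact hb p hp
  | @teqSub1 X0 u u' U hax X σ hJ h1 h2 hσ =>
    exact C.termEq_inst (hd _ hJ) (K (H.ctx hJ)) (fun c0 η0 E0 =>
      ih _ hJ c0 η0 _ E0 _ (E0.zm_actB hP))
      (M (H.ctx h1) hσ) (fun p hp => ih _ (hσ p hp))
  | @teqSub2 X0 t U hax X σ τ hJ h1 h2 hστ =>
    intro c η Γ E b hb
    have hs := ih _ h1 c η Γ E b hb
    show EqT T Γ (vty c η _ b (.app t _)) (vty c η _ b (.app t _))
    rw [vty_app] at hs ⊢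
    rw [vty_app]
    refine EqT.app hP ⟨_, hs⟩ ?_
    simp only [List.flatMap_map]
    refine forall₂_flatMap_same fun p hp => forall₂_append' (forall₂_map_same fun e he => ?_)
      (.cons (ih _ (hστ p hp) c η Γ E b hb) .nil)
    obtain ⟨q, hq, rfl⟩ := List.mem_map.1 he
    rw [tenB_var, tenB_var]
    exact E.eta_congr I hY (hd _ (hστ p hp)) hq

end Ambient

section Row

variable {TA : Set (Judg A)} {TB : Set (Judg B)} {T : Set (Judg (A.tensor B))}
  {D : Judg B → Prop} {c c0 : Expr A → SortE A} {η η0 : B.Var → Expr A → Expr (A.tensor B)}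
  {X X0 : PreCtx A} {Y : PreCtx B} {Γ : PreCtx (A.tensor B)}
  {chA : PreCtx A → A.Var} {chB : PreCtx B → B.Var}
  {v : Expr B} {V : SortE B} {θ : A.Var → Expr A} {b : A.Var → Expr (A.tensor B)}

/-- A fixed term `v` of `B`, for substitution instances of judgments of `A`. -/
structure Row (TA : Set (Judg A)) (TB : Set (Judg B)) (T : Set (Judg (A.tensor B)))
    (D : Judg B → Prop) (chA : PreCtx A → A.Var) (Y : PreCtx B) (v : Expr B)
    (V : SortE B) : Prop where
  ih : IH TA TB T D
  freshA : FreshCh chA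
  sort : D (.sort Y V)
  wt : WT (QD D Y) Y v

theorem Row.ctx (C : Row TA TB T D chA Y v V) : D (.ctx Y) := C.ih.her.ctx C.sort

theorem Row.trans (C : Row TA TB T D chA Y v V) (E : Env TA TB T c η X Y Γ) {U0 : SortE A}
    (E0 : Env TA TB T c0 η0 X0 Y (zm c0 η0 X0 (chA X0, U0) Y []))
    (hU0 : Derivable TA (.sort X0 U0)) (hθ : Mor TA X X0 θ) {u : Expr A}
    (hu : Act T c η Γ u (U0.subst θ) Y) :
    ∃ Θ, TrA TA T D c0 c η0 η X0 (chA X0, U0) Y [] Γ θ u V (tb c η v) Θ :=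
  E.transA C.ih C.ctx E0 (C.freshA X0) hU0 hθ hu (by simp)

theorem Row.tb_subst (C : Row TA TB T D chA Y v V) {U0 : SortE A} {u : Expr A}
    {Θ : (A.tensor B).Var → Expr (A.tensor B)} (E : Env TA TB T c η X Y Γ)
    (E0 : Env TA TB T c0 η0 X0 Y (zm c0 η0 X0 (chA X0, U0) Y []))
    (t : TrA TA T D c0 c η0 η X0 (chA X0, U0) Y [] Γ θ u V b Θ)
    (K : ∀ X1 p', X1 ++ [p'] <+: X0 → G TA TB T (.sort X1 p'.2) (.term Y v V))
    (L : ∀ p ∈ X0, G TA TB T (.term X (θ p.1) (p.2.subst θ)) (.term Y v V))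
    (x : A.Var) (hx : HasT TA X0 (.var x)) :
    EqT T Γ ((tb c0 η0 v x).subst Θ) (vty c η V (tb c η v) (θ x)) := by
  obtain ⟨p, hp, rfl⟩ := hx.mem_ctx C.ih.hA
  have h : HasT T (zm c0 η0 X0 (chA X0, U0) Y []) (tb c0 η0 v p.1) :=
    ⟨_, E0.actB_of C.ih.hA C.ih.hB C.ih.hP K p hp⟩
  have := t.ten_term C.ih C.ctx h hx (E0.cok.args C.ih.hA hx) C.wt
  rw [E0.cok.var p hp, Expr.subst_var] at this
  rw [tb, E0.cok.var p hp]
  exact this.trans C.ih.hP (L p hp c η Γ E)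

theorem Row.sort_inst (C : Row TA TB T D chA Y v V)
    {U0 : SortE A} (hU0 : Derivable TA (.sort X0 U0))
    (K : ∀ X1 p', X1 ++ [p'] <+: X0 → G TA TB T (.sort X1 p'.2) (.term Y v V))
    (key : ∀ c0 η0, Env TA TB T c0 η0 X0 Y (zm c0 η0 X0 (chA X0, U0) Y []) →
      Derivable T (.term (zm c0 η0 X0 (chA X0, U0) Y [])
        (tenB c0 η0 v (.var (chA X0)) U0) (tso c0 η0 (.var (chA X0)) U0 V (tb c0 η0 v))))
    (hθ : Mor TA X X0 θ)
    (L : ∀ p ∈ X0, G TA TB T (.term X (θ p.1) (p.2.subst θ)) (.term Y v V)) :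
    G TA TB T (.sort X (U0.subst θ)) (.term Y v V) := by
  intro c η Γ E u hu
  obtain ⟨c0, η0, E0⟩ := source_nil C.ih C.freshA hU0 C.ctx
  obtain ⟨Θ, t⟩ := C.trans E E0 hU0 hθ hu
  have k := key c0 η0 E0
  exact (t.ten C.ih ⟨_, k⟩ (hU0.sort_args C.ih.hA) C.wt).conv C.ih.hP
    (Derivable.sub C.ih.hP k t.mor) (t.tso C.ih ((Derivable.hered C.ih.hP).term k)
      (hU0.sort_args C.ih.hA) (C.ih.her.wt_sort C.sort) fun x hx _ => C.tb_subst E E0 t K L x hx)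

theorem Row.sortEq_inst (C : Row TA TB T D chA Y v V)
    {U0 U0' : SortE A} (hU0 : Derivable TA (.sortEq X0 U0 U0'))
    (key : ∀ c0 η0, Env TA TB T c0 η0 X0 Y (zm c0 η0 X0 (chA X0, U0) Y []) →
      EqT T (zm c0 η0 X0 (chA X0, U0) Y [])
        (tenB c0 η0 v (.var (chA X0)) U0) (tenB c0 η0 v (.var (chA X0)) U0'))
    (hθ : Mor TA X X0 θ) :
    G TA TB T (.sortEq X (U0.subst θ) (U0'.subst θ)) (.term Y v V) := by
  intro c η Γ E u hu
  obtain ⟨h1, h2⟩ := (Derivable.hered C.ih.hA).sortEq hU0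
  obtain ⟨c0, η0, E0⟩ := source_nil C.ih C.freshA h1 C.ctx
  obtain ⟨Θ, t⟩ := C.trans E E0 h1 hθ hu
  have k := key c0 η0 E0
  obtain ⟨k1, k2⟩ := k.hasT C.ih.hP
  exact ((t.ten C.ih k1 (h1.sort_args C.ih.hA) C.wt).symm C.ih.hP).trans C.ih.hP
    ((k.subst C.ih.hP t.mor).trans C.ih.hP (t.ten C.ih k2 (h2.sort_args C.ih.hA) C.wt))

theorem Row.term_inst (C : Row TA TB T D chA Y v V)
    {u0 : Expr A} {U0 : SortE A} (hu0 : Derivable TA (.term X0 u0 U0))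
    (K : ∀ X1 p', X1 ++ [p'] <+: X0 → G TA TB T (.sort X1 p'.2) (.term Y v V))
    (key : ∀ c0 η0, Env TA TB T c0 η0 X0 Y (zm c0 η0 X0 (chA X0, U0) Y []) →
      EqT T (zm c0 η0 X0 (chA X0, U0) Y []) (tenB c0 η0 v u0 U0) (vty c0 η0 V (tb c0 η0 v) u0))
    (hθ : Mor TA X X0 θ)
    (L : ∀ p ∈ X0, G TA TB T (.term X (θ p.1) (p.2.subst θ)) (.term Y v V)) :
    G TA TB T (.term X (u0.subst θ) (U0.subst θ)) (.term Y v V) := by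
  intro c η Γ E
  have hU0 := (Derivable.hered C.ih.hA).term hu0
  have hu : Derivable TA (.term X (u0.subst θ) (U0.subst θ)) := Derivable.sub C.ih.hA hu0 hθ
  obtain ⟨c0, η0, E0⟩ := source_nil C.ih C.freshA hU0 C.ctx
  obtain ⟨Θ, t⟩ := C.trans E E0 hU0 hθ (E.act C.ih C.ctx hu)
  have k := key c0 η0 E0
  obtain ⟨k1, k2⟩ := k.hasT C.ih.hP
  exact ((t.ten_term C.ih C.ctx k1 ⟨_, hu0⟩ (hU0.sort_args C.ih.hA) C.wt).symm C.ih.hP).trans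
    C.ih.hP ((k.subst C.ih.hP t.mor).trans C.ih.hP
      (t.vty C.ih k2 ⟨_, hu0⟩ (C.ih.her.wt_sort C.sort) fun x hx _ => C.tb_subst E E0 t K L x hx))

theorem good_term_axiom (I : IH TA TB T D) (hT : TAx TA TB T chA chB) (fA : FreshCh chA)
    {t' : B.TermSym} (hax' : introTerm Y t' V ∈ TB) (hV : D (.sort Y V))
    (hv : ∀ q ∈ Y, D (.term Y (.var q.1) q.2)) {J : Judg A} (hJ : Derivable TA J) :
    G TA TB T J (.term Y (.app t' (ctxVars Y)) V) := by
  have hA := I.hA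
  have hP := I.hP
  have hY := I.her.ctx hV
  have C : Row TA TB T D chA Y (.app t' (ctxVars Y)) V := by
    refine ⟨I, fA, hV, .app (fun τ hτ => ?_) fun τ hτ => ?_⟩
    all_goals obtain ⟨q, hq, rfl⟩ := List.mem_map.1 hτ
    exacts [I.wt_var hY hq, ⟨Y, q.2, List.prefix_refl _, hv q hq⟩]
  refine G.induct hA (fun DA H hd ih J hs => ?_) hJ
  have K : ∀ {X0}, DA (.ctx X0) → ∀ X1 p', X1 ++ [p'] <+: X0 →
      G TA TB T (.sort X1 p'.2) (.term Y (.app t' (ctxVars Y)) V) := fun h X1 p' hp =>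
    ih _ (H.prefix_sort h hp)
  have Lv : ∀ {X0}, DA (.ctx X0) → ∀ p ∈ X0,
      G TA TB T (.term X0 (Expr.var p.1) p.2) (.term Y (.app t' (ctxVars Y)) V) := by
    intro X0 h p hp c η Γ E
    have := E.actB_of hA I.hB hP (K h) p hp
    show EqT T Γ (tenB c η _ _ _) (vty c η _ _ _)
    rw [vty_var]
    rw [tb, E.cok.var p hp] at this ⊢
    exact HasT.refl hP ⟨_, this⟩
  have L : ∀ {X0}, DA (.ctx X0) → ∀ p ∈ X0,
      G TA TB T (.term X0 (Expr.var p.1) (p.2.subst Expr.var))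
        (.term Y (.app t' (ctxVars Y)) V) := by
    intro X0 h p hp
    rw [SortE.subst_id]
    exact Lv h p hp
  have M : ∀ {X X0 σ}, DA (.ctx X) → (∀ p ∈ X0, DA (.term X (σ p.1) (p.2.subst σ))) →
      Mor TA X X0 σ := fun h h' => ⟨hd _ h, fun p hp => hd _ (h' p hp)⟩
  cases hs with
  | ctx_nil | ctx_cons | t1 | t2 | t3 | seqteq | teqA | teqSub1 | teqSub2 =>
    exact fun _ _ _ _ => trivial
  | s1 h => exact fun c η Γ E u hu => HasT.refl hP ⟨_, ih _ h c η Γ E u hu⟩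
  | s2 h =>
    exact fun c η Γ E u hu =>
      (ih _ h c η Γ E u (E.act_conv I hY ((hd _ h).symm hA) hu)).symm hP
  | s3 h1 h2 =>
    exact fun c η Γ E u hu => (ih _ h1 c η Γ E u hu).trans hP
      (ih _ h2 c η Γ E u (E.act_conv I hY (hd _ h1) hu))
  | seqt h1 h2 =>
    exact fun c η Γ E => ((ih _ h1 c η Γ E _ (E.act I hY (hd _ h2))).symm hP).trans hP
      (ih _ h2 c η Γ E)
  | @var X p hp h => exact Lv (H.ctx h) p hp
  | @sA X S hax h hv' =>
    have hs : Derivable TA (.sort X ⟨S, ctxVars X⟩) := .ax_sort hA hax (hd _ h)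
    have := C.sort_inst hs (K h) (fun c0 η0 E0 =>
      .ax_term hP (hT.st (sort_mem hax) (term_mem hax') E0.cok E0.eok)
        (I.good hV hs c0 η0 _ E0 _ _ (E0.zm_act hP) (E0.actB_of hA I.hB hP (K h))))
      (Mor.id hA (hd _ h)) (L h)
    rwa [SortE.subst_id] at this
  | @sSub X0 S hax X σ hJ hX hσ =>
    have := C.sort_inst (hd _ hJ) (K (H.ctx hJ)) (fun c0 η0 E0 =>
      ih _ hJ c0 η0 _ E0 _ (E0.zm_act hP))
      (M hX hσ) (fun p hp => ih _ (hσ p hp))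
    rwa [sort_ctxVars_subst] at this
  | @seqA X U U' hax h1 h2 =>
    have hs : Derivable TA (.sortEq X U U') := .step (.seqA hax (hd _ h1) (hd _ h2))
    have hc : DA (.ctx X) := H.ctx h1
    have := C.sortEq_inst (θ := Expr.var) hs (fun c0 η0 E0 => by
      have a2 := E0.act_conv I hY hs (E0.zm_act hP)
      have k1 := ih _ h1 c0 η0 _ E0 _ (E0.zm_act hP)
      have k2 := ih _ h2 c0 η0 _ E0 _ a2
      exact Derivable.ax_termEq (hT.seqt hax (term_mem hax') E0.cok E0.eok) k1 (k2.conv hP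
        ((I.good hV hs c0 η0 _ E0 _ _ (E0.zm_act hP) (E0.actB_of hA I.hB hP (K hc))).symm hP)))
      (Mor.id hA (hd _ hc))
    rwa [SortE.subst_id, SortE.subst_id] at this
  | @seqSub1 X0 U U' hax X σ hJ h1 h2 hσ =>
    exact C.sortEq_inst (hd _ hJ) (fun c0 η0 E0 => ih _ hJ c0 η0 _ E0 _ (E0.zm_act hP))
      (M (H.ctx h1) hσ)
  | @seqSub2 X0 S hax X σ τ hJ h1 h2 hστ =>
    intro c η Γ E u hu
    have hs := ih _ h1 c η Γ E u hu
    show EqT T Γ (tenB c η (.app t' _) _ _) (tenB c η (.app t' _) _ _)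
    rw [tenB_app] at hs ⊢
    rw [tenB_app]
    refine EqT.app hP ⟨_, hs⟩ (forall₂_append' ?_ ?_)
    · simp only [List.flatMap_map]
      refine forall₂_flatMap_same fun p hp => forall₂_map_same fun e he => ?_
      obtain ⟨q, hq, rfl⟩ := List.mem_map.1 he
      rw [tenB_var, tenB_var]
      exact E.eta_congr I hY (hd _ (hστ p hp)) hq
    · refine forall₂_map_same fun e he => ?_
      obtain ⟨q, hq, rfl⟩ := List.mem_map.1 he
      rw [tenB_var, tenB_var]
      exact HasT.refl hP ⟨_, hu q hq⟩
  | @tA X t U hax h hv' =>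
    have hu : Derivable TA (.term X (.app t (ctxVars X)) U) := .ax_term hA hax (hd _ h)
    have := C.term_inst hu (K (H.ctx h)) (fun c0 η0 E0 => by
      have E1 := E0.tc_env hP
      rw [List.append_nil] at E1
      refine (Derivable.ax_termEq (hT.tt (term_mem hax) (term_mem hax') E0.cok E0.eok)
        (ih _ h c0 η0 _ E1 _ (E1.act I hY hu))
        (I.good hV hu c0 η0 _ E1 _ (E1.actB_of hA I.hB hP (K (H.ctx h))))).weak hP
          E0.ctx ?_
      rw [zm_nil]
      exact tc_subset (List.subset_append_left _ _) (List.Subset.refl _))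
      (Mor.id hA (hd _ (H.ctx h))) (L (H.ctx h))
    rwa [SortE.subst_id, Expr.subst_id] at this
  | @tSub X0 t U hax X σ hJ hU hσ =>
    have := C.term_inst (hd _ hJ) (K (H.ctx hJ)) (fun c0 η0 E0 => ih _ hJ c0 η0 _ E0)
      (M (H.ctx hU) hσ) (fun p hp => ih _ (hσ p hp))
    rwa [app_ctxVars_subst] at this

theorem good_termEq_axiom (I : IH TA TB T D) (hT : TAx TA TB T chA chB) (fA : FreshCh chA)
    {v v' : Expr B} (hax' : .termEq Y v v' V ∈ TB) (h : D (.term Y v V)) (h' : D (.term Y v' V))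
    {J : Judg A} (hJ : Derivable TA J) : G TA TB T J (.termEq Y v v' V) := by
  have hA := I.hA
  have hP := I.hP
  have hV := I.her.term h
  have C : Row TA TB T D chA Y v V := ⟨I, fA, hV, (I.her.wt_term h).1⟩
  have C' : Row TA TB T D chA Y v' V := ⟨I, fA, hV, (I.her.wt_term h').1⟩
  have inst : ∀ {X X0 U0 θ}, Derivable TA (.sort X0 U0) →
      (∀ c0 η0, Env TA TB T c0 η0 X0 Y (zm c0 η0 X0 (chA X0, U0) Y []) →
        EqT T (zm c0 η0 X0 (chA X0, U0) Y [])
          (tenB c0 η0 v (.var (chA X0)) U0) (tenB c0 η0 v' (.var (chA X0)) U0)) →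
      Mor TA X X0 θ → G TA TB T (.sort X (U0.subst θ)) (.termEq Y v v' V) := by
    intro X X0 U0 θ hU0 key hθ c η Γ E u hu
    obtain ⟨c0, η0, E0⟩ := source_nil I fA hU0 C.ctx
    obtain ⟨Θ, t⟩ := C.trans E E0 hU0 hθ hu
    have k := key c0 η0 E0
    obtain ⟨k1, k2⟩ := k.hasT hP
    exact ((t.ten I k1 (hU0.sort_args hA) C.wt).symm hP).trans hP
      ((k.subst hP t.mor).trans hP (t.ten I k2 (hU0.sort_args hA) C'.wt))
  refine G.induct hA (fun DA H hd ih J hs => ?_) hJ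
  cases hs with
  | ctx_nil | ctx_cons | s1 | s2 | s3 | t1 | t2 | t3 | seqt | seqteq | var | tA | seqA | teqA
  | tSub | seqSub1 | seqSub2 | teqSub1 | teqSub2 =>
    exact fun _ _ _ _ => trivial
  | @sA X S hax hX hv' =>
    have hs : Derivable TA (.sort X ⟨S, ctxVars X⟩) := .ax_sort hA hax (hd _ hX)
    have := inst hs (fun c0 η0 E0 => by
      have k1 := I.good h hs c0 η0 _ E0 _ (E0.zm_act hP)
      have k2 := I.good h' hs c0 η0 _ E0 _ (E0.zm_act hP)
      refine Derivable.ax_termEq (hT.steq (sort_mem hax) hax' E0.cok E0.eok) k1 (k2.conv hP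
        (((Derivable.hered hP).term k1).sort_congr hP
          (forall₂_append' ?_ ?_) |>.symm hP))
      · refine forall₂_flatMap_same fun e he => forall₂_append' ?_ ?_
        · rw [List.forall₂_same]
          intro e' he'
          exact (((Derivable.hered hP).term k1).sort_args hP e' (List.mem_append_left _
            (List.mem_flatMap.2 ⟨e, he, List.mem_append_left _ he'⟩))).refl hP
        · obtain ⟨p, hp, rfl⟩ := List.mem_map.1 he
          refine .cons ?_ .nil
          rw [vty_var, vty_var]
          obtain ⟨X1, hX1, hp1⟩ := H.entry hX hp
          rw [tb, tb, E0.cok.var p hp]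
          have E1 := E0.prefix hA I.hB ((List.prefix_append _ _).trans hX1) (List.prefix_refl _)
          exact ih _ hp1 c0 η0 _ E1 _ (E0.act_var hP hp)
      · rw [List.forall₂_same]
        intro e' he'
        exact (((Derivable.hered hP).term k1).sort_args hP e' (List.mem_append_right _ he')).refl
          hP)
      (Mor.id hA (hd _ hX))
    rwa [SortE.subst_id] at this
  | @sSub X0 S hax X σ hJ hX hσ =>
    have := inst (hd _ hJ) (fun c0 η0 E0 => ih _ hJ c0 η0 _ E0 _ (E0.zm_act hP))
      ⟨hd _ hX, fun p hp => hd _ (hσ p hp)⟩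
    rwa [sort_ctxVars_subst] at this

end Row

section

variable {TA : Set (Judg A)} {TB : Set (Judg B)} {T : Set (Judg (A.tensor B))}
  {D : Judg B → Prop} {c c0 : Expr A → SortE A} {η η0 : B.Var → Expr A → Expr (A.tensor B)}
  {X X0 : PreCtx A} {Y Y0 : PreCtx B} {Γ : PreCtx (A.tensor B)}
  {chA : PreCtx A → A.Var} {chB : PreCtx B → B.Var}
  {v v' : Expr B} {V V' : SortE B} {φ : B.Var → Expr B}

theorem Env.actB_conv_of (hA : IsPretheory TA) (hB : IsPretheory TB) (hP : IsPretheory T)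
    (E : Env TA TB T c η X Y Γ)
    (K : ∀ X1 p, X1 ++ [p] <+: X → G TA TB T (.sort X1 p.2) (.sortEq Y V V'))
    {b : A.Var → Expr (A.tensor B)} (hb : ActB T c η Γ b V X) : ActB T c η Γ b V' X := by
  intro p hp
  obtain ⟨X1, hpre, hs⟩ := (Derivable.hered hA).entry E.ctxA hp
  have h1 : X1 <+: X := (List.prefix_append _ _).trans hpre
  exact (hb p hp).conv hP (K X1 p hpre c η Γ (E.prefix hA hB h1 (List.prefix_refl _))
    _ b (E.act_var hP hp) (hb.mono h1.subset))

theorem good_sortEq_axiom (I : IH TA TB T D) (hT : TAx TA TB T chA chB) (fA : FreshCh chA)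
    (fB : FreshCh chB) (hax' : .sortEq Y V V' ∈ TB) (h : D (.sort Y V)) (h' : D (.sort Y V'))
    {J : Judg A} (hJ : Derivable TA J) : G TA TB T J (.sortEq Y V V') := by
  have hA := I.hA
  have hB := I.hB
  have hP := I.hP
  have hY : D (.ctx Y) := I.her.ctx h
  have C : Col TA TB T D chA chB Y V := ⟨I, fA, fB, hY, I.der h, I.her.wt_sort h⟩
  have source : ∀ {X U}, Derivable TA (.sort X U) →
      ∃ c : Expr A → SortE A, ∃ η : B.Var → Expr A → Expr (A.tensor B),
      Env TA TB T c η X Y (zm c η X (chA X, U) Y [(chB Y, V)]) := fun hU =>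
    source_col I fA fB hU hY C.sort fun X1 p hp =>
      I.good h ((Derivable.hered hA).prefix_sort ((Derivable.hered hA).ctx hU) hp)
  have colb : ∀ {c c0 η η0 X X0 U0 Γ θ u b Θ}, Env TA TB T c η X Y Γ →
      TrA TA T D c0 c η0 η X0 (chA X0, U0) Y [(chB Y, V)] Γ θ u V b Θ → ActB T c η Γ b V X →
      (∀ p ∈ X0, G TA TB T (.term X (θ p.1) (p.2.subst θ)) (.sortEq Y V V')) →
      ∀ x, HasT TA X0 (.var x) →
      EqT T Γ ((vr (chB Y) x : Expr (A.tensor B)).subst Θ) (vty c η V' b (θ x)) := by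
    intro c c0 η η0 X X0 U0 Γ θ u b Θ E t hb L x hx
    obtain ⟨p, hp, rfl⟩ := hx.mem_ctx hA
    rw [t.col_subst (List.mem_singleton_self _)]
    exact L p hp c η Γ E b hb
  have inst_sort : ∀ {X X0 U0 θ}, Derivable TA (.sort X0 U0) →
      (∀ c0 η0, Env TA TB T c0 η0 X0 Y (zm c0 η0 X0 (chA X0, U0) Y [(chB Y, V)]) →
        Derivable T (.sortEq (zm c0 η0 X0 (chA X0, U0) Y [(chB Y, V)])
        (tso c0 η0 (.var (chA X0)) U0 V (vr (chB Y)))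
        (tso c0 η0 (.var (chA X0)) U0 V' (vr (chB Y))))) →
      Mor TA X X0 θ →
      (∀ p ∈ X0, G TA TB T (.term X (θ p.1) (p.2.subst θ)) (.sortEq Y V V')) →
      G TA TB T (.sort X (U0.subst θ)) (.sortEq Y V V') := by
    intro X X0 U0 θ hU0 key hθ L c η Γ E u b hu hb
    obtain ⟨c0, η0, E0⟩ := source hU0
    obtain ⟨Θ, t⟩ := C.trans E E0 hU0 hθ hu hb fun p hp => I.good h (hθ.2 p hp)
    have k := key c0 η0 E0
    obtain ⟨k1, k2⟩ := (Derivable.hered hP).sortEq k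
    have e2 := t.tso I (b' := b) k2 (hU0.sort_args hA) (I.her.wt_sort h')
      fun x hx _ => colb E t hb L x hx
    exact ((t.tso_col C k1 hU0).symm hP).trans_sort ((Derivable.sub hP k t.mor).trans_sort e2)
  have inst_term : ∀ {X X0 u0 U0 θ}, Derivable TA (.term X0 u0 U0) →
      (∀ c0 η0, Env TA TB T c0 η0 X0 Y (zm c0 η0 X0 (chA X0, U0) Y [(chB Y, V)]) →
        EqT T (zm c0 η0 X0 (chA X0, U0) Y [(chB Y, V)])
          (vty c0 η0 V (vr (chB Y)) u0) (vty c0 η0 V' (vr (chB Y)) u0)) →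
      Mor TA X X0 θ →
      (∀ p ∈ X0, G TA TB T (.term X (θ p.1) (p.2.subst θ)) (.sortEq Y V V')) →
      G TA TB T (.term X (u0.subst θ) (U0.subst θ)) (.sortEq Y V V') := by
    intro X X0 u0 U0 θ hu0 key hθ L c η Γ E b hb
    have hU0 := (Derivable.hered hA).term hu0
    have hu : Derivable TA (.term X (u0.subst θ) (U0.subst θ)) := Derivable.sub hA hu0 hθ
    obtain ⟨c0, η0, E0⟩ := source hU0
    obtain ⟨Θ, t⟩ := C.trans E E0 hU0 hθ (E.act I hY hu) hb fun p hp => I.good h (hθ.2 p hp)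
    have k := key c0 η0 E0
    obtain ⟨k1, k2⟩ := k.hasT hP
    exact ((t.vty_col C k1 ⟨_, hu0⟩).symm hP).trans hP ((k.subst hP t.mor).trans hP
      (t.vty I k2 ⟨_, hu0⟩ (I.her.wt_sort h') fun x hx _ => colb E t hb L x hx))
  refine G.induct hA (fun DA H hd ih J hs => ?_) hJ
  have K : ∀ {X0}, DA (.ctx X0) → ∀ X1 p', X1 ++ [p'] <+: X0 →
      G TA TB T (.sort X1 p'.2) (.sortEq Y V V') := fun h X1 p' hp =>
    ih _ (H.prefix_sort h hp)
  have Lv : ∀ {X0}, ∀ p ∈ X0,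
      G TA TB T (.term X0 (Expr.var p.1) p.2) (.sortEq Y V V') := by
    intro X0 p hp c η Γ E b hb
    show EqT T Γ (vty c η _ _ (.var p.1)) (vty c η _ _ (.var p.1))
    rw [vty_var, vty_var]
    exact HasT.refl hP ⟨_, hb p hp⟩
  have L : ∀ {X0}, ∀ p ∈ X0,
      G TA TB T (.term X0 (Expr.var p.1) (p.2.subst Expr.var)) (.sortEq Y V V') := by
    intro X0 p hp
    rw [SortE.subst_id]
    exact Lv p hp
  cases hs with
  | ctx_nil | ctx_cons | s1 | s2 | s3 | t1 | t2 | t3 | seqteq | seqA | teqA | seqSub1 | seqSub2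
  | teqSub1 | teqSub2 => exact fun _ _ _ _ => trivial
  | seqt h1 h2 => exact fun c η Γ E b hb => ih _ h2 c η Γ E b hb
  | @var X p hp hs => exact Lv p hp
  | @sA X S hax hX hv' =>
    have hs : Derivable TA (.sort X ⟨S, ctxVars X⟩) := .ax_sort hA hax (hd _ hX)
    have := inst_sort hs (fun c0 η0 E0 => .step (.seqA (hT.sseq (sort_mem hax) hax' E0.cok E0.eok)
      (I.good h hs c0 η0 _ E0 _ _ (E0.zm_act hP) (E0.zm_actB hP))
      (I.good h' hs c0 η0 _ E0 _ _ (E0.zm_act hP)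
        (E0.actB_conv_of hA hB hP (K hX) (E0.zm_actB hP)))))
      (Mor.id hA (hd _ hX)) L
    rwa [SortE.subst_id] at this
  | @sSub X0 S hax X σ hJ hX hσ =>
    have := inst_sort (hd _ hJ) (fun c0 η0 E0 =>
      ih _ hJ c0 η0 _ E0 _ _ (E0.zm_act hP) (E0.zm_actB hP))
      ⟨hd _ hX, fun p hp => hd _ (hσ p hp)⟩ (fun p hp => ih _ (hσ p hp))
    rwa [sort_ctxVars_subst] at this
  | @tA X t U hax hU hv' =>
    have hX : DA (.ctx X) := H.ctx hU
    have hu : Derivable TA (.term X (.app t (ctxVars X)) U) := .ax_term hA hax (hd _ hU)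
    have := inst_term hu (fun c0 η0 E0 => by
      have E1 := E0.tc_env hP
      have hb := E1.tc_actB hP
      exact (Derivable.ax_termEq (hT.tseq (term_mem hax) hax' E0.cok E0.eok)
        (I.good h hu c0 η0 _ E1 _ hb)
        ((I.good h' hu c0 η0 _ E1 _ (E1.actB_conv_of hA hB hP (K hX) hb)).conv hP
          ((ih _ hU c0 η0 _ E1 _ _ (E1.act I hY hu) hb).symm hP))).weak hP E0.ctx
          (List.subset_append_left _ _))
      (Mor.id hA (hd _ hX)) L
    rwa [SortE.subst_id, Expr.subst_id] at this
  | @tSub X0 t U hax X σ hJ hU hσ =>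
    have hX : DA (.ctx X) := H.ctx hU
    have := inst_term (hd _ hJ) (fun c0 η0 E0 => ih _ hJ c0 η0 _ E0 _ (E0.zm_actB hP))
      ⟨hd _ hX, fun p hp => hd _ (hσ p hp)⟩ (fun p hp => ih _ (hσ p hp))
    rwa [app_ctxVars_subst] at this

/-! ## Substitution instances of judgments of the second theory -/

/-- A substitution in `B`. -/
structure Inst (TA : Set (Judg A)) (TB : Set (Judg B)) (T : Set (Judg (A.tensor B)))
    (D : Judg B → Prop) (chA : PreCtx A → A.Var) (chB : PreCtx B → B.Var) (Y Y0 : PreCtx B)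
    (φ : B.Var → Expr B) : Prop where
  ih : IH TA TB T D
  freshA : FreshCh chA
  freshB : FreshCh chB
  ctx : D (.ctx Y)
  ctx0 : D (.ctx Y0)
  sub : ∀ q ∈ Y0, D (.term Y (φ q.1) (q.2.subst φ))

variable {U U' : SortE A} {u : Expr A} {b : A.Var → Expr (A.tensor B)}

theorem TrB.top_refl {ηa : B.Var → Expr A → Expr (A.tensor B)} {p0 : A.Var × SortE A}
    {Qs : PreCtx B} {Φ : (A.tensor B).Var → Expr (A.tensor B)} (hP : IsPretheory T)
    (t : TrB TA T c ηa η X p0 Y0 Qs Γ φ u b Φ) : ∀ q ∈ Y0,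
    HasT T Γ ((ηa q.1 (.var p0.1)).subst Φ) →
      EqT T Γ ((ηa q.1 (.var p0.1)).subst Φ) (tenB c η (φ q.1) u p0.2) := by
  intro q hq h
  rw [t.top_subst q hq] at h ⊢
  exact h.refl hP

theorem TrB.col_refl {ηa : B.Var → Expr A → Expr (A.tensor B)} {p0 : A.Var × SortE A}
    {Φ : (A.tensor B).Var → Expr (A.tensor B)} {q : B.Var × SortE B} (hP : IsPretheory T)
    (t : TrB TA T c ηa η X p0 Y0 [q] Γ φ u b Φ) : ∀ x, HasT TA X (.var x) →
    HasT T Γ ((vr q.1 x : Expr (A.tensor B)).subst Φ) →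
      EqT T Γ ((vr q.1 x : Expr (A.tensor B)).subst Φ) (b x) := by
  intro x _ h
  rw [t.col_subst (List.mem_singleton_self _)] at h ⊢
  exact h.refl hP

theorem Inst.trans_col (C : Inst TA TB T D chA chB Y Y0 φ) (E : Env TA TB T c η X Y Γ)
    (hU : Derivable TA (.sort X U)) (hV : D (.sort Y0 V)) (hu : Act T c η Γ u U Y)
    (hb : ActB T c η Γ b (V.subst φ) X) :
    ∃ ηa Φ, Env TA TB T c ηa X Y0 (zm c ηa X (chA X, U) Y0 [(chB Y0, V)]) ∧
      TrB TA T c ηa η X (chA X, U) Y0 [(chB Y0, V)] Γ φ u b Φ := by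
  have I := C.ih
  obtain ⟨ηa, hη⟩ := exists_eok I.hB c (I.der C.ctx0)
  have E0 : Env TA TB T c ηa X Y0 (zm c ηa X (chA X, U) Y0 [(chB Y0, V)]) :=
    zm_ctx_singleton I hU (C.freshA X) E.cok hη C.ctx0 (C.freshB Y0) (I.der hV)
      fun X1 p hp => I.good hV ((Derivable.hered I.hA).prefix_sort E.ctxA hp)
  obtain ⟨Φ, t⟩ := E.transB I C.ctx0 E0 (C.freshA X) hU C.sub hu (Qs := [(chB Y0, V)]) (b := b)
    fun q0 hq0 => by
      obtain rfl := List.mem_singleton.1 hq0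
      exact ⟨C.freshB Y0, fun τ hτ => (I.her.wt_sort hV τ hτ).1, hb⟩
  exact ⟨ηa, Φ, E0, t⟩

theorem Inst.trans_nil (C : Inst TA TB T D chA chB Y Y0 φ) (E : Env TA TB T c η X Y Γ)
    (hU : Derivable TA (.sort X U)) (hu : Act T c η Γ u U Y) :
    ∃ ηa Φ, Env TA TB T c ηa X Y0 (zm c ηa X (chA X, U) Y0 []) ∧
      TrB TA T c ηa η X (chA X, U) Y0 [] Γ φ u b Φ := by
  have I := C.ih
  obtain ⟨ηa, hη⟩ := exists_eok I.hB c (I.der C.ctx0)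
  have E0 : Env TA TB T c ηa X Y0 (zm c ηa X (chA X, U) Y0 []) :=
    zm_ctx_nil I hU (C.freshA X) E.cok hη C.ctx0
  obtain ⟨Φ, t⟩ := E.transB I C.ctx0 E0 (C.freshA X) hU C.sub hu (Qs := []) (b := b)
    (by simp)
  exact ⟨ηa, Φ, E0, t⟩

theorem Inst.wt (C : Inst TA TB T D chA chB Y Y0 φ) (hV : D (.sort Y0 V)) :
    ∀ τ ∈ V.args, WT (QD D Y0) Y0 τ := fun τ hτ => (C.ih.her.wt_sort hV τ hτ).1

theorem Inst.good_sort (C : Inst TA TB T D chA chB Y Y0 φ) (hV : D (.sort Y0 V)) {J : Judg A}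
    (hJ : Derivable TA J) : G TA TB T J (.sort Y (V.subst φ)) := by
  have I := C.ih
  have hA := I.hA
  have hP := I.hP
  cases J with
  | ctx => exact fun _ _ _ _ => trivial
  | sort X U =>
    intro c η Γ E u b hu hb
    obtain ⟨ηa, Φ, E0, t⟩ := C.trans_col E hJ hV hu hb
    exact Derivable.sort_right hP (t.tso I (I.good hV hJ c ηa _ E0 _ _ (E0.zm_act hP)
      (E0.zm_actB hP)) (hJ.sort_args hA) (C.wt hV) (t.top_refl hP) (t.col_refl hP))
  | term X u U =>
    intro c η Γ E b hb
    have hU := (Derivable.hered hA).term hJ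
    obtain ⟨ηa, Φ, E0, t⟩ := C.trans_col E hU hV (E.act I C.ctx hJ) hb
    have k := I.good hV hJ c ηa _ E0 _ (E0.zm_actB hP)
    exact (t.vty I ⟨_, k⟩ ⟨_, hJ⟩ (C.wt hV) (t.col_refl hP)).conv hP (Derivable.sub hP k t.mor)
      (t.tso I ((Derivable.hered hP).term k) (hU.sort_args hA) (C.wt hV)
        (fun q hq h => t.act I E C.ctx0 C.sub hJ hq h) (t.col_refl hP))
  | sortEq X U U' =>
    intro c η Γ E u b hu hb
    obtain ⟨hU, hU'⟩ := (Derivable.hered hA).sortEq hJ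
    obtain ⟨ηa, Φ, E0, t⟩ := C.trans_col E hU hV hu hb
    have k := I.good hV hJ c ηa _ E0 _ _ (E0.zm_act hP) (E0.zm_actB hP)
    obtain ⟨k1, k2⟩ := (Derivable.hered hP).sortEq k
    refine ((t.tso I k1 (hU.sort_args hA) (C.wt hV) (t.top_refl hP)
      (t.col_refl hP)).symm hP).trans_sort ((Derivable.sub hP k t.mor).trans_sort
      (t.tso I k2 (hU'.sort_args hA) (C.wt hV) (fun q hq h => ?_) (t.col_refl hP)))
    exact (t.top_refl hP q hq h).trans hP (I.good (C.sub q hq) hJ c η Γ E u hu)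
  | termEq X u u' U =>
    intro c η Γ E b hb
    obtain ⟨hu, hu'⟩ := (Derivable.hered hA).termEq hJ
    obtain ⟨ηa, Φ, E0, t⟩ := C.trans_col E ((Derivable.hered hA).term hu) hV
      (E.act I C.ctx hu) hb
    have k := I.good hV hJ c ηa _ E0 _ (E0.zm_actB hP)
    obtain ⟨k1, k2⟩ := k.hasT hP
    exact ((t.vty I k1 ⟨_, hu⟩ (C.wt hV) (t.col_refl hP)).symm hP).trans hP
      ((k.subst hP t.mor).trans hP (t.vty I k2 ⟨_, hu'⟩ (C.wt hV) (t.col_refl hP)))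

theorem Inst.good_sortEq (C : Inst TA TB T D chA chB Y Y0 φ) (hV : D (.sortEq Y0 V V'))
    {J : Judg A} (hJ : Derivable TA J) : G TA TB T J (.sortEq Y (V.subst φ) (V'.subst φ)) := by
  have I := C.ih
  have hA := I.hA
  have hP := I.hP
  obtain ⟨hV1, hV2⟩ := I.her.sortEq hV
  cases J with
  | ctx | sortEq | termEq => exact fun _ _ _ _ => trivial
  | sort X U =>
    intro c η Γ E u b hu hb
    obtain ⟨ηa, Φ, E0, t⟩ := C.trans_col E hJ hV1 hu hb
    have k := I.good hV hJ c ηa _ E0 _ _ (E0.zm_act hP) (E0.zm_actB hP)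
    obtain ⟨k1, k2⟩ := (Derivable.hered hP).sortEq k
    exact ((t.tso I k1 (hJ.sort_args hA) (C.wt hV1) (t.top_refl hP)
      (t.col_refl hP)).symm hP).trans_sort ((Derivable.sub hP k t.mor).trans_sort
      (t.tso I k2 (hJ.sort_args hA) (C.wt hV2) (t.top_refl hP) (t.col_refl hP)))
  | term X u U =>
    intro c η Γ E b hb
    obtain ⟨ηa, Φ, E0, t⟩ := C.trans_col E ((Derivable.hered hA).term hJ) hV1
      (E.act I C.ctx hJ) hb
    have k := I.good hV hJ c ηa _ E0 _ (E0.zm_actB hP)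
    obtain ⟨k1, k2⟩ := k.hasT hP
    exact ((t.vty I k1 ⟨_, hJ⟩ (C.wt hV1) (t.col_refl hP)).symm hP).trans hP
      ((k.subst hP t.mor).trans hP (t.vty I k2 ⟨_, hJ⟩ (C.wt hV2) (t.col_refl hP)))

theorem Inst.tb_subst (C : Inst TA TB T D chA chB Y Y0 φ) (hv : D (.term Y0 v V))
    {ηa : B.Var → Expr A → Expr (A.tensor B)} {Φ : (A.tensor B).Var → Expr (A.tensor B)}
    (E : Env TA TB T c η X Y Γ) (E0 : Env TA TB T c ηa X Y0 (zm c ηa X (chA X, U) Y0 []))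
    (t : TrB TA T c ηa η X (chA X, U) Y0 [] Γ φ u b Φ) (x : A.Var) (hx : HasT TA X (.var x)) :
    EqT T Γ ((tb c ηa v x).subst Φ) (tb c η (v.subst φ) x) := by
  have I := C.ih
  obtain ⟨p, hp, rfl⟩ := hx.mem_ctx I.hA
  exact t.ten I ⟨_, E0.actB I hv p hp⟩ (E0.cok.args I.hA hx) (I.her.wt_term hv).1
    fun q hq h => t.act I E C.ctx0 C.sub (E.cok.typed I.hA hx) hq h

theorem Inst.good_term (C : Inst TA TB T D chA chB Y Y0 φ) (hv : D (.term Y0 v V)) {J : Judg A}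
    (hJ : Derivable TA J) : G TA TB T J (.term Y (v.subst φ) (V.subst φ)) := by
  have I := C.ih
  have hA := I.hA
  have hP := I.hP
  have hV := I.her.term hv
  have hwt := (I.her.wt_term hv).1
  cases J with
  | ctx | termEq => exact fun _ _ _ _ => trivial
  | sort X U =>
    intro c η Γ E u hu
    obtain ⟨ηa, Φ, E0, t⟩ := C.trans_nil (b := vr (chB Y)) E hJ hu
    have k := I.good hv hJ c ηa _ E0 _ (E0.zm_act hP)
    exact (t.ten I ⟨_, k⟩ (hJ.sort_args hA) hwt (t.top_refl hP)).conv hP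
      (Derivable.sub hP k t.mor) (t.tso I ((Derivable.hered hP).term k) (hJ.sort_args hA)
        (C.wt hV) (t.top_refl hP) fun x hx _ => C.tb_subst hv E E0 t x hx)
  | sortEq X U U' =>
    intro c η Γ E u hu
    obtain ⟨hU, hU'⟩ := (Derivable.hered hA).sortEq hJ
    obtain ⟨ηa, Φ, E0, t⟩ := C.trans_nil (b := vr (chB Y)) E hU hu
    have k := I.good hv hJ c ηa _ E0 _ (E0.zm_act hP)
    obtain ⟨k1, k2⟩ := k.hasT hP
    refine ((t.ten I k1 (hU.sort_args hA) hwt (t.top_refl hP)).symm hP).trans hP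
      ((k.subst hP t.mor).trans hP (t.ten I k2 (hU'.sort_args hA) hwt fun q hq h => ?_))
    exact (t.top_refl hP q hq h).trans hP (I.good (C.sub q hq) hJ c η Γ E u hu)
  | term X u U =>
    intro c η Γ E
    have hU := (Derivable.hered hA).term hJ
    obtain ⟨ηa, Φ, E0, t⟩ := C.trans_nil (b := vr (chB Y)) E hU (E.act I C.ctx hJ)
    have k := I.good hv hJ c ηa _ E0
    obtain ⟨k1, k2⟩ := k.hasT hP
    exact ((t.ten I k1 (hU.sort_args hA) hwt fun q hq h =>
      t.act I E C.ctx0 C.sub hJ hq h).symm hP).trans hP ((k.subst hP t.mor).trans hP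
      (t.vty I k2 ⟨_, hJ⟩ (C.wt hV) fun x hx _ => C.tb_subst hv E E0 t x hx))

theorem Inst.good_termEq (C : Inst TA TB T D chA chB Y Y0 φ) (hv : D (.termEq Y0 v v' V))
    {J : Judg A} (hJ : Derivable TA J) :
    G TA TB T J (.termEq Y (v.subst φ) (v'.subst φ) (V.subst φ)) := by
  have I := C.ih
  have hA := I.hA
  have hP := I.hP
  obtain ⟨hv1, hv2⟩ := I.her.termEq hv
  cases J with
  | ctx | term | sortEq | termEq => exact fun _ _ _ _ => trivial
  | sort X U =>
    intro c η Γ E u hu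
    obtain ⟨ηa, Φ, E0, t⟩ := C.trans_nil (b := vr (chB Y)) E hJ hu
    have k := I.good hv hJ c ηa _ E0 _ (E0.zm_act hP)
    obtain ⟨k1, k2⟩ := k.hasT hP
    exact ((t.ten I k1 (hJ.sort_args hA) (I.her.wt_term hv1).1 (t.top_refl hP)).symm hP).trans hP
      ((k.subst hP t.mor).trans hP
        (t.ten I k2 (hJ.sort_args hA) (I.her.wt_term hv2).1 (t.top_refl hP)))

end

section Main

variable {TA : Set (Judg A)} {TB : Set (Judg B)} {T : Set (Judg (A.tensor B))}
  {D : Judg B → Prop} {c : Expr A → SortE A} {η : B.Var → Expr A → Expr (A.tensor B)}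
  {X : PreCtx A} {Y Y0 : PreCtx B} {Γ : PreCtx (A.tensor B)}
  {chA : PreCtx A → A.Var} {chB : PreCtx B → B.Var}
  {v v' w : Expr B} {V V' V'' : SortE B} {σ τ : B.Var → Expr B} {J : Judg A}

theorem good_var (I : IH TA TB T D) {q : B.Var × SortE B} (hq : q ∈ Y) (hV : D (.sort Y q.2))
    (hJ : Derivable TA J) : G TA TB T J (.term Y (.var q.1) q.2) := by
  have hA := I.hA
  have hP := I.hP
  have htb : ∀ {c : Expr A → SortE A} {η : B.Var → Expr A → Expr (A.tensor B)}, EOK c η Y →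
      tb c η (.var q.1) = vr q.1 := fun hη => by
    funext x
    rw [tb, tenB_var, hη q hq, vty_var]
  cases J with
  | ctx | termEq => exact fun _ _ _ _ => trivial
  | sort X U =>
    intro c η Γ E u hu
    have h := hu q hq
    rw [tenB_var, htb E.eok]
    exact h
  | sortEq X U U' =>
    intro c η Γ E u hu
    show EqT T Γ (tenB c η (.var q.1) u _) (tenB c η (.var q.1) u _)
    rw [tenB_var, tenB_var]
    exact HasT.refl hP ⟨_, hu q hq⟩
  | term X u U =>
    intro c η Γ E
    show EqT T Γ (tenB c η (.var q.1) u _) (vty c η q.2 _ u)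
    rw [tenB_var, htb E.eok, ← E.eok q hq]
    exact HasT.refl hP ⟨_, E.act I (I.her.ctx (J := .sort Y q.2) hV) hJ q hq⟩

theorem good_seqSub2 (I : IH TA TB T D) {S : B.SortSym}
    (h : D (.sort Y ⟨S, Y0.map fun q => σ q.1⟩))
    (hστ : ∀ q ∈ Y0, D (.termEq Y (σ q.1) (τ q.1) (q.2.subst σ))) (hJ : Derivable TA J) :
    G TA TB T J (.sortEq Y ⟨S, Y0.map fun q => σ q.1⟩ ⟨S, Y0.map fun q => τ q.1⟩) := by
  have hA := I.hA
  have hP := I.hP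
  have hY : D (.ctx Y) := I.her.ctx h
  have ten : ∀ {X c η Γ}, Env TA TB T c η X Y Γ → ∀ {s}, HasT TA X s → ∀ q ∈ Y0,
      EqT T Γ (tenB c η (σ q.1) s (c s)) (tenB c η (τ q.1) s (c s)) := fun E s hs q hq =>
    I.good (hστ q hq) (E.cok.sort hA hs) _ _ _ E s (E.act I hY (E.cok.typed hA hs))
  have col : ∀ {X c η Γ}, Env TA TB T c η X Y Γ → ∀ {b},
      ActB T c η Γ b ⟨S, Y0.map fun q => σ q.1⟩ X → ∀ e, HasT TA X e →
      EqT T Γ (vty c η ⟨S, Y0.map fun q => σ q.1⟩ b e)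
        (vty c η ⟨S, Y0.map fun q => τ q.1⟩ b e) := by
    intro X c η Γ E b hb e
    induction e using Expr.induct with
    | hv x =>
      intro he
      obtain ⟨p, hp, rfl⟩ := he.mem_ctx hA
      rw [vty_var, vty_var]
      exact HasT.refl hP ⟨_, hb p hp⟩
    | ha t es ih =>
      intro he
      have k := I.good h (E.cok.typed hA he) c η Γ E b hb
      have ht : HasT T Γ (vty c η ⟨S, Y0.map fun q => σ q.1⟩ b (.app t es)) := ⟨_, k⟩
      rw [vty_app] at ht ⊢
      rw [vty_app]
      refine EqT.app hP ht (forall₂_flatMap_same fun e hes =>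
        forall₂_append' ?_ (.cons (ih e hes (he.args hA e hes)) .nil))
      simp only [List.map_map]
      exact forall₂_map_same fun q hq => ten E (he.args hA e hes) q hq
  cases J with
  | ctx | sortEq | termEq => exact fun _ _ _ _ => trivial
  | sort X U =>
    intro c η Γ E u b hu hb
    have k := I.good h hJ c η Γ E u b hu hb
    refine k.sort_congr hP (forall₂_append' (forall₂_flatMap_same fun s hs =>
      forall₂_append' ?_ (.cons (col E hb s (hJ.sort_args hA s hs)) .nil)) ?_)
    · simp only [List.map_map]
      exact forall₂_map_same fun q hq => ten E (hJ.sort_args hA s hs) q hq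
    · simp only [List.map_map]
      exact forall₂_map_same fun q hq => I.good (hστ q hq) hJ c η Γ E u hu
  | term X u U =>
    intro c η Γ E b hb
    exact col E hb u ⟨_, hJ⟩

theorem good_teqSub2 (I : IH TA TB T D) {t : B.TermSym}
    (h : D (.term Y (.app t (Y0.map fun q => σ q.1)) V))
    (hστ : ∀ q ∈ Y0, D (.termEq Y (σ q.1) (τ q.1) (q.2.subst σ))) (hJ : Derivable TA J) :
    G TA TB T J (.termEq Y (.app t (Y0.map fun q => σ q.1)) (.app t (Y0.map fun q => τ q.1)) V) := by
  have hA := I.hA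
  have hP := I.hP
  have hY : D (.ctx Y) := I.her.ctx h
  cases J with
  | ctx | term | sortEq | termEq => exact fun _ _ _ _ => trivial
  | sort X U =>
    intro c η Γ E u hu
    have ht : HasT T Γ (tenB c η (.app t (Y0.map fun q => σ q.1)) u U) :=
      ⟨_, I.good h hJ c η Γ E u hu⟩
    show EqT T Γ (tenB c η (.app t (Y0.map fun q => σ q.1)) u U)
      (tenB c η (.app t (Y0.map fun q => τ q.1)) u U)
    rw [tenB_app] at ht ⊢
    rw [tenB_app]
    refine EqT.app hP ht (forall₂_append' (forall₂_flatMap_same fun s hs => ?_) ?_)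
    · have hs' := hJ.sort_args hA s hs
      simp only [List.map_map]
      exact forall₂_map_same fun q hq => I.good (hστ q hq) (E.cok.sort hA hs') _ _ _ E s
        (E.act I hY (E.cok.typed hA hs'))
    · simp only [List.map_map]
      exact forall₂_map_same fun q hq => I.good (hστ q hq) hJ c η Γ E u hu

theorem good_s1 (I : IH TA TB T D) (h : D (.sort Y V)) (hJ : Derivable TA J) :
    G TA TB T J (.sortEq Y V V) := by
  cases J with
  | ctx | sortEq | termEq => exact fun _ _ _ _ => trivial
  | sort X U => exact fun c η Γ E u b hu hb => (I.good h hJ c η Γ E u b hu hb).refl_sort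
  | term X u U => exact fun c η Γ E b hb => HasT.refl I.hP ⟨_, I.good h hJ c η Γ E b hb⟩

theorem good_s2 (I : IH TA TB T D) (h : D (.sortEq Y V V')) (hJ : Derivable TA J) :
    G TA TB T J (.sortEq Y V' V) := by
  cases J with
  | ctx | sortEq | termEq => exact fun _ _ _ _ => trivial
  | sort X U =>
    exact fun c η Γ E u b hu hb =>
      (I.good h hJ c η Γ E u b hu (E.actB_conv_symm I h hb)).symm I.hP
  | term X u U =>
    exact fun c η Γ E b hb =>
      (I.good h hJ c η Γ E b (E.actB_conv_symm I h hb)).symm I.hP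

theorem good_s3 (I : IH TA TB T D) (h : D (.sortEq Y V V')) (h' : D (.sortEq Y V' V''))
    (hJ : Derivable TA J) : G TA TB T J (.sortEq Y V V'') := by
  cases J with
  | ctx | sortEq | termEq => exact fun _ _ _ _ => trivial
  | sort X U =>
    exact fun c η Γ E u b hu hb =>
      (I.good h hJ c η Γ E u b hu hb).trans_sort
        (I.good h' hJ c η Γ E u b hu (E.actB_conv I h hb))
  | term X u U =>
    exact fun c η Γ E b hb =>
      (I.good h hJ c η Γ E b hb).trans I.hP
        (I.good h' hJ c η Γ E b (E.actB_conv I h hb))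

theorem good_t1 (I : IH TA TB T D) (h : D (.term Y v V)) (hJ : Derivable TA J) :
    G TA TB T J (.termEq Y v v V) := by
  cases J with
  | ctx | term | sortEq | termEq => exact fun _ _ _ _ => trivial
  | sort X U => exact fun c η Γ E u hu => HasT.refl I.hP ⟨_, I.good h hJ c η Γ E u hu⟩

theorem good_t2 (I : IH TA TB T D) (h : D (.termEq Y v v' V)) (hJ : Derivable TA J) :
    G TA TB T J (.termEq Y v' v V) := by
  cases J with
  | ctx | term | sortEq | termEq => exact fun _ _ _ _ => trivial
  | sort X U => exact fun c η Γ E u hu => (I.good h hJ c η Γ E u hu).symm I.hP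

theorem good_t3 (I : IH TA TB T D) (h : D (.termEq Y v v' V)) (h' : D (.termEq Y v' w V))
    (hJ : Derivable TA J) : G TA TB T J (.termEq Y v w V) := by
  cases J with
  | ctx | term | sortEq | termEq => exact fun _ _ _ _ => trivial
  | sort X U =>
    exact fun c η Γ E u hu =>
      (I.good h hJ c η Γ E u hu).trans I.hP
        (I.good h' hJ c η Γ E u hu)

theorem good_seqteq (I : IH TA TB T D) (h : D (.termEq Y v v' V)) (hJ : Derivable TA J) :
    G TA TB T J (.termEq Y v v' V') := by
  cases J with
  | ctx | term | sortEq | termEq => exact fun _ _ _ _ => trivial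
  | sort X U => exact fun c η Γ E u hu => I.good h hJ c η Γ E u hu

theorem good_seqt (I : IH TA TB T D) (h : D (.sortEq Y V V')) (hv : D (.term Y v V))
    (hJ : Derivable TA J) : G TA TB T J (.term Y v V') := by
  cases J with
  | ctx | termEq => exact fun _ _ _ _ => trivial
  | sort X U =>
    exact fun c η Γ E u hu =>
      (I.good hv hJ c η Γ E u hu).conv I.hP
        (I.good h hJ c η Γ E u _ hu (E.actB I hv))
  | sortEq X U U' => exact fun c η Γ E u hu => I.good hv hJ c η Γ E u hu
  | term X u U =>
    exact fun c η Γ E =>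
      (I.good hv hJ c η Γ E).trans I.hP
        (I.good h hJ c η Γ E _ (E.actB I hv))

theorem good (hA : IsPretheory TA) (hB : IsPretheory TB) (hP : IsPretheory T)
    (hT : TAx TA TB T chA chB) (fA : FreshCh chA) (fB : FreshCh chB) {J' : Judg B}
    (hJ' : Derivable TB J') (hJ : Derivable TA J) : G TA TB T J J' := by
  obtain ⟨n, hn⟩ := hJ'
  induction n generalizing J' J with
  | zero => exact absurd hn (by simp [DerAt])
  | succ n ih =>
    have I : IH TA TB T (DerAt TB n) := ⟨hA, hB, hP, DerAt.hered hB n, fun h => ⟨n, h⟩,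
      fun h _ hJ => ih hJ h⟩
    have inst : ∀ {Y Y0 φ}, DerAt TB n (.ctx Y) → DerAt TB n (.ctx Y0) →
        (∀ q ∈ Y0, DerAt TB n (.term Y (φ q.1) (q.2.subst φ))) →
        Inst TA TB T (DerAt TB n) chA chB Y Y0 φ := fun h1 h2 h3 => ⟨I, fA, fB, h1, h2, h3⟩
    rcases hn with hn | hn
    · exact ih hJ hn
    cases hn.clean hB with
    | ctx_nil | ctx_cons =>
      cases J with
      | _ => exact fun _ _ _ _ => trivial
    | s1 h => exact good_s1 I h hJ
    | s2 h => exact good_s2 I h hJ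
    | s3 h1 h2 => exact good_s3 I h1 h2 hJ
    | t1 h => exact good_t1 I h hJ
    | t2 h => exact good_t2 I h hJ
    | t3 h1 h2 => exact good_t3 I h1 h2 hJ
    | seqt h1 h2 => exact good_seqt I h1 h2 hJ
    | seqteq h1 h2 h3 h4 => exact good_seqteq I h2 hJ
    | var hp h => exact good_var I hp h hJ
    | sA hax h hv => exact good_sort_axiom I hT fA fB hax h hv hJ
    | tA hax h hv => exact good_term_axiom I hT fA hax h hv hJ
    | seqA hax h1 h2 => exact good_sortEq_axiom I hT fA fB hax h1 h2 hJ
    | teqA hax h1 h2 => exact good_termEq_axiom I hT fA hax h1 h2 hJ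
    | @sSub Y0 S hax Y σ hv hY hσ =>
      rw [← sort_ctxVars_subst]
      exact (inst hY (I.her.ctx hv) hσ).good_sort hv hJ
    | @tSub Y0 t V hax Y σ hv hV hσ =>
      rw [← app_ctxVars_subst]
      exact (inst (I.her.ctx hV) (I.her.ctx hv) hσ).good_term hv hJ
    | @seqSub1 Y0 V V' hax Y σ hv h1 h2 hσ =>
      exact (inst (I.her.ctx h1) (I.her.ctx hv) hσ).good_sortEq hv hJ
    | seqSub2 hax hv h1 h2 hστ => exact good_seqSub2 I h1 hστ hJ
    | @teqSub1 Y0 v v' V hax Y σ hv h1 h2 hσ =>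
      exact (inst (I.her.ctx h1) (I.her.ctx hv) hσ).good_termEq hv hJ
    | teqSub2 hax hv h1 h2 hστ => exact good_teqSub2 I h1 hστ hJ

end Main

theorem flatMap_map_length {α β γ : Type*} (l : List α) (l' : List β) (f : α → β → γ) :
    (l.flatMap fun a => l'.map (f a)).length = l.length * l'.length := by
  induction l with
  | nil => simp
  | cons a l ih => simp [ih, Nat.add_mul, Nat.add_comm]

theorem flatMap_map_getElem? {α β γ : Type*} (l : List α) (l' : List β) (f : α → β → γ) {i j : ℕ}
    (hi : i < l.length) (hj : j < l'.length) :
    (l.flatMap fun a => l'.map (f a))[i * l'.length + j]? = some (f l[i] l'[j]) := by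
  induction l generalizing i with
  | nil => simp at hi
  | cons a l ih =>
    rw [List.flatMap_cons]
    cases i with
    | zero => rw [List.getElem?_append_left (by simpa using hj)]; simp [hj]
    | succ i =>
      rw [List.getElem?_append_right (by rw [List.length_map, Nat.succ_mul]; omega),
        List.length_map, show (i + 1) * l'.length + j - l'.length = i * l'.length + j by
          rw [Nat.succ_mul]; omega, ih (by simpa using hi)]
      simp

/-- A list is the lexicographic grid of `f` over `l` and `l'` iff its entries are those of `f`. -/
theorem eq_flatMap_map_iff {α β γ : Type*} {l : List α} {l' : List β} {f : α → β → γ}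
    {L : List γ} : L = (l.flatMap fun a => l'.map (f a)) ↔
      L.length = l.length * l'.length ∧ ∀ i j (hi : i < l.length) (hj : j < l'.length)
        (h : i * l'.length + j < L.length), L[i * l'.length + j]'h = f l[i] l'[j] := by
  constructor
  · intro h
    refine ⟨by rw [h, flatMap_map_length], fun i j hi hj h' => ?_⟩
    have := flatMap_map_getElem? l l' f hi hj
    rw [← h, List.getElem?_eq_getElem h'] at this
    exact Option.some.inj this
  · rintro ⟨hl, h⟩
    refine List.ext_getElem? fun k => ?_
    by_cases hk : k < L.length
    · have hk' : k < l.length * l'.length := hl ▸ hk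
      have hpos : 0 < l'.length := Nat.pos_of_ne_zero fun h0 => by simp [h0] at hk'
      have hj : k % l'.length < l'.length := Nat.mod_lt _ hpos
      have hi : k / l'.length < l.length := (Nat.div_lt_iff_lt_mul hpos).2 hk'
      have hd : k / l'.length * l'.length + k % l'.length = k := Nat.div_add_mod' k _
      have hk2 : k / l'.length * l'.length + k % l'.length < L.length := hd.symm ▸ hk
      have h1 := flatMap_map_getElem? l l' f hi hj
      rw [← h _ _ hi hj hk2, ← List.getElem?_eq_getElem hk2, hd] at h1
      exact h1.symm
    · rw [List.getElem?_eq_none (by omega), List.getElem?_eq_none]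
      rw [flatMap_map_length]; omega

theorem isGrid_iff {γ : Type} {m n : ℕ} {M : ℕ → ℕ → γ} {L : List γ} :
    IsGrid m n M L ↔ L = ((List.range m).flatMap fun i => (List.range n).map (M i)) := by
  rw [eq_flatMap_map_iff]
  simp [IsGrid]

theorem range_map_eq {α γ : Type*} {l : List α} {F : ℕ → γ} {f : α → γ}
    (h : ∀ i (hi : i < l.length), F i = f (l[i]'hi)) : (List.range l.length).map F = l.map f := by
  refine List.ext_getElem (by simp) fun i h1 h2 => ?_
  simpa using h i (by simpa using h1)

theorem range_flatMap_eq {α γ : Type*} {l : List α} {F : ℕ → List γ} {f : α → List γ}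
    (h : ∀ i (hi : i < l.length), F i = f (l[i]'hi)) :
    (List.range l.length).flatMap F = l.flatMap f := by
  rw [List.flatMap_def, List.flatMap_def, range_map_eq h]

theorem pairsR_eq {x : A.Var} {Y : PreCtx B} {g : ℕ → Expr (A.tensor B)}
    {h : B.Var → Expr (A.tensor B)} (hg : ∀ j (hj : j < Y.length), g j = h (Y[j]'hj).1) :
    pairsR x Y g = Y.map fun q => ((x, q.1), h q.1) := by
  refine List.ext_getElem (by simp [pairsR]) fun j h1 h2 => ?_
  have hj : j < Y.length := by simpa using h2
  simp [pairsR, hg j hj]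

theorem pairsL_eq {X : PreCtx A} {y : B.Var} {g : ℕ → Expr (A.tensor B)}
    {h : A.Var → Expr (A.tensor B)} (hg : ∀ i (hi : i < X.length), g i = h (X[i]'hi).1) :
    pairsL X y g = X.map fun p => ((p.1, y), h p.1) := by
  refine List.ext_getElem (by simp [pairsL]) fun i h1 h2 => ?_
  have hi : i < X.length := by simpa using h2
  simp [pairsL, hg i hi]

/-- The functional form of `⊗_t`. -/
noncomputable def tg (c : Expr A → SortE A) (η : B.Var → Expr A → Expr (A.tensor B)) (u : Expr A)
    (U : SortE A) (V : SortE B) : Expr B → Expr (A.tensor B)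
  | .var y => vty c η V (vr y) u
  | .app t ts => tenB c η (.app t ts) u U

section
variable {TA : Set (Judg A)} {TB : Set (Judg B)} {c : Expr A → SortE A}
  {η : B.Var → Expr A → Expr (A.tensor B)} {X : PreCtx A} {Y : PreCtx B}

theorem tg_canon (h : EOK c η Y) {v : Expr B} {V : SortE B} (hv : CanonSort TB Y v V)
    (u : Expr A) (U : SortE A) : tg c η u U V v = tenB c η v u U := by
  cases hv with
  | var hi => rw [tenB_var, h _ (List.getElem_mem hi)]; rfl
  | app hax => rfl

theorem tg_var (h : EOK c η Y) {q : B.Var × SortE B} (hq : q ∈ Y) (u : Expr A) (U : SortE A) :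
    tg c η u U q.2 (.var q.1) = η q.1 u := (h q hq u).symm

theorem COK.of_canon (h : COK TA X c) {e : Expr A} {U : SortE A} (he : CanonSort TA X e U) :
    U = c e := by
  cases he with
  | var hi => exact (h.var _ (List.getElem_mem hi)).symm
  | app hax => exact (h.app hax _).symm

theorem COK.canonSort (hA : IsPretheory TA) (h : COK TA X c) {e : Expr A} (he : HasT TA X e) :
    CanonSort TA X e (c e) := by
  cases e with
  | var x =>
    obtain ⟨p, hp, rfl⟩ := he.mem_ctx hA
    obtain ⟨i, hi, rfl⟩ := List.getElem_of_mem hp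
    rw [h.var _ hp]
    exact .var hi
  | app t f =>
    obtain ⟨⟨Xa, V⟩, hax, -⟩ := hA.term_intro t
    rw [h.app hax]
    exact .app hax

theorem EOK.tb_var (h : EOK c η Y) {q : B.Var × SortE B} (hq : q ∈ Y) : tb c η (.var q.1) = vr q.1 := by
  funext x
  rw [tb, tenB_var, h q hq, vty_var]

theorem tg_var_left (hB : IsPretheory TB) (h : EOK c η Y) {v : Expr B} (hv : HasT TB Y v)
    (x : A.Var) (U : SortE A) (V : SortE B) :
    tg c η (.var x) U V v = tenB c η v (.var x) U := by
  cases v with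
  | var y =>
    obtain ⟨q, hq, rfl⟩ := hv.mem_ctx hB
    rw [tenB_var, h q hq, vty_var]
    exact vty_var ..
  | app t ts => rfl

theorem tg_tb (hB : IsPretheory TB) (hc : COK TA X c) (h : EOK c η Y) {v : Expr B}
    (hv : HasT TB Y v) {p : A.Var × SortE A} (hp : p ∈ X) (V : SortE B) :
    tg c η (.var p.1) p.2 V v = tb c η v p.1 := by
  rw [tg_var_left hB h hv, tb, hc.var p hp]

/-- Substitutions acting trivially on the left. -/
theorem subA_id (hA : IsPretheory TA) (hc : COK TA X c) (hη : EOK c η Y) {Q : Expr B → Prop}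
    {Θ : (A.tensor B).Var → Expr (A.tensor B)}
    (hΘ : ∀ p ∈ X, ∀ q ∈ Y, Θ (p.1, q.1) = .var (p.1, q.1)) :
    SubA (fun _ => True) Eq c c η η (HasT TA X) Q Y Expr.var Θ where
  cong := cong_eq
  app h := h.args hA
  srt h := hc.args hA h
  can _ := by rw [Expr.subst_id, SortE.subst_id]
  eok := hη
  eok' := hη
  sub {x} h q hq := by
    obtain ⟨p, hp, rfl⟩ := h.mem_ctx hA
    rw [hΘ p hp q hq, hη q hq, vty_var]; rfl
  mis _ _ := by rw [SortE.subst_id]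

theorem mem_map_fst_pair {X : PreCtx A} {y : B.Var} {h : A.Var → Expr (A.tensor B)}
    {k : (A.tensor B).Var} :
    k ∈ (X.map fun p => ((p.1, y), h p.1)).map Prod.fst ↔ (∃ p ∈ X, p.1 = k.1) ∧ k.2 = y := by
  obtain ⟨a, b⟩ := k
  simp only [List.map_map, List.mem_map, Function.comp, Prod.mk.injEq]
  constructor
  · rintro ⟨p, hp, rfl, rfl⟩; exact ⟨⟨p, hp, rfl⟩, rfl⟩
  · rintro ⟨⟨p, hp, h1⟩, h2⟩; exact ⟨p, hp, h1, h2.symm⟩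

theorem mem_map_fst_pair' {Y : PreCtx B} {x : A.Var} {h : B.Var → Expr (A.tensor B)}
    {k : (A.tensor B).Var} :
    k ∈ (Y.map fun q => ((x, q.1), h q.1)).map Prod.fst ↔ k.1 = x ∧ ∃ q ∈ Y, q.1 = k.2 := by
  obtain ⟨a, b⟩ := k
  simp only [List.map_map, List.mem_map, Function.comp, Prod.mk.injEq]
  constructor
  · rintro ⟨p, hp, rfl, rfl⟩; exact ⟨rfl, ⟨p, hp, rfl⟩⟩
  · rintro ⟨h1, p, hp, h2⟩; exact ⟨p, hp, h1.symm, h2⟩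

theorem lookupV_pairL {y : B.Var} {h : A.Var → Expr (A.tensor B)} {p : A.Var × SortE A}
    (hp : p ∈ X) : lookupV (X.map fun p => ((p.1, y), h p.1)) (p.1, y) = h p.1 := by
  refine lookupV_of_mem (List.mem_map.2 ⟨p, hp, rfl⟩) fun e' he' => ?_
  obtain ⟨p', -, he⟩ := List.mem_map.1 he'
  simp only [Prod.mk.injEq] at he
  rw [← he.2, he.1.1]

theorem lookupV_pairR {x : A.Var} {h : B.Var → Expr (A.tensor B)} {q : B.Var × SortE B}
    (hq : q ∈ Y) : lookupV (Y.map fun q => ((x, q.1), h q.1)) (x, q.1) = h q.1 := by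
  refine lookupV_of_mem (List.mem_map.2 ⟨q, hq, rfl⟩) fun e' he' => ?_
  obtain ⟨p', -, he⟩ := List.mem_map.1 he'
  simp only [Prod.mk.injEq] at he
  rw [← he.2, he.1.2]

theorem tenB_substL_pairsR (hA : IsPretheory TA) (hB : IsPretheory TB) (hc : COK TA X c)
    (hη : EOK c η Y) {u : Expr A} {U : SortE A} (hU : Derivable TA (.sort X U)) {v : Expr B}
    (hv : HasT TB Y v) {x : A.Var} (hx : ∀ p ∈ X, p.1 ≠ x) {g : ℕ → Expr (A.tensor B)}
    (hg : ∀ j (hj : j < Y.length), g j = η (Y[j]'hj).1 u) :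
    (tenB c η v (.var x) U).substL (pairsR x Y g) = tenB c η v u U := by
  rw [pairsR_eq (h := fun y => η y u) hg]
  obtain ⟨V, hv⟩ := hv
  have S := subA_id (Q := QD (Derivable TB) Y) hA hc hη
    (Θ := lookupV (Y.map fun q => ((x, q.1), η q.1 u)))
    fun p hp q hq => lookupV_not_mem fun h => hx p hp ((mem_map_fst_pair' (h := fun y => η y u)).1 h).1
  have := S.ten_top (u := .var x) (u' := u) (U := U) (hU.sort_args hA) (fun q hq _ => by
    rw [hη q hq, vty_var, vr, Expr.subst_var, lookupV_pairR (h := fun y => η y u) hq])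
    ((Derivable.hered hB).wt_term hv).1 trivial
  rw [SortE.subst_id] at this
  exact this

theorem vty_substL_pairsL (hA : IsPretheory TA) (hB : IsPretheory TB) (hc : COK TA X c)
    (hη : EOK c η Y) {u : Expr A} (hu : HasT TA X u) {V : SortE B}
    (hV : Derivable TB (.sort Y V)) {b : A.Var → Expr (A.tensor B)} {y : B.Var}
    (hy : ∀ q ∈ Y, q.1 ≠ y) {g : ℕ → Expr (A.tensor B)}
    (hg : ∀ i (hi : i < X.length), g i = b (X[i]'hi).1) :
    (vty c η V (vr y) u).substL (pairsL X y g) = vty c η V b u := by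
  rw [pairsL_eq (h := b) hg]
  have S := subA_id (Q := QD (Derivable TB) Y) hA hc hη
    (Θ := lookupV (X.map fun p => ((p.1, y), b p.1)))
    fun p hp q hq => lookupV_not_mem fun h => hy q hq (mem_map_fst_pair.1 h).2
  have := S.vty (b := vr y) (b' := b) ((Derivable.hered hB).wt_sort hV) (fun x hx _ => by
    obtain ⟨p, hp, rfl⟩ := hx.mem_ctx hA
    rw [vr, Expr.subst_var, vty_var, lookupV_pairL (h := b) hp]) hu trivial
  rw [Expr.subst_id] at this
  exact this

/-- Substituting for the two fresh variables in the tensor of two sorts. -/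
theorem tso_subst (hA : IsPretheory TA) (hB : IsPretheory TB) (hc : COK TA X c)
    (hη : EOK c η Y) {u u' : Expr A} {U : SortE A} (hU : Derivable TA (.sort X U)) {V : SortE B}
    (hV : Derivable TB (.sort Y V)) {b b' : A.Var → Expr (A.tensor B)}
    {Θ : (A.tensor B).Var → Expr (A.tensor B)}
    (hΘ : ∀ p ∈ X, ∀ q ∈ Y, Θ (p.1, q.1) = .var (p.1, q.1))
    (hu : ∀ q ∈ Y, (η q.1 u).subst Θ = η q.1 u')
    (hb : ∀ p ∈ X, (b p.1).subst Θ = b' p.1) :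
    (tso c η u U V b).subst Θ = tso c η u' U V b' := by
  have S := subA_id (Q := QD (Derivable TB) Y) hA hc hη hΘ
  have := S.tsoArgs (u := u) (u' := u') (U := U) (V := V) (b := b) (b' := b') (hU.sort_args hA)
    ((Derivable.hered hB).wt_sort hV) (fun q hq _ => hu q hq) (fun x hx _ => by
      obtain ⟨p, hp, rfl⟩ := hx.mem_ctx hA
      rw [hb p hp, vty_var]) fun _ _ => trivial
  rw [SortE.subst_id] at this
  exact SortE.ext' rfl (by rwa [List.forall₂_eq_eq_eq] at this)

end

/-- The inputs for which the tensor term operations are meaningful. -/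
structure ArgOK (TA : Set (Judg A)) (a : TArg A) : Prop where
  srt : Derivable TA (.sort a.ctx a.srt)
  tm : (∃ x, a.tm = .var x) ∨ HasT TA a.ctx a.tm

theorem ArgOK.hasT_app {TA : Set (Judg A)} {X : PreCtx A} {s : A.TermSym} {ss : List (Expr A)}
    {U : SortE A} (h : ArgOK TA ⟨X, .app s ss, U⟩) : HasT TA X (.app s ss) :=
  h.tm.resolve_left fun ⟨x, hx⟩ => by cases hx

section
variable {TA : Set (Judg A)} {TB : Set (Judg B)} {c : Expr A → SortE A}
  {η : B.Var → Expr A → Expr (A.tensor B)} {X : PreCtx A} {Y : PreCtx B}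

theorem Derivable.argOK_var {U : SortE A} (h : Derivable TA (.sort X U)) (x : A.Var) :
    ArgOK TA ⟨X, .var x, U⟩ := ⟨h, Or.inl ⟨x, rfl⟩⟩

theorem COK.argOK (hA : IsPretheory TA) (h : COK TA X c) {e : Expr A} (he : HasT TA X e) :
    ArgOK TA ⟨X, e, c e⟩ := ⟨h.sort hA he, Or.inr he⟩

theorem CanonSort.argOK (hA : IsPretheory TA) {e : Expr A} {U : SortE A}
    (hX : Derivable TA (.ctx X)) (h : CanonSort TA X e U) (he : HasT TA X e) :
    ArgOK TA ⟨X, e, U⟩ := by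
  obtain ⟨c, hc⟩ := exists_cok hA U hX.ctx_nodup
  rw [hc.of_canon h]
  exact hc.argOK hA he

theorem take_sort (hA : IsPretheory TA) (hX : Derivable TA (.ctx X)) {i : ℕ}
    (hi : i < X.length) : Derivable TA (.sort (X.take i) (X[i]'hi).2) := by
  have H := Derivable.hered hA
  have h1 : X.take i ++ [X[i]] <+: X := by
    rw [List.take_append_getElem]; exact List.take_prefix _ _
  exact (H.ctx_inv (H.prefix hX h1)).1

theorem Derivable.ctx_of_sort (hA : IsPretheory TA) {U : SortE A}
    (h : Derivable TA (.sort X U)) : Derivable TA (.ctx X) := (Derivable.hered hA).ctx h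

theorem TTg.eq_tg (hA : IsPretheory TA) (hB : IsPretheory TB) {f : Bool} {a : TArg A}
    {b : TArg B} {e : Expr (A.tensor B)} (h : TTg TA TB f a b e) (hf : f = false)
    (hc : COK TA a.ctx c) (hη : EOK c η b.ctx) (ha : ArgOK TA a) (hb : ArgOK TB b) :
    e = tg c η a.tm a.srt b.srt b.tm := by
  induction h with
  | @varvar _ X U x Y V y => exact (vty_var (c := c) (η := η) V (vr y) x).symm
  | @varapp _ X x S ss Y t ts V SS TSf hSS hTS M out hM hMx hout ihM ihMx =>
    have hss := ha.srt.sort_args hA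
    have hY := hb.srt.ctx_of_sort hB
    have hts := hb.hasT_app.args hB
    have ok i (hi : i < ss.length) : SS i = c ss[i] := hc.of_canon (hSS i hi)
    have okt j (hj : j < ts.length) := (hTS j hj).argOK hB hY (hts _ (List.getElem_mem hj))
    show Expr.app _ _ = tenB c η (.app t ts) (.var x) ⟨S, ss⟩
    rw [tenB_app, isGrid_iff.1 hout, List.range_succ, List.flatMap_append, List.flatMap_singleton]
    congr 2
    · refine range_flatMap_eq fun i hi => range_map_eq fun j hj => ?_
      rw [ihM i hi j hj hf hc hη ((hSS i hi).argOK hA (ha.srt.ctx_of_sort hA)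
        (hss _ (List.getElem_mem hi))) (okt j hj), tg_canon hη (hTS j hj), ok i hi]
    · refine range_map_eq fun j hj => ?_
      rw [ihMx j hj hf hc hη ha (okt j hj), tg_canon hη (hTS j hj)]
  | @appvar _ X s ss U Y y T ts SS TSf hSS hTS M out hM hMy hout ihM ihMy =>
    have hX := ha.srt.ctx_of_sort hA
    have hY := hb.srt.ctx_of_sort hB
    have hss := ha.hasT_app.args hA
    have hts := hb.srt.sort_args hB
    have oks i (hi : i < ss.length) := (hSS i hi).argOK hA hX (hss _ (List.getElem_mem hi))
    show Expr.app _ _ = vty c η ⟨T, ts⟩ (vr y) (.app s ss)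
    rw [vty_app, isGrid_iff.1 hout]
    congr 1
    refine range_flatMap_eq fun i hi => ?_
    rw [List.range_succ, List.map_append, List.map_singleton]
    congr 1
    · refine range_map_eq fun j hj => ?_
      rw [ihM i hi j hj hf hc hη (oks i hi) ((hTS j hj).argOK hB hY (hts _ (List.getElem_mem hj))),
        tg_canon hη (hTS j hj), hc.of_canon (hSS i hi)]
    · rw [ihMy i hi hf hc hη (oks i hi) hb]; rfl
  | @appapp_base X s ss U Y t ts V x hx e0 h0 g hg ih0 ihg =>
    rw [ih0 rfl hc hη (ha.srt.argOK_var x) hb]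
    refine tenB_substL_pairsR hA hB hc hη ha.srt hb.hasT_app hx fun j hj => ?_
    rw [ihg j hj rfl hc (hη.mono (List.take_subset _ _)) ha
      ((take_sort hB (hb.srt.ctx_of_sort hB) hj).argOK_var _)]
    exact tg_var hη (List.getElem_mem hj) ..
  | appapp_star => cases hf

theorem exists_fresh (X : PreCtx A) : ∃ x : A.Var, ∀ p ∈ X, p.1 ≠ x := by
  classical
  have := A.var_infinite
  obtain ⟨x, hx⟩ := Infinite.exists_notMem_finset (X.map Prod.fst).toFinset
  exact ⟨x, fun p hp h => hx (List.mem_toFinset.2 (List.mem_map.2 ⟨p, hp, h⟩))⟩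

theorem TTg.of_newvar (hA : IsPretheory TA) (hB : IsPretheory TB) (hc : COK TA X c)
    {V : SortE B} (hV : Derivable TB (.sort Y V))
    (H : ∀ τ ∈ V.args, ∀ W, CanonSort TB Y τ W → ∀ u U, ArgOK TA ⟨X, u, U⟩ →
      TTg TA TB false ⟨X, u, U⟩ ⟨Y, τ, W⟩ (tenB c η τ u U)) (y : B.Var) (u : Expr A) :
    ∀ U, ArgOK TA ⟨X, u, U⟩ → TTg TA TB false ⟨X, u, U⟩ ⟨Y, .var y, V⟩ (vty c η V (vr y) u) := by
  induction u using Expr.induct with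
  | hv x => intro U _; rw [vty_var]; exact .varvar
  | ha s ss ih =>
    intro U hu
    obtain ⟨T, ts⟩ := V
    obtain ⟨cB, hcB⟩ := exists_cok hB ⟨T, ts⟩ (hV.ctx_of_sort hB).ctx_nodup
    have hss e (he : e ∈ ss) : HasT TA X e := hu.hasT_app.args hA e he
    have hts e (he : e ∈ ts) : CanonSort TB Y e (cB e) := hcB.canonSort hB (hV.sort_args hB e he)
    rw [vty_app]
    let F : Option (Expr A) → Option (Expr B) → Expr (A.tensor B)
      | some e, some v => tenB c η v e (c e)
      | some e, none => vty c η ⟨T, ts⟩ (vr y) e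
      | none, _ => vty c η ⟨T, ts⟩ (vr y) (.app s ss)
    refine .appvar (fun i => ss[i]?.elim U c) (fun j => ts[j]?.elim ⟨T, ts⟩ cB) (fun i hi => ?_)
      (fun j hj => ?_) (fun i j => F ss[i]? ts[j]?) _ (fun i hi j hj => ?_) (fun i hi => ?_)
      (isGrid_iff.2 ?_)
    · simpa [hi] using hc.canonSort hA (hss _ (List.getElem_mem hi))
    · simpa [hj] using hts _ (List.getElem_mem hj)
    · simpa [hi, hj, F] using H _ (List.getElem_mem hj) _ (hts _ (List.getElem_mem hj)) _ _
        (hc.argOK hA (hss _ (List.getElem_mem hi)))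
    · simpa [hi, F] using ih _ (List.getElem_mem hi) _ (hc.argOK hA (hss _ (List.getElem_mem hi)))
    · refine (range_flatMap_eq fun i hi => ?_).symm
      rw [List.range_succ, List.map_append, List.map_singleton]
      congr 1
      · exact range_map_eq fun j hj => by simp [hi, hj, F]
      · simp [hi, F]

theorem TTg.of_newapp (hA : IsPretheory TA) (hB : IsPretheory TB) (hc : COK TA X c)
    (hη : EOK c η Y) {V : SortE B} {t : B.TermSym} {ts : List (Expr B)}
    (ht : HasT TB Y (.app t ts)) (hY : Derivable TB (.ctx Y))
    (H : ∀ τ ∈ ts, ∀ W, CanonSort TB Y τ W → ∀ u U, ArgOK TA ⟨X, u, U⟩ →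
      TTg TA TB false ⟨X, u, U⟩ ⟨Y, τ, W⟩ (tenB c η τ u U))
    (K : ∀ j (hj : j < Y.length), ∀ u U, ArgOK TA ⟨X, u, U⟩ →
      TTg TA TB false ⟨X, u, U⟩ ⟨Y.take j, .var (Y[j]'hj).1, (Y[j]'hj).2⟩ (η (Y[j]'hj).1 u))
    {u : Expr A} {U : SortE A} (hu : ArgOK TA ⟨X, u, U⟩) :
    TTg TA TB false ⟨X, u, U⟩ ⟨Y, .app t ts, V⟩ (tenB c η (.app t ts) u U) := by
  have hvar (x : A.Var) :
      TTg TA TB false ⟨X, .var x, U⟩ ⟨Y, .app t ts, V⟩ (tenB c η (.app t ts) (.var x) U) := by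
    obtain ⟨S, ss⟩ := U
    obtain ⟨cB, hcB⟩ := exists_cok hB V hY.ctx_nodup
    have hss e (he : e ∈ ss) : HasT TA X e := hu.srt.sort_args hA e he
    have hts e (he : e ∈ ts) : CanonSort TB Y e (cB e) := hcB.canonSort hB (ht.args hB e he)
    rw [tenB_app]
    let F : Option (Expr A) → Option (Expr B) → Expr (A.tensor B)
      | some e, some v => tenB c η v e (c e)
      | none, some v => tenB c η v (.var x) ⟨S, ss⟩
      | _, none => tenB c η (.app t ts) u ⟨S, ss⟩
    refine .varapp (fun i => ss[i]?.elim ⟨S, ss⟩ c) (fun j => ts[j]?.elim V cB) (fun i hi => ?_)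
      (fun j hj => ?_) (fun i j => F ss[i]? ts[j]?) _ (fun i hi j hj => ?_) (fun j hj => ?_)
      (isGrid_iff.2 ?_)
    · simpa [hi] using hc.canonSort hA (hss _ (List.getElem_mem hi))
    · simpa [hj] using hts _ (List.getElem_mem hj)
    · simpa [hi, hj, F] using H _ (List.getElem_mem hj) _ (hts _ (List.getElem_mem hj)) _ _
        (hc.argOK hA (hss _ (List.getElem_mem hi)))
    · simpa [hj, F] using H _ (List.getElem_mem hj) _ (hts _ (List.getElem_mem hj)) _ _
        (hu.srt.argOK_var x)
    · rw [List.range_succ, List.flatMap_append, List.flatMap_singleton]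
      congr 1
      · exact (range_flatMap_eq fun i hi => range_map_eq fun j hj => by simp [hi, hj, F]).symm
      · exact (range_map_eq fun j hj => by simp [hj, F]).symm
  cases u with
  | var x => exact hvar x
  | app s ss =>
    obtain ⟨x, hx⟩ := exists_fresh X
    have h := TTg.appapp_base hx _ (hvar x)
      (fun j => Y[j]?.elim (tenB c η (.app t ts) (.var x) U)
        fun q => η q.1 (.app s ss)) fun j hj => by simpa [hj] using K j hj _ _ hu
    rwa [tenB_substL_pairsR (u := .app s ss) hA hB hc hη hu.srt ht hx fun j hj => by simp [hj]] at h

theorem TTg.total (hA : IsPretheory TA) (hB : IsPretheory TB) (hc : COK TA X c) (n : ℕ) :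
    ∀ {Y : PreCtx B}, Y.length = n → EOK c η Y → ∀ {u U v V}, ArgOK TA ⟨X, u, U⟩ →
      ArgOK TB ⟨Y, v, V⟩ → TTg TA TB false ⟨X, u, U⟩ ⟨Y, v, V⟩ (tg c η u U V v) := by
  induction n using Nat.strong_induction_on with
  | _ n IH =>
  intro Y hn hη u U v V hu hv
  have hY := hv.srt.ctx_of_sort hB
  have K j (hj : j < Y.length) u U (hu : ArgOK TA ⟨X, u, U⟩) :
      TTg TA TB false ⟨X, u, U⟩ ⟨Y.take j, .var (Y[j]'hj).1, (Y[j]'hj).2⟩ (η (Y[j]'hj).1 u) := by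
    rw [← tg_var hη (List.getElem_mem hj) u U]
    exact IH j (hn ▸ hj) (by rw [List.length_take]; omega) (hη.mono (List.take_subset _ _)) hu
      ((take_sort hB hY hj).argOK_var _)
  have main : ∀ v, WT (QD (Derivable TB) Y) Y v → HasT TB Y v → ∀ W, CanonSort TB Y v W →
      ∀ u U, ArgOK TA ⟨X, u, U⟩ → TTg TA TB false ⟨X, u, U⟩ ⟨Y, v, W⟩ (tenB c η v u U) := by
    intro v hw
    induction hw with
    | @var q hq h hQ ih =>
      intro ht W hW u U hu
      obtain ⟨cB, hcB⟩ := exists_cok hB W hY.ctx_nodup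
      have hs : Derivable TB (.sort Y q.2) := by
        have := hcB.sort hB ht
        rwa [hcB.var q hq] at this
      rw [hcB.of_canon hW, hcB.var q hq, tenB_var, hη q hq]
      exact of_newvar hA hB hc hs (fun τ hτ => ih τ hτ (hs.sort_args hB τ hτ)) _ _ _ hu
    | app h hQ ih =>
      intro ht W hW u U hu
      exact of_newapp hA hB hc hη ht hY (fun τ hτ => ih τ hτ (ht.args hB τ hτ)) K hu
  have main' v (hv : HasT TB Y v) := main v (by
    obtain ⟨V, hv⟩ := hv
    exact ((Derivable.hered hB).wt_term hv).1) hv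
  cases v with
  | var y =>
    exact of_newvar hA hB hc hv.srt (fun τ hτ => main' τ (hv.srt.sort_args hB τ hτ)) _ _ _ hu
  | app t ts =>
    have ht := hv.hasT_app
    exact of_newapp hA hB hc hη ht hY (fun τ hτ => main' τ (ht.args hB τ hτ)) K hu

end

section
variable {TA : Set (Judg A)} {TB : Set (Judg B)} {c : Expr A → SortE A}
  {η : B.Var → Expr A → Expr (A.tensor B)} {X : PreCtx A} {Y : PreCtx B}

theorem grid_dropLast {γ : Type} (m n : ℕ) (M : ℕ → ℕ → γ) :
    ((List.range (m + 1)).flatMap fun i => (List.range (n + 1)).map (M i)).dropLast =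
      ((List.range m).flatMap fun i => (List.range n).map (M i) ++ [M i n]) ++
        (List.range n).map (M m) := by
  simp only [List.range_succ, List.flatMap_append, List.flatMap_singleton, List.map_append,
    List.map_singleton, ← List.append_assoc, List.dropLast_concat]

theorem TSo.eq_tso (hA : IsPretheory TA) (hB : IsPretheory TB) (hc : COK TA X c)
    (hη : EOK c η Y) {x : A.Var} {U : SortE A} {y : B.Var} {V : SortE B}
    {W : SortE (A.tensor B)} (h : TSo TA TB false X x U Y y V W)
    (hU : Derivable TA (.sort X U)) (hV : Derivable TB (.sort Y V)) :
    W = tso c η (.var x) U V (vr y) := by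
  cases h with
  | mk hx hy SS TSf hSS hTS M out hM hMx hMy hout =>
    rename_i S ss T ts
    have hX := hU.ctx_of_sort hA
    have hY := hV.ctx_of_sort hB
    have hss := hU.sort_args hA
    have hts := hV.sort_args hB
    have oks i (hi : i < ss.length) := (hSS i hi).argOK hA hX (hss _ (List.getElem_mem hi))
    have okt j (hj : j < ts.length) := (hTS j hj).argOK hB hY (hts _ (List.getElem_mem hj))
    refine SortE.ext' rfl ?_
    show out.dropLast = tsoArgs c η (.var x) ⟨S, ss⟩ ⟨T, ts⟩ (vr y)
    rw [isGrid_iff.1 hout, grid_dropLast, tsoArgs]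
    congr 1
    · refine range_flatMap_eq fun i hi => ?_
      congr 1
      · refine range_map_eq fun j hj => ?_
        rw [(hM i hi j hj).eq_tg hA hB rfl hc hη (oks i hi) (okt j hj), tg_canon hη (hTS j hj),
          hc.of_canon (hSS i hi)]
      · rw [(hMy i hi).eq_tg hA hB rfl hc hη (oks i hi) (hV.argOK_var y)]; rfl
    · refine range_map_eq fun j hj => ?_
      rw [(hMx j hj).eq_tg hA hB rfl hc hη (hU.argOK_var x) (okt j hj), tg_canon hη (hTS j hj)]

theorem TSo.total (hA : IsPretheory TA) (hB : IsPretheory TB) (hc : COK TA X c)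
    (hη : EOK c η Y) {x : A.Var} {U : SortE A} {y : B.Var} {V : SortE B}
    (hx : ∀ p ∈ X, p.1 ≠ x) (hy : ∀ q ∈ Y, q.1 ≠ y)
    (hU : Derivable TA (.sort X U)) (hV : Derivable TB (.sort Y V)) :
    TSo TA TB false X x U Y y V (tso c η (.var x) U V (vr y)) := by
  obtain ⟨S, ss⟩ := U
  obtain ⟨T, ts⟩ := V
  obtain ⟨cB, hcB⟩ := exists_cok hB ⟨T, ts⟩ (hV.ctx_of_sort hB).ctx_nodup
  have hss e (he : e ∈ ss) : HasT TA X e := hU.sort_args hA e he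
  have hts e (he : e ∈ ts) : HasT TB Y e := hV.sort_args hB e he
  have ctt e (he : e ∈ ts) : CanonSort TB Y e (cB e) := hcB.canonSort hB (hts e he)
  have tot {u U v V} (hu : ArgOK TA ⟨X, u, U⟩) (hv : ArgOK TB ⟨Y, v, V⟩) :=
    TTg.total hA hB hc _ rfl hη hu hv
  let F : Option (Expr A) → Option (Expr B) → Expr (A.tensor B)
    | some e, some v => tenB c η v e (c e)
    | none, some v => tenB c η v (.var x) ⟨S, ss⟩
    | some e, none => vty c η ⟨T, ts⟩ (vr y) e
    | none, none => .var (x, y)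
  have key : tso c η (.var x) ⟨S, ss⟩ ⟨T, ts⟩ (vr y) = ⟨(S, T),
      ((List.range (ss.length + 1)).flatMap fun i =>
        (List.range (ts.length + 1)).map fun j => F ss[i]? ts[j]?).dropLast⟩ := by
    refine SortE.ext' rfl ?_
    rw [grid_dropLast]
    show tsoArgs c η (.var x) ⟨S, ss⟩ ⟨T, ts⟩ (vr y) = _
    rw [tsoArgs]
    congr 1
    · refine (range_flatMap_eq fun i hi => ?_).symm
      congr 1
      · exact range_map_eq fun j hj => by simp [hi, hj, F]
      · simp [hi, F]
    · exact (range_map_eq fun j hj => by simp [hj, F]).symm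
  rw [key]
  refine .mk hx hy (fun i => ss[i]?.elim ⟨S, ss⟩ c) (fun j => ts[j]?.elim ⟨T, ts⟩ cB)
    (fun i hi => ?_) (fun j hj => ?_) (fun i j => F ss[i]? ts[j]?) _ (fun i hi j hj => ?_)
    (fun j hj => ?_) (fun i hi => ?_) (isGrid_iff.2 rfl)
  · simpa [hi] using hc.canonSort hA (hss _ (List.getElem_mem hi))
  · simpa [hj] using ctt _ (List.getElem_mem hj)
  · have := tot (hc.argOK hA (hss _ (List.getElem_mem hi))) (hcB.argOK hB (hts _ (List.getElem_mem hj)))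
    rw [tg_canon hη (ctt _ (List.getElem_mem hj))] at this
    simpa [hi, hj, F] using this
  · have := tot (hU.argOK_var x) (hcB.argOK hB (hts _ (List.getElem_mem hj)))
    rw [tg_canon hη (ctt _ (List.getElem_mem hj))] at this
    simpa [hj, F] using this
  · have := tot (hc.argOK hA (hss _ (List.getElem_mem hi))) (hV.argOK_var y)
    simpa [hi, F, tg] using this

theorem TTd.eq_or (hA : IsPretheory TA) (hB : IsPretheory TB) (hc : COK TA X c)
    (hη : EOK c η Y) {u : Expr A} {U : SortE A} {v : Expr B} {V : SortE B}
    {e : Expr (A.tensor B)} (h : TTd TA TB false ⟨X, u, U⟩ ⟨Y, v, V⟩ e)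
    (hU : Derivable TA (.term X u U)) (hV : Derivable TB (.term Y v V)) :
    e = tg c η u U V v ∨ e = vty c η V (tb c η v) u := by
  have hA' := (Derivable.hered hA).term hU
  have hB' := (Derivable.hered hB).term hV
  have okA : ArgOK TA ⟨X, u, U⟩ := ⟨hA', Or.inr ⟨_, hU⟩⟩
  have okB : ArgOK TB ⟨Y, v, V⟩ := ⟨hB', Or.inr ⟨_, hV⟩⟩
  cases h with
  | varL h => exact Or.inl (h.eq_tg hA hB rfl hc hη okA okB)
  | varR h => exact Or.inl (h.eq_tg hA hB rfl hc hη okA okB)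
  | appapp_base hy e0 h0 g hg =>
    rw [h0.eq_tg hA hB rfl hc hη okA (hB'.argOK_var _)]
    refine Or.inr (vty_substL_pairsL hA hB hc hη ⟨_, hU⟩ hB' hy fun i hi => ?_)
    rw [(hg i hi).eq_tg hA hB rfl (hc.mono (List.take_subset _ _)) hη
      ((take_sort hA (hA'.ctx_of_sort hA) hi).argOK_var _) okB]
    exact tg_tb hB hc hη ⟨_, hV⟩ (List.getElem_mem hi) _

theorem tg_eq_or (hB : IsPretheory TB) (hη : EOK c η Y) {v : Expr B} (hv : HasT TB Y v)
    (u : Expr A) (U : SortE A) (V : SortE B) :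
    tg c η u U V v = tenB c η v u U ∨ tg c η u U V v = vty c η V (tb c η v) u := by
  cases v with
  | var y =>
    obtain ⟨q, hq, rfl⟩ := hv.mem_ctx hB
    rw [hη.tb_var hq]
    exact Or.inr rfl
  | app t ts => exact Or.inl rfl

theorem take_subset_dropLast {α : Type*} {l : List α} {i : ℕ} (hi : i < l.length) :
    l.take i ⊆ l.dropLast := by
  rw [List.dropLast_eq_take]
  exact (List.take_prefix_take_left (by omega)).subset

theorem take_fresh (hA : IsPretheory TA) (hX : Derivable TA (.ctx X)) {i : ℕ}
    (hi : i < X.length) : ∀ p ∈ X.take i, p.1 ≠ (X[i]'hi).1 := by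
  have H := Derivable.hered hA
  have h1 : X.take i ++ [X[i]] <+: X := by
    rw [List.take_append_getElem]; exact List.take_prefix _ _
  exact (H.ctx_inv (H.prefix hX h1)).2

theorem tCtx_iff (hA : IsPretheory TA) (hB : IsPretheory TB) (hX : Derivable TA (.ctx X))
    (hY : Derivable TB (.ctx Y)) (hc : COK TA X.dropLast c) (hη : EOK c η Y.dropLast)
    {Z : PreCtx (A.tensor B)} : TCtx TA TB false X Y Z ↔ Z = tc c η X Y := by
  rw [tc, eq_flatMap_map_iff, TCtx]
  refine and_congr_right fun _ => forall_congr' fun i => forall_congr' fun j => forall_congr' fun hi =>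
    forall_congr' fun hj => forall_congr' fun hk => ?_
  have hci := hc.mono (take_subset_dropLast hi)
  have hηj := hη.mono (take_subset_dropLast hj)
  rw [Prod.ext_iff (x := Z[_])]
  refine and_congr_right fun _ => ⟨fun h => TSo.eq_tso hA hB hci hηj h (take_sort hA hX hi)
    (take_sort hB hY hj), fun h => ?_⟩
  rw [h]
  exact .total hA hB hci hηj (take_fresh hA hX hi) (take_fresh hB hY hj) (take_sort hA hX hi)
    (take_sort hB hY hj)

section
variable {U : SortE A} {V : SortE B} {x : A.Var} {y : B.Var}

theorem tso_pairsL (hA : IsPretheory TA) (hB : IsPretheory TB) (hc : COK TA X c)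
    (hη : EOK c η Y) (hU : Derivable TA (.sort X U)) (hV : Derivable TB (.sort Y V))
    (hy : ∀ q ∈ Y, q.1 ≠ y) {g : ℕ → Expr (A.tensor B)} {b : A.Var → Expr (A.tensor B)}
    (hg : ∀ i (hi : i < X.length), g i = b (X[i]'hi).1) :
    (tso c η (.var x) U V (vr y)).substL (pairsL X y g) = tso c η (.var x) U V b := by
  rw [pairsL_eq (h := b) hg]
  have h0 x q (hq : q ∈ Y) : lookupV (X.map fun p => ((p.1, y), b p.1)) (x, q.1) = .var (x, q.1) :=
    lookupV_not_mem fun h => hy q hq (mem_map_fst_pair.1 h).2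
  refine tso_subst hA hB hc hη hU hV (fun p _ q hq => h0 _ q hq) (fun q hq => ?_) fun p hp => ?_
  · rw [hη q hq, vty_var, vr, Expr.subst_var]; exact h0 _ q hq
  · rw [vr, Expr.subst_var]; exact lookupV_pairL hp

theorem tso_pairsR (hA : IsPretheory TA) (hB : IsPretheory TB) (hc : COK TA X c)
    (hη : EOK c η Y) (hU : Derivable TA (.sort X U)) (hV : Derivable TB (.sort Y V))
    (hx : ∀ p ∈ X, p.1 ≠ x) {u : Expr A} {g : ℕ → Expr (A.tensor B)}
    (hg : ∀ j (hj : j < Y.length), g j = η (Y[j]'hj).1 u) :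
    (tso c η (.var x) U V (vr y)).substL (pairsR x Y g) = tso c η u U V (vr y) := by
  rw [pairsR_eq (h := fun y => η y u) hg]
  have h0 p (hp : p ∈ X) y : lookupV (Y.map fun q => ((x, q.1), η q.1 u)) (p.1, y) = .var (p.1, y) :=
    lookupV_not_mem fun h => hx p hp ((mem_map_fst_pair' (h := fun y => η y u)).1 h).1
  refine tso_subst hA hB hc hη hU hV (fun p hp q _ => h0 p hp _) (fun q hq => ?_) fun p hp => ?_
  · rw [hη q hq, vty_var, vr, Expr.subst_var]; exact lookupV_pairR (h := fun y => η y u) hq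
  · rw [vr, Expr.subst_var]; exact h0 p hp y

theorem tso_pairsLR (hA : IsPretheory TA) (hB : IsPretheory TB) (hc : COK TA X c)
    (hη : EOK c η Y) (hU : Derivable TA (.sort X U)) (hV : Derivable TB (.sort Y V))
    (hx : ∀ p ∈ X, p.1 ≠ x) (hy : ∀ q ∈ Y, q.1 ≠ y) {u : Expr A}
    {b : A.Var → Expr (A.tensor B)} {gx gy : ℕ → Expr (A.tensor B)}
    (hgx : ∀ i (hi : i < X.length), gx i = b (X[i]'hi).1)
    (hgy : ∀ j (hj : j < Y.length), gy j = η (Y[j]'hj).1 u) :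
    (tso c η (.var x) U V (vr y)).substL (pairsL X y gx ++ pairsR x Y gy) = tso c η u U V b := by
  rw [pairsL_eq (h := b) hgx, pairsR_eq (h := fun y => η y u) hgy]
  refine tso_subst hA hB hc hη hU hV (fun p hp q hq => ?_) (fun q hq => ?_) fun p hp => ?_
  · rw [lookupV_append_right fun h => hy q hq (mem_map_fst_pair.1 h).2]
    exact lookupV_not_mem fun h => hx p hp ((mem_map_fst_pair' (h := fun y => η y u)).1 h).1
  · rw [hη q hq, vty_var, vr, Expr.subst_var,
      lookupV_append_right fun h => hy q hq (mem_map_fst_pair.1 h).2]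
    exact lookupV_pairR (h := fun y => η y u) hq
  · rw [vr, Expr.subst_var, lookupV_append_left (mem_map_fst_pair (k := (p.1, y)).2 ⟨⟨p, hp, rfl⟩, rfl⟩)]
    exact lookupV_pairL hp

end
end

/-! ## The tensors of derivable judgments, in closed form -/

/-- The closed form of the tensor of two judgments. -/
inductive TRes (c : Expr A → SortE A) (η : B.Var → Expr A → Expr (A.tensor B))
    (chA : PreCtx A → A.Var) (chB : PreCtx B → B.Var) :
    Judg A → Judg B → Judg (A.tensor B) → Prop where
  | ss {X U Y V} : TRes c η chA chB (.sort X U) (.sort Y V)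
      (.sort (zm c η X (chA X, U) Y [(chB Y, V)]) (tso c η (.var (chA X)) U V (vr (chB Y))))
  | seqs {X U U' Y V} : TRes c η chA chB (.sortEq X U U') (.sort Y V)
      (.sortEq (zm c η X (chA X, U) Y [(chB Y, V)])
        (tso c η (.var (chA X)) U V (vr (chB Y))) (tso c η (.var (chA X)) U' V (vr (chB Y))))
  | sseq {X U Y V V'} : TRes c η chA chB (.sort X U) (.sortEq Y V V')
      (.sortEq (zm c η X (chA X, U) Y [(chB Y, V)])
        (tso c η (.var (chA X)) U V (vr (chB Y))) (tso c η (.var (chA X)) U V' (vr (chB Y))))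
  | st {X U Y v V} : TRes c η chA chB (.sort X U) (.term Y v V)
      (.term (zm c η X (chA X, U) Y []) (tenB c η v (.var (chA X)) U)
        (tso c η (.var (chA X)) U V (tb c η v)))
  | seqt {X U U' Y v V} : TRes c η chA chB (.sortEq X U U') (.term Y v V)
      (.termEq (zm c η X (chA X, U) Y []) (tenB c η v (.var (chA X)) U)
        (tenB c η v (.var (chA X)) U') (tso c η (.var (chA X)) U V (tb c η v)))
  | steq {X U Y v v' V} : TRes c η chA chB (.sort X U) (.termEq Y v v' V)
      (.termEq (zm c η X (chA X, U) Y []) (tenB c η v (.var (chA X)) U)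
        (tenB c η v' (.var (chA X)) U) (tso c η (.var (chA X)) U V (tb c η v)))
  | ts {X u U Y V} : TRes c η chA chB (.term X u U) (.sort Y V)
      (.term (tc c η X (Y ++ [(chB Y, V)])) (vty c η V (vr (chB Y)) u)
        (tso c η u U V (vr (chB Y))))
  | teqs {X u u' U Y V} : TRes c η chA chB (.termEq X u u' U) (.sort Y V)
      (.termEq (tc c η X (Y ++ [(chB Y, V)])) (vty c η V (vr (chB Y)) u)
        (vty c η V (vr (chB Y)) u') (tso c η u U V (vr (chB Y))))
  | tseq {X u U Y V V'} : TRes c η chA chB (.term X u U) (.sortEq Y V V')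
      (.termEq (tc c η X (Y ++ [(chB Y, V)])) (vty c η V (vr (chB Y)) u)
        (vty c η V' (vr (chB Y)) u) (tso c η u U V (vr (chB Y))))
  | tt {X u U Y v V e1 e2}
      (h1 : e1 = tenB c η v u U ∨ e1 = vty c η V (tb c η v) u)
      (h2 : e2 = tenB c η v u U ∨ e2 = vty c η V (tb c η v) u) :
      TRes c η chA chB (.term X u U) (.term Y v V)
        (.termEq (tc c η X Y) e1 e2 (tso c η u U V (tb c η v)))

section Closed

variable {TA : Set (Judg A)} {TB : Set (Judg B)}
  {c : Expr A → SortE A} {η : B.Var → Expr A → Expr (A.tensor B)}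
  {X : PreCtx A} {Y : PreCtx B} {u : Expr A} {U : SortE A} {v : Expr B} {V : SortE B}
  {chA : PreCtx A → A.Var} {chB : PreCtx B → B.Var}

theorem ttg_iff (hA : IsPretheory TA) (hB : IsPretheory TB) (hc : COK TA X c) (hη : EOK c η Y)
    (ha : ArgOK TA ⟨X, u, U⟩) (hb : ArgOK TB ⟨Y, v, V⟩) {e : Expr (A.tensor B)} :
    TTg TA TB false ⟨X, u, U⟩ ⟨Y, v, V⟩ e ↔ e = tg c η u U V v :=
  ⟨fun h => h.eq_tg hA hB rfl hc hη ha hb, fun h => h ▸ TTg.total hA hB hc _ rfl hη ha hb⟩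

theorem Derivable.argOK (hA : IsPretheory TA) (h : Derivable TA (.term X u U)) :
    ArgOK TA ⟨X, u, U⟩ := ⟨(Derivable.hered hA).term h, Or.inr ⟨U, h⟩⟩

theorem ttg_left_iff (hA : IsPretheory TA) (hB : IsPretheory TB) (hc : COK TA X c)
    (hη : EOK c η Y) (hU : Derivable TA (.sort X U)) (hv : Derivable TB (.term Y v V)) {x : A.Var}
    {e : Expr (A.tensor B)} :
    TTg TA TB false ⟨X, .var x, U⟩ ⟨Y, v, V⟩ e ↔ e = tenB c η v (.var x) U := by
  rw [ttg_iff hA hB hc hη (hU.argOK_var x) (hv.argOK hB), tg_var_left hB hη ⟨V, hv⟩]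

theorem ttg_right_iff (hA : IsPretheory TA) (hB : IsPretheory TB) (hc : COK TA X c)
    (hη : EOK c η Y) (hu : Derivable TA (.term X u U)) (hV : Derivable TB (.sort Y V)) {y : B.Var}
    {e : Expr (A.tensor B)} :
    TTg TA TB false ⟨X, u, U⟩ ⟨Y, .var y, V⟩ e ↔ e = vty c η V (vr y) u := by
  rw [ttg_iff hA hB hc hη (hu.argOK hA) (hV.argOK_var y), tg]

theorem ttg_take_left_iff (hA : IsPretheory TA) (hB : IsPretheory TB) (hc : COK TA X c)
    (hη : EOK c η Y) (hX : Derivable TA (.ctx X)) (hv : Derivable TB (.term Y v V)) {i : ℕ}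
    (hi : i < X.length) {e : Expr (A.tensor B)} :
    TTg TA TB false ⟨X.take i, .var (X[i]'hi).1, (X[i]'hi).2⟩ ⟨Y, v, V⟩ e ↔
      e = tb c η v (X[i]'hi).1 := by
  rw [ttg_iff hA hB (hc.mono (List.take_subset _ _)) hη ((take_sort hA hX hi).argOK_var _)
    (hv.argOK hB), tg_tb hB hc hη ⟨V, hv⟩ (List.getElem_mem hi)]

theorem ttg_take_right_iff (hA : IsPretheory TA) (hB : IsPretheory TB) (hc : COK TA X c)
    (hη : EOK c η Y) (hu : Derivable TA (.term X u U)) (hY : Derivable TB (.ctx Y)) {j : ℕ}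
    (hj : j < Y.length) {e : Expr (A.tensor B)} :
    TTg TA TB false ⟨X, u, U⟩ ⟨Y.take j, .var (Y[j]'hj).1, (Y[j]'hj).2⟩ e ↔
      e = η (Y[j]'hj).1 u := by
  rw [ttg_iff hA hB hc (hη.mono (List.take_subset _ _)) (hu.argOK hA)
    ((take_sort hB hY hj).argOK_var _), tg_var hη (List.getElem_mem hj)]

theorem exists_getElem_eq {α γ : Type*} [Nonempty γ] (l : List α) (f : α → γ) :
    ∃ g : ℕ → γ, ∀ i (hi : i < l.length), g i = f (l[i]'hi) := by
  classical
  exact ⟨fun i => if h : i < l.length then f (l[i]'h) else Classical.arbitrary γ,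
    fun i hi => by simp [hi]⟩

theorem tCtx_snoc (hA : IsPretheory TA) (hB : IsPretheory TB) (hc : COK TA X c) (hη : EOK c η Y)
    (fA : FreshCh chA) (hU : Derivable TA (.sort X U)) (hY : Derivable TB (.ctx Y))
    {Z : PreCtx (A.tensor B)} :
    TCtx TA TB false (X ++ [(chA X, U)]) Y Z ↔ Z = zm c η X (chA X, U) Y [] := by
  rw [zm_nil, tCtx_iff hA hB (Derivable.snoc hA hU (fA X)) hY (by simpa using hc)
    (hη.mono (List.dropLast_subset _))]

theorem tCtx_snoc_right (hA : IsPretheory TA) (hB : IsPretheory TB) (hc : COK TA X c)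
    (hη : EOK c η Y) (fB : FreshCh chB) (hX : Derivable TA (.ctx X))
    (hV : Derivable TB (.sort Y V)) {Z : PreCtx (A.tensor B)} :
    TCtx TA TB false X (Y ++ [(chB Y, V)]) Z ↔ Z = tc c η X (Y ++ [(chB Y, V)]) := by
  rw [tCtx_iff hA hB hX (Derivable.snoc hB hV (fB Y)) (hc.mono (List.dropLast_subset _))
    (by simpa using hη)]

theorem tCtx_snoc_snoc (hA : IsPretheory TA) (hB : IsPretheory TB) (hc : COK TA X c)
    (hη : EOK c η Y) (fA : FreshCh chA) (fB : FreshCh chB) (hU : Derivable TA (.sort X U))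
    (hV : Derivable TB (.sort Y V)) {Z : PreCtx (A.tensor B)} :
    TCtx TA TB false (X ++ [(chA X, U)]) (Y ++ [(chB Y, V)]) Z ↔
      Z = tc c η (X ++ [(chA X, U)]) (Y ++ [(chB Y, V)]) := by
  rw [tCtx_iff hA hB (Derivable.snoc hA hU (fA X)) (Derivable.snoc hB hV (fB Y))
    (by simpa using hc) (by simpa using hη)]

theorem tc_dropLast (p : A.Var × SortE A) (q : B.Var × SortE B) :
    (tc c η (X ++ [p]) (Y ++ [q])).dropLast = zm c η X p Y [q] := by
  rw [tc_append, tc_row_append, ← List.append_assoc]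
  simp [tc, zm]

/-- Every tensor of two derivable judgments has the closed form. -/
theorem TJudg.res (hA : IsPretheory TA) (hB : IsPretheory TB) (fA : FreshCh chA)
    (fB : FreshCh chB) {J : Judg A} {J' : Judg B} {K : Judg (A.tensor B)}
    (h : TJudg TA TB chA chB false J J' K) (hJ : Derivable TA J) (hJ' : Derivable TB J')
    (hc : COK TA J.ctxOf c) (hη : EOK c η J'.ctxOf) : TRes c η chA chB J J' K := by
  have HA := Derivable.hered hA
  have HB := Derivable.hered hB
  generalize hf : false = f at h
  cases h <;> subst hf <;> simp only [Judg.ctxOf] at hc hη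
  case ss X U Y V Z W hZ hW =>
    rw [(tCtx_snoc_snoc hA hB hc hη fA fB hJ hJ').1 hZ, tc_dropLast,
      hW.eq_tso hA hB hc hη hJ hJ']
    exact .ss
  case st X U Y v V Z e W g hZ he hW hg =>
    have hV := HB.term hJ'
    rw [(tCtx_snoc hA hB hc hη fA hJ (HB.ctx hV)).1 hZ, hW.eq_tso hA hB hc hη hJ hV,
      (ttg_left_iff hA hB hc hη hJ hJ').1 he,
      tso_pairsL hA hB hc hη hJ hV (fB Y) fun i hi =>
        (ttg_take_left_iff hA hB hc hη (HA.ctx hJ) hJ' hi).1 (hg i hi)]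
    exact .st
  case ts X u U Y V Z e W g hZ he hW hg =>
    have hU := HA.term hJ
    rw [(tCtx_snoc_right hA hB hc hη fB (HA.ctx hU) hJ').1 hZ, hW.eq_tso hA hB hc hη hU hJ',
      (ttg_right_iff hA hB hc hη hJ hJ').1 he,
      tso_pairsR hA hB hc hη hU hJ' (fA X) fun j hj =>
        (ttg_take_right_iff hA hB hc hη hJ (HB.ctx hJ') hj).1 (hg j hj)]
    exact .ts
  case tt X u U Y v V Z e1 e2 W gx gy hZ he1 he2 hW hgx hgy =>
    have hU := HA.term hJ
    have hV := HB.term hJ'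
    have h1 := (ttg_iff hA hB hc hη (hJ.argOK hA) (hJ'.argOK hB)).1 he1
    have h0 := tg_eq_or (c := c) (η := η) hB hη ⟨V, hJ'⟩ u U V
    rw [(tCtx_iff hA hB (HA.ctx hU) (HB.ctx hV) (hc.mono (List.dropLast_subset _))
        (hη.mono (List.dropLast_subset _))).1 hZ, hW.eq_tso hA hB hc hη hU hV,
      tso_pairsLR hA hB hc hη hU hV (fA X) (fB Y) (b := tb c η v) (u := u)
        (fun i hi => (ttg_take_left_iff hA hB hc hη (HA.ctx hU) hJ' hi).1 (hgx i hi))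
        fun j hj => (ttg_take_right_iff hA hB hc hη hJ (HB.ctx hV) hj).1 (hgy j hj)]
    refine .tt (h1 ▸ h0) ?_
    rcases he2.eq_or hA hB hc hη hJ hJ' with h2 | h2
    · exact h2 ▸ h0
    · exact .inr h2
  case sseq X U Y V V' Z W W' hZ hW hW' =>
    rw [(tCtx_snoc_snoc hA hB hc hη fA fB hJ (HB.sortEq hJ').1).1 hZ, tc_dropLast,
      hW.eq_tso hA hB hc hη hJ (HB.sortEq hJ').1, hW'.eq_tso hA hB hc hη hJ (HB.sortEq hJ').2]
    exact .sseq
  case seqs X U U' Y V Z W W' hZ hW hW' =>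
    rw [(tCtx_snoc_snoc hA hB hc hη fA fB (HA.sortEq hJ).1 hJ').1 hZ, tc_dropLast,
      hW.eq_tso hA hB hc hη (HA.sortEq hJ).1 hJ', hW'.eq_tso hA hB hc hη (HA.sortEq hJ).2 hJ']
    exact .seqs
  case steq X U Y v v' V Z e e' W g hZ he he' hW hg =>
    obtain ⟨hv, hv'⟩ := HB.termEq hJ'
    have hV := HB.term hv
    rw [(tCtx_snoc hA hB hc hη fA hJ (HB.ctx hV)).1 hZ, hW.eq_tso hA hB hc hη hJ hV,
      (ttg_left_iff hA hB hc hη hJ hv).1 he, (ttg_left_iff hA hB hc hη hJ hv').1 he',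
      tso_pairsL hA hB hc hη hJ hV (fB Y) fun i hi =>
        (ttg_take_left_iff hA hB hc hη (HA.ctx hJ) hv hi).1 (hg i hi)]
    exact .steq
  case teqs X u u' U Y V Z e e' W g hZ he he' hW hg =>
    obtain ⟨hu, hu'⟩ := HA.termEq hJ
    have hU := HA.term hu
    rw [(tCtx_snoc_right hA hB hc hη fB (HA.ctx hU) hJ').1 hZ, hW.eq_tso hA hB hc hη hU hJ',
      (ttg_right_iff hA hB hc hη hu hJ').1 he, (ttg_right_iff hA hB hc hη hu' hJ').1 he',
      tso_pairsR hA hB hc hη hU hJ' (fA X) fun j hj =>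
        (ttg_take_right_iff hA hB hc hη hu (HB.ctx hJ') hj).1 (hg j hj)]
    exact .teqs
  case seqt X U U' Y v V Z e e' W g hZ he he' hW hg =>
    obtain ⟨hU, hU'⟩ := HA.sortEq hJ
    have hV := HB.term hJ'
    rw [(tCtx_snoc hA hB hc hη fA hU (HB.ctx hV)).1 hZ, hW.eq_tso hA hB hc hη hU hV,
      (ttg_left_iff hA hB hc hη hU hJ').1 he, (ttg_left_iff hA hB hc hη hU' hJ').1 he',
      tso_pairsL hA hB hc hη hU hV (fB Y) fun i hi =>
        (ttg_take_left_iff hA hB hc hη (HA.ctx hU) hJ' hi).1 (hg i hi)]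
    exact .seqt
  case tseq X u U Y V V' Z e e' W g hZ he he' hW hg =>
    obtain ⟨hV, hV'⟩ := HB.sortEq hJ'
    have hU := HA.term hJ
    rw [(tCtx_snoc_right hA hB hc hη fB (HA.ctx hU) hV).1 hZ, hW.eq_tso hA hB hc hη hU hV,
      (ttg_right_iff hA hB hc hη hJ hV).1 he, (ttg_right_iff hA hB hc hη hJ hV').1 he',
      tso_pairsR hA hB hc hη hU hV (fA X) fun j hj =>
        (ttg_take_right_iff hA hB hc hη hJ (HB.ctx hV) hj).1 (hg j hj)]
    exact .tseq

end Closed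

instance : Nonempty (Expr A) := (inferInstance : Nonempty A.Var).map Expr.var

section Axioms

variable {TA : Set (Judg A)} {TB : Set (Judg B)}
  {c : Expr A → SortE A} {η : B.Var → Expr A → Expr (A.tensor B)}
  {X : PreCtx A} {Y : PreCtx B} {u : Expr A} {U : SortE A} {v : Expr B} {V : SortE B}
  {chA : PreCtx A → A.Var} {chB : PreCtx B → B.Var}

theorem ttd_app (hA : IsPretheory TA) (hB : IsPretheory TB) (hc : COK TA X c) (hη : EOK c η Y)
    (fB : FreshCh chB) {s : A.TermSym} {ss : List (Expr A)} {t : B.TermSym} {ts : List (Expr B)}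
    (hu : Derivable TA (.term X (.app s ss) U)) (hv : Derivable TB (.term Y (.app t ts) V)) :
    TTd TA TB false ⟨X, .app s ss, U⟩ ⟨Y, .app t ts, V⟩
      (vty c η V (tb c η (.app t ts)) (.app s ss)) := by
  have hV := (Derivable.hered hB).term hv
  have hX := (Derivable.hered hA).ctx ((Derivable.hered hA).term hu)
  obtain ⟨g, hg⟩ := exists_getElem_eq X fun p => tb c η (.app t ts) p.1
  rw [← vty_substL_pairsL hA hB hc hη ⟨U, hu⟩ hV (fB Y) hg]
  refine .appapp_base (fB Y) _ ((ttg_right_iff hA hB hc hη hu hV).2 rfl) g fun i hi => ?_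
  rw [ttg_take_left_iff hA hB hc hη hX hv hi, hg i hi]

theorem tensorAx_tAx (hA : IsGAT TA) (hB : IsGAT TB) (fA : FreshCh chA) (fB : FreshCh chB) :
    TAx TA TB (tensorAx TA TB chA chB) chA chB := by
  obtain ⟨hA, dA⟩ := hA
  obtain ⟨hB, dB⟩ := hB
  have HA := Derivable.hered hA
  have HB := Derivable.hered hB
  constructor
  case ss =>
    intro X U Y V hJ hJ' c η hc hη
    have dJ := dA _ hJ
    have dJ' := dB _ hJ'
    refine ⟨_, _, hJ, hJ', ?_⟩
    rw [← tc_dropLast]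
    exact .ss ((tCtx_snoc_snoc hA hB hc hη fA fB dJ dJ').2 rfl)
      (TSo.total hA hB hc hη (fA X) (fB Y) dJ dJ')
  case seqs =>
    intro X U U' Y V hJ hJ' c η hc hη
    obtain ⟨hU, hU'⟩ := HA.sortEq (dA _ hJ)
    have dJ' := dB _ hJ'
    refine ⟨_, _, hJ, hJ', ?_⟩
    rw [← tc_dropLast]
    exact .seqs ((tCtx_snoc_snoc hA hB hc hη fA fB hU dJ').2 rfl)
      (TSo.total hA hB hc hη (fA X) (fB Y) hU dJ') (TSo.total hA hB hc hη (fA X) (fB Y) hU' dJ')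
  case sseq =>
    intro X U Y V V' hJ hJ' c η hc hη
    obtain ⟨hV, hV'⟩ := HB.sortEq (dB _ hJ')
    have dJ := dA _ hJ
    refine ⟨_, _, hJ, hJ', ?_⟩
    rw [← tc_dropLast]
    exact .sseq ((tCtx_snoc_snoc hA hB hc hη fA fB dJ hV).2 rfl)
      (TSo.total hA hB hc hη (fA X) (fB Y) dJ hV) (TSo.total hA hB hc hη (fA X) (fB Y) dJ hV')
  case st =>
    intro X U Y v V hJ hJ' c η hc hη
    have dJ := dA _ hJ
    have dJ' := dB _ hJ'
    have hV := HB.term dJ'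
    obtain ⟨g, hg⟩ := exists_getElem_eq X fun p => tb c η v p.1
    refine ⟨_, _, hJ, hJ', ?_⟩
    rw [← tso_pairsL hA hB hc hη dJ hV (fB Y) hg]
    exact .st ((tCtx_snoc hA hB hc hη fA dJ (HB.ctx hV)).2 rfl)
      ((ttg_left_iff hA hB hc hη dJ dJ').2 rfl) (TSo.total hA hB hc hη (fA X) (fB Y) dJ hV)
      fun i hi => (ttg_take_left_iff hA hB hc hη (HA.ctx dJ) dJ' hi).2 (hg i hi)
  case seqt =>
    intro X U U' Y v V hJ hJ' c η hc hη
    obtain ⟨hU, hU'⟩ := HA.sortEq (dA _ hJ)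
    have dJ' := dB _ hJ'
    have hV := HB.term dJ'
    obtain ⟨g, hg⟩ := exists_getElem_eq X fun p => tb c η v p.1
    refine ⟨_, _, hJ, hJ', ?_⟩
    rw [← tso_pairsL hA hB hc hη hU hV (fB Y) hg]
    exact .seqt ((tCtx_snoc hA hB hc hη fA hU (HB.ctx hV)).2 rfl)
      ((ttg_left_iff hA hB hc hη hU dJ').2 rfl) ((ttg_left_iff hA hB hc hη hU' dJ').2 rfl)
      (TSo.total hA hB hc hη (fA X) (fB Y) hU hV)
      fun i hi => (ttg_take_left_iff hA hB hc hη (HA.ctx hU) dJ' hi).2 (hg i hi)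
  case steq =>
    intro X U Y v v' V hJ hJ' c η hc hη
    have dJ := dA _ hJ
    obtain ⟨hv, hv'⟩ := HB.termEq (dB _ hJ')
    have hV := HB.term hv
    obtain ⟨g, hg⟩ := exists_getElem_eq X fun p => tb c η v p.1
    refine ⟨_, _, hJ, hJ', ?_⟩
    rw [← tso_pairsL hA hB hc hη dJ hV (fB Y) hg]
    exact .steq ((tCtx_snoc hA hB hc hη fA dJ (HB.ctx hV)).2 rfl)
      ((ttg_left_iff hA hB hc hη dJ hv).2 rfl) ((ttg_left_iff hA hB hc hη dJ hv').2 rfl)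
      (TSo.total hA hB hc hη (fA X) (fB Y) dJ hV)
      fun i hi => (ttg_take_left_iff hA hB hc hη (HA.ctx dJ) hv hi).2 (hg i hi)
  case ts =>
    intro X u U Y V hJ hJ' c η hc hη
    have dJ := dA _ hJ
    have dJ' := dB _ hJ'
    have hU := HA.term dJ
    obtain ⟨g, hg⟩ := exists_getElem_eq Y fun q => η q.1 u
    refine ⟨_, _, hJ, hJ', ?_⟩
    rw [← tso_pairsR hA hB hc hη hU dJ' (fA X) hg]
    exact .ts ((tCtx_snoc_right hA hB hc hη fB (HA.ctx hU) dJ').2 rfl)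
      ((ttg_right_iff hA hB hc hη dJ dJ').2 rfl) (TSo.total hA hB hc hη (fA X) (fB Y) hU dJ')
      fun j hj => (ttg_take_right_iff hA hB hc hη dJ (HB.ctx dJ') hj).2 (hg j hj)
  case teqs =>
    intro X u u' U Y V hJ hJ' c η hc hη
    obtain ⟨hu, hu'⟩ := HA.termEq (dA _ hJ)
    have dJ' := dB _ hJ'
    have hU := HA.term hu
    obtain ⟨g, hg⟩ := exists_getElem_eq Y fun q => η q.1 u
    refine ⟨_, _, hJ, hJ', ?_⟩
    rw [← tso_pairsR hA hB hc hη hU dJ' (fA X) hg]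
    exact .teqs ((tCtx_snoc_right hA hB hc hη fB (HA.ctx hU) dJ').2 rfl)
      ((ttg_right_iff hA hB hc hη hu dJ').2 rfl) ((ttg_right_iff hA hB hc hη hu' dJ').2 rfl)
      (TSo.total hA hB hc hη (fA X) (fB Y) hU dJ')
      fun j hj => (ttg_take_right_iff hA hB hc hη hu (HB.ctx dJ') hj).2 (hg j hj)
  case tseq =>
    intro X u U Y V V' hJ hJ' c η hc hη
    have dJ := dA _ hJ
    obtain ⟨hV, hV'⟩ := HB.sortEq (dB _ hJ')
    have hU := HA.term dJ
    obtain ⟨g, hg⟩ := exists_getElem_eq Y fun q => η q.1 u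
    refine ⟨_, _, hJ, hJ', ?_⟩
    rw [← tso_pairsR hA hB hc hη hU hV (fA X) hg]
    exact .tseq ((tCtx_snoc_right hA hB hc hη fB (HA.ctx hU) hV).2 rfl)
      ((ttg_right_iff hA hB hc hη dJ hV).2 rfl) ((ttg_right_iff hA hB hc hη dJ hV').2 rfl)
      (TSo.total hA hB hc hη (fA X) (fB Y) hU hV)
      fun j hj => (ttg_take_right_iff hA hB hc hη dJ (HB.ctx hV) hj).2 (hg j hj)
  case tt =>
    intro X u U Y v V hJ hJ' c η hc hη
    have dJ := dA _ hJ
    have dJ' := dB _ hJ'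
    have hU := HA.term dJ
    have hV := HB.term dJ'
    obtain ⟨gx, hgx⟩ := exists_getElem_eq X fun p => tb c η v p.1
    obtain ⟨gy, hgy⟩ := exists_getElem_eq Y fun q => η q.1 u
    refine ⟨_, _, hJ, hJ', ?_⟩
    rw [← tso_pairsLR hA hB hc hη hU hV (fA X) (fB Y) hgx hgy]
    obtain ⟨s, rfl⟩ := hA.term_shape _ _ _ hJ
    obtain ⟨t, rfl⟩ := hB.term_shape _ _ _ hJ'
    exact .tt ((tCtx_iff hA hB (HA.ctx hU) (HB.ctx hV) (hc.mono (List.dropLast_subset _))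
        (hη.mono (List.dropLast_subset _))).2 rfl)
      ((ttg_iff hA hB hc hη (dJ.argOK hA) (dJ'.argOK hB)).2 rfl)
      (ttd_app hA hB hc hη fB dJ dJ') (TSo.total hA hB hc hη (fA X) (fB Y) hU hV)
      (fun i hi => (ttg_take_left_iff hA hB hc hη (HA.ctx hU) dJ' hi).2 (hgx i hi))
      fun j hj => (ttg_take_right_iff hA hB hc hη dJ (HB.ctx hV) hj).2 (hgy j hj)

end Axioms

/-! ## The tensor product is a pretheory -/

section Pretheory

variable {TA : Set (Judg A)} {TB : Set (Judg B)}
  {c : Expr A → SortE A} {η : B.Var → Expr A → Expr (A.tensor B)}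
  {X : PreCtx A} {Y : PreCtx B} {u : Expr A} {U : SortE A} {v : Expr B} {V : SortE B}
  {chA : PreCtx A → A.Var} {chB : PreCtx B → B.Var}

theorem Occurs.fixed {k : A.Var} {e : Expr A} (h : Occurs k e) {σ : A.Var → Expr A}
    (he : e.subst σ = e) : σ k = .var k := by
  induction h with
  | var => simpa [Expr.subst_var] using he
  | @app t es e hm _ ih =>
    rw [Expr.subst_app] at he
    injection he with _ he
    exact ih (List.map_inj_left.1 (he.trans (List.map_id es).symm) e hm)

theorem SOccurs.fixed {k : A.Var} {U : SortE A} (h : SOccurs k U) {σ : A.Var → Expr A}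
    (hU : U.subst σ = U) : σ k = .var k := by
  obtain ⟨e, he, hk⟩ := h
  exact hk.fixed
    (List.map_inj_left.1 ((congrArg SortE.args hU).trans (List.map_id U.args).symm) e he)

theorem tc_length : (tc c η X Y).length = X.length * Y.length := flatMap_map_length ..

theorem tc_getElem? {i j : ℕ} (hi : i < X.length) (hj : j < Y.length) :
    (tc c η X Y)[i * Y.length + j]? = some ((X[i].1, Y[j].1),
      tso c η (.var X[i].1) X[i].2 Y[j].2 (vr Y[j].1)) := flatMap_map_getElem? X Y _ hi hj

theorem mem_take_tc {i j k : ℕ} (hi : i < X.length) (hj : j < Y.length)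
    (h : i * Y.length + j < k) : (X[i].1, Y[j].1) ∈ ((tc c η X Y).take k).map Prod.fst := by
  refine List.mem_map.2 ⟨((X[i].1, Y[j].1), tso c η (.var X[i].1) X[i].2 Y[j].2 (vr Y[j].1)),
    List.mem_of_getElem? (i := i * Y.length + j) ?_, rfl⟩
  rw [List.getElem?_take_of_lt h, tc_getElem? hi hj]

theorem isPreCtx_tc (hA : IsPretheory TA) (hB : IsPretheory TB) (hX : Derivable TA (.ctx X))
    (hY : Derivable TB (.ctx Y)) (hc : COK TA X.dropLast c) (hη : EOK c η Y.dropLast) :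
    IsPreCtx (tc c η X Y) := by
  classical
  intro k hk w hw
  by_contra hn
  have hk' : k < X.length * Y.length := tc_length (c := c) (η := η) ▸ hk
  have hY0 : 0 < Y.length := Nat.pos_of_ne_zero fun h => by simp [h] at hk'
  have hi : k / Y.length < X.length := Nat.div_lt_of_lt_mul (Nat.mul_comm _ _ ▸ hk')
  have hj : k % Y.length < Y.length := Nat.mod_lt _ hY0
  have hkk : k / Y.length * Y.length + k % Y.length = k := by
    rw [Nat.mul_comm]; exact Nat.div_add_mod ..
  generalize k / Y.length = i at *
  generalize k % Y.length = j at *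
  have e : (tc c η X Y)[k] = ((X[i].1, Y[j].1),
      tso c η (.var X[i].1) X[i].2 Y[j].2 (vr Y[j].1)) := by
    have := tc_getElem? (c := c) (η := η) hi hj
    rw [hkk, List.getElem?_eq_getElem hk] at this
    exact Option.some.inj this
  rw [e] at hw
  obtain ⟨w', hw'⟩ := exists_ne w
  let Θ : (A.tensor B).Var → Expr (A.tensor B) := fun z => if z = w then .var w' else .var z
  have hΘ : ∀ i' j' (hi' : i' < X.length) (hj' : j' < Y.length),
      i' < i ∨ i' = i ∧ j' < j → Θ (X[i'].1, Y[j'].1) = .var (X[i'].1, Y[j'].1) := by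
    intro i' j' hi' hj' h
    simp only [Θ]
    rw [if_neg]
    intro hz
    refine hn (hz ▸ mem_take_tc hi' hj' ?_)
    rcases h with h | ⟨rfl, h⟩
    · have := Nat.mul_le_mul_right Y.length (Nat.succ_le_of_lt h)
      rw [Nat.succ_mul] at this
      omega
    · omega
  have hη' := hη.mono (take_subset_dropLast hj)
  have hfix := SOccurs.fixed hw (σ := Θ) (tso_subst hA hB
    (hc.mono (take_subset_dropLast hi)) hη' (take_sort hA hX hi) (take_sort hB hY hj)
    (fun p hp q hq => ?_) (fun q hq => ?_) fun p hp => ?_)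
  · have hw0 : Θ w = .var w' := if_pos rfl
    rw [hw0] at hfix
    injection hfix with hfix
    exact hw' hfix
  · obtain ⟨i', hi', rfl⟩ := List.mem_take_iff_getElem.1 hp
    obtain ⟨j', hj', rfl⟩ := List.mem_take_iff_getElem.1 hq
    exact hΘ i' j' (by omega) (by omega) (Or.inl (by omega))
  · rw [hη' q hq, vty_var, vr, Expr.subst_var]
    obtain ⟨j', hj', rfl⟩ := List.mem_take_iff_getElem.1 hq
    exact hΘ i j' hi (by omega) (Or.inr ⟨rfl, by omega⟩)
  · rw [vr, Expr.subst_var]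
    obtain ⟨i', hi', rfl⟩ := List.mem_take_iff_getElem.1 hp
    exact hΘ i' j (by omega) hj (Or.inl (by omega))

theorem IsPreCtx.dropLast {Z : PreCtx A} (h : IsPreCtx Z) : IsPreCtx Z.dropLast := by
  intro i hi w hw
  have hi' : i < Z.length - 1 := by simpa using hi
  rw [List.getElem_dropLast] at hw
  rw [List.dropLast_eq_take, List.take_take, min_eq_left (by omega)]
  exact h i (by omega) w hw

theorem ctxVars_tc : ctxVars (tc c η X Y) =
    (ctxVars X).flatMap fun s => Y.map fun q => vty c η q.2 (vr q.1) s := by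
  simp only [ctxVars, tc, List.map_flatMap, List.map_map, List.flatMap_map]
  refine List.flatMap_congr fun p _ => List.map_congr_left fun q _ => ?_
  simp [vty_var, vr]

theorem EOK.map_tenB (h : EOK c η Y) (s : Expr A) (U : SortE A) :
    ((ctxVars Y).map fun v => tenB c η v s U) = Y.map fun q => vty c η q.2 (vr q.1) s := by
  rw [ctxVars, List.map_map]
  exact List.map_congr_left fun q hq => by simpa [tenB_var] using h q hq s

theorem tso_args_intro (h : EOK c η Y) (hU : U.args = ctxVars X) (hV : V.args = ctxVars Y)
    (x : A.Var) (y : B.Var) : (tso c η (.var x) U V (vr y)).args =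
      ctxVars (zm c η X (x, U) Y [(y, V)]) := by
  have e : ∀ L L' : PreCtx (A.tensor B), ctxVars (L ++ L') = ctxVars L ++ ctxVars L' :=
    fun L L' => List.map_append
  rw [zm, e, ctxVars_tc, ctxVars_tc]
  simp only [tso, tsoArgs, hU, hV, h.map_tenB]
  simp [ctxVars]

theorem tenB_intro (h : EOK c η Y) (hU : U.args = ctxVars X) (x : A.Var) (t : B.TermSym) :
    tenB c η (.app t (ctxVars Y)) (.var x) U =
      .app (Sum.inl (U.head, t)) (ctxVars (zm c η X (x, U) Y [])) := by
  rw [zm_nil, ctxVars_tc, tenB_app]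
  simp only [hU, h.map_tenB]
  simp [ctxVars]

theorem vty_intro (h : EOK c η Y) (hV : V.args = ctxVars Y) (y : B.Var) (s : A.TermSym) :
    vty c η V (vr y) (.app s (ctxVars X)) =
      .app (Sum.inr (s, V.head)) (ctxVars (tc c η X (Y ++ [(y, V)]))) := by
  rw [ctxVars_tc, vty_app]
  simp only [hV, h.map_tenB]
  simp

theorem Derivable.exists_cok (hA : IsPretheory TA) {J : Judg A} (h : Derivable TA J)
    (hJ : ∀ X, J ≠ .ctx X) : ∃ c, COK TA J.ctxOf c := by
  have hn := Derivable.ctx_nodup h.ctx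
  cases J with
  | ctx X => exact absurd rfl (hJ X)
  | sort X U => exact GATPaper.exists_cok hA U hn
  | term X u U => exact GATPaper.exists_cok hA U hn
  | sortEq X U V => exact GATPaper.exists_cok hA U hn
  | termEq X u v U => exact GATPaper.exists_cok hA U hn

theorem TJudg.exists_res (hA : IsPretheory TA) (hB : IsPretheory TB) (fA : FreshCh chA)
    (fB : FreshCh chB) {J : Judg A} {J' : Judg B} {K : Judg (A.tensor B)}
    (h : TJudg TA TB chA chB false J J' K) (hJ : Derivable TA J) (hJ' : Derivable TB J') :
    ∃ c η, COK TA J.ctxOf c ∧ EOK c η J'.ctxOf ∧ TRes c η chA chB J J' K := by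
  obtain ⟨c, hc⟩ := hJ.exists_cok hA (by rintro X rfl; cases h)
  obtain ⟨η, hη⟩ := exists_eok hB c hJ'.ctx
  exact ⟨c, η, hc, hη, h.res hA hB fA fB hJ hJ' hc hη⟩

theorem isPreCtx_zm_singleton (hA : IsPretheory TA) (hB : IsPretheory TB) (fA : FreshCh chA)
    (fB : FreshCh chB) (hU : Derivable TA (.sort X U)) (hV : Derivable TB (.sort Y V))
    (hc : COK TA X c) (hη : EOK c η Y) : IsPreCtx (zm c η X (chA X, U) Y [(chB Y, V)]) := by
  rw [← tc_dropLast]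
  exact (isPreCtx_tc hA hB (Derivable.snoc hA hU (fA X)) (Derivable.snoc hB hV (fB Y))
    (by rwa [List.dropLast_concat]) (by rwa [List.dropLast_concat])).dropLast

theorem isPreCtx_zm_nil (hA : IsPretheory TA) (hB : IsPretheory TB) (fA : FreshCh chA)
    (hU : Derivable TA (.sort X U)) (hY : Derivable TB (.ctx Y))
    (hc : COK TA X c) (hη : EOK c η Y) : IsPreCtx (zm c η X (chA X, U) Y []) := by
  rw [zm_nil]
  exact isPreCtx_tc hA hB (Derivable.snoc hA hU (fA X)) hY (by rwa [List.dropLast_concat])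
    (hη.mono (List.dropLast_subset Y))

theorem isPreCtx_tc_concat (hA : IsPretheory TA) (hB : IsPretheory TB) (fB : FreshCh chB)
    (hX : Derivable TA (.ctx X)) (hV : Derivable TB (.sort Y V))
    (hc : COK TA X c) (hη : EOK c η Y) : IsPreCtx (tc c η X (Y ++ [(chB Y, V)])) :=
  isPreCtx_tc hA hB hX (Derivable.snoc hB hV (fB Y)) (hc.mono (List.dropLast_subset X))
    (by rwa [List.dropLast_concat])

theorem TRes.isPreCtx (hA : IsPretheory TA) (hB : IsPretheory TB) (fA : FreshCh chA)
    (fB : FreshCh chB) {J : Judg A} {J' : Judg B} {K : Judg (A.tensor B)}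
    (h : TRes c η chA chB J J' K) (hJ : Derivable TA J) (hJ' : Derivable TB J')
    (hc : COK TA J.ctxOf c) (hη : EOK c η J'.ctxOf) : IsPreCtx K.ctxOf := by
  have HA := Derivable.hered hA
  have HB := Derivable.hered hB
  cases h with
  | ss => exact isPreCtx_zm_singleton hA hB fA fB hJ hJ' hc hη
  | seqs => exact isPreCtx_zm_singleton hA hB fA fB (HA.sortEq hJ).1 hJ' hc hη
  | sseq => exact isPreCtx_zm_singleton hA hB fA fB hJ (HB.sortEq hJ').1 hc hη
  | st => exact isPreCtx_zm_nil hA hB fA hJ hJ'.ctx hc hη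
  | seqt => exact isPreCtx_zm_nil hA hB fA (HA.sortEq hJ).1 hJ'.ctx hc hη
  | steq => exact isPreCtx_zm_nil hA hB fA hJ hJ'.ctx hc hη
  | ts => exact isPreCtx_tc_concat hA hB fB hJ.ctx hJ' hc hη
  | teqs => exact isPreCtx_tc_concat hA hB fB hJ.ctx hJ' hc hη
  | tseq => exact isPreCtx_tc_concat hA hB fB hJ.ctx (HB.sortEq hJ').1 hc hη
  | tt =>
    exact isPreCtx_tc hA hB hJ.ctx hJ'.ctx (hc.mono (List.dropLast_subset _))
      (hη.mono (List.dropLast_subset _))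

theorem sort_mem_tensorAx (hA : IsGAT TA) (hB : IsGAT TB) (fA : FreshCh chA) (fB : FreshCh chB)
    {Z : PreCtx (A.tensor B)} {W : SortE (A.tensor B)}
    (h : Judg.sort Z W ∈ tensorAx TA TB chA chB) :
    ∃ X U Y V, .sort X U ∈ TA ∧ .sort Y V ∈ TB ∧ ∀ c η, COK TA X c → EOK c η Y →
      Z = zm c η X (chA X, U) Y [(chB Y, V)] ∧ W = tso c η (.var (chA X)) U V (vr (chB Y)) := by
  obtain ⟨J, J', hJ, hJ', h⟩ := h
  have res := fun c η (hc : COK TA J.ctxOf c) (hη : EOK c η J'.ctxOf) =>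
    h.res hA.1 hB.1 fA fB (hA.2 _ hJ) (hB.2 _ hJ') hc hη
  generalize hK : Judg.sort Z W = K at res h
  cases h with
  | ss =>
    refine ⟨_, _, _, _, hJ, hJ', fun c η hc hη => ?_⟩
    rw [← hK] at res
    generalize hK' : Judg.sort Z W = K at res
    cases res c η hc hη
    injection hK' with h1 h2
    exact ⟨h1, h2⟩
  | _ => cases hK

theorem term_mem_tensorAx (hA : IsGAT TA) (hB : IsGAT TB) (fA : FreshCh chA) (fB : FreshCh chB)
    {Z : PreCtx (A.tensor B)} {e : Expr (A.tensor B)} {W : SortE (A.tensor B)}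
    (h : Judg.term Z e W ∈ tensorAx TA TB chA chB) :
    (∃ X U Y v V, .sort X U ∈ TA ∧ .term Y v V ∈ TB ∧ ∀ c η, COK TA X c → EOK c η Y →
      Z = zm c η X (chA X, U) Y [] ∧ e = tenB c η v (.var (chA X)) U ∧
      W = tso c η (.var (chA X)) U V (tb c η v)) ∨
    ∃ X u U Y V, .term X u U ∈ TA ∧ .sort Y V ∈ TB ∧ ∀ c η, COK TA X c → EOK c η Y →
      Z = tc c η X (Y ++ [(chB Y, V)]) ∧ e = vty c η V (vr (chB Y)) u ∧
      W = tso c η u U V (vr (chB Y)) := by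
  obtain ⟨J, J', hJ, hJ', h⟩ := h
  have res := fun c η (hc : COK TA J.ctxOf c) (hη : EOK c η J'.ctxOf) =>
    h.res hA.1 hB.1 fA fB (hA.2 _ hJ) (hB.2 _ hJ') hc hη
  generalize hK : Judg.term Z e W = K at res h
  cases h with
  | st =>
    refine Or.inl ⟨_, _, _, _, _, hJ, hJ', fun c η hc hη => ?_⟩
    rw [← hK] at res
    generalize hK' : Judg.term Z e W = K at res
    cases res c η hc hη
    injection hK' with h1 h2 h3
    exact ⟨h1, h2, h3⟩
  | ts =>
    refine Or.inr ⟨_, _, _, _, _, hJ, hJ', fun c η hc hη => ?_⟩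
    rw [← hK] at res
    generalize hK' : Judg.term Z e W = K at res
    cases res c η hc hη
    injection hK' with h1 h2 h3
    exact ⟨h1, h2, h3⟩
  | _ => cases hK

theorem tensorAx_sort_shape (hA : IsGAT TA) (hB : IsGAT TB) (fA : FreshCh chA)
    (fB : FreshCh chB) {Z : PreCtx (A.tensor B)} {W : SortE (A.tensor B)}
    (h : Judg.sort Z W ∈ tensorAx TA TB chA chB) : W.args = ctxVars Z := by
  obtain ⟨X, U, Y, V, hU, hV, e⟩ := sort_mem_tensorAx hA hB fA fB h
  obtain ⟨c, hc⟩ := (hA.2 _ hU).exists_cok hA.1 (by simp)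
  obtain ⟨η, hη⟩ := exists_eok hB.1 c (hB.2 _ hV).ctx
  obtain ⟨rfl, rfl⟩ := e c η hc hη
  exact tso_args_intro hη (hA.1.sort_shape _ _ hU) (hB.1.sort_shape _ _ hV) _ _

theorem tensorAx_term_shape (hA : IsGAT TA) (hB : IsGAT TB) (fA : FreshCh chA)
    (fB : FreshCh chB) {Z : PreCtx (A.tensor B)} {e : Expr (A.tensor B)} {W : SortE (A.tensor B)}
    (h : Judg.term Z e W ∈ tensorAx TA TB chA chB) :
    ∃ t, e = .app t (ctxVars Z) := by
  obtain ⟨X, U, Y, v, V, hU, hv, e⟩ | ⟨X, u, U, Y, V, hu, hV, e⟩ := term_mem_tensorAx hA hB fA fB h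
  · obtain ⟨c, hc⟩ := (hA.2 _ hU).exists_cok hA.1 (by simp)
    obtain ⟨η, hη⟩ := exists_eok hB.1 c (hB.2 _ hv).ctx
    obtain ⟨rfl, rfl, rfl⟩ := e c η hc hη
    obtain ⟨t, rfl⟩ := hB.1.term_shape _ _ _ hv
    exact ⟨_, tenB_intro hη (hA.1.sort_shape _ _ hU) _ t⟩
  · obtain ⟨c, hc⟩ := (hA.2 _ hu).exists_cok hA.1 (by simp)
    obtain ⟨η, hη⟩ := exists_eok hB.1 c (hB.2 _ hV).ctx
    obtain ⟨rfl, rfl, rfl⟩ := e c η hc hη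
    obtain ⟨t, rfl⟩ := hA.1.term_shape _ _ _ hu
    exact ⟨_, vty_intro hη (hB.1.sort_shape _ _ hV) _ t⟩

theorem tensorAx_sort_intro (hA : IsGAT TA) (hB : IsGAT TB) (fA : FreshCh chA)
    (fB : FreshCh chB) (S : (A.tensor B).SortSym) :
    ∃! Z, introSort Z S ∈ tensorAx TA TB chA chB := by
  obtain ⟨S, S'⟩ := S
  obtain ⟨X, hX, uX⟩ := hA.1.sort_intro S
  obtain ⟨Y, hY, uY⟩ := hB.1.sort_intro S'
  obtain ⟨c, hc⟩ := (hA.2 _ hX).exists_cok hA.1 (by simp [introSort])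
  obtain ⟨η, hη⟩ := exists_eok hB.1 c (hB.2 _ hY).ctx
  refine ⟨zm c η X (chA X, ⟨S, ctxVars X⟩) Y [(chB Y, ⟨S', ctxVars Y⟩)], ?_, ?_⟩
  · have h := (tensorAx_tAx hA hB fA fB).ss hX hY hc hη
    have := tensorAx_sort_shape hA hB fA fB h
    rwa [SortE.ext' (U := tso ..) (V := ⟨(S, S'), _⟩) rfl this] at h
  · intro Z hZ
    obtain ⟨X1, U, Y1, V, hU, hV, e⟩ := sort_mem_tensorAx hA hB fA fB hZ
    have eU : U = ⟨U.head, ctxVars X1⟩ := SortE.ext' rfl (hA.1.sort_shape _ _ hU)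
    have eV : V = ⟨V.head, ctxVars Y1⟩ := SortE.ext' rfl (hB.1.sort_shape _ _ hV)
    have hh : U.head = S ∧ V.head = S' := by
      obtain ⟨c1, hc1⟩ := (hA.2 _ hU).exists_cok hA.1 (by simp)
      obtain ⟨η1, hη1⟩ := exists_eok hB.1 c1 (hB.2 _ hV).ctx
      have := congrArg SortE.head (e c1 η1 hc1 hη1).2
      exact ⟨(congrArg Prod.fst this).symm, (congrArg Prod.snd this).symm⟩
    rw [hh.1] at eU
    rw [hh.2] at eV
    subst eU eV
    obtain rfl := uX _ hU
    obtain rfl := uY _ hV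
    exact (e c η hc hη).1

theorem tensorAx_term_intro_left (hA : IsGAT TA) (hB : IsGAT TB) (fA : FreshCh chA)
    (fB : FreshCh chB) (S : A.SortSym) (t : B.TermSym) :
    ∃! p : PreCtx (A.tensor B) × SortE (A.tensor B),
      introTerm p.1 (Sum.inl (S, t)) p.2 ∈ tensorAx TA TB chA chB := by
  obtain ⟨X, hX, uX⟩ := hA.1.sort_intro S
  obtain ⟨⟨Y, V⟩, hY, uY⟩ := hB.1.term_intro t
  obtain ⟨c, hc⟩ := (hA.2 _ hX).exists_cok hA.1 (by simp [introSort])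
  obtain ⟨η, hη⟩ := exists_eok hB.1 c (hB.2 _ hY).ctx
  refine ⟨(zm c η X (chA X, ⟨S, ctxVars X⟩) Y [],
    tso c η (.var (chA X)) ⟨S, ctxVars X⟩ V (tb c η (.app t (ctxVars Y)))), ?_, ?_⟩
  · have h := (tensorAx_tAx hA hB fA fB).st hX hY hc hη
    rwa [show (Y, V).1 = Y from rfl, tenB_intro (X := X) (Y := Y) hη rfl] at h
  · rintro ⟨Z, W⟩ hZ
    obtain ⟨X1, U, Y1, v, V1, hU, hv, e⟩ | ⟨X1, u, U, Y1, V1, hu, hV, e⟩ :=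
      term_mem_tensorAx hA hB fA fB hZ
    · obtain ⟨t', rfl⟩ := hB.1.term_shape _ _ _ hv
      have sU := hA.1.sort_shape _ _ hU
      have eU : U = ⟨U.head, ctxVars X1⟩ := SortE.ext' rfl sU
      have hh : U.head = S ∧ t' = t := by
        obtain ⟨c1, hc1⟩ := (hA.2 _ hU).exists_cok hA.1 (by simp)
        obtain ⟨η1, hη1⟩ := exists_eok hB.1 c1 (hB.2 _ hv).ctx
        have := (e c1 η1 hc1 hη1).2.1
        rw [tenB_intro (X := X1) (Y := Y1) hη1 sU] at this
        injection this with this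
        injection this with this
        injection this with h1 h2
        exact ⟨h1.symm, h2.symm⟩
      obtain ⟨hS, rfl⟩ := hh
      rw [hS] at eU
      subst eU
      obtain rfl := uX _ hU
      obtain ⟨rfl, rfl⟩ := Prod.ext_iff.1 (uY (Y1, V1) hv)
      exact Prod.ext_iff.2 ⟨(e c η hc hη).1, (e c η hc hη).2.2⟩
    · obtain ⟨t', rfl⟩ := hA.1.term_shape _ _ _ hu
      obtain ⟨c1, hc1⟩ := (hA.2 _ hu).exists_cok hA.1 (by simp)
      obtain ⟨η1, hη1⟩ := exists_eok hB.1 c1 (hB.2 _ hV).ctx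
      have := (e c1 η1 hc1 hη1).2.1
      rw [vty_intro (X := X1) (Y := Y1) hη1 (hB.1.sort_shape _ _ hV)] at this
      injection this with this
      cases this

theorem tensorAx_term_intro_right (hA : IsGAT TA) (hB : IsGAT TB) (fA : FreshCh chA)
    (fB : FreshCh chB) (s : A.TermSym) (S : B.SortSym) :
    ∃! p : PreCtx (A.tensor B) × SortE (A.tensor B),
      introTerm p.1 (Sum.inr (s, S)) p.2 ∈ tensorAx TA TB chA chB := by
  obtain ⟨⟨X, U⟩, hX, uX⟩ := hA.1.term_intro s
  obtain ⟨Y, hY, uY⟩ := hB.1.sort_intro S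
  obtain ⟨c, hc⟩ := (hA.2 _ hX).exists_cok hA.1 (by simp [introTerm])
  obtain ⟨η, hη⟩ := exists_eok hB.1 c (hB.2 _ hY).ctx
  refine ⟨(tc c η X (Y ++ [(chB Y, ⟨S, ctxVars Y⟩)]),
    tso c η (.app s (ctxVars X)) U ⟨S, ctxVars Y⟩ (vr (chB Y))), ?_, ?_⟩
  · have h := (tensorAx_tAx hA hB fA fB).ts hX hY hc hη
    rwa [show (X, U).1 = X from rfl, vty_intro (X := X) (Y := Y) hη rfl] at h
  · rintro ⟨Z, W⟩ hZ
    obtain ⟨X1, U1, Y1, v, V, hU, hv, e⟩ | ⟨X1, u, U1, Y1, V, hu, hV, e⟩ :=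
      term_mem_tensorAx hA hB fA fB hZ
    · obtain ⟨t', rfl⟩ := hB.1.term_shape _ _ _ hv
      obtain ⟨c1, hc1⟩ := (hA.2 _ hU).exists_cok hA.1 (by simp)
      obtain ⟨η1, hη1⟩ := exists_eok hB.1 c1 (hB.2 _ hv).ctx
      have := (e c1 η1 hc1 hη1).2.1
      rw [tenB_intro (X := X1) (Y := Y1) hη1 (hA.1.sort_shape _ _ hU)] at this
      injection this with this
      cases this
    · obtain ⟨s', rfl⟩ := hA.1.term_shape _ _ _ hu
      have sV := hB.1.sort_shape _ _ hV
      have eV : V = ⟨V.head, ctxVars Y1⟩ := SortE.ext' rfl sV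
      have hh : s' = s ∧ V.head = S := by
        obtain ⟨c1, hc1⟩ := (hA.2 _ hu).exists_cok hA.1 (by simp)
        obtain ⟨η1, hη1⟩ := exists_eok hB.1 c1 (hB.2 _ hV).ctx
        have := (e c1 η1 hc1 hη1).2.1
        rw [vty_intro (X := X1) (Y := Y1) hη1 sV] at this
        injection this with this
        injection this with this
        injection this with h1 h2
        exact ⟨h1.symm, h2.symm⟩
      obtain ⟨rfl, hS⟩ := hh
      rw [hS] at eV
      subst eV
      obtain rfl := uY _ hV
      obtain ⟨rfl, rfl⟩ := Prod.ext_iff.1 (uX (X1, U1) hu)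
      exact Prod.ext_iff.2 ⟨(e c η hc hη).1, (e c η hc hη).2.2⟩

theorem isPretheory_tensorAx (hA : IsGAT TA) (hB : IsGAT TB) (fA : FreshCh chA)
    (fB : FreshCh chB) : IsPretheory (tensorAx TA TB chA chB) where
  no_ctx := by
    rintro Z ⟨J, J', -, -, h⟩
    cases h
  wf_ctx := by
    rintro K ⟨J, J', hJ, hJ', h⟩
    obtain ⟨c, η, hc, hη, r⟩ := h.exists_res hA.1 hB.1 fA fB (hA.2 _ hJ) (hB.2 _ hJ')
    exact r.isPreCtx hA.1 hB.1 fA fB (hA.2 _ hJ) (hB.2 _ hJ') hc hη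
  sort_intro := tensorAx_sort_intro hA hB fA fB
  sort_shape _ _ h := tensorAx_sort_shape hA hB fA fB h
  term_intro := by
    rintro (⟨S, t⟩ | ⟨s, S⟩)
    · exact tensorAx_term_intro_left hA hB fA fB S t
    · exact tensorAx_term_intro_right hA hB fA fB s S
  term_shape _ _ _ h := tensorAx_term_shape hA hB fA fB h

end Pretheory

/-! ## Derivability of the tensor product of judgments -/

section Main

variable {TA : Set (Judg A)} {TB : Set (Judg B)} {T : Set (Judg (A.tensor B))}
  {c : Expr A → SortE A} {η : B.Var → Expr A → Expr (A.tensor B)}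
  {X : PreCtx A} {Y : PreCtx B} {u : Expr A} {U : SortE A} {v : Expr B} {V : SortE B}
  {chA : PreCtx A → A.Var} {chB : PreCtx B → B.Var}

theorem ih_derivable (hA : IsPretheory TA) (hB : IsPretheory TB) (hP : IsPretheory T)
    (hT : TAx TA TB T chA chB) (fA : FreshCh chA) (fB : FreshCh chB) :
    IH TA TB T (Derivable TB) where
  hA := hA
  hB := hB
  hP := hP
  her := Derivable.hered hB
  der := id
  good h _ h' := good hA hB hP hT fA fB h h'

theorem env_zm_singleton (I : IH TA TB T (Derivable TB)) (fA : FreshCh chA) (fB : FreshCh chB)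
    (hU : Derivable TA (.sort X U)) (hV : Derivable TB (.sort Y V)) (hc : COK TA X c)
    (hη : EOK c η Y) : Env TA TB T c η X Y (zm c η X (chA X, U) Y [(chB Y, V)]) :=
  zm_ctx_singleton I (p := (chA X, U)) hU (fA X) hc hη hV.ctx (q := (chB Y, V)) (fB Y) hV
    fun _ _ hp => I.good hV ((Derivable.hered I.hA).prefix_sort hU.ctx hp)

theorem env_tc_concat (I : IH TA TB T (Derivable TB)) (fA : FreshCh chA) (fB : FreshCh chB)
    (hU : Derivable TA (.sort X U)) (hV : Derivable TB (.sort Y V)) (hc : COK TA X c)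
    (hη : EOK c η Y) : Env TA TB T c η X Y (tc c η X (Y ++ [(chB Y, V)])) :=
  (env_zm_singleton I fA fB hU hV hc hη).tc_env I.hP

theorem env_zm_nil (I : IH TA TB T (Derivable TB)) (fA : FreshCh chA)
    (hU : Derivable TA (.sort X U)) (hY : Derivable TB (.ctx Y)) (hc : COK TA X c)
    (hη : EOK c η Y) : Env TA TB T c η X Y (zm c η X (chA X, U) Y []) :=
  zm_ctx_nil I (p := (chA X, U)) hU (fA X) hc hη hY

theorem env_tc (I : IH TA TB T (Derivable TB)) (fA : FreshCh chA)
    (hU : Derivable TA (.sort X U)) (hY : Derivable TB (.ctx Y)) (hc : COK TA X c)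
    (hη : EOK c η Y) : Env TA TB T c η X Y (tc c η X Y) := by
  simpa using (env_zm_nil I fA hU hY hc hη).tc_env I.hP

theorem TRes.derivable (I : IH TA TB T (Derivable TB)) (fA : FreshCh chA) (fB : FreshCh chB)
    {J : Judg A} {J' : Judg B} {K : Judg (A.tensor B)} (h : TRes c η chA chB J J' K)
    (hJ : Derivable TA J) (hJ' : Derivable TB J') (hc : COK TA J.ctxOf c)
    (hη : EOK c η J'.ctxOf) : Derivable T K := by
  have HA := Derivable.hered I.hA
  have HB := Derivable.hered I.hB
  have hP := I.hP
  have g := I.good hJ' hJ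
  cases h with
  | ss =>
    have E := env_zm_singleton I fA fB hJ hJ' hc hη
    exact g c η _ E _ _ (E.zm_act hP) (E.zm_actB hP)
  | seqs =>
    have E := env_zm_singleton I fA fB (HA.sortEq hJ).1 hJ' hc hη
    exact g c η _ E _ _ (E.zm_act hP) (E.zm_actB hP)
  | sseq =>
    have E := env_zm_singleton I fA fB hJ (HB.sortEq hJ').1 hc hη
    exact g c η _ E _ _ (E.zm_act hP) (E.zm_actB hP)
  | st =>
    have E := env_zm_nil I fA hJ hJ'.ctx hc hη
    exact g c η _ E _ (E.zm_act hP)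
  | seqt =>
    have E := env_zm_nil I fA (HA.sortEq hJ).1 hJ'.ctx hc hη
    exact (g c η _ E _ (E.zm_act hP)).at hP (I.good hJ' (HA.sortEq hJ).1 c η _ E _ (E.zm_act hP))
  | steq =>
    have E := env_zm_nil I fA hJ hJ'.ctx hc hη
    exact (g c η _ E _ (E.zm_act hP)).at hP (I.good (HB.termEq hJ').1 hJ c η _ E _ (E.zm_act hP))
  | ts =>
    have E := env_tc_concat I fA fB (HA.term hJ) hJ' hc hη
    exact g c η _ E _ (E.tc_actB hP)
  | teqs =>
    have E := env_tc_concat I fA fB (HA.term (HA.termEq hJ).1) hJ' hc hη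
    exact (g c η _ E _ (E.tc_actB hP)).at hP (I.good hJ' (HA.termEq hJ).1 c η _ E _ (E.tc_actB hP))
  | tseq =>
    have E := env_tc_concat I fA fB (HA.term hJ) (HB.sortEq hJ').1 hc hη
    exact (g c η _ E _ (E.tc_actB hP)).at hP (I.good (HB.sortEq hJ').1 hJ c η _ E _ (E.tc_actB hP))
  | @tt X u U Y v V e1 e2 h1 h2 =>
    have E := env_tc I fA (HA.term hJ) hJ'.ctx hc hη
    have e : EqT T (tc c η X Y) (tenB c η v u U) (vty c η V (tb c η v) u) := g c η _ E
    have hl : Derivable T (.term (tc c η X Y) (tenB c η v u U) (tso c η u U V (tb c η v))) :=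
      I.good hJ' (HA.term hJ) c η _ E _ (E.act I hJ'.ctx hJ)
    have hr := e.typed hP hl
    obtain rfl | rfl := h1 <;> obtain rfl | rfl := h2
    · exact .step (.t1 hl)
    · exact e.at hP hl
    · exact (e.symm hP).at hP hr
    · exact .step (.t1 hr)

theorem TJudg.derivable (hA : IsGAT TA) (hB : IsGAT TB) (fA : FreshCh chA) (fB : FreshCh chB)
    {J : Judg A} {J' : Judg B} {K : Judg (A.tensor B)} (h : TJudg TA TB chA chB false J J' K)
    (hJ : Derivable TA J) (hJ' : Derivable TB J') :
    Derivable (tensorAx TA TB chA chB) K := by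
  obtain ⟨c, η, hc, hη, r⟩ := h.exists_res hA.1 hB.1 fA fB hJ hJ'
  exact r.derivable (ih_derivable hA.1 hB.1 (isPretheory_tensorAx hA hB fA fB)
    (tensorAx_tAx hA hB fA fB) fA fB) fA fB hJ hJ' hc hη

end Main

/-- For generalized algebraic theories `𝔸`, `𝔹` (with chosen fresh
variables for each context), the pair `(𝔸,𝔹)` is `h`-derivable for every `h ≥ 0`;
equivalently, `J ⊙ J'` is derivable in the pretheory `𝔸 ⊗ 𝔹` for all derivable
judgments `J` of `𝔸` and `J'` of `𝔹` for which `J ⊙ J'` is defined.  In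
particular every axiom of `𝔸 ⊗ 𝔹` is derivable, so `𝔸 ⊗ 𝔹` is itself a
generalized algebraic theory. -/
theorem tensor_product_is_a_theory
    (A B : Alphabet) (TA : Set (Judg A)) (TB : Set (Judg B))
    (hA : IsGAT TA) (hB : IsGAT TB)
    (chA : PreCtx A → A.Var) (hchA : FreshCh chA)
    (chB : PreCtx B → B.Var) (hchB : FreshCh chB) :
    (∀ h : ℕ, hDerivable TA TB chA chB h) ∧
    (∀ (J : Judg A) (J' : Judg B) (K : Judg (A.tensor B)),
        Derivable TA J → Derivable TB J' → TJudg TA TB chA chB false J J' K →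
        Derivable (tensorAx TA TB chA chB) K) ∧
    IsGAT (tensorAx TA TB chA chB) := by
  refine ⟨fun _ J J' K hJ hJ' _ h => h.derivable hA hB hchA hchB hJ hJ',
    fun J J' K hJ hJ' h => h.derivable hA hB hchA hchB hJ hJ',
    isPretheory_tensorAx hA hB hchA hchB, ?_⟩
  rintro K ⟨J, J', hJ, hJ', h⟩
  exact h.derivable hA hB hchA hchB (hA.2 J hJ) (hB.2 J' hJ')

end GATPaper
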